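/- Fix an integer r ≥ 3. Let A_1, A_2, …, A_{C(n,r)} be a uniformly random ordering of all r-subsets of [n], let H_t = {A_1,…,A_t}, and let T = min{ t : A_1 ∪ ⋯ ∪ A_t = [n] }. Then with high probability Φ(H_T) > [e^{−(r−1)}·log n]^{n/r}·e^{−o(n)}; precisely: for all δ > 0 and ρ > 0 there is n₀ such that for every n ≥ n₀ divisible by r, P( Φ(H_T) > (e^{−(r−1)}·log n)^{n/r}·e^{−δn} ) ≥ 1 − ρ. -/

import Mathlib

open Finset

/-- The set of perfect matchings of the `r`-graph `H` on vertex set `V`. -/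
def pmSet (V : Finset ℕ) (H : Finset (Finset ℕ)) : Finset (Finset (Finset ℕ)) :=
  H.powerset.filter (fun M => (∀ A ∈ M, ∀ B ∈ M, A ≠ B → A ∩ B = ∅) ∧ M.biUnion id = V)

/-- The number of perfect matchings of `H` (denoted `Φ(H)`). -/
def pmCount (V : Finset ℕ) (H : Finset (Finset ℕ)) : ℕ := (pmSet V H).card

/-- All `r`-element subsets of `[n]`. -/
def Kn (n r : ℕ) : Finset (Finset ℕ) := Finset.powersetCard r (Finset.range n)

/-- Given an ordering `σ` of all `r`-subsets of `[n]`, `Ht n r t σ = {A_1,…,A_t}`. -/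
def Ht (n r t : ℕ) (σ : Fin (Kn n r).card ≃ {A // A ∈ Kn n r}) : Finset (Finset ℕ) :=
  (Finset.univ.filter (fun i : Fin (Kn n r).card => (i : ℕ) < t)).image
    (fun i => ((σ i) : Finset ℕ))

/-- The hitting time `T = min{t : A_1 ∪ ⋯ ∪ A_t = [n]}`. -/
noncomputable def hitTime (n r : ℕ) (σ : Fin (Kn n r).card ≃ {A // A ∈ Kn n r}) : ℕ :=
  sInf {t : ℕ | (Ht n r t σ).biUnion id = Finset.range n}

namespace Sham

lemma sum_le_sum_of_injOn {α β : Type*} [DecidableEq β] {s : Finset α} {t : Finset β}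
    {f : α → ℝ} {g : β → ℝ} (i : α → β) (hi : ∀ a ∈ s, i a ∈ t)
    (hinj : Set.InjOn i s) (hg : ∀ b ∈ t, 0 ≤ g b) (h : ∀ a ∈ s, f a ≤ g (i a)) :
    ∑ a ∈ s, f a ≤ ∑ b ∈ t, g b := by
  calc ∑ a ∈ s, f a ≤ ∑ a ∈ s, g (i a) := sum_le_sum h
    _ = ∑ b ∈ s.image i, g b := (sum_image hinj).symm
    _ ≤ ∑ b ∈ t, g b := sum_le_sum_of_subset_of_nonneg (image_subset_iff.2 hi)
        (fun b hb _ => hg b hb)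

section PMs
variable {V : Type*} [DecidableEq V]

/-- perfect matchings of `W` in `G` -/
def PM (G : Finset (Finset V)) (W : Finset V) : Finset (Finset (Finset V)) :=
  G.powerset.filter (fun M => (∀ A ∈ M, ∀ B ∈ M, A ≠ B → A ∩ B = ∅) ∧ M.biUnion id = W)

/-- total weight of the edges inside `U` -/
noncomputable def wt (G : Finset (Finset V)) (a : Finset V → ℝ) (U : Finset V) : ℝ :=
  ∑ e ∈ G.filter (fun e => e ⊆ U), a e

/-- averaged log weight -/
noncomputable def gavg (G : Finset (Finset V)) (a : Finset V → ℝ) (M : Finset (Finset V))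
    (k : ℕ) : ℝ :=
  (∑ N ∈ M.powersetCard k, Real.log (wt G a (N.biUnion id))) / (M.card.choose k : ℝ)

noncomputable def hwt (G : Finset (Finset V)) (a : Finset V → ℝ) (M : Finset (Finset V)) : ℝ :=
  (M.card.factorial : ℝ) * Real.exp (-∑ k ∈ Icc 1 M.card, gavg G a M k)

lemma mem_PM {G : Finset (Finset V)} {W : Finset V} {M : Finset (Finset V)} :
    M ∈ PM G W ↔ M ⊆ G ∧ (∀ A ∈ M, ∀ B ∈ M, A ≠ B → A ∩ B = ∅) ∧ M.biUnion id = W := by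
  simp [PM]

lemma PM_mono {G G' : Finset (Finset V)} (h : G ⊆ G') (W : Finset V) : PM G W ⊆ PM G' W := by
  intro M hM
  rw [mem_PM] at hM ⊢
  exact ⟨hM.1.trans h, hM.2⟩

lemma PM_erase {G : Finset (Finset V)} {W : Finset V} {M : Finset (Finset V)} (hM : M ∈ PM G W)
    {e : Finset V} (he : e ∈ M) : M.erase e ∈ PM G (W \ e) := by
  rw [mem_PM] at hM ⊢
  obtain ⟨h1, h2, h3⟩ := hM
  refine ⟨(erase_subset _ _).trans h1, fun A hA B hB => h2 A (mem_of_mem_erase hA) B (mem_of_mem_erase hB), ?_⟩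
  subst h3
  ext x
  simp only [mem_biUnion, mem_erase, id, mem_sdiff]
  constructor
  · rintro ⟨f, ⟨hfe, hf⟩, hx⟩
    refine ⟨⟨f, hf, hx⟩, fun hxe => ?_⟩
    have := h2 f hf e he hfe
    have : x ∈ f ∩ e := mem_inter.2 ⟨hx, hxe⟩
    simp_all
  · rintro ⟨⟨f, hf, hx⟩, hxe⟩
    exact ⟨f, ⟨fun h => hxe (h ▸ hx), hf⟩, hx⟩

lemma PM_edge_subset {G : Finset (Finset V)} {W : Finset V} {M : Finset (Finset V)}
    (hM : M ∈ PM G W) {e : Finset V} (he : e ∈ M) : e ⊆ W := by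
  rw [mem_PM] at hM
  rw [← hM.2.2]
  exact subset_biUnion_of_mem id he

lemma PM_disj {G : Finset (Finset V)} {W : Finset V} {M : Finset (Finset V)}
    (hM : M ∈ PM G W) {e f : Finset V} (he : e ∈ M) (hf : f ∈ M) (h : e ≠ f) : Disjoint e f := by
  rw [mem_PM] at hM
  exact disjoint_iff_inter_eq_empty.2 (hM.2.1 e he f hf h)

lemma PM_card {G : Finset (Finset V)} {r : ℕ} (hG : ∀ e ∈ G, e.card = r) {W : Finset V}
    {M : Finset (Finset V)} (hM : M ∈ PM G W) : M.card * r = W.card := by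
  have h := hM
  rw [mem_PM] at hM
  rw [← hM.2.2, card_biUnion (t := id) (fun x hx y hy hxy => PM_disj h hx hy hxy)]
  rw [sum_congr rfl (fun e he => by rw [id, hG e (hM.1 he)])]
  simp

/-- insert an edge in a perfect matching -/
lemma PM_insert {G : Finset (Finset V)} {W : Finset V} {M : Finset (Finset V)} {e : Finset V}
    (heG : e ∈ G) (heW : e ⊆ W) (hM : M ∈ PM G (W \ e)) : insert e M ∈ PM G W := by
  have h := hM
  rw [mem_PM] at hM ⊢
  obtain ⟨h1, h2, h3⟩ := hM
  have hd : ∀ f ∈ M, Disjoint f e := fun f hf =>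
    disjoint_of_subset_left (PM_edge_subset h hf) sdiff_disjoint
  refine ⟨insert_subset heG h1, ?_, ?_⟩
  · intro A hA B hB hAB
    rw [mem_insert] at hA hB
    rcases hA with rfl | hA <;> rcases hB with rfl | hB
    · exact absurd rfl hAB
    · exact disjoint_iff_inter_eq_empty.1 (hd B hB).symm
    · exact disjoint_iff_inter_eq_empty.1 (hd A hA)
    · exact h2 A hA B hB hAB
  · rw [biUnion_insert, h3, id, union_sdiff_of_subset heW]

/-- sums over matchings with a marked edge -/
lemma sum_PM_edge_le {G : Finset (Finset V)} {W : Finset V} (P : Finset V → Prop) [DecidablePred P]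
    (F : Finset V → Finset (Finset V) → ℝ)
    (hF : ∀ e ∈ G, ∀ M, M ⊆ G → 0 ≤ F e M) :
    ∑ M ∈ PM G W, ∑ e ∈ M.filter P, F e (M.erase e) ≤
      ∑ e ∈ G.filter (fun e => e ⊆ W ∧ P e), ∑ M ∈ PM G (W \ e), F e M := by
  rw [Finset.sum_sigma', Finset.sum_sigma']
  refine sum_le_sum_of_injOn (fun p => ⟨p.2, p.1.erase p.2⟩) ?_ ?_ ?_ ?_
  · rintro ⟨M, e⟩ h
    simp only [mem_sigma, mem_filter] at h ⊢
    exact ⟨⟨(mem_PM.1 h.1).1 h.2.1, PM_edge_subset h.1 h.2.1, h.2.2⟩, PM_erase h.1 h.2.1⟩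
  · rintro ⟨M, e⟩ h ⟨M', e'⟩ h' hh
    simp only [coe_sigma, Set.mem_sigma_iff, mem_coe, mem_filter] at h h'
    simp only [Sigma.mk.injEq, heq_eq_eq] at hh
    obtain ⟨rfl, h2⟩ := hh
    have : M = M' := by
      rw [← insert_erase h.2.1, ← insert_erase h'.2.1, h2]
    subst this
    rfl
  · rintro ⟨e, M⟩ h
    simp only [mem_sigma] at h
    exact hF _ (mem_filter.1 h.1).1 _ (mem_PM.1 h.2).1
  · rintro ⟨M, e⟩ h
    exact le_rfl


lemma PM_empty {G : Finset (Finset V)} {r : ℕ} (hr : 1 ≤ r) (hG : ∀ e ∈ G, e.card = r) :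
    PM G ∅ = {∅} := by
  ext M
  rw [mem_singleton]
  constructor
  · intro h
    have := PM_card hG h
    rw [card_empty, Nat.mul_eq_zero] at this
    rcases this with h | h
    · exact card_eq_zero.1 h
    · omega
  · rintro rfl
    simp [mem_PM]

lemma wt_pos {G : Finset (Finset V)} {a : Finset V → ℝ} (ha : ∀ e ∈ G, 0 < a e) {U e : Finset V}
    (he : e ∈ G) (heU : e ⊆ U) : 0 < wt G a U :=
  sum_pos (fun f hf => ha f (mem_filter.1 hf).1) ⟨e, mem_filter.2 ⟨he, heU⟩⟩

lemma hwt_nonneg (G : Finset (Finset V)) (a : Finset V → ℝ) (M : Finset (Finset V)) :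
    0 ≤ hwt G a M := by unfold hwt; positivity

/-- averaging over removal of one edge -/
lemma gavg_erase (G : Finset (Finset V)) (a : Finset V → ℝ) (M : Finset (Finset V)) {k : ℕ}
    (hk : k < M.card) :
    ∑ e ∈ M, gavg G a (M.erase e) k = M.card * gavg G a M k := by
  have h1 : ∀ e ∈ M, gavg G a (M.erase e) k =
      (∑ N ∈ M.powersetCard k, if e ∉ N then Real.log (wt G a (N.biUnion id)) else 0) /
        ((M.card - 1).choose k : ℝ) := by
    intro e he
    unfold gavg
    rw [card_erase_of_mem he, ← sum_filter]
    congr 2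
    ext N
    simp only [mem_powersetCard, mem_filter, subset_erase]
    tauto
  rw [sum_congr rfl h1, ← sum_div, sum_comm]
  have h2 : ∀ N ∈ M.powersetCard k, (∑ e ∈ M, if e ∉ N then Real.log (wt G a (N.biUnion id)) else 0)
      = ((M.card - k : ℕ) : ℝ) * Real.log (wt G a (N.biUnion id)) := by
    intro N hN
    rw [mem_powersetCard] at hN
    rw [← sum_filter, sum_const, nsmul_eq_mul]
    congr 2
    rw [← hN.2, ← card_sdiff_of_subset hN.1]
    congr 1
    ext e
    simp [mem_sdiff]
  rw [sum_congr rfl h2, ← mul_sum]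
  unfold gavg
  have h3 : ((M.card - 1).choose k : ℝ) * M.card = (M.card.choose k : ℝ) * ((M.card - k : ℕ) : ℝ) := by
    have := Nat.choose_mul_succ_eq (M.card - 1) k
    rw [Nat.sub_add_cancel (by omega)] at this
    exact_mod_cast this
  have h4 : ((M.card - 1).choose k : ℝ) ≠ 0 := by
    have := Nat.choose_pos (n := M.card - 1) (k := k) (by omega)
    positivity
  have h5 : (M.card.choose k : ℝ) ≠ 0 := by
    have := Nat.choose_pos (n := M.card) (k := k) (by omega)
    positivity
  field_simp
  linear_combination (-(∑ N ∈ M.powersetCard k, Real.log (wt G a (N.biUnion id)))) * h3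

lemma jensen_exp {α : Type*} (s : Finset α) (f : α → ℝ) (c : ℝ) (h : ∑ x ∈ s, f x = s.card * c) :
    s.card * Real.exp c ≤ ∑ x ∈ s, Real.exp (f x) := by
  have : ∀ x ∈ s, Real.exp c * (1 + (f x - c)) ≤ Real.exp (f x) := by
    intro x _
    have h1 := Real.add_one_le_exp (f x - c)
    have h2 : Real.exp (f x) = Real.exp c * Real.exp (f x - c) := by rw [← Real.exp_add]; ring_nf
    rw [h2]
    exact mul_le_mul_of_nonneg_left (by linarith) (Real.exp_pos _).le
  refine le_trans (le_of_eq ?_) (sum_le_sum this)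
  rw [← mul_sum, sum_add_distrib, sum_sub_distrib, h]
  simp
  ring

lemma hwt_le {G : Finset (Finset V)} {a : Finset V → ℝ} (ha : ∀ e ∈ G, 0 < a e) {W : Finset V}
    {M : Finset (Finset V)} (hM : M ∈ PM G W) (hne : M.Nonempty) :
    hwt G a M * wt G a W ≤ ∑ e ∈ M, hwt G a (M.erase e) := by
  have hc : 0 < M.card := card_pos.2 hne
  obtain ⟨e₀, he₀⟩ := hne
  have hW : 0 < wt G a W := wt_pos ha ((mem_PM.1 hM).1 he₀) (PM_edge_subset hM he₀)
  have hJ := jensen_exp M (fun e => -∑ k ∈ Icc 1 (M.card - 1), gavg G a (M.erase e) k)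
    (-∑ k ∈ Icc 1 (M.card - 1), gavg G a M k) (by
      rw [sum_neg_distrib, sum_comm, mul_neg, mul_sum]
      congr 1
      refine sum_congr rfl fun k hk => ?_
      rw [mem_Icc] at hk
      exact gavg_erase G a M (by omega))
  have h1 : ∑ e ∈ M, hwt G a (M.erase e) = ((M.card - 1).factorial : ℝ) *
      ∑ e ∈ M, Real.exp (-∑ k ∈ Icc 1 (M.card - 1), gavg G a (M.erase e) k) := by
    rw [mul_sum]
    refine sum_congr rfl fun e he => ?_
    unfold hwt
    rw [card_erase_of_mem he]
  have h2 : hwt G a M * wt G a W = ((M.card - 1).factorial : ℝ) *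
      (M.card * Real.exp (-∑ k ∈ Icc 1 (M.card - 1), gavg G a M k)) := by
    unfold hwt
    have h3 : Icc 1 M.card = insert M.card (Icc 1 (M.card - 1)) := by
      ext k; simp only [mem_Icc, mem_insert]; omega
    have h4 : gavg G a M M.card = Real.log (wt G a W) := by
      unfold gavg
      rw [powersetCard_self, sum_singleton, (mem_PM.1 hM).2.2]
      simp
    rw [h3, sum_insert (by simp only [mem_Icc]; omega), h4, neg_add, Real.exp_add, Real.exp_neg, Real.exp_log hW]
    have h5 : (M.card.factorial : ℝ) = M.card * (M.card - 1).factorial := by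
      exact_mod_cast (Nat.mul_factorial_pred (by omega)).symm
    rw [h5]
    field_simp
  rw [h1, h2]
  exact mul_le_mul_of_nonneg_left hJ (by positivity)

theorem bregman {G : Finset (Finset V)} {r : ℕ} (hr : 1 ≤ r) (hG : ∀ e ∈ G, e.card = r)
    {a : Finset V → ℝ} (ha : ∀ e ∈ G, 0 < a e) (W : Finset V) :
    ∑ M ∈ PM G W, (∏ e ∈ M, a e) * hwt G a M ≤ 1 := by
  induction hw : W.card using Nat.strong_induction_on generalizing W with
  | _ n ih =>
  rcases W.eq_empty_or_nonempty with rfl | hWne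
  · rw [PM_empty hr hG]
    simp [hwt]
  · rcases (PM G W).eq_empty_or_nonempty with h | ⟨M₀, hM₀⟩
    · simp [h]
    have hne : ∀ M ∈ PM G W, M.Nonempty := by
      intro M hM
      rw [← card_pos]
      have := PM_card hG hM
      have := card_pos.2 hWne
      by_contra h0
      have : M.card = 0 := by omega
      simp_all
    obtain ⟨e₀, he₀⟩ := hne M₀ hM₀
    have hW : 0 < wt G a W := wt_pos ha ((mem_PM.1 hM₀).1 he₀) (PM_edge_subset hM₀ he₀)
    rw [← mul_le_mul_iff_left₀ hW, one_mul, sum_mul]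
    calc ∑ M ∈ PM G W, (∏ e ∈ M, a e) * hwt G a M * wt G a W
        ≤ ∑ M ∈ PM G W, ∑ e ∈ M.filter (fun _ => True), a e * ((∏ e' ∈ M.erase e, a e') * hwt G a (M.erase e)) := by
          refine sum_le_sum fun M hM => ?_
          have h1 := hwt_le ha hM (hne M hM)
          have h2 : 0 ≤ ∏ e ∈ M, a e := prod_nonneg fun e he => (ha e ((mem_PM.1 hM).1 he)).le
          rw [mul_assoc]
          refine (mul_le_mul_of_nonneg_left h1 h2).trans (le_of_eq ?_)
          rw [mul_sum, filter_true]
          refine sum_congr rfl fun e he => ?_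
          rw [← mul_prod_erase M a he]
          ring
      _ ≤ ∑ e ∈ G.filter (fun e => e ⊆ W ∧ True), ∑ M ∈ PM G (W \ e), a e * ((∏ e' ∈ M, a e') * hwt G a M) := by
          refine sum_PM_edge_le (fun _ => True) (fun e M => a e * ((∏ e' ∈ M, a e') * hwt G a M)) ?_
          intro e he M hM
          exact mul_nonneg (ha e he).le (mul_nonneg
            (prod_nonneg fun e' he' => (ha e' (hM he')).le) (hwt_nonneg _ _ _))
      _ ≤ ∑ e ∈ G.filter (fun e => e ⊆ W ∧ True), a e := by
          refine sum_le_sum fun e he => ?_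
          rw [mem_filter] at he
          rw [← mul_sum]
          refine mul_le_of_le_one_right (ha e he.1).le (ih (W \ e).card ?_ _ rfl)
          rw [← hw]
          refine card_lt_card (sdiff_ssubset he.2.1 ?_)
          rw [← card_pos, hG e he.1]; omega
      _ = wt G a W := by simp [wt]

end PMs
end Sham

namespace Sham

lemma descFact_le (k ν t : ℕ) (h : k ≤ ν) : k.descFactorial t * ν ^ t ≤ ν.descFactorial t * k ^ t := by
  induction t with
  | zero => simp
  | succ t ih =>
    rw [Nat.descFactorial_succ, Nat.descFactorial_succ, pow_succ, pow_succ]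
    have : (k - t) * ν ≤ (ν - t) * k := by
      rw [Nat.sub_mul, Nat.sub_mul, Nat.mul_comm k ν]
      have : t * k ≤ t * ν := Nat.mul_le_mul_left _ h
      omega
    calc (k - t) * k.descFactorial t * (ν ^ t * ν) = (k.descFactorial t * ν ^ t) * ((k - t) * ν) := by ring
      _ ≤ (ν.descFactorial t * k ^ t) * ((ν - t) * k) := Nat.mul_le_mul ih this
      _ = _ := by ring

lemma choose_ratio {k ν t : ℕ} (h : k ≤ ν) (ht : t ≤ k) :
    (ν - t).choose (k - t) * ν ^ t ≤ ν.choose k * k ^ t := by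
  have h1 := Nat.choose_mul (n := ν) ht
  have h2 := descFact_le k ν t h
  rw [Nat.descFactorial_eq_factorial_mul_choose, Nat.descFactorial_eq_factorial_mul_choose] at h2
  have h3 : k.choose t * ν ^ t ≤ ν.choose t * k ^ t := by
    have : t.factorial * (k.choose t * ν ^ t) ≤ t.factorial * (ν.choose t * k ^ t) := by
      calc _ = t.factorial * k.choose t * ν ^ t := by ring
        _ ≤ _ := h2
        _ = _ := by ring
    exact Nat.le_of_mul_le_mul_left this (Nat.factorial_pos t)
  have h4 : 0 < ν.choose t := Nat.choose_pos (ht.trans h)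
  refine Nat.le_of_mul_le_mul_left ?_ h4
  calc ν.choose t * ((ν - t).choose (k - t) * ν ^ t) = (ν.choose t * (ν - t).choose (k - t)) * ν ^ t := by ring
    _ = ν.choose k * (k.choose t * ν ^ t) := by rw [← h1]; ring
    _ ≤ ν.choose k * (ν.choose t * k ^ t) := Nat.mul_le_mul_left _ h3
    _ = _ := by ring

lemma card_superset_le {α : Type*} [DecidableEq α] (M S : Finset α) (hS : S ⊆ M) {k : ℕ} (hk : k ≤ M.card) :
    (((M.powersetCard k).filter (fun N => S ⊆ N)).card : ℝ) ≤
      (M.card.choose k : ℝ) * ((k : ℝ) / M.card) ^ S.card := by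
  by_cases hSk : S.card ≤ k
  · have h1 : ((M.powersetCard k).filter (fun N => S ⊆ N)).card ≤ ((M \ S).powersetCard (k - S.card)).card := by
      refine card_le_card_of_injOn (fun N => N \ S) ?_ ?_
      · intro N hN
        simp only [coe_filter, Set.mem_ofPred_eq, mem_powersetCard] at hN
        simp only [mem_coe, mem_powersetCard]
        refine ⟨sdiff_subset_sdiff hN.1.1 le_rfl, ?_⟩
        rw [card_sdiff_of_subset hN.2, hN.1.2]
      · intro N hN N' hN' h
        simp only [coe_filter, Set.mem_ofPred_eq, mem_powersetCard] at hN hN'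
        rw [← sdiff_union_of_subset hN.2, ← sdiff_union_of_subset hN'.2]
        simp only at h
        rw [h]
    rw [card_powersetCard, card_sdiff_of_subset hS] at h1
    have h2 := choose_ratio hk hSk
    rcases Nat.eq_zero_or_pos M.card with h0 | h0
    · have : S = ∅ := by rw [← card_eq_zero]; have := card_le_card hS; omega
      subst this
      simp
    rw [div_pow, ← mul_div_assoc, le_div_iff₀ (by positivity)]
    exact_mod_cast (Nat.mul_le_mul_right _ h1).trans h2
  · have : (M.powersetCard k).filter (fun N => S ⊆ N) = ∅ := by
      rw [filter_eq_empty_iff]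
      intro N hN h
      rw [mem_powersetCard] at hN
      have := card_le_card h
      omega
    rw [this]
    simp only [card_empty, Nat.cast_zero]
    positivity

lemma prod_Icc_natCast_fact (ν : ℕ) : ∏ k ∈ Icc 1 ν, (k : ℝ) = (ν.factorial : ℝ) := by
  induction ν with
  | zero => simp
  | succ n ih =>
    rw [prod_Icc_succ_top (by omega), ih, Nat.factorial_succ]
    push_cast; ring

section
variable {V : Type*} [DecidableEq V]

/-- pairs of vertices have codegree at most two -/
def QR (G : Finset (Finset V)) : Prop :=
  ∀ x y : V, x ≠ y → (G.filter (fun e => x ∈ e ∧ y ∈ e)).card ≤ 2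

lemma QR.mono {G G' : Finset (Finset V)} (h : QR G') (hs : G ⊆ G') : QR G := fun x y hxy =>
  (card_le_card (filter_subset_filter _ hs)).trans (h x y hxy)

/-- edges of the matching which meet e -/
def meet (M : Finset (Finset V)) (e : Finset V) : Finset (Finset V) := M.filter (fun f => (f ∩ e).Nonempty)

lemma meet_sub {G : Finset (Finset V)} {W : Finset V} {M : Finset (Finset V)} (hM : M ∈ PM G W)
    {e : Finset V} {N : Finset (Finset V)} (hN : N ⊆ M) (he : e ⊆ N.biUnion id) : meet M e ⊆ N := by
  intro f hf
  simp only [meet, mem_filter] at hf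
  obtain ⟨hf, x, hx⟩ := hf
  rw [mem_inter] at hx
  have := he hx.2
  rw [mem_biUnion] at this
  obtain ⟨f', hf', hx'⟩ := this
  by_cases h : f = f'
  · rwa [h]
  · exact absurd hx' (disjoint_left.1 (PM_disj hM hf (hN hf') h) hx.1)

lemma meet_card {G : Finset (Finset V)} {W : Finset V} {M : Finset (Finset V)} (hM : M ∈ PM G W)
    {e : Finset V} (he : e ⊆ W) (h : ∀ f ∈ M, ∀ x ∈ f, ∀ y ∈ f, x ∈ e → y ∈ e → x = y) :
    e.card ≤ (meet M e).card := by
  have h3 := (mem_PM.1 hM).2.2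
  have : ∀ x ∈ e, ∃ f ∈ M, x ∈ f := by
    intro x hx
    have := he hx
    rw [← h3, mem_biUnion] at this
    exact this
  choose! F hF using this
  refine card_le_card_of_injOn F ?_ ?_
  · intro x hx
    simp only [meet, coe_filter, Set.mem_ofPred_eq]
    exact ⟨(hF x hx).1, x, mem_inter.2 ⟨(hF x hx).2, hx⟩⟩
  · intro x hx y hy hxy
    exact h (F x) (hF x hx).1 x (hF x hx).2 y (hxy ▸ (hF y hy).2) hx hy

lemma meet_pos {G : Finset (Finset V)} {W : Finset V} {M : Finset (Finset V)} (hM : M ∈ PM G W)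
    {e : Finset V} (he : e ⊆ W) (hne : e.Nonempty) : 1 ≤ (meet M e).card := by
  obtain ⟨x, hx⟩ := hne
  have := he hx
  rw [← (mem_PM.1 hM).2.2, mem_biUnion] at this
  obtain ⟨f, hf, hxf⟩ := this
  exact card_pos.2 ⟨f, mem_filter.2 ⟨hf, x, mem_inter.2 ⟨hxf, hx⟩⟩⟩

/-- few edges meet some edge of the matching twice -/
lemma card_double {G : Finset (Finset V)} (hQ : QR G) {r : ℕ} (M : Finset (Finset V))
    (hM : ∀ f ∈ M, f.card = r) (G' : Finset (Finset V)) (hG' : G' ⊆ G)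
    (h : ∀ e ∈ G', ∃ f ∈ M, ∃ x ∈ f, ∃ y ∈ f, x ∈ e ∧ y ∈ e ∧ x ≠ y) :
    G'.card ≤ M.card * (2 * r ^ 2) := by
  have h1 : G' ⊆ M.biUnion (fun f => f.offDiag.biUnion (fun p => G.filter (fun e => p.1 ∈ e ∧ p.2 ∈ e))) := by
    intro e he
    obtain ⟨f, hf, x, hx, y, hy, hxe, hye, hxy⟩ := h e he
    simp only [mem_biUnion, mem_filter]
    exact ⟨f, hf, (x, y), mem_offDiag.2 ⟨hx, hy, hxy⟩, hG' he, hxe, hye⟩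
  refine (card_le_card h1).trans (card_biUnion_le_card_mul _ _ _ fun f hf => ?_)
  refine (card_biUnion_le_card_mul _ _ 2 fun p hp => ?_).trans ?_
  · rw [mem_offDiag] at hp
    exact hQ _ _ hp.2.2
  · rw [offDiag_card, hM f hf]
    have : r * r - r ≤ r ^ 2 := by rw [sq]; omega
    nlinarith

lemma avg_wt_le {G : Finset (Finset V)} {r : ℕ} (hr : 1 ≤ r) (hG : ∀ e ∈ G, e.card = r)
    {a : Finset V → ℝ} (ha : ∀ e ∈ G, 0 < a e) (ha1 : ∀ e ∈ G, a e ≤ 1) (hQ : QR G)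
    {A : ℝ} (hA : ∑ e ∈ G, a e ≤ A) {W : Finset V} {M : Finset (Finset V)} (hM : M ∈ PM G W)
    {k : ℕ} (hk : k ≤ M.card) :
    ∑ N ∈ M.powersetCard k, wt G a (N.biUnion id) ≤
      (M.card.choose k : ℝ) * (A * ((k : ℝ) / M.card) ^ r + 2 * r ^ 2 * M.card * ((k : ℝ) / M.card)) := by
  have hMG := (mem_PM.1 hM).1
  set p : ℝ := (k : ℝ) / M.card with hp
  have hp0 : 0 ≤ p := by positivity
  have hp1 : p ≤ 1 := div_le_one_of_le₀ (by exact_mod_cast hk) (by positivity)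
  have h1 : ∑ N ∈ M.powersetCard k, wt G a (N.biUnion id) ≤
      ∑ e ∈ G, a e * ∑ N ∈ M.powersetCard k, if e ⊆ N.biUnion id then (1:ℝ) else 0 := by
    apply le_of_eq
    simp_rw [mul_sum]
    rw [sum_comm]
    refine sum_congr rfl fun N _ => ?_
    unfold wt
    rw [sum_filter]
    refine sum_congr rfl fun e _ => ?_
    split_ifs <;> simp
  refine h1.trans ?_
  classical
  set bad : Finset V → Prop := fun e => ∃ f ∈ M, ∃ x ∈ f, ∃ y ∈ f, x ∈ e ∧ y ∈ e ∧ x ≠ y with hbad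
  have h2 : ∀ e ∈ G, (∑ N ∈ M.powersetCard k, if e ⊆ N.biUnion id then (1:ℝ) else 0) ≤
      (M.card.choose k : ℝ) * (p ^ r + if bad e then p else 0) := by
    intro e he
    rw [← sum_filter, sum_const, nsmul_eq_mul, mul_one]
    by_cases heW : e ⊆ W
    · have h3 : (((M.powersetCard k).filter (fun N => e ⊆ N.biUnion id)).card : ℝ) ≤
          (M.card.choose k : ℝ) * p ^ (meet M e).card := by
        refine le_trans ?_ (card_superset_le M (meet M e) (filter_subset _ _) hk)
        norm_cast
        refine card_le_card fun N hN => ?_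
        rw [mem_filter] at hN ⊢
        exact ⟨hN.1, meet_sub hM (mem_powersetCard.1 hN.1).1 hN.2⟩
      refine h3.trans (mul_le_mul_of_nonneg_left ?_ (by positivity))
      by_cases hb : bad e
      · rw [if_pos hb]
        have := pow_le_of_le_one hp0 hp1 (n := (meet M e).card)
          (by have := meet_pos hM heW (by rw [← card_pos, hG e he]; omega); omega)
        have : 0 ≤ p ^ r := by positivity
        linarith
      · rw [if_neg hb, add_zero]
        refine pow_le_pow_of_le_one hp0 hp1 ?_
        rw [← hG e he]
        refine meet_card hM heW ?_
        intro f hf x hx y hy hxe hye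
        by_contra hxy
        exact hb ⟨f, hf, x, hx, y, hy, hxe, hye, hxy⟩
    · rw [filter_eq_empty_iff.2]
      · simp only [card_empty, Nat.cast_zero]
        split_ifs <;> positivity
      · intro N hN h
        apply heW
        rw [← (mem_PM.1 hM).2.2]
        exact h.trans (biUnion_subset_biUnion_of_subset_left _ (mem_powersetCard.1 hN).1)
  calc ∑ e ∈ G, a e * ∑ N ∈ M.powersetCard k, (if e ⊆ N.biUnion id then (1:ℝ) else 0)
      ≤ ∑ e ∈ G, a e * ((M.card.choose k : ℝ) * (p ^ r + if bad e then p else 0)) :=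
        sum_le_sum fun e he => mul_le_mul_of_nonneg_left (h2 e he) (ha e he).le
    _ = (M.card.choose k : ℝ) * ((∑ e ∈ G, a e) * p ^ r + ∑ e ∈ G, a e * if bad e then p else 0) := by
        rw [sum_mul, ← sum_add_distrib, mul_sum]
        exact sum_congr rfl fun e _ => by ring
    _ ≤ _ := by
        refine mul_le_mul_of_nonneg_left (add_le_add ?_ ?_) (by positivity)
        · exact mul_le_mul_of_nonneg_right hA (by positivity)
        · calc ∑ e ∈ G, a e * (if bad e then p else 0) ≤ ∑ e ∈ G, if bad e then p else 0 := by
                refine sum_le_sum fun e he => ?_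
                split_ifs
                · exact mul_le_of_le_one_left hp0 (ha1 e he)
                · simp
            _ = (G.filter bad).card * p := by rw [← sum_filter, sum_const, nsmul_eq_mul]
            _ ≤ _ := by
                refine mul_le_mul_of_nonneg_right ?_ hp0
                have := card_double hQ (r := r) M (fun f hf => hG f (hMG hf)) (G.filter bad) (filter_subset _ _)
                  (fun e he => (mem_filter.1 he).2)
                calc ((G.filter bad).card : ℝ) ≤ ((M.card * (2 * r ^ 2) : ℕ) : ℝ) := by exact_mod_cast this
                  _ = _ := by push_cast; ring

lemma log_avg {α : Type*} (s : Finset α) (hs : s.Nonempty) (f : α → ℝ) (hf : ∀ x ∈ s, 0 < f x) {b : ℝ}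
    (hb : 0 < b) (h : ∑ x ∈ s, f x ≤ s.card * b) : (∑ x ∈ s, Real.log (f x)) / s.card ≤ Real.log b := by
  have h0 : (0:ℝ) < s.card := by exact_mod_cast card_pos.2 hs
  rw [div_le_iff₀ h0]
  have : ∀ x ∈ s, Real.log (f x) ≤ Real.log b + (f x / b - 1) := by
    intro x hx
    have h1 := Real.log_le_sub_one_of_pos (div_pos (hf x hx) hb)
    rw [Real.log_div (hf x hx).ne' hb.ne'] at h1
    linarith
  refine (sum_le_sum this).trans ?_
  rw [sum_add_distrib, sum_sub_distrib, ← sum_div]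
  simp only [sum_const, nsmul_eq_mul, mul_one]
  have : (∑ x ∈ s, f x) / b ≤ s.card := by rw [div_le_iff₀ hb]; exact h
  linarith

/-- the upper bound for the weighted number of perfect matchings -/
theorem Z_upper {G : Finset (Finset V)} {r : ℕ} (hr : 1 ≤ r) (hG : ∀ e ∈ G, e.card = r)
    {a : Finset V → ℝ} (ha : ∀ e ∈ G, 0 < a e) (ha1 : ∀ e ∈ G, a e ≤ 1) (hQ : QR G)
    {A : ℝ} (hA : ∑ e ∈ G, a e ≤ A) {W : Finset V} {ν : ℕ} (hν : W.card = ν * r) :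
    ∑ M ∈ PM G W, ∏ e ∈ M, a e ≤
      ∏ k ∈ Icc 1 ν, ((A * ((k : ℝ) / ν) ^ r + 2 * r ^ 2 * ν * ((k : ℝ) / ν)) / k) := by
  set b : ℕ → ℝ := fun k => A * ((k : ℝ) / ν) ^ r + 2 * r ^ 2 * ν * ((k : ℝ) / ν) with hb
  have hA0 : 0 ≤ A := (sum_nonneg fun e he => (ha e he).le).trans hA
  have hbpos : ∀ k ∈ Icc 1 ν, 0 < b k := by
    intro k hk
    rw [mem_Icc] at hk
    have h1 : (0:ℝ) < k := by exact_mod_cast hk.1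
    have h2 : (0:ℝ) < ν := by exact_mod_cast (show 0 < ν by omega)
    have h3 : (0:ℝ) < r := by exact_mod_cast hr
    have : 0 ≤ A * ((k : ℝ) / ν) ^ r := by positivity
    have : 0 < 2 * r ^ 2 * ν * ((k : ℝ) / ν) := by positivity
    simp only [hb]
    linarith
  have hprod : (ν.factorial : ℝ) = ∏ k ∈ Icc 1 ν, (k : ℝ) := by
    rw [← prod_Icc_natCast_fact ν]
  have hcard : ∀ M ∈ PM G W, M.card = ν := by
    intro M hM
    have := PM_card hG hM
    rw [hν] at this
    exact Nat.eq_of_mul_eq_mul_right (by omega) this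
  have hh : ∀ M ∈ PM G W, (∏ k ∈ Icc 1 ν, b k / k)⁻¹ ≤ hwt G a M := by
    intro M hM
    unfold hwt
    rw [hcard M hM, prod_div_distrib, ← hprod, inv_div, div_eq_mul_inv]
    refine mul_le_mul_of_nonneg_left ?_ (by positivity)
    rw [Real.exp_neg, Real.exp_sum]
    refine inv_anti₀ (prod_pos fun k _ => Real.exp_pos _) ?_
    refine prod_le_prod (fun k _ => (Real.exp_pos _).le) fun k hk => ?_
    rw [← Real.le_log_iff_exp_le (hbpos k hk)]
    unfold gavg
    rw [mem_Icc] at hk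
    have hkM : k ≤ M.card := by rw [hcard M hM]; exact hk.2
    have := log_avg (M.powersetCard k) (powersetCard_nonempty.2 hkM) (fun N => wt G a (N.biUnion id)) ?_
      (hbpos k (mem_Icc.2 hk)) ?_
    · rwa [card_powersetCard] at this
    · intro N hN
      rw [mem_powersetCard] at hN
      obtain ⟨e, he⟩ : N.Nonempty := by rw [← card_pos]; omega
      exact wt_pos ha ((mem_PM.1 hM).1 (hN.1 he)) (subset_biUnion_of_mem id he)
    · rw [card_powersetCard]
      have := avg_wt_le hr hG ha ha1 hQ hA hM hkM
      rw [hcard M hM] at this ⊢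
      exact this
  have hP : 0 < ∏ k ∈ Icc 1 ν, b k / k := prod_pos fun k hk => div_pos (hbpos k hk) (by
    rw [mem_Icc] at hk; exact_mod_cast hk.1)
  have h1 := bregman hr hG ha W
  have h2 : (∑ M ∈ PM G W, ∏ e ∈ M, a e) * (∏ k ∈ Icc 1 ν, b k / k)⁻¹ ≤ 1 := by
    refine le_trans ?_ h1
    rw [sum_mul]
    exact sum_le_sum fun M hM => mul_le_mul_of_nonneg_left (hh M hM)
      (prod_nonneg fun e he => (ha e ((mem_PM.1 hM).1 he)).le)
  rwa [mul_inv_le_iff₀ hP, one_mul] at h2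

end
end Sham

namespace Sham

section
variable {V : Type*} [DecidableEq V]

/-- light sets -/
def Light (G : Finset (Finset V)) (W : Finset V) (θ : ℝ) (S : Finset V) : Prop :=
  S ⊆ W ∧ ((PM G (W \ S)).card : ℝ) < θ

/-- upper bound product -/
noncomputable def Ub (r : ℕ) (A : ℝ) (ν : ℕ) : ℝ :=
  ∏ k ∈ Icc 1 ν, ((A * ((k : ℝ) / ν) ^ r + 2 * r ^ 2 * ν * ((k : ℝ) / ν)) / k)

open scoped Classical in
theorem light_few {G : Finset (Finset V)} {r : ℕ} (hr : 1 ≤ r) (hG : ∀ e ∈ G, e.card = r)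
    (hQ : QR G) {W : Finset V} {ν : ℕ} (hν : W.card = ν * r) {t φ θ lam : ℝ} (ht : (G.card : ℝ) ≤ t)
    (hφ0 : 0 < φ) (hθ : 0 ≤ θ) (hφ : φ ≤ (PM G W).card)
    (hU : Ub r (t - lam / 2) ν < φ * Real.exp (-(t * θ / φ))) :
    ((G.filter (Light G W θ)).card : ℝ) < lam := by
  by_contra hlam
  push Not at hlam
  set L := G.filter (Light G W θ) with hL
  set a : Finset V → ℝ := fun e => if e ∈ L then Real.exp (-Real.log 2) else 1 with hadef
  have hhalf : Real.exp (-Real.log 2) = 1 / 2 := by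
    rw [Real.exp_neg, Real.exp_log (by norm_num)]; norm_num
  have ha : ∀ e ∈ G, 0 < a e := by
    intro e _; simp only [hadef]; split_ifs <;> positivity
  have ha1 : ∀ e ∈ G, a e ≤ 1 := by
    intro e _; simp only [hadef]; split_ifs
    · rw [hhalf]; norm_num
    · exact le_rfl
  have hA : ∑ e ∈ G, a e ≤ t - lam / 2 := by
    have h1 : ∑ e ∈ G, a e = ∑ e ∈ G, (1 - (1/2) * if e ∈ L then (1:ℝ) else 0) := by
      refine sum_congr rfl fun e _ => ?_
      simp only [hadef, hhalf]; split_ifs <;> norm_num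
    rw [h1, sum_sub_distrib, ← mul_sum, ← sum_filter]
    have h2 : G.filter (fun e => e ∈ L) = L := by
      rw [filter_mem_eq_inter]; exact inter_eq_right.2 (filter_subset _ _)
    rw [h2]; simp only [sum_const, nsmul_eq_mul, mul_one]
    linarith
  have hZ := Z_upper hr hG ha ha1 hQ hA hν
  have hΦ : 0 < ((PM G W).card : ℝ) := hφ0.trans_le hφ
  have hprod : ∀ M ∈ PM G W, ∏ e ∈ M, a e = Real.exp (-Real.log 2 * (M.filter (fun e => e ∈ L)).card) := by
    intro M _
    simp only [hadef]
    rw [prod_ite, prod_const, prod_const_one, mul_one, ← Real.exp_nat_mul]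
    ring_nf
  have hpairs : ∑ M ∈ PM G W, ((M.filter (fun e => e ∈ L)).card : ℝ) ≤ t * θ := by
    have h1 := sum_PM_edge_le (G := G) (W := W) (fun e => e ∈ L) (fun _ _ => (1:ℝ)) (fun _ _ _ _ => zero_le_one)
    simp only [sum_const, nsmul_eq_mul, mul_one] at h1
    refine h1.trans ?_
    have ht0 : G.card * θ ≤ t * θ := mul_le_mul_of_nonneg_right ht hθ
    refine le_trans ?_ ht0
    calc ∑ e ∈ G.filter (fun e => e ⊆ W ∧ e ∈ L), ((PM G (W \ e)).card : ℝ)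
        ≤ ∑ e ∈ G.filter (fun e => e ⊆ W ∧ e ∈ L), θ := by
          refine sum_le_sum fun e he => ?_
          have := (mem_filter.1 he).2.2
          rw [hL, mem_filter] at this
          exact this.2.2.le
      _ ≤ _ := by
          rw [sum_const, nsmul_eq_mul]
          exact mul_le_mul_of_nonneg_right (by exact_mod_cast card_filter_le _ _) hθ
  set c := (∑ M ∈ PM G W, ((M.filter (fun e => e ∈ L)).card : ℝ)) / (PM G W).card with hc
  have hJ := jensen_exp (PM G W) (fun M => -Real.log 2 * (M.filter (fun e => e ∈ L)).card) (-Real.log 2 * c) (by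
    rw [← mul_sum, mul_left_comm, hc, mul_div_cancel₀ _ hΦ.ne'])
  have hZ2 : ∑ M ∈ PM G W, ∏ e ∈ M, a e = ∑ M ∈ PM G W, Real.exp (-Real.log 2 * (M.filter (fun e => e ∈ L)).card) :=
    sum_congr rfl hprod
  rw [hZ2] at hZ
  have h3 : Ub r (t - lam / 2) ν < φ * Real.exp (-(t * θ / φ)) := hU
  have hc0 : 0 ≤ c := div_nonneg (sum_nonneg fun _ _ => Nat.cast_nonneg _) hΦ.le
  have h5 : c ≤ t * θ / φ := by
    rw [hc, div_le_div_iff₀ hΦ hφ0]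
    have h6 : 0 ≤ ∑ M ∈ PM G W, ((M.filter (fun e => e ∈ L)).card : ℝ) := sum_nonneg fun _ _ => Nat.cast_nonneg _
    nlinarith
  have h4 : φ * Real.exp (-(t * θ / φ)) ≤ (PM G W).card * Real.exp (-Real.log 2 * c) := by
    refine mul_le_mul hφ (Real.exp_le_exp.2 ?_) (Real.exp_pos _).le hΦ.le
    have : Real.log 2 * c ≤ 1 * c := mul_le_mul_of_nonneg_right (by have := Real.log_two_lt_d9; linarith) hc0
    linarith
  unfold Ub at h3
  linarith

end

lemma log_fact_le {n : ℕ} (hn : 1 ≤ n) : Real.log n.factorial ≤ n * Real.log n - n + 1 + Real.log n := by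
  induction n, hn using Nat.le_induction with
  | base => simp
  | succ n hn ih =>
    have h0 : (0:ℝ) < n := by exact_mod_cast hn
    rw [Nat.factorial_succ]
    push_cast
    rw [Real.log_mul (by positivity) (by positivity)]
    have h1 := Real.one_sub_inv_le_log_of_pos (show (0:ℝ) < (n + 1) / n by positivity)
    rw [Real.log_div (by positivity) (by positivity)] at h1
    have h2 : 1 - ((n + 1 : ℝ) / n)⁻¹ = 1 / (n + 1) := by field_simp; ring
    rw [h2] at h1
    have h3 : (n + 1 : ℝ) * (1 / (n + 1)) ≤ (n + 1) * (Real.log (n + 1) - Real.log n) :=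
      mul_le_mul_of_nonneg_left h1 (by positivity)
    have h4 : (n + 1 : ℝ) * (1 / (n + 1)) = 1 := by field_simp
    nlinarith

lemma log_fact_ge (n : ℕ) : n * Real.log n - n ≤ Real.log n.factorial := by
  rcases Nat.eq_zero_or_pos n with rfl | hn
  · simp
  have h0 : (0:ℝ) < n := by exact_mod_cast hn
  have h := Real.pow_div_factorial_le_exp (n : ℝ) h0.le n
  have h1 := Real.log_le_log (by positivity) h
  rw [Real.log_exp, Real.log_div (by positivity) (by positivity), Real.log_pow] at h1
  linarith

lemma choose_exp_le (ν h : ℕ) {x : ℝ} (hx : 0 < x) :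
    ((ν + h).choose h : ℝ) ≤ Real.exp (x * (ν + h) + h * Real.log (1 / x)) := by
  have h1 : ((ν + h).choose h : ℝ) * x ^ h ≤ (1 + x) ^ (ν + h) := by
    rw [add_comm 1 x, add_pow]
    have := single_le_sum (f := fun m => x ^ m * 1 ^ (ν + h - m) * ((ν + h).choose m : ℝ))
      (s := range (ν + h + 1)) (fun i _ => by positivity) (mem_range.2 (show h < ν + h + 1 by omega))
    simp only [one_pow, mul_one] at this ⊢
    rw [mul_comm]
    exact this
  have h2 : (1 + x) ^ (ν + h) ≤ Real.exp (x * (ν + h)) := by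
    have := Real.add_one_le_exp x
    calc (1 + x) ^ (ν + h) ≤ (Real.exp x) ^ (ν + h) := pow_le_pow_left₀ (by positivity) (by linarith) _
      _ = _ := by rw [← Real.exp_nat_mul]; push_cast; ring_nf
  have h3 : Real.exp (h * Real.log (1 / x)) = (x ^ h)⁻¹ := by
    rw [Real.exp_nat_mul, Real.exp_log (by positivity), one_div, inv_pow]
  rw [Real.exp_add, h3, ← div_eq_mul_inv, le_div_iff₀ (by positivity)]
  exact h1.trans h2

lemma Ub_le_exact {q : ℕ} (hq : 1 ≤ q) {A : ℝ} (hA : 0 < A) {ν h : ℕ} (hν : 1 ≤ ν)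
    (hh : 2 * ((q:ℝ) + 1) ^ 2 * ν / A * ν ^ q ≤ (h : ℝ) ^ q) :
    Ub (q + 1) A ν ≤ (A / ν) ^ ν * ((ν.factorial * (ν + h).choose h : ℝ) / (ν : ℝ) ^ ν) ^ q := by
  have hν0 : (0:ℝ) < ν := by exact_mod_cast hν
  have h1 : ∀ k ∈ Icc 1 ν, ((A * ((k : ℝ) / ν) ^ (q + 1) + 2 * ((q + 1 : ℕ) : ℝ) ^ 2 * ν * ((k : ℝ) / ν)) / k)
      ≤ A / ν * (((k + h : ℕ) : ℝ) / ν) ^ q := by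
    intro k hk
    have hk0 : (0:ℝ) < k := by exact_mod_cast (mem_Icc.1 hk).1
    have h2 : (k:ℝ) ^ q + (h:ℝ) ^ q ≤ ((k + h : ℕ) : ℝ) ^ q := by
      push_cast
      exact pow_add_pow_le hk0.le (by positivity) (by omega)
    have h3 : ((A * ((k : ℝ) / ν) ^ (q + 1) + 2 * ((q + 1 : ℕ) : ℝ) ^ 2 * ν * ((k : ℝ) / ν)) / k)
        = A / ν * ((k ^ q + 2 * ((q:ℝ) + 1) ^ 2 * ν / A * ν ^ q) / ν ^ q) := by
      push_cast
      rw [div_pow, pow_succ, pow_succ]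
      field_simp
    rw [h3, div_pow]
    gcongr
    linarith
  unfold Ub
  refine (prod_le_prod (fun k hk => by positivity) h1).trans (le_of_eq ?_)
  rw [prod_mul_distrib, prod_const, Nat.card_Icc, Nat.add_sub_cancel, prod_pow, prod_div_distrib, prod_const,
    Nat.card_Icc, Nat.add_sub_cancel]
  congr 3
  have h4 : ∀ ν : ℕ, (∏ k ∈ Icc 1 ν, ((k + h : ℕ) : ℝ)) * h.factorial = (ν + h).factorial := by
    intro ν
    induction ν with
    | zero => simp
    | succ n ih =>
      rw [prod_Icc_succ_top (by omega), mul_right_comm, ih, Nat.add_right_comm, Nat.factorial_succ]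
      push_cast; ring
  have h5 := h4 ν
  have h6 : ((ν + h).factorial : ℝ) = (ν + h).choose h * h.factorial * ν.factorial := by
    have := Nat.choose_mul_factorial_mul_factorial (n := ν + h) (k := h) (by omega)
    rw [Nat.add_sub_cancel] at this
    exact_mod_cast this.symm
  rw [h6] at h5
  have h7 : (h.factorial : ℝ) ≠ 0 := by positivity
  apply mul_right_cancel₀ h7
  linarith


/-- asymptotic form of the upper bound -/
theorem Ub_asymp {q : ℕ} (hq : 1 ≤ q) {ε : ℝ} (hε : 0 < ε) (hε1 : ε ≤ 1) :
    ∃ D₀ : ℝ, 0 < D₀ ∧ ∃ ν₀ : ℕ, ∀ ν : ℕ, ν₀ ≤ ν → ∀ A : ℝ, D₀ * ν ≤ A →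
      Ub (q + 1) A ν ≤ Real.exp (ν * (Real.log (A / ν) - q + ε)) := by
  have hq0 : (0:ℝ) < q := by exact_mod_cast hq
  have hq1 : (1:ℝ) ≤ q := by exact_mod_cast hq
  set x : ℝ := ε / (10 * q) with hx
  have hx0 : 0 < x := by positivity
  have hx1 : x ≤ 1 := by rw [hx, div_le_one (by positivity)]; nlinarith
  have hl0 : 0 ≤ Real.log (1 / x) := Real.log_nonneg (by rw [le_div_iff₀ hx0]; linarith)
  set p : ℝ := x / (1 + Real.log (1 / x)) with hp
  have hp0 : 0 < p := by positivity
  have hpx : p * (1 + Real.log (1 / x)) = x := by rw [hp]; field_simp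
  have hp1 : p ≤ x := by nlinarith
  set D₀ : ℝ := 2 * ((q:ℝ) + 1) ^ 2 / p ^ q with hD
  have hD0 : 0 < D₀ := by positivity
  have hlim : ∀ᶠ ν : ℕ in Filter.atTop, 1 + Real.log (ν : ℝ) ≤ ε / (2 * q) * ν := by
    have h1 := (Real.isLittleO_log_id_atTop.comp_tendsto tendsto_natCast_atTop_atTop).bound
      (show (0:ℝ) < ε / (4 * q) by positivity)
    have h2 := Filter.Tendsto.eventually_ge_atTop (tendsto_natCast_atTop_atTop (R := ℝ)) (4 * q / ε)
    filter_upwards [h1, h2] with ν h1 h2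
    simp only [Function.comp, id, Real.norm_eq_abs, Nat.abs_cast] at h1
    have h3 := (abs_le.1 h1).2
    have h4 : ε / (4 * q) * (4 * q / ε) = 1 := by field_simp
    have h5 : ε / (4 * q) * (4 * q / ε) ≤ ε / (4 * q) * ν := mul_le_mul_of_nonneg_left h2 (by positivity)
    have h6 : ε / (2 * q) * ν = ε / (4 * q) * ν + ε / (4 * q) * ν := by field_simp; ring
    linarith
  obtain ⟨ν₁, hν₁⟩ := Filter.eventually_atTop.1 hlim
  refine ⟨D₀, hD0, max ν₁ (max 1 ⌈1 / p⌉₊), fun ν hν A hA => ?_⟩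
  have hνa : 1 + Real.log (ν : ℝ) ≤ ε / (2 * q) * ν := hν₁ ν (le_trans (le_max_left _ _) hν)
  have hν1 : 1 ≤ ν := le_trans (le_trans (le_max_left _ _) (le_max_right _ _)) hν
  have hνp : 1 / p ≤ ν := by
    refine (Nat.le_ceil _).trans ?_
    exact_mod_cast le_trans (le_trans (le_max_right _ _) (le_max_right _ _)) hν
  have hν0 : (0:ℝ) < ν := by exact_mod_cast hν1
  have hpν : 1 ≤ p * ν := by rw [div_le_iff₀ hp0] at hνp; linarith
  have hA0 : 0 < A := lt_of_lt_of_le (by positivity) hA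
  set h : ℕ := ⌈p * ν⌉₊ with hh
  have hh1 : p * ν ≤ h := Nat.le_ceil _
  have hh2 : (h:ℝ) ≤ 2 * p * ν := by
    have := (Nat.ceil_lt_add_one (show 0 ≤ p * ν by positivity)).le
    linarith
  have hU := Ub_le_exact hq hA0 (h := h) hν1 (by
    calc 2 * ((q:ℝ) + 1) ^ 2 * ν / A * ν ^ q ≤ p ^ q * ν ^ q := by
          refine mul_le_mul_of_nonneg_right ?_ (by positivity)
          rw [div_le_iff₀ hA0]
          have : p ^ q * (D₀ * ν) ≤ p ^ q * A := mul_le_mul_of_nonneg_left hA (by positivity)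
          have h3 : p ^ q * (D₀ * ν) = 2 * ((q:ℝ) + 1) ^ 2 * ν := by rw [hD]; field_simp
          linarith
      _ = (p * ν) ^ q := by rw [mul_pow]
      _ ≤ (h:ℝ) ^ q := pow_le_pow_left₀ (by positivity) hh1 q)
  refine hU.trans ?_
  have hch : 0 < ((ν + h).choose h : ℝ) := by
    exact_mod_cast Nat.choose_pos (by omega)
  rw [← Real.log_le_iff_le_exp (by positivity), Real.log_mul (by positivity) (by positivity), Real.log_pow,
    Real.log_pow, Real.log_div (by positivity) (by positivity), Real.log_div (by positivity) (by positivity),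
    Real.log_mul (by positivity) (by positivity), Real.log_pow]
  have h1 := log_fact_le hν1
  have h2 := Real.log_le_log hch (choose_exp_le ν h hx0)
  rw [Real.log_exp] at h2
  have h3 : x * (ν + h) + h * Real.log (1 / x) ≤ 5 * x * ν := by
    have a1 : (h:ℝ) * Real.log (1 / x) ≤ 2 * p * ν * Real.log (1 / x) := mul_le_mul_of_nonneg_right hh2 hl0
    have a2 : 2 * p * ν * Real.log (1 / x) ≤ 2 * x * ν := by
      have : p * Real.log (1 / x) ≤ x := by nlinarith
      nlinarith
    have a3 : x * h ≤ 1 * h := mul_le_mul_of_nonneg_right hx1 (by positivity)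
    have a4 : p * ν ≤ x * ν := mul_le_mul_of_nonneg_right hp1 hν0.le
    have a5 : x * h ≤ x * (2 * p * ν) := mul_le_mul_of_nonneg_left hh2 hx0.le
    have a6 : x * (2 * p * ν) ≤ 1 * (2 * p * ν) := mul_le_mul_of_nonneg_right hx1 (by positivity)
    linarith
  have h4 : (q:ℝ) * (5 * x * ν) = ε / 2 * ν := by rw [hx]; field_simp; ring
  have h5 : (q:ℝ) * (ε / (2 * q) * ν) = ε / 2 * ν := by field_simp
  have h6 : (q:ℝ) * (Real.log ν.factorial + Real.log ((ν + h).choose h : ℝ) - ν * Real.log ν) ≤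
      q * (-ν + ε / (2 * q) * ν + 5 * x * ν) := by
    refine mul_le_mul_of_nonneg_left ?_ hq0.le
    linarith
  have h7 : q * (-ν + ε / (2 * q) * ν + 5 * x * ν) = -(q:ℝ) * ν + ε * ν := by
    rw [mul_add, mul_add, h4, h5]; ring
  linarith

end Sham

namespace Sham

open scoped Classical in
/-- uniform probability -/
noncomputable def Pr {Ω : Type*} [Fintype Ω] (E : Ω → Prop) : ℝ :=
  ((univ.filter E).card : ℝ) / Fintype.card Ω

lemma Pr_eq {Ω : Type*} [Fintype Ω] (E : Ω → Prop) [DecidablePred E] :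
    Pr E = ((univ.filter E).card : ℝ) / Fintype.card Ω := by
  unfold Pr
  congr!

section resample
variable {N : ℕ} {X : Type*} [Fintype X]

lemma sum_update [DecidableEq (Fin N)] (k : Fin N) (f : (Fin N → X) → ℝ) :
    ∑ ω : Fin N → X, ∑ x : X, f (Function.update ω k x) = Fintype.card X * ∑ ω : Fin N → X, f ω := by
  rw [← Fintype.sum_prod_type' (f := fun (ω : Fin N → X) (x : X) => f (Function.update ω k x))]
  have h : ∑ p : (Fin N → X) × X, f (Function.update p.1 k p.2) = ∑ p : (Fin N → X) × X, f p.1 := by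
    refine Finset.sum_bij' (fun p _ => (Function.update p.1 k p.2, p.1 k))
      (fun p _ => (Function.update p.1 k p.2, p.1 k)) ?_ ?_ ?_ ?_ ?_
    all_goals simp
  rw [h, Fintype.sum_prod_type]
  simp [mul_sum]

lemma sum_swap (j k : Fin N) (f : (Fin N → X) → ℝ) :
    ∑ ω : Fin N → X, f (fun i => ω (Equiv.swap j k i)) = ∑ ω : Fin N → X, f ω :=
  Equiv.sum_comp ((Equiv.swap j k).arrowCongr (Equiv.refl X)) f

lemma forward_bound (S : Finset (Fin N)) (hX : 0 < Fintype.card X) (f : Fin N → (Fin N → X) → ℝ)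
    (h0 : ∀ τ ∈ S, ∀ ω, 0 ≤ f τ ω)
    (hdep : ∀ τ ∈ S, ∀ k : Fin N, τ < k → ∀ ω x, f τ (Function.update ω k x) = f τ ω)
    (hf : ∀ τ ∈ S, ∀ ω, ∑ x : X, f τ (Function.update ω τ x) ≤ Fintype.card X) :
    ∑ ω : Fin N → X, ∏ τ ∈ S, f τ ω ≤ Fintype.card (Fin N → X) := by
  have hX' : (0:ℝ) < Fintype.card X := by exact_mod_cast hX
  induction S using Finset.induction_on_max with
  | empty => simp
  | insert a S ha ih =>
    have hna : a ∉ S := fun h => lt_irrefl _ (ha a h)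
    refine le_trans ?_ (ih (fun τ hτ => h0 τ (mem_insert_of_mem hτ)) (fun τ hτ => hdep τ (mem_insert_of_mem hτ))
      (fun τ hτ => hf τ (mem_insert_of_mem hτ)))
    rw [← mul_le_mul_iff_right₀ hX', ← sum_update a, mul_sum]
    refine sum_le_sum fun ω _ => ?_
    have : ∀ x : X, ∏ τ ∈ insert a S, f τ (Function.update ω a x) =
        (∏ τ ∈ S, f τ ω) * f a (Function.update ω a x) := by
      intro x
      rw [prod_insert hna, mul_comm]
      congr 1
      exact prod_congr rfl fun τ hτ => hdep τ (mem_insert_of_mem hτ) a (ha τ hτ) ω x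
    simp_rw [this]
    rw [← mul_sum, mul_comm]
    exact mul_le_mul_of_nonneg_right (hf a (mem_insert_self _ _) ω)
      (prod_nonneg fun τ hτ => h0 τ (mem_insert_of_mem hτ) ω)

lemma backward_bound (S : Finset (Fin N)) (g : Fin N → (Fin N → X) → ℝ) {c : ℝ}
    (h0 : ∀ τ ∈ S, ∀ ω, 0 ≤ g τ ω)
    (hinv : ∀ τ ∈ S, ∀ k j : Fin N, k < τ → j ≤ k → ∀ ω : Fin N → X,
      g τ (fun i => ω (Equiv.swap j k i)) = g τ ω)
    (hg : ∀ τ ∈ S, ∀ ω : Fin N → X, ∑ j ∈ Finset.Iic τ, g τ (fun i => ω (Equiv.swap j τ i)) ≤ (τ.val + 1) * c) :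
    ∑ ω : Fin N → X, ∏ τ ∈ S, g τ ω ≤ c ^ S.card * Fintype.card (Fin N → X) := by
  induction S using Finset.induction_on_min with
  | empty => simp
  | insert a S ha ih =>
    have hna : a ∉ S := fun h => lt_irrefl _ (ha a h)
    have ih' := ih (fun τ hτ => h0 τ (mem_insert_of_mem hτ)) (fun τ hτ => hinv τ (mem_insert_of_mem hτ))
      (fun τ hτ => hg τ (mem_insert_of_mem hτ))
    rcases isEmpty_or_nonempty (Fin N → X) with hem | ⟨⟨ω₀⟩⟩
    · simp
    have ha0 : (0:ℝ) < a.val + 1 := by positivity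
    have hc0 : 0 ≤ c := by
      have h1 := hg a (mem_insert_self _ _) ω₀
      have h2 : 0 ≤ ∑ j ∈ Finset.Iic a, g a (fun i => ω₀ (Equiv.swap j a i)) :=
        sum_nonneg fun j _ => h0 a (mem_insert_self _ _) _
      by_contra hc
      push Not at hc
      nlinarith
    have key : (a.val + 1 : ℝ) * ∑ ω : Fin N → X, ∏ τ ∈ insert a S, g τ ω ≤
        (a.val + 1 : ℝ) * (c * ∑ ω : Fin N → X, ∏ τ ∈ S, g τ ω) := by
      have h1 : (a.val + 1 : ℝ) * ∑ ω : Fin N → X, ∏ τ ∈ insert a S, g τ ω =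
          ∑ j ∈ Finset.Iic a, ∑ ω : Fin N → X, ∏ τ ∈ insert a S, g τ (fun i => ω (Equiv.swap j a i)) := by
        rw [sum_congr rfl (fun j _ => sum_swap j a (fun ω => ∏ τ ∈ insert a S, g τ ω)), sum_const, Fin.card_Iic]
        simp
      rw [h1, sum_comm, mul_sum, mul_sum]
      refine sum_le_sum fun ω _ => ?_
      have h2 : ∀ j ∈ Finset.Iic a, ∏ τ ∈ insert a S, g τ (fun i => ω (Equiv.swap j a i)) =
          g a (fun i => ω (Equiv.swap j a i)) * ∏ τ ∈ S, g τ ω := by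
        intro j hj
        rw [prod_insert hna]
        congr 1
        exact prod_congr rfl fun τ hτ => hinv τ (mem_insert_of_mem hτ) a j (ha τ hτ) (mem_Iic.1 hj) ω
      rw [sum_congr rfl h2, ← sum_mul, ← mul_assoc]
      exact mul_le_mul_of_nonneg_right (hg a (mem_insert_self _ _) ω)
        (prod_nonneg fun τ hτ => h0 τ (mem_insert_of_mem hτ) ω)
    have key' := le_of_mul_le_mul_left key ha0
    rw [card_insert_of_notMem hna, pow_succ', mul_assoc]
    exact key'.trans (mul_le_mul_of_nonneg_left ih' hc0)

end resample

section slots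
variable {N : ℕ} {X : Type*} {V : Type*} [DecidableEq V] (ed : X → Finset V)

/-- the graph at time t -/
def GG (ω : Fin N → X) (t : ℕ) : Finset (Finset V) :=
  (univ.filter (fun i : Fin N => i.val < t)).image (fun i => ed (ω i))

/-- codegree condition along the process -/
def Cod (ω : Fin N → X) (t : ℕ) : Prop :=
  ∀ x y : V, x ≠ y → (univ.filter (fun i : Fin N => i.val < t ∧ x ∈ ed (ω i) ∧ y ∈ ed (ω i))).card ≤ 2

variable {ed}

lemma mem_GG {ω : Fin N → X} {t : ℕ} {e : Finset V} : e ∈ GG ed ω t ↔ ∃ i : Fin N, i.val < t ∧ ed (ω i) = e := by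
  simp [GG]

lemma GG_mono {ω : Fin N → X} {t t' : ℕ} (h : t ≤ t') : GG ed ω t ⊆ GG ed ω t' := by
  intro e he
  rw [mem_GG] at he ⊢
  obtain ⟨i, hi, h2⟩ := he
  exact ⟨i, by omega, h2⟩

lemma GG_congr {ω ω' : Fin N → X} {t : ℕ} (h : ∀ i : Fin N, i.val < t → ω i = ω' i) : GG ed ω t = GG ed ω' t := by
  ext e
  simp only [mem_GG]
  exact exists_congr fun i => and_congr_right fun hi => by rw [h i hi]

lemma GG_card (ω : Fin N → X) (t : ℕ) : (GG ed ω t).card ≤ t := by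
  refine card_image_le.trans ?_
  have : (univ.filter (fun i : Fin N => i.val < t)).card ≤ (range t).card :=
    card_le_card_of_injOn (fun i => i.val) (fun i hi => by simpa using hi) (fun i _ j _ h => Fin.ext h)
  simpa using this

lemma swap_lt {j k : Fin N} {t : ℕ} (hj : j.val < t) (hk : k.val < t) (i : Fin N) (hi : i.val < t) :
    (Equiv.swap j k i).val < t := by
  by_cases h1 : i = j
  · subst h1; rwa [Equiv.swap_apply_left]
  by_cases h2 : i = k
  · subst h2; rwa [Equiv.swap_apply_right]
  · rwa [Equiv.swap_apply_of_ne_of_ne h1 h2]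

lemma GG_swap {j k : Fin N} {t : ℕ} (hj : j.val < t) (hk : k.val < t) (ω : Fin N → X) :
    GG ed (fun i => ω (Equiv.swap j k i)) t = GG ed ω t := by
  ext e
  simp only [mem_GG]
  constructor
  · rintro ⟨i, hi, h⟩
    exact ⟨Equiv.swap j k i, swap_lt hj hk i hi, h⟩
  · rintro ⟨i, hi, h⟩
    exact ⟨Equiv.swap j k i, swap_lt hj hk i hi, by simpa using h⟩

lemma card_swap {j k : Fin N} {t : ℕ} (hj : j.val < t) (hk : k.val < t) (ω : Fin N → X) (P : X → Prop)
    [DecidablePred P] :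
    (univ.filter (fun i : Fin N => i.val < t ∧ P (ω (Equiv.swap j k i)))).card =
      (univ.filter (fun i : Fin N => i.val < t ∧ P (ω i))).card := by
  refine Finset.card_bij' (fun i _ => Equiv.swap j k i) (fun i _ => Equiv.swap j k i) ?_ ?_ ?_ ?_
  · intro i hi; simp only [mem_filter, mem_univ, true_and] at hi ⊢
    exact ⟨swap_lt hj hk i hi.1, hi.2⟩
  · intro i hi; simp only [mem_filter, mem_univ, true_and] at hi ⊢
    exact ⟨swap_lt hj hk i hi.1, by simpa using hi.2⟩
  · intro i _; simp
  · intro i _; simp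

lemma Cod_swap {j k : Fin N} {t : ℕ} (hj : j.val < t) (hk : k.val < t) (ω : Fin N → X) :
    Cod ed (fun i => ω (Equiv.swap j k i)) t ↔ Cod ed ω t := by
  unfold Cod
  refine forall_congr' fun x => forall_congr' fun y => imp_congr_right fun _ => ?_
  rw [card_swap hj hk ω (fun z => x ∈ ed z ∧ y ∈ ed z)]

lemma Cod.mono {ω : Fin N → X} {t t' : ℕ} (h : Cod ed ω t') (ht : t ≤ t') : Cod ed ω t := by
  intro x y hxy
  refine (card_le_card ?_).trans (h x y hxy)
  intro i hi
  simp only [mem_filter, mem_univ, true_and] at hi ⊢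
  exact ⟨by omega, hi.2⟩

lemma Cod.QR {ω : Fin N → X} {t : ℕ} (h : Cod ed ω t) : QR (GG ed ω t) := by
  intro x y hxy
  refine le_trans ?_ (h x y hxy)
  refine (card_le_card (t := (univ.filter (fun i : Fin N => i.val < t ∧ x ∈ ed (ω i) ∧ y ∈ ed (ω i))).image (fun i => ed (ω i))) ?_).trans card_image_le
  intro e he
  rw [mem_filter, mem_GG] at he
  obtain ⟨⟨i, hi, rfl⟩, h2⟩ := he
  exact mem_image.2 ⟨i, by simp [hi, h2], rfl⟩

lemma Cod.mult {r : ℕ} (hr : 2 ≤ r) (hed : ∀ x, (ed x).card = r) {ω : Fin N → X} {t : ℕ} (h : Cod ed ω t)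
    (P : Finset V → Prop) [DecidablePred P] :
    (univ.filter (fun i : Fin N => i.val < t ∧ P (ed (ω i)))).card ≤ 2 * ((GG ed ω t).filter P).card := by
  refine card_le_mul_card_image_of_maps_to (f := fun i => ed (ω i)) ?_ 2 ?_
  · intro i hi
    simp only [mem_filter, mem_univ, true_and] at hi
    rw [mem_filter, mem_GG]
    exact ⟨⟨i, hi.1, rfl⟩, hi.2⟩
  · intro e he
    rw [mem_filter, mem_GG] at he
    obtain ⟨⟨i₀, hi₀, rfl⟩, h2⟩ := he
    obtain ⟨x, hx, y, hy, hxy⟩ := one_lt_card.1 (show 1 < (ed (ω i₀)).card by rw [hed]; omega)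
    refine le_trans (card_le_card ?_) (h x y hxy)
    intro i hi
    simp only [mem_filter, mem_univ, true_and] at hi ⊢
    exact ⟨hi.1.1, by rw [hi.2]; exact ⟨hx, hy⟩⟩

/-- adding the edge itself does not change the number of matchings avoiding it -/
lemma PM_insert_self {G G' : Finset (Finset V)} {e W : Finset V} (he : e.Nonempty) (h1 : G ⊆ G')
    (h2 : G' ⊆ insert e G) : PM G' (W \ e) = PM G (W \ e) := by
  refine Subset.antisymm ?_ (PM_mono h1 _)
  intro M hM
  have hM' := hM
  rw [mem_PM] at hM ⊢
  refine ⟨fun f hf => ?_, hM.2⟩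
  rcases mem_insert.1 (h2 (hM.1 hf)) with rfl | h
  · obtain ⟨x, hx⟩ := he
    have := PM_edge_subset hM' hf hx
    simp at this
    exact absurd hx this.2
  · exact h

end slots
end Sham

namespace Sham

section slots
variable {N : ℕ} {X : Type*} [Fintype X] {V : Type*} [DecidableEq V] {ed : X → Finset V}

open scoped Classical in
/-- a slot is bad for the pair W, φ -/
def BadSlot (ed : X → Finset V) (ω : Fin N → X) (lo hi : ℕ) (W : Finset V) (φ θ δ' : ℝ) : Prop :=
  φ ≤ (PM (GG ed ω lo) W).card ∧
    δ' * Fintype.card X ≤ ((univ.filter (fun x : X => Light (GG ed ω hi) W θ (ed x))).card : ℝ)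

lemma Light.anti {G G' : Finset (Finset V)} (h : G ⊆ G') {W : Finset V} {θ : ℝ} {S : Finset V}
    (hL : Light G' W θ S) : Light G W θ S :=
  ⟨hL.1, lt_of_le_of_lt (by exact_mod_cast card_le_card (PM_mono h _)) hL.2⟩

lemma update_lt {X : Type*} (ω : Fin N → X) (k : Fin N) (x : X) {t : ℕ} (h : t ≤ k.val) (i : Fin N) (hi : i.val < t) :
    Function.update ω k x i = ω i := by
  rw [Function.update_of_ne]
  rintro rfl
  omega

lemma GG_update (ω : Fin N → X) (k : Fin N) (x : X) {t : ℕ} (h : t ≤ k.val) :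
    GG ed (Function.update ω k x) t = GG ed ω t := GG_congr (update_lt ω k x h)

open scoped Classical in
theorem slot_bound {K ℓ κ r : ℕ} (hr : 2 ≤ r) (hed : ∀ x, (ed x).card = r) (hX : 0 < Fintype.card X)
    (U : Finset (Fin N)) (bm : Fin N → Fin K) (lo hi : Fin K → ℕ)
    (hslot : ∀ b, (U.filter (fun τ => bm τ = b)).card = ℓ)
    (hlohi : ∀ τ ∈ U, lo (bm τ) ≤ τ.val ∧ τ.val < hi (bm τ)) (W : Fin K → Finset V) (φ θ : Fin K → ℝ)
    {δ' δ'' : ℝ} (hδ' : 0 ≤ δ') (hδ'' : 0 ≤ δ'')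
    (hLL : ∀ τ ∈ U, ∀ G : Finset (Finset V), (∀ e ∈ G, e.card = r) → QR G → G.card ≤ τ.val + 1 →
      φ (bm τ) ≤ (PM G (W (bm τ))).card →
      ((G.filter (Light G (W (bm τ)) (θ (bm τ)))).card : ℝ) ≤ δ'' / 2 * (τ.val + 1))
    {t : ℕ} (ht : ∀ τ ∈ U, τ.val < t) :
    Pr (fun ω : Fin N → X => Cod ed ω t ∧
      κ ≤ (univ.filter (fun b => BadSlot ed ω (lo b) (hi b) (W b) (φ b) (θ b) δ')).card) ≤
      Real.exp (K * ℓ * δ'' / 2 - κ * ℓ * δ' / 4) := by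
  have hX' : (0:ℝ) < Fintype.card X := by exact_mod_cast hX
  set cond : Fin N → (Fin N → X) → Prop := fun τ ω =>
    BadSlot ed ω τ.val τ.val (W (bm τ)) (φ (bm τ)) (θ (bm τ)) δ' with hcond
  set LL : Fin N → (Fin N → X) → Prop := fun τ ω =>
    Light (GG ed ω τ.val) (W (bm τ)) (θ (bm τ)) (ed (ω τ)) with hLLdef
  set XX : Fin N → (Fin N → X) → Prop := fun τ ω =>
    (Cod ed ω (τ.val + 1) ∧ φ (bm τ) ≤ (PM (GG ed ω (τ.val + 1)) (W (bm τ))).card) ∧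
      Light (GG ed ω (τ.val + 1)) (W (bm τ)) (θ (bm τ)) (ed (ω τ)) with hXX
  set f : Fin N → (Fin N → X) → ℝ := fun τ ω =>
    if cond τ ω then Real.exp (δ' / 2) * (1 - (1 / 2) * if LL τ ω then 1 else 0) else 1 with hf
  set g : Fin N → (Fin N → X) → ℝ := fun τ ω => 1 + if XX τ ω then 1 else 0 with hg
  have hf0 : ∀ τ ω, 0 ≤ f τ ω := by
    intro τ ω
    simp only [hf]
    split_ifs
    · have := Real.exp_pos (δ' / 2); nlinarith
    · have := Real.exp_pos (δ' / 2); nlinarith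
    · norm_num
  have hg0 : ∀ τ ω, 0 ≤ g τ ω := by
    intro τ ω; simp only [hg]; split_ifs <;> norm_num
  have hcu : ∀ τ k : Fin N, τ ≤ k → ∀ ω x, cond τ (Function.update ω k x) = cond τ ω := by
    intro τ k hk ω x
    simp only [hcond, BadSlot]
    rw [GG_update ω k x (show τ.val ≤ k.val from hk)]
  have hF : ∑ ω : Fin N → X, ∏ τ ∈ U, f τ ω ≤ Fintype.card (Fin N → X) := by
    refine forward_bound U hX f (fun τ _ => hf0 τ) ?_ ?_
    · intro τ _ k hk ω x
      simp only [hf, hLLdef]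
      rw [hcu τ k hk.le ω x, GG_update ω k x (show τ.val ≤ k.val from hk.le),
        Function.update_of_ne hk.ne]
    · intro τ _ ω
      simp only [hf]
      simp_rw [hcu τ τ le_rfl ω]
      by_cases hc : cond τ ω
      · simp only [if_pos hc]
        rw [← mul_sum, sum_sub_distrib, ← mul_sum, ← sum_filter]
        simp only [sum_const, nsmul_eq_mul, mul_one, card_univ]
        have h1 : (univ.filter (fun x => LL τ (Function.update ω τ x))) =
            univ.filter (fun x : X => Light (GG ed ω τ.val) (W (bm τ)) (θ (bm τ)) (ed x)) := by
          ext x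
          simp only [hLLdef, mem_filter, mem_univ, true_and]
          rw [GG_update ω τ x le_rfl, Function.update_self]
        rw [h1]
        have h2 := hc.2
        have h3 : (Fintype.card X : ℝ) - 1 / 2 * ((univ.filter (fun x : X => Light (GG ed ω τ.val) (W (bm τ)) (θ (bm τ)) (ed x))).card : ℝ)
            ≤ Fintype.card X * Real.exp (-(δ' / 2)) := by
          have := Real.add_one_le_exp (-(δ' / 2))
          nlinarith
        calc _ ≤ Real.exp (δ' / 2) * (Fintype.card X * Real.exp (-(δ' / 2))) :=
              mul_le_mul_of_nonneg_left h3 (Real.exp_pos _).le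
          _ = Fintype.card X * (Real.exp (δ' / 2) * Real.exp (-(δ' / 2))) := by ring
          _ = _ := by rw [← Real.exp_add]; simp
      · simp [if_neg hc]
  have hB : ∑ ω : Fin N → X, ∏ τ ∈ U, g τ ω ≤ (1 + δ'') ^ U.card * Fintype.card (Fin N → X) := by
    refine backward_bound U g (fun τ _ => hg0 τ) ?_ ?_
    · intro τ _ k j hk hj ω
      have h1 : j.val < τ.val + 1 := by have : j.val ≤ k.val := hj; have : k.val < τ.val := hk; omega
      have h2 : k.val < τ.val + 1 := by have : k.val < τ.val := hk; omega
      have h3 : XX τ (fun i => ω (Equiv.swap j k i)) ↔ XX τ ω := by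
        simp only [hXX]
        rw [GG_swap h1 h2, Cod_swap h1 h2, Equiv.swap_apply_of_ne_of_ne (lt_of_le_of_lt hj hk).ne' hk.ne']
      simp only [hg]
      rw [if_congr h3 rfl rfl]
    · intro τ hτ ω
      have h3 : ∀ j ∈ Finset.Iic τ, XX τ (fun i => ω (Equiv.swap j τ i)) ↔
          (Cod ed ω (τ.val + 1) ∧ φ (bm τ) ≤ (PM (GG ed ω (τ.val + 1)) (W (bm τ))).card) ∧
            Light (GG ed ω (τ.val + 1)) (W (bm τ)) (θ (bm τ)) (ed (ω j)) := by
        intro j hj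
        have h1 : j.val < τ.val + 1 := Nat.lt_succ_of_le (show j ≤ τ from mem_Iic.1 hj)
        simp only [hXX]
        rw [GG_swap h1 (Nat.lt_succ_self _), Cod_swap h1 (Nat.lt_succ_self _), Equiv.swap_apply_right]
      simp only [hg]
      rw [sum_add_distrib]
      have h4 : ∑ j ∈ Finset.Iic τ, (if XX τ (fun i => ω (Equiv.swap j τ i)) then (1:ℝ) else 0) ≤ (τ.val + 1) * δ'' := by
        rw [sum_congr rfl (fun j hj => by rw [if_congr (h3 j hj) rfl rfl])]
        by_cases hc : Cod ed ω (τ.val + 1) ∧ φ (bm τ) ≤ (PM (GG ed ω (τ.val + 1)) (W (bm τ))).card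
        · simp only [hc, true_and]
          rw [← sum_filter]
          simp only [sum_const, nsmul_eq_mul, mul_one]
          have h5 := hLL τ hτ (GG ed ω (τ.val + 1)) (by
            intro e he; rw [mem_GG] at he; obtain ⟨i, _, rfl⟩ := he; exact hed _) hc.1.QR (GG_card _ _) hc.2
          have h6 := hc.1.mult hr hed (Light (GG ed ω (τ.val + 1)) (W (bm τ)) (θ (bm τ)))
          have h7 : ((Finset.Iic τ).filter (fun j => Light (GG ed ω (τ.val + 1)) (W (bm τ)) (θ (bm τ)) (ed (ω j)))).card ≤
            (univ.filter (fun i : Fin N => i.val < τ.val + 1 ∧ Light (GG ed ω (τ.val + 1)) (W (bm τ)) (θ (bm τ)) (ed (ω i)))).card := by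
            refine card_le_card fun j hj => ?_
            simp only [mem_filter, mem_univ, true_and, mem_Iic] at hj ⊢
            exact ⟨Nat.lt_succ_of_le hj.1, hj.2⟩
          have h8 : (((Finset.Iic τ).filter (fun j => Light (GG ed ω (τ.val + 1)) (W (bm τ)) (θ (bm τ)) (ed (ω j)))).card : ℝ) ≤
            2 * (((GG ed ω (τ.val + 1)).filter (Light (GG ed ω (τ.val + 1)) (W (bm τ)) (θ (bm τ)))).card : ℝ) := by
            exact_mod_cast h7.trans h6
          linarith
        · have : ∑ x ∈ Iic τ, (if (Cod ed ω (τ.val + 1) ∧ φ (bm τ) ≤ (PM (GG ed ω (τ.val + 1)) (W (bm τ))).card) ∧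
            Light (GG ed ω (τ.val + 1)) (W (bm τ)) (θ (bm τ)) (ed (ω x)) then (1:ℝ) else 0) = 0 :=
            sum_eq_zero fun j _ => if_neg fun h => hc h.1
          rw [this]; positivity
      simp only [sum_const, Fin.card_Iic, nsmul_eq_mul, mul_one]
      push_cast
      linarith
  have hUcard : U.card = K * ℓ := by
    rw [card_eq_sum_card_fiberwise (f := bm) (t := univ) (by simp)]
    simp [hslot]
  have hB' : ∑ ω : Fin N → X, ∏ τ ∈ U, g τ ω ≤ Real.exp (K * ℓ * δ'') * Fintype.card (Fin N → X) := by
    refine hB.trans (mul_le_mul_of_nonneg_right ?_ (by positivity))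
    have := Real.add_one_le_exp δ''
    calc (1 + δ'') ^ U.card ≤ (Real.exp δ'') ^ U.card := pow_le_pow_left₀ (by positivity) (by linarith) _
      _ = _ := by rw [← Real.exp_nat_mul, hUcard]; push_cast; ring_nf
  -- on the event
  set E : (Fin N → X) → Prop := fun ω => Cod ed ω t ∧
      κ ≤ (univ.filter (fun b => BadSlot ed ω (lo b) (hi b) (W b) (φ b) (θ b) δ')).card with hE
  have hev : ∀ ω, E ω → Real.exp (κ * ℓ * δ' / 2) ≤ (∏ τ ∈ U, f τ ω) * ∏ τ ∈ U, g τ ω := by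
    intro ω hω
    rw [← prod_mul_distrib]
    have h1 : ∀ τ ∈ U, (if cond τ ω then Real.exp (δ' / 2) else 1) ≤ f τ ω * g τ ω := by
      intro τ hτ
      have hgge : 1 ≤ g τ ω := by simp only [hg]; split_ifs <;> norm_num
      by_cases hc : cond τ ω
      · simp only [if_pos hc]
        have hfv : f τ ω = Real.exp (δ' / 2) * (1 - (1 / 2) * if LL τ ω then 1 else 0) := by
          simp only [hf]; rw [if_pos hc]
        rw [hfv]
        by_cases hL : LL τ ω
        · have hx : XX τ ω := by
            have hsub : GG ed ω τ.val ⊆ GG ed ω (τ.val + 1) := GG_mono (Nat.le_succ _)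
            refine ⟨⟨hω.1.mono (ht τ hτ), hc.1.trans (by exact_mod_cast card_le_card (PM_mono hsub _))⟩, hL.1, ?_⟩
            rw [PM_insert_self (G := GG ed ω τ.val) (by rw [← card_pos, hed]; omega) hsub]
            · exact hL.2
            · intro e he
              rw [mem_GG] at he
              obtain ⟨i, hi, rfl⟩ := he
              rw [mem_insert, mem_GG]
              rcases Nat.lt_succ_iff_lt_or_eq.1 hi with h | h
              · exact Or.inr ⟨i, h, rfl⟩
              · left; rw [Fin.ext h]
          have hgv : g τ ω = 2 := by simp only [hg]; rw [if_pos hx]; norm_num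
          rw [hgv, if_pos hL]
          apply le_of_eq; ring
        · rw [if_neg hL]
          have := Real.exp_pos (δ' / 2)
          nlinarith
      · simp only [if_neg hc]
        have hfv : f τ ω = 1 := by simp only [hf]; rw [if_neg hc]
        rw [hfv]; linarith
    refine le_trans ?_ (prod_le_prod (fun τ _ => by split_ifs <;> positivity) h1)
    rw [prod_ite, prod_const, prod_const_one, mul_one, ← Real.exp_nat_mul, Real.exp_le_exp]
    have h2 : κ * ℓ ≤ (U.filter (fun τ => cond τ ω)).card := by
      have h3 : ((univ.filter (fun b => BadSlot ed ω (lo b) (hi b) (W b) (φ b) (θ b) δ')).biUnion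
          (fun b => U.filter (fun τ => bm τ = b))) ⊆ U.filter (fun τ => cond τ ω) := by
        intro τ hτ
        simp only [mem_biUnion, mem_filter, mem_univ, true_and] at hτ ⊢
        obtain ⟨b, hb, hτU, rfl⟩ := hτ
        refine ⟨hτU, ?_, ?_⟩
        · exact hb.1.trans (by exact_mod_cast card_le_card (PM_mono (GG_mono (hlohi τ hτU).1) _))
        · refine hb.2.trans ?_
          have : (univ.filter (fun x : X => Light (GG ed ω (hi (bm τ))) (W (bm τ)) (θ (bm τ)) (ed x))) ⊆
            (univ.filter (fun x : X => Light (GG ed ω τ.val) (W (bm τ)) (θ (bm τ)) (ed x))) := by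
            intro x hx
            simp only [mem_filter, mem_univ, true_and] at hx ⊢
            exact hx.anti (GG_mono (hlohi τ hτU).2.le)
          exact_mod_cast card_le_card this
      refine le_trans ?_ (card_le_card h3)
      rw [card_biUnion, sum_congr rfl (fun b _ => hslot b), sum_const, smul_eq_mul]
      · exact Nat.mul_le_mul_right _ hω.2
      · intro b _ b' _ hbb
        rw [Function.onFun, disjoint_left]
        intro τ h1 h2
        rw [mem_filter] at h1 h2
        exact hbb (h1.2.symm.trans h2.2)
    have h4 : (κ * ℓ : ℝ) ≤ ((U.filter (fun τ => cond τ ω)).card : ℝ) := by exact_mod_cast h2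
    nlinarith
  -- combine
  set c := Real.exp (κ * ℓ * δ' / 4) with hc
  set s := Real.exp (K * ℓ * δ'' / 2) with hs
  have hc0 : 0 < c := Real.exp_pos _
  have hs0 : 0 < s := Real.exp_pos _
  have hcc : c * c = Real.exp (κ * ℓ * δ' / 2) := by rw [hc, ← Real.exp_add]; ring_nf
  have hss : s * s = Real.exp (K * ℓ * δ'') := by rw [hs, ← Real.exp_add]; ring_nf
  have hsum : ∑ ω : Fin N → X, (if E ω then 2 * c else 0) ≤
      ∑ ω : Fin N → X, (s * (∏ τ ∈ U, f τ ω) + s⁻¹ * ∏ τ ∈ U, g τ ω) := by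
    refine sum_le_sum fun ω _ => ?_
    have ha : 0 ≤ ∏ τ ∈ U, f τ ω := prod_nonneg fun τ _ => hf0 τ ω
    have hb : 0 ≤ ∏ τ ∈ U, g τ ω := prod_nonneg fun τ _ => hg0 τ ω
    set a := ∏ τ ∈ U, f τ ω
    set b := ∏ τ ∈ U, g τ ω
    split_ifs with hω
    · have h1 := hev ω hω
      rw [← hcc] at h1
      have h2 : (s * a) * (s⁻¹ * b) = a * b := by field_simp
      have h3 : 0 ≤ s * a := by positivity
      have h4 : 0 ≤ s⁻¹ * b := by positivity
      have h5 : (2 * c) ^ 2 ≤ (s * a + s⁻¹ * b) ^ 2 := by nlinarith [sq_nonneg (s * a - s⁻¹ * b)]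
      exact le_of_sq_le_sq h5 (by positivity)
    · positivity
  rw [sum_add_distrib, ← mul_sum, ← mul_sum, ← sum_filter, sum_const, nsmul_eq_mul] at hsum
  have hΩ : (0:ℝ) < Fintype.card (Fin N → X) := by
    have : Nonempty X := Fintype.card_pos_iff.1 hX
    exact_mod_cast Fintype.card_pos
  have h1 : ((univ.filter E).card : ℝ) * (2 * c) ≤ 2 * s * Fintype.card (Fin N → X) := by
    refine hsum.trans ?_
    have h2 := mul_le_mul_of_nonneg_left hF hs0.le
    have h3 := mul_le_mul_of_nonneg_left hB' (inv_pos.2 hs0).le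
    have h4 : s⁻¹ * (Real.exp (K * ℓ * δ'') * Fintype.card (Fin N → X)) = s * Fintype.card (Fin N → X) := by
      rw [← hss]; field_simp
    linarith
  have h2 : Real.exp (K * ℓ * δ'' / 2 - κ * ℓ * δ' / 4) = s / c := by rw [Real.exp_sub]
  rw [h2]
  rw [Pr_eq, div_le_div_iff₀ hΩ hc0]
  linarith

end slots
end Sham

namespace Sham

section greedy
variable {V : Type*} [DecidableEq V]

/-- matchings of size j inside V₀ -/
def Mat (G : Finset (Finset V)) (V₀ : Finset V) (j : ℕ) : Finset (Finset (Finset V)) :=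
  G.powerset.filter (fun M => (∀ A ∈ M, ∀ B ∈ M, A ≠ B → A ∩ B = ∅) ∧ M.biUnion id ⊆ V₀ ∧ M.card = j)

lemma mem_Mat {G : Finset (Finset V)} {V₀ : Finset V} {j : ℕ} {M : Finset (Finset V)} :
    M ∈ Mat G V₀ j ↔ M ∈ PM G (M.biUnion id) ∧ M.biUnion id ⊆ V₀ ∧ M.card = j := by
  simp only [Mat, mem_filter, mem_powerset, mem_PM, and_true]
  tauto

lemma Mat_step {G : Finset (Finset V)} {r : ℕ} (hr : 1 ≤ r) (hG : ∀ e ∈ G, e.card = r) {V₀ : Finset V} {j : ℕ}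
    {L : ℝ}
    (hL : ∀ U ⊆ V₀, U.card = V₀.card - r * j → L ≤ ((G.filter (fun e => e ⊆ U)).card : ℝ)) :
    ((Mat G V₀ j).card : ℝ) * L ≤ (j + 1) * (Mat G V₀ (j + 1)).card := by
  have h1 : ((Mat G V₀ j).card : ℝ) * L ≤ ∑ M ∈ Mat G V₀ j, ∑ e ∈ G.filter (fun e => e ⊆ V₀ \ M.biUnion id), (1:ℝ) := by
    rw [← nsmul_eq_mul, ← sum_const]
    refine sum_le_sum fun M hM => ?_
    rw [mem_Mat] at hM
    have := hL (V₀ \ M.biUnion id) sdiff_subset (by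
      rw [card_sdiff_of_subset hM.2.1, ← PM_card hG hM.1, hM.2.2, Nat.mul_comm])
    simpa using this
  refine h1.trans ?_
  have h2 : (j + 1 : ℝ) * (Mat G V₀ (j + 1)).card = ∑ M ∈ Mat G V₀ (j + 1), ∑ e ∈ M, (1:ℝ) := by
    rw [sum_congr rfl (g := fun _ => (j + 1 : ℝ))]
    · rw [sum_const, nsmul_eq_mul, mul_comm]
    · intro M hM
      rw [mem_Mat] at hM
      simp [hM.2.2]
  rw [h2, sum_sigma', sum_sigma']
  refine sum_le_sum_of_injOn (fun p => ⟨insert p.2 p.1, p.2⟩) ?_ ?_ (fun _ _ => zero_le_one) (fun _ _ => le_rfl)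
  · rintro ⟨M, e⟩ h
    simp only [mem_sigma, mem_filter] at h ⊢
    obtain ⟨hM, he, heU⟩ := h
    rw [mem_Mat] at hM ⊢
    have hene : e.Nonempty := by rw [← card_pos, hG e he]; omega
    have heM : e ∉ M := by
      intro h
      obtain ⟨x, hx⟩ := hene
      have := mem_sdiff.1 (heU hx)
      exact this.2 (mem_biUnion.2 ⟨e, h, hx⟩)
    have hdis : Disjoint e (M.biUnion id) := disjoint_of_subset_left heU sdiff_disjoint
    refine ⟨⟨?_, ?_, ?_⟩, mem_insert_self _ _⟩
    · rw [biUnion_insert]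
      refine PM_insert he subset_union_left ?_
      rw [id, union_sdiff_left, sdiff_eq_self_of_disjoint hdis.symm]
      exact hM.1
    · rw [biUnion_insert]
      exact union_subset (heU.trans sdiff_subset) hM.2.1
    · rw [card_insert_of_notMem heM, hM.2.2]
  · rintro ⟨M, e⟩ h ⟨M', e'⟩ h' hh
    simp only [coe_sigma, Set.mem_sigma_iff, mem_coe, mem_filter] at h h'
    simp only [Sigma.mk.injEq, heq_eq_eq] at hh
    obtain ⟨h2, rfl⟩ := hh
    have hnot : ∀ M'' : Finset (Finset V), e ∈ G → e ⊆ V₀ \ M''.biUnion id → e ∉ M'' := by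
      intro M'' he heU h
      have hene : e.Nonempty := by rw [← card_pos, hG e he]; omega
      obtain ⟨x, hx⟩ := hene
      exact (mem_sdiff.1 (heU hx)).2 (mem_biUnion.2 ⟨e, h, hx⟩)
    have : M = M' := by
      rw [← erase_insert (hnot M h.2.1 h.2.2), ← erase_insert (hnot M' h'.2.1 h'.2.2), h2]
    subst this
    rfl

lemma desc_mul (n₀ r j : ℕ) : n₀.descFactorial (r * j) * (n₀ - r * j).descFactorial r = n₀.descFactorial (r * (j + 1)) := by
  rw [Nat.mul_succ, Nat.add_comm, ← Nat.descFactorial_mul_descFactorial (k := r * j) (m := r + r * j) (by omega)]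
  rw [Nat.add_sub_cancel, Nat.mul_comm]

theorem greedy {G : Finset (Finset V)} {r : ℕ} (hr : 1 ≤ r) (hG : ∀ e ∈ G, e.card = r) {V₀ : Finset V} {J : ℕ}
    (hJ : r * J ≤ V₀.card) {c : ℝ} (hc : 0 ≤ c)
    (h : ∀ U ⊆ V₀, V₀.card - r * J ≤ U.card → c * (U.card.descFactorial r : ℝ) ≤ ((G.filter (fun e => e ⊆ U)).card : ℝ)) :
    ∃ W ⊆ V₀, W.card = r * J ∧ c ^ J * (r * J).factorial / J.factorial ≤ ((PM G W).card : ℝ) := by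
  have h1 : ∀ j ≤ J, c ^ j * (V₀.card.descFactorial (r * j) : ℝ) ≤ j.factorial * (Mat G V₀ j).card := by
    intro j
    induction j with
    | zero =>
      intro _
      have : ∅ ∈ Mat G V₀ 0 := by simp [Mat]
      have : 1 ≤ (Mat G V₀ 0).card := card_pos.2 ⟨_, this⟩
      simpa using this
    | succ j ih =>
      intro hj
      have ih' := ih (by omega)
      have hrj : r * j ≤ r * J := Nat.mul_le_mul_left _ (by omega)
      have h2 := Mat_step hr hG (V₀ := V₀) (j := j) (L := c * ((V₀.card - r * j).descFactorial r : ℝ)) (by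
        intro U hU hUc
        have := h U hU (by omega)
        rwa [hUc] at this)
      have h3 : (0:ℝ) ≤ c * ((V₀.card - r * j).descFactorial r : ℝ) := by positivity
      calc c ^ (j + 1) * (V₀.card.descFactorial (r * (j + 1)) : ℝ)
          = (c ^ j * (V₀.card.descFactorial (r * j) : ℝ)) * (c * ((V₀.card - r * j).descFactorial r : ℝ)) := by
            rw [← desc_mul]; push_cast; ring
        _ ≤ (j.factorial * (Mat G V₀ j).card) * (c * ((V₀.card - r * j).descFactorial r : ℝ)) :=
            mul_le_mul_of_nonneg_right ih' h3
        _ = j.factorial * ((Mat G V₀ j).card * (c * ((V₀.card - r * j).descFactorial r : ℝ))) := by ring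
        _ ≤ j.factorial * ((j + 1) * (Mat G V₀ (j + 1)).card) := mul_le_mul_of_nonneg_left h2 (by positivity)
        _ = _ := by rw [Nat.factorial_succ]; push_cast; ring
  have h2 := h1 J le_rfl
  by_contra hcon
  push Not at hcon
  set B := c ^ J * (r * J).factorial / J.factorial with hB
  have h3 : (Mat G V₀ J).card ≤ ∑ W ∈ V₀.powersetCard (r * J), (PM G W).card := by
    rw [← card_sigma]
    refine card_le_card_of_injOn (fun M => ⟨M.biUnion id, M⟩) ?_ ?_
    · intro M hM
      rw [mem_coe, mem_Mat] at hM
      simp only [coe_sigma, Set.mem_sigma_iff, mem_coe, mem_powersetCard]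
      refine ⟨⟨hM.2.1, ?_⟩, hM.1⟩
      rw [← PM_card hG hM.1, hM.2.2, Nat.mul_comm]
    · intro M _ M' _ hh
      simp only [Sigma.mk.injEq, heq_eq_eq] at hh
      exact hh.2
  have hne : (V₀.powersetCard (r * J)).Nonempty := powersetCard_nonempty.2 hJ
  have h4 : (∑ W ∈ V₀.powersetCard (r * J), ((PM G W).card : ℝ)) < ∑ W ∈ V₀.powersetCard (r * J), B := by
    refine sum_lt_sum_of_nonempty hne fun W hW => ?_
    rw [mem_powersetCard] at hW
    exact hcon W hW.1 hW.2
  rw [sum_const, card_powersetCard, nsmul_eq_mul] at h4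
  have h5 : ((Mat G V₀ J).card : ℝ) ≤ ∑ W ∈ V₀.powersetCard (r * J), ((PM G W).card : ℝ) := by exact_mod_cast h3
  have h6 : (J.factorial : ℝ) * (V₀.card.choose (r * J) * B) = c ^ J * (V₀.card.descFactorial (r * J) : ℝ) := by
    rw [Nat.descFactorial_eq_factorial_mul_choose, hB]
    push_cast
    field_simp
  have h7 : (J.factorial : ℝ) * (Mat G V₀ J).card < J.factorial * (V₀.card.choose (r * J) * B) :=
    mul_lt_mul_of_pos_left (lt_of_le_of_lt h5 h4) (by positivity)
  linarith

end greedy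

section chernoff
variable {N : ℕ} {X : Type*} [Fintype X]

lemma Pr_mono {Ω : Type*} [Fintype Ω] {E F : Ω → Prop} (h : ∀ ω, E ω → F ω) : Pr E ≤ Pr F := by
  classical
  rw [Pr_eq, Pr_eq]
  gcongr
  exact h _

lemma Pr_or {Ω : Type*} [Fintype Ω] (E F : Ω → Prop) : Pr (fun ω => E ω ∨ F ω) ≤ Pr E + Pr F := by
  classical
  rw [Pr_eq, Pr_eq, Pr_eq, ← add_div, filter_or]
  gcongr
  exact_mod_cast card_union_le _ _

lemma Pr_nonneg {Ω : Type*} [Fintype Ω] (E : Ω → Prop) : 0 ≤ Pr E := by unfold Pr; positivity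

lemma Pr_exists {Ω ι : Type*} [Fintype Ω] (s : Finset ι) (E : ι → Ω → Prop) :
    Pr (fun ω => ∃ i ∈ s, E i ω) ≤ ∑ i ∈ s, Pr (E i) := by
  classical
  induction s using Finset.induction_on with
  | empty => simp [Pr]
  | insert a s ha ih =>
    rw [sum_insert ha]
    refine le_trans (Pr_mono ?_) ((Pr_or (E a) (fun ω => ∃ i ∈ s, E i ω)).trans (by gcongr))
    rintro ω ⟨i, hi, h⟩
    rcases mem_insert.1 hi with rfl | hi
    · exact Or.inl h
    · exact Or.inr ⟨i, hi, h⟩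

lemma Pr_exists_le {Ω ι : Type*} [Fintype Ω] (s : Finset ι) (E : ι → Ω → Prop) {p : ℝ}
    (h : ∀ i ∈ s, Pr (E i) ≤ p) : Pr (fun ω => ∃ i ∈ s, E i ω) ≤ s.card * p := by
  refine (Pr_exists s E).trans ((sum_le_sum h).trans ?_)
  simp

/-- Markov -/
lemma Pr_markov {Ω : Type*} [Fintype Ω] [Nonempty Ω] (E : Ω → Prop) (f : Ω → ℝ) (hf : ∀ ω, 0 ≤ f ω) {c b : ℝ} (hc : 0 < c)
    (hE : ∀ ω, E ω → c ≤ f ω) (hb : ∑ ω, f ω ≤ b * Fintype.card Ω) : Pr E ≤ b / c := by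
  classical
  have hΩ : (0:ℝ) < Fintype.card Ω := by exact_mod_cast Fintype.card_pos
  rw [Pr_eq, div_le_div_iff₀ hΩ hc]
  refine le_trans ?_ hb
  rw [← nsmul_eq_mul, ← sum_const]
  refine (sum_le_sum (g := f) fun ω hω => hE ω (mem_filter.1 hω).2).trans ?_
  exact sum_le_sum_of_subset_of_nonneg (filter_subset _ _) (fun ω _ _ => hf ω)

lemma exp_neg_quad {β : ℝ} (h : 0 ≤ β) : Real.exp (-β) ≤ 1 - β + β ^ 2 / 2 := by
  have h1 := Real.quadratic_le_exp_of_nonneg h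
  have h3 : 0 < 1 + β + β ^ 2 / 2 := by positivity
  rw [Real.exp_neg]
  refine (inv_anti₀ h3 h1).trans ?_
  rw [inv_le_iff_one_le_mul₀ h3]
  nlinarith [sq_nonneg (β ^ 2)]

open scoped Classical in
/-- Chernoff lower tail -/
lemma chernoff_lower (hX : 0 < Fintype.card X) (S : Finset (Fin N)) (Q : X → Prop) {p β : ℝ} (hp0 : 0 ≤ p) (hβ : 0 ≤ β)
    (hp : p * Fintype.card X ≤ ((univ.filter Q).card : ℝ)) :
    Pr (fun ω : Fin N → X => ((S.filter (fun i => Q (ω i))).card : ℝ) ≤ (1 - β) * (p * S.card)) ≤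
      Real.exp (-(β ^ 2 / 2 * (p * S.card))) := by
  have hX' : (0:ℝ) < Fintype.card X := by exact_mod_cast hX
  have : Nonempty X := Fintype.card_pos_iff.1 hX
  have hb1 : Real.exp (-β) ≤ 1 := Real.exp_le_one_iff.2 (by linarith)
  set A := p * (1 - Real.exp (-β)) with hA
  have h1 := forward_bound S hX (fun τ (ω : Fin N → X) => Real.exp A * (1 - (1 - Real.exp (-β)) * if Q (ω τ) then 1 else 0))
    (by
      intro τ _ ω
      refine mul_nonneg (Real.exp_pos _).le ?_
      have := Real.exp_pos (-β)
      split_ifs <;> linarith)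
    (by
      intro τ _ k hk ω x
      rw [Function.update_of_ne hk.ne])
    (by
      intro τ _ ω
      simp only [Function.update_self]
      rw [← mul_sum, sum_sub_distrib, ← mul_sum, ← sum_filter]
      simp only [sum_const, nsmul_eq_mul, mul_one, card_univ]
      have h2 : (Fintype.card X : ℝ) - (1 - Real.exp (-β)) * ((univ.filter Q).card : ℝ) ≤ Fintype.card X * Real.exp (-A) := by
        have h3 := Real.add_one_le_exp (-A)
        have h4 : (1 - Real.exp (-β)) * (p * Fintype.card X) ≤ (1 - Real.exp (-β)) * ((univ.filter Q).card : ℝ) :=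
          mul_le_mul_of_nonneg_left hp (by linarith)
        nlinarith
      calc _ ≤ Real.exp A * (Fintype.card X * Real.exp (-A)) := mul_le_mul_of_nonneg_left h2 (Real.exp_pos _).le
        _ = Fintype.card X * (Real.exp A * Real.exp (-A)) := by ring
        _ = _ := by rw [← Real.exp_add]; simp)
  have h2 := Pr_markov (fun ω : Fin N → X => ((S.filter (fun i => Q (ω i))).card : ℝ) ≤ (1 - β) * (p * S.card))
    _ (c := Real.exp (A * S.card - β * ((1 - β) * (p * S.card)))) (b := 1) (fun ω => prod_nonneg (s := S)
      (f := fun τ => Real.exp A * (1 - (1 - Real.exp (-β)) * if Q (ω τ) then 1 else 0)) (by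
      intro τ _
      refine mul_nonneg (Real.exp_pos _).le ?_
      have := Real.exp_pos (-β)
      split_ifs <;> linarith)) (Real.exp_pos _) (by
      intro ω hω
      have h3 : ∀ τ ∈ S, Real.exp A * (1 - (1 - Real.exp (-β)) * if Q (ω τ) then 1 else 0) =
          Real.exp A * (if Q (ω τ) then Real.exp (-β) else 1) := by
        intro τ _; split_ifs <;> ring
      rw [prod_congr rfl h3, prod_mul_distrib, prod_const, prod_ite, prod_const, prod_const_one, mul_one,
        ← Real.exp_nat_mul, ← Real.exp_nat_mul, ← Real.exp_add, Real.exp_le_exp]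
      nlinarith) (by rw [one_mul]; exact h1)
  refine h2.trans ?_
  rw [one_div, ← Real.exp_neg, Real.exp_le_exp]
  have h5 := exp_neg_quad hβ
  have h6 : 0 ≤ p * S.card := by positivity
  have h7 : (p * S.card) * (β - β ^ 2 / 2) ≤ (p * S.card) * (1 - Real.exp (-β)) := mul_le_mul_of_nonneg_left (by linarith) h6
  rw [hA]
  nlinarith

end chernoff
end Sham

namespace Sham

section resample2
variable {N : ℕ} {X : Type*} [Fintype X]

open scoped Classical in
/-- resampling a set of coordinates -/
lemma resample_count (I : Finset (Fin N)) (R : (Fin N → X) → Prop) (Q : (Fin N → X) → X → Prop) {p : ℝ} (hp : 0 ≤ p)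
    (hX : 0 < Fintype.card X)
    (hR : ∀ i ∈ I, ∀ ω x, R (Function.update ω i x) ↔ R ω)
    (hQ : ∀ i ∈ I, ∀ ω x y, Q (Function.update ω i x) y ↔ Q ω y)
    (hc : ∀ ω, R ω → ((univ.filter (Q ω)).card : ℝ) ≤ p * Fintype.card X) :
    Pr (fun ω => R ω ∧ ∀ i ∈ I, Q ω (ω i)) ≤ p ^ I.card * Pr R := by
  have hX' : (0:ℝ) < Fintype.card X := by exact_mod_cast hX
  induction I using Finset.induction_on with
  | empty => simp
  | insert a I ha ih =>
    have ih' := ih (fun i hi => hR i (mem_insert_of_mem hi)) (fun i hi => hQ i (mem_insert_of_mem hi))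
    rw [card_insert_of_notMem ha, pow_succ', mul_assoc]
    refine le_trans ?_ (mul_le_mul_of_nonneg_left ih' hp)
    rw [Pr_eq, Pr_eq, ← mul_div_assoc]
    refine div_le_div_of_nonneg_right ?_ (by positivity)
    have e1 : ∀ (E : (Fin N → X) → Prop) [DecidablePred E], ((univ.filter E).card : ℝ) = ∑ ω, if E ω then (1:ℝ) else 0 := by
      intro E _; simp
    rw [e1, e1, ← mul_le_mul_iff_right₀ hX', ← sum_update a, mul_sum, mul_sum]
    refine sum_le_sum fun ω _ => ?_
    have e2 : ∀ x, (R (Function.update ω a x) ∧ ∀ i ∈ insert a I, Q (Function.update ω a x) (Function.update ω a x i)) ↔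
        (R ω ∧ ∀ i ∈ I, Q ω (ω i)) ∧ Q ω x := by
      intro x
      rw [hR a (mem_insert_self _ _), forall_mem_insert, and_assoc]
      refine and_congr_right fun _ => ?_
      rw [hQ a (mem_insert_self _ _), Function.update_self, and_comm]
      refine and_congr_left fun _ => forall₂_congr fun i hi => ?_
      rw [hQ a (mem_insert_self _ _), Function.update_of_ne]
      rintro rfl
      exact ha hi
    simp_rw [e2]
    by_cases h : R ω ∧ ∀ i ∈ I, Q ω (ω i)
    · have h' := hc ω h.1
      simp_rw [and_iff_right h]
      rw [if_pos h, sum_boole, mul_one]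
      linarith
    · simp [h]

open scoped Classical in
/-- strong lower tail -/
lemma low_tail (hX : 0 < Fintype.card X) (S : Finset (Fin N)) (Q : X → Prop) {p lam : ℝ} (hl : 0 < lam) (hl1 : lam ≤ 1)
    (k : ℕ) (hp : p * Fintype.card X ≤ ((univ.filter Q).card : ℝ)) :
    Pr (fun ω : Fin N → X => (S.filter (fun i => Q (ω i))).card ≤ k) ≤
      (1 / lam) ^ k * Real.exp (-((1 - lam) * (p * S.card))) := by
  have hX' : (0:ℝ) < Fintype.card X := by exact_mod_cast hX
  have : Nonempty X := Fintype.card_pos_iff.1 hX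
  set A := p * (1 - lam) with hA
  have h0 : ∀ τ (ω : Fin N → X), 0 ≤ Real.exp A * (if Q (ω τ) then lam else 1) := by
    intro τ ω
    refine mul_nonneg (Real.exp_pos _).le ?_
    split_ifs <;> linarith
  have h1 := forward_bound S hX (fun τ (ω : Fin N → X) => Real.exp A * (if Q (ω τ) then lam else 1))
    (fun τ _ ω => h0 τ ω)
    (by
      intro τ _ k hk ω x
      rw [Function.update_of_ne hk.ne])
    (by
      intro τ _ ω
      simp only [Function.update_self]
      have e1 : ∀ x : X, (if Q x then lam else 1) = 1 - (1 - lam) * (if Q x then 1 else 0) := by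
        intro x; split_ifs <;> ring
      simp_rw [e1]
      rw [← mul_sum, sum_sub_distrib, ← mul_sum, ← sum_filter]
      simp only [sum_const, nsmul_eq_mul, mul_one, card_univ]
      have h2 : (Fintype.card X : ℝ) - (1 - lam) * ((univ.filter Q).card : ℝ) ≤ Fintype.card X * Real.exp (-A) := by
        have h3 := Real.add_one_le_exp (-A)
        have h4 : (1 - lam) * (p * Fintype.card X) ≤ (1 - lam) * ((univ.filter Q).card : ℝ) :=
          mul_le_mul_of_nonneg_left hp (by linarith)
        nlinarith
      calc _ ≤ Real.exp A * (Fintype.card X * Real.exp (-A)) := mul_le_mul_of_nonneg_left h2 (Real.exp_pos _).le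
        _ = Fintype.card X * (Real.exp A * Real.exp (-A)) := by ring
        _ = _ := by rw [← Real.exp_add]; simp)
  have h2 := Pr_markov (fun ω : Fin N → X => (S.filter (fun i => Q (ω i))).card ≤ k)
    _ (c := Real.exp (A * S.card) * lam ^ k) (b := 1) (fun ω => prod_nonneg (s := S)
      (f := fun τ => Real.exp A * (if Q (ω τ) then lam else 1)) (fun τ _ => h0 τ ω)) (by positivity) (by
      intro ω hω
      rw [prod_mul_distrib, prod_const, prod_ite, prod_const, prod_const_one, mul_one,
        ← Real.exp_nat_mul, mul_comm A]
      exact mul_le_mul_of_nonneg_left (pow_le_pow_of_le_one hl.le hl1 hω) (Real.exp_pos _).le) (by rw [one_mul]; exact h1)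
  refine h2.trans (le_of_eq ?_)
  rw [one_div, mul_inv, ← Real.exp_neg, one_div, inv_pow, mul_comm, hA]
  congr 2
  ring

/-- resampling inside a product class -/
lemma pi_resample [DecidableEq X] (C : Fin N → Finset X) (J : Finset (Fin N)) (f : (Fin N → X) → ℝ) :
    ∑ ω ∈ Fintype.piFinset C, ∑ y ∈ Fintype.piFinset C, f (J.piecewise y ω) =
      (Fintype.piFinset C).card * ∑ ω ∈ Fintype.piFinset C, f ω := by
  rw [← sum_product' (f := fun ω y => f (J.piecewise y ω))]
  have h : ∑ p ∈ Fintype.piFinset C ×ˢ Fintype.piFinset C, f (J.piecewise p.2 p.1) =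
      ∑ p ∈ Fintype.piFinset C ×ˢ Fintype.piFinset C, f p.1 := by
    have hm : ∀ p ∈ Fintype.piFinset C ×ˢ Fintype.piFinset C,
        (J.piecewise p.2 p.1, J.piecewise p.1 p.2) ∈ Fintype.piFinset C ×ˢ Fintype.piFinset C := by
      intro p hp
      rw [mem_product, Fintype.mem_piFinset, Fintype.mem_piFinset] at hp ⊢
      constructor <;> intro i <;> by_cases hi : i ∈ J <;> simp [hi, hp.1 i, hp.2 i]
    have hii : ∀ p : (Fin N → X) × (Fin N → X), J.piecewise (J.piecewise p.1 p.2) (J.piecewise p.2 p.1) = p.1 ∧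
        J.piecewise (J.piecewise p.2 p.1) (J.piecewise p.1 p.2) = p.2 := by
      intro p
      constructor <;> funext i <;> by_cases hi : i ∈ J <;> simp [hi]
    refine Finset.sum_bij' (fun p _ => (J.piecewise p.2 p.1, J.piecewise p.1 p.2))
      (fun p _ => (J.piecewise p.2 p.1, J.piecewise p.1 p.2)) hm hm ?_ ?_ ?_
    · intro p _; exact Prod.ext (hii p).1 (hii p).2
    · intro p _; exact Prod.ext (hii p).1 (hii p).2
    · intro p _; rfl
  rw [h, sum_product]
  simp [mul_sum]

/-- counting elements of a product class by the values on some coordinates -/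
lemma pi_count [DecidableEq X] {k : ℕ} (C : Fin N → Finset X) (c : Fin k → Fin N) (hc : Function.Injective c)
    (Bad : Finset (Fin k → X)) {L b : ℝ} (hL : 0 < L) (hb : (Bad.card : ℝ) ≤ b)
    (hCL : ∀ j, L ≤ (C (c j)).card) (hb0 : 0 ≤ b) :
    (((Fintype.piFinset C).filter (fun y => (fun j => y (c j)) ∈ Bad)).card : ℝ) ≤
      b / L ^ k * (Fintype.piFinset C).card := by
  classical
  set P : ℕ := ∏ i ∈ univ \ univ.image c, (C i).card with hP
  have h1 : ∀ z ∈ Bad, (((Fintype.piFinset C).filter (fun y => (fun j => y (c j)) ∈ Bad)).filter (fun y => (fun j => y (c j)) = z)).card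
      ≤ P := by
    intro z _
    set C' : Fin N → Finset X := fun i => if h : ∃ j, c j = i then {z h.choose} else C i with hC'
    have h2 : (((Fintype.piFinset C).filter (fun y => (fun j => y (c j)) ∈ Bad)).filter (fun y => (fun j => y (c j)) = z)) ⊆
        Fintype.piFinset C' := by
      intro y hy
      simp only [mem_filter, Fintype.mem_piFinset] at hy ⊢
      intro i
      simp only [hC']
      split_ifs with h
      · rw [mem_singleton, ← hy.2]
        simp only [h.choose_spec]
      · exact hy.1.1 i
    refine (card_le_card h2).trans ?_
    rw [Fintype.card_piFinset, ← prod_sdiff (subset_univ (univ.image c))]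
    have h3 : ∏ i ∈ univ.image c, (C' i).card = 1 := by
      refine prod_eq_one fun i hi => ?_
      have : ∃ j, c j = i := by simpa using hi
      simp [hC', this]
    have h4 : ∏ i ∈ univ \ univ.image c, (C' i).card = P := by
      refine prod_congr rfl fun i hi => ?_
      have : ¬ ∃ j, c j = i := by simpa using hi
      simp only [hC', dif_neg this]
    rw [h3, h4, mul_one]
  have h5 := card_le_mul_card_image_of_maps_to (s := (Fintype.piFinset C).filter (fun y => (fun j => y (c j)) ∈ Bad))
    (t := Bad) (f := fun y => (fun j => y (c j))) (fun y hy => (mem_filter.1 hy).2) P (fun z hz => h1 z hz)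
  have h6 : (Fintype.piFinset C).card = P * ∏ j, (C (c j)).card := by
    rw [Fintype.card_piFinset, ← prod_sdiff (subset_univ (univ.image c)), prod_image (fun a _ b _ h => hc h)]
  have h7 : L ^ k ≤ ((∏ j, (C (c j)).card : ℕ) : ℝ) := by
    push_cast
    calc L ^ k = ∏ j : Fin k, L := by simp
      _ ≤ _ := prod_le_prod (fun _ _ => hL.le) (fun j _ => hCL j)
  have h8 : (((Fintype.piFinset C).filter (fun y => (fun j => y (c j)) ∈ Bad)).card : ℝ) ≤ P * Bad.card := by
    exact_mod_cast h5
  rw [h6]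
  push_cast at h7 ⊢
  have hLk : 0 < L ^ k := pow_pos hL k
  calc _ ≤ (P : ℝ) * Bad.card := h8
    _ ≤ P * b := mul_le_mul_of_nonneg_left hb (Nat.cast_nonneg _)
    _ = b / L ^ k * (P * L ^ k) := by
        rw [mul_comm (P:ℝ) (L^k), ← mul_assoc, div_mul_cancel₀ _ hLk.ne', mul_comm]
    _ ≤ _ := mul_le_mul_of_nonneg_left (mul_le_mul_of_nonneg_left h7 (Nat.cast_nonneg _)) (div_nonneg hb0 hLk.le)

end resample2

section emb
variable {n r : ℕ}

/-- the edge of a tuple -/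
def ed (x : Fin r ↪ Fin n) : Finset (Fin n) := univ.map x

lemma mem_ed {x : Fin r ↪ Fin n} {v : Fin n} : v ∈ ed x ↔ ∃ j, x j = v := by simp [ed]

lemma card_ed (x : Fin r ↪ Fin n) : (ed x).card = r := by simp [ed]

lemma card_X : Fintype.card (Fin r ↪ Fin n) = n.descFactorial r := by simp [Fintype.card_embedding_eq]

open scoped Classical in
lemma card_ed_subset (U : Finset (Fin n)) : (univ.filter (fun x : Fin r ↪ Fin n => ed x ⊆ U)).card = U.card.descFactorial r := by
  have h : Fintype.card (Fin r ↪ U) = U.card.descFactorial r := by simp [Fintype.card_embedding_eq]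
  rw [← h, ← card_univ]
  symm
  refine card_bij (fun y _ => y.trans (Function.Embedding.subtype _)) ?_ ?_ ?_
  · intro y _
    simp only [mem_filter, mem_univ, true_and]
    intro v hv
    obtain ⟨j, rfl⟩ := mem_ed.1 hv
    exact (y j).2
  · intro y _ y' _ h
    ext j
    have := DFunLike.congr_fun h j
    simpa using congrArg Fin.val this
  · intro x hx
    simp only [mem_filter, mem_univ, true_and] at hx
    refine ⟨⟨fun j => ⟨x j, hx (mem_ed.2 ⟨j, rfl⟩)⟩, ?_⟩, mem_univ _, ?_⟩
    · intro a b h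
      exact x.injective (by simpa using h)
    · ext j; rfl

lemma desc_succ_sub (m r : ℕ) : (m + 1).descFactorial r = m.descFactorial r + r * m.descFactorial (r - 1) := by
  cases r with
  | zero => simp
  | succ r =>
    rw [Nat.succ_descFactorial_succ, Nat.descFactorial_succ, Nat.add_sub_cancel]
    by_cases h : r ≤ m
    · obtain ⟨k, rfl⟩ := Nat.exists_eq_add_of_le h
      rw [Nat.add_sub_cancel_left]
      ring
    · push Not at h
      rw [Nat.descFactorial_eq_zero_iff_lt.2 h]
      simp

open scoped Classical in
lemma card_mem_ed (v : Fin n) : n * (univ.filter (fun x : Fin r ↪ Fin n => v ∈ ed x)).card = r * n.descFactorial r := by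
  obtain ⟨m, rfl⟩ : ∃ m, n = m + 1 := ⟨n - 1, by have := v.pos; omega⟩
  have h1 := card_filter_add_card_filter_not (s := (univ : Finset (Fin r ↪ Fin (m+1)))) (fun x => v ∈ ed x)
  have h2 : (univ.filter (fun x : Fin r ↪ Fin (m+1) => ¬ v ∈ ed x)) = univ.filter (fun x => ed x ⊆ univ.erase v) := by
    ext x
    simp only [mem_filter, mem_univ, true_and, subset_erase, subset_univ]
  rw [h2, card_ed_subset, card_univ, card_X, card_erase_of_mem (mem_univ _), card_univ, Fintype.card_fin, desc_succ_sub] at h1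
  have h3 : (univ.filter (fun x : Fin r ↪ Fin (m+1) => v ∈ ed x)).card = r * m.descFactorial (r - 1) := by
    simp only [Nat.add_sub_cancel] at h1
    omega
  rw [h3]
  cases r with
  | zero => simp
  | succ r =>
    rw [Nat.add_sub_cancel, Nat.succ_descFactorial_succ]
    ring

open scoped Classical in
lemma card_mem2_ed {u v : Fin n} (huv : u ≠ v) :
    n * (n - 1) * (univ.filter (fun x : Fin r ↪ Fin n => u ∈ ed x ∧ v ∈ ed x)).card = r * (r - 1) * n.descFactorial r := by
  obtain ⟨m, rfl⟩ : ∃ m, n = m + 2 := ⟨n - 2, by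
    have := u.pos; have := u.isLt; have := v.isLt; have : u.val ≠ v.val := fun h => huv (Fin.ext h); omega⟩
  have h1 := card_filter_add_card_filter_not (s := (univ.filter (fun x : Fin r ↪ Fin (m+2) => u ∈ ed x))) (fun x => v ∈ ed x)
  rw [filter_filter, filter_filter] at h1
  have h2 := card_filter_add_card_filter_not (s := (univ.filter (fun x : Fin r ↪ Fin (m+2) => ¬ v ∈ ed x))) (fun x => u ∈ ed x)
  rw [filter_filter, filter_filter] at h2
  have e1 : (univ.filter (fun x : Fin r ↪ Fin (m+2) => ¬ v ∈ ed x)) = univ.filter (fun x => ed x ⊆ univ.erase v) := by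
    ext x
    simp only [mem_filter, mem_univ, true_and, subset_erase, subset_univ]
  have e2 : (univ.filter (fun x : Fin r ↪ Fin (m+2) => ¬ v ∈ ed x ∧ ¬ u ∈ ed x)) = univ.filter (fun x => ed x ⊆ (univ.erase v).erase u) := by
    ext x
    simp only [mem_filter, mem_univ, true_and, subset_erase, subset_univ]
  have e3 : (univ.filter (fun x : Fin r ↪ Fin (m+2) => ¬ v ∈ ed x ∧ u ∈ ed x)) =
      (univ.filter (fun x : Fin r ↪ Fin (m+2) => u ∈ ed x ∧ ¬ v ∈ ed x)) := by
    ext x; simp [and_comm]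
  rw [e1, e2, e3, card_ed_subset, card_ed_subset, card_erase_of_mem (mem_erase.2 ⟨huv, mem_univ _⟩), card_erase_of_mem (mem_univ _), card_univ,
    Fintype.card_fin] at h2
  have h3 := card_mem_ed (r := r) u
  have h4 : (m + 2) * (r * (m + 1).descFactorial (r - 1)) = r * (m + 2).descFactorial r := by
    cases r with
    | zero => simp
    | succ r => rw [Nat.add_sub_cancel, Nat.succ_descFactorial_succ]; ring
  have h5 := Nat.eq_of_mul_eq_mul_left (by omega) (h3.trans h4.symm)
  have h6 : m + 2 - 1 - 1 = m := by omega
  have h7 : m + 2 - 1 = m + 1 := by omega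
  rw [h6, h7, desc_succ_sub] at h2
  rw [h5] at h1
  have h8 : (univ.filter (fun x : Fin r ↪ Fin (m+2) => u ∈ ed x ∧ v ∈ ed x)).card = r * ((r - 1) * m.descFactorial (r - 1 - 1)) := by
    rw [desc_succ_sub, mul_add] at h1
    omega
  rw [h8, h7]
  rcases r with _ | _ | r
  · simp
  · simp
  · simp only [Nat.add_sub_cancel]
    rw [Nat.succ_descFactorial_succ, Nat.succ_descFactorial_succ]
    ring

open scoped Classical in
lemma card_owner {q : ℕ} (v : Fin n) :
    n * (univ.filter (fun x : Fin (q+1) ↪ Fin n => x 0 = v)).card = n.descFactorial (q+1) := by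
  have h1 : ∀ u, (univ.filter (fun x : Fin (q+1) ↪ Fin n => x 0 = u)).card = (univ.filter (fun x : Fin (q+1) ↪ Fin n => x 0 = v)).card := by
    intro u
    refine card_bij' (fun x _ => x.trans (Equiv.swap u v).toEmbedding) (fun x _ => x.trans (Equiv.swap u v).toEmbedding) ?_ ?_ ?_ ?_
    · intro x hx; simp at hx ⊢; simp [hx]
    · intro x hx; simp at hx ⊢; simp [hx]
    · intro x _; ext j; simp
    · intro x _; ext j; simp
  have h2 := card_eq_sum_card_fiberwise (s := (univ : Finset (Fin (q+1) ↪ Fin n))) (t := univ) (f := fun x => x 0) (fun _ _ => mem_univ _)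
  rw [sum_congr rfl (fun u _ => h1 u), card_univ, card_X] at h2
  rw [h2]
  simp

end emb
end Sham

namespace Sham

section plans
variable {n r N : ℕ}

/-- a small set described by a tuple -/
def optSet {n D : ℕ} (f : Fin D → Option (Fin n)) : Finset (Fin n) := univ.filter (fun v => ∃ i, f i = some v)

lemma optSet_card {n D : ℕ} (f : Fin D → Option (Fin n)) : (optSet f).card ≤ D := by
  have h : (optSet f).card ≤ ((univ : Finset (Fin D)).image f).card := by
    refine card_le_card_of_injOn some ?_ (fun a _ b _ h => Option.some_injective _ h)
    intro v hv
    simp only [optSet, coe_filter, mem_univ, true_and, Set.mem_ofPred_eq] at hv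
    simpa using hv
  exact h.trans (card_image_le.trans (by simp))

lemma optSet_surj {n D : ℕ} (S : Finset (Fin n)) (h : S.card ≤ D) : ∃ f : Fin D → Option (Fin n), optSet f = S := by
  refine ⟨fun i => if h : i.val < S.card then some ((S.equivFin.symm ⟨i.val, h⟩ : S) : Fin n) else none, ?_⟩
  ext v
  simp only [optSet, mem_filter, mem_univ, true_and]
  constructor
  · rintro ⟨i, hi⟩
    split_ifs at hi with h1
    · rw [← Option.some_injective _ hi]
      exact Subtype.mem _
  · intro hv
    refine ⟨⟨(S.equivFin ⟨v, hv⟩).val, lt_of_lt_of_le (Fin.isLt _) h⟩, ?_⟩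
    simp

/-- the per-block part of a plan -/
abbrev PlanT (n D q Ex : ℕ) := (Fin D → Option (Fin n)) × (Fin D → Option (Fin n)) × Fin q × Fin Ex

lemma card_PlanT (n D q Ex : ℕ) : Fintype.card (PlanT n D q Ex) = (n + 1) ^ D * ((n + 1) ^ D * (q * Ex)) := by
  simp [PlanT]

def planW {n D q Ex K : ℕ} (W₀ : Finset (Fin n)) (p : Fin K → PlanT n D q Ex) (b : Fin K) : Finset (Fin n) :=
  (W₀ \ (univ.filter (fun b' => b' < b)).biUnion (fun b' => optSet (p b').1)) \ optSet (p b).2.1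

lemma planW_sub {n D q Ex K : ℕ} (W₀ : Finset (Fin n)) (p : Fin K → PlanT n D q Ex) (b : Fin K) : planW W₀ p b ⊆ W₀ :=
  sdiff_subset.trans sdiff_subset

lemma planW_card {n D q Ex K : ℕ} (W₀ : Finset (Fin n)) (p : Fin K → PlanT n D q Ex) (b : Fin K) :
    W₀.card ≤ (planW W₀ p b).card + D * (K + 1) := by
  unfold planW
  set R := (univ.filter (fun b' => b' < b)).biUnion (fun b' => optSet (p b').1)
  have h1 : R.card ≤ K * D := by
    refine card_biUnion_le.trans ((sum_le_sum fun b' _ => optSet_card _).trans ?_)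
    rw [sum_const, smul_eq_mul]
    exact Nat.mul_le_mul_right _ ((card_le_univ _).trans (by simp))
  have h2 := optSet_card (p b).2.1
  have h3 := le_card_sdiff R W₀
  have h4 := le_card_sdiff (optSet (p b).2.1) (W₀ \ R)
  rw [mul_add, mul_one, mul_comm D]
  omega

def slo (τ₀ ℓ q b j : ℕ) : ℕ := τ₀ + (b * q + j) * ℓ

open scoped Classical in
theorem plans_bound {D q Ex K ℓ κ τ₀ t : ℕ} (hr : 2 ≤ r) (hX : 0 < Fintype.card (Fin r ↪ Fin n)) (hq : 1 ≤ q)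
    (hend : τ₀ + K * q * ℓ ≤ t) (htN : t ≤ N) (good : Finset (Fin n) → Prop) (φ : Finset (Fin n) → ℕ → ℝ)
    {δ' δ'' : ℝ} (hδ' : 0 ≤ δ') (hδ'' : 0 ≤ δ'')
    (hLL : ∀ W₀, good W₀ → ∀ W ⊆ W₀, W₀.card ≤ W.card + D * (K + 1) → ∀ ex < Ex, ∀ τ, τ₀ ≤ τ → τ < t →
      ∀ G : Finset (Finset (Fin n)), (∀ e ∈ G, e.card = r) → QR G → G.card ≤ τ + 1 → φ W₀ ex ≤ (PM G W).card →
      ((G.filter (Light G W (φ W₀ (ex + 1)))).card : ℝ) ≤ δ'' / 2 * (τ + 1)) :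
    Pr (fun ω : Fin N → (Fin r ↪ Fin n) => Cod ed ω t ∧ ∃ W₀, good W₀ ∧ ∃ p : Fin K → PlanT n D q Ex,
      κ ≤ (univ.filter (fun b : Fin K => BadSlot ed ω (slo τ₀ ℓ q b (p b).2.2.1) (slo τ₀ ℓ q b (p b).2.2.1 + ℓ) (planW W₀ p b)
        (φ W₀ (p b).2.2.2) (φ W₀ ((p b).2.2.2 + 1)) δ')).card) ≤
      2 ^ n * ((n + 1) ^ D * ((n + 1) ^ D * (q * Ex)) : ℝ) ^ K * Real.exp (K * ℓ * δ'' / 2 - κ * ℓ * δ' / 4) := by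
  have key : ∀ z ∈ (univ.filter (fun z : Finset (Fin n) × (Fin K → PlanT n D q Ex) => good z.1)),
      Pr (fun ω : Fin N → (Fin r ↪ Fin n) => Cod ed ω t ∧ 
        κ ≤ (univ.filter (fun b : Fin K => BadSlot ed ω (slo τ₀ ℓ q b (z.2 b).2.2.1) (slo τ₀ ℓ q b (z.2 b).2.2.1 + ℓ) (planW z.1 z.2 b)
        (φ z.1 (z.2 b).2.2.2) (φ z.1 ((z.2 b).2.2.2 + 1)) δ')).card) ≤ Real.exp (K * ℓ * δ'' / 2 - κ * ℓ * δ' / 4) := by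
    rintro ⟨W₀, p⟩ hz
    have hg : good W₀ := (mem_filter.1 hz).2
    simp only
    rcases Nat.eq_zero_or_pos K with hK | hK
    · subst hK
      rcases Nat.eq_zero_or_pos κ with hκ | hκ
      · subst hκ
        refine le_trans (b := (1:ℝ)) ?_ (by simp)
        rw [Pr_eq]
        refine div_le_one_of_le₀ ?_ (by positivity)
        exact_mod_cast card_le_univ _
      · refine le_trans (b := (0:ℝ)) (le_of_eq ?_) (Real.exp_pos _).le
        rw [Pr_eq, filter_false_of_mem]
        · simp
        · intro ω _ h
          have := h.2
          simp at this
          omega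
    have hlo : ∀ b : Fin K, slo τ₀ ℓ q b (p b).2.2.1 + ℓ ≤ t := by
      intro b
      unfold slo
      have h1 : b.val * q + (p b).2.2.1.val + 1 ≤ K * q := by
        have := (p b).2.2.1.isLt
        calc b.val * q + (p b).2.2.1.val + 1 ≤ b.val * q + q := by omega
          _ = (b.val + 1) * q := by ring
          _ ≤ _ := Nat.mul_le_mul_right _ b.isLt
      have h2 := Nat.mul_le_mul_right ℓ h1
      have : (b.val * q + (p b).2.2.1.val + 1) * ℓ = (b.val * q + (p b).2.2.1.val) * ℓ + ℓ := by ring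
      omega
    set bm : Fin N → Fin K := fun τ => if h : (τ.val - τ₀) / (q * ℓ) < K then ⟨(τ.val - τ₀) / (q * ℓ), h⟩ else ⟨0, hK⟩ with hbm
    set U : Finset (Fin N) := univ.filter (fun τ => ∃ b : Fin K, slo τ₀ ℓ q b (p b).2.2.1 ≤ τ.val ∧ τ.val < slo τ₀ ℓ q b (p b).2.2.1 + ℓ) with hU
    have hbmU : ∀ (b : Fin K) (τ : Fin N), slo τ₀ ℓ q b (p b).2.2.1 ≤ τ.val → τ.val < slo τ₀ ℓ q b (p b).2.2.1 + ℓ → bm τ = b := by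
      intro b τ h1 h2
      have h3 : (τ.val - τ₀) / (q * ℓ) = b.val := by
        unfold slo at h1 h2
        have hj := (p b).2.2.1.isLt
        have e1 : (b.val * q + (p b).2.2.1.val) * ℓ = b.val * (q * ℓ) + (p b).2.2.1.val * ℓ := by ring
        have e2 : ((p b).2.2.1.val + 1) * ℓ ≤ q * ℓ := Nat.mul_le_mul_right _ hj
        have e3 : ((p b).2.2.1.val + 1) * ℓ = (p b).2.2.1.val * ℓ + ℓ := by ring
        rw [e1] at h1 h2
        have : 0 < q * ℓ := Nat.mul_pos (by omega) (by omega)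
        rw [Nat.div_eq_iff this]
        constructor
        · omega
        · have e4 : (b.val + 1) * (q * ℓ) = b.val * (q * ℓ) + q * ℓ := by ring
          omega
      simp only [hbm]
      rw [dif_pos (by rw [h3]; exact b.isLt)]
      exact Fin.ext h3
    have hUb : ∀ b, U.filter (fun τ => bm τ = b) = univ.filter (fun τ : Fin N => slo τ₀ ℓ q b (p b).2.2.1 ≤ τ.val ∧ τ.val < slo τ₀ ℓ q b (p b).2.2.1 + ℓ) := by
      intro b
      ext τ
      simp only [hU, mem_filter, mem_univ, true_and]
      constructor
      · rintro ⟨⟨b', h1, h2⟩, h3⟩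
        have := hbmU b' τ h1 h2
        rw [h3] at this
        subst this
        exact ⟨h1, h2⟩
      · rintro ⟨h1, h2⟩
        exact ⟨⟨b, h1, h2⟩, hbmU b τ h1 h2⟩
    have hUlo : ∀ τ ∈ U, slo τ₀ ℓ q (bm τ) (p (bm τ)).2.2.1 ≤ τ.val ∧ τ.val < slo τ₀ ℓ q (bm τ) (p (bm τ)).2.2.1 + ℓ := by
      intro τ hτ
      obtain ⟨b, h1, h2⟩ := (mem_filter.1 hτ).2
      rw [hbmU b τ h1 h2]
      exact ⟨h1, h2⟩
    refine slot_bound hr card_ed hX U bm (fun b => slo τ₀ ℓ q b (p b).2.2.1) (fun b => slo τ₀ ℓ q b (p b).2.2.1 + ℓ) ?_ hUlo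
      (fun b => planW W₀ p b) (fun b => φ W₀ (p b).2.2.2) (fun b => φ W₀ ((p b).2.2.2 + 1)) hδ' hδ'' ?_ (t := t) ?_
    · intro b
      rw [hUb]
      have : (univ.filter (fun τ : Fin N => slo τ₀ ℓ q b (p b).2.2.1 ≤ τ.val ∧ τ.val < slo τ₀ ℓ q b (p b).2.2.1 + ℓ)).card =
          (Ico (slo τ₀ ℓ q b (p b).2.2.1) (slo τ₀ ℓ q b (p b).2.2.1 + ℓ)).card := by
        refine card_bij (fun τ _ => τ.val) ?_ ?_ ?_
        · intro τ hτ; simpa using hτ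
        · intro a _ b _ h; exact Fin.ext h
        · intro x hx
          rw [mem_Ico] at hx
          have := hlo b
          exact ⟨⟨x, by omega⟩, by simpa using hx, rfl⟩
      rw [this]; simp
    · intro τ hτ G hG hQ hGc hφ
      have h1 := hUlo τ hτ
      have h2 := hlo (bm τ)
      have h3 : τ₀ ≤ slo τ₀ ℓ q (bm τ) (p (bm τ)).2.2.1 := Nat.le_add_right _ _
      exact hLL W₀ hg _ (planW_sub _ _ _) (planW_card _ _ _) _ (Fin.isLt _) τ.val (by omega) (by omega) G hG hQ hGc hφ
    · intro τ hτ
      have h1 := hUlo τ hτ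
      have h2 := hlo (bm τ)
      omega
  refine le_trans (Pr_mono ?_) ((Pr_exists_le _ _ key).trans ?_)
  · rintro ω ⟨hc, W₀, hg, p, h⟩
    exact ⟨(W₀, p), by simpa using hg, hc, h⟩
  · refine mul_le_mul_of_nonneg_right ?_ (Real.exp_pos _).le
    have h1 : (univ.filter (fun z : Finset (Fin n) × (Fin K → PlanT n D q Ex) => good z.1)).card ≤
        2 ^ n * ((n + 1) ^ D * ((n + 1) ^ D * (q * Ex))) ^ K := by
      refine (card_le_univ _).trans (le_of_eq ?_)
      rw [Fintype.card_prod, Fintype.card_finset, Fintype.card_fun, card_PlanT]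
      simp
    exact_mod_cast h1

end plans
end Sham

namespace Sham

section block
variable {n q N : ℕ}

def GoodBlock (ω : Fin N → (Fin (q+1) ↪ Fin n)) (τ₀ ℓ b g : ℕ) (W : Finset (Fin n)) (φ : ℕ → ℝ) (δ' : ℝ) : Prop :=
  ∀ j < q, ∀ test ⊆ W, test.card = (q + 1) * j →
    ¬ BadSlot ed ω (slo τ₀ ℓ q b j) (slo τ₀ ℓ q b j + ℓ) (W \ test) (φ (q * g + j)) (φ (q * g + j + 1)) δ'

/-- partial sequences of sets -/
def okSeq (ω : Fin N → (Fin (q+1) ↪ Fin n)) (τ₀ ℓ b g : ℕ) (W : Finset (Fin n)) (φ : ℕ → ℝ) (j : ℕ)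
    (y : Fin q → (Fin (q+1) ↪ Fin n)) : Prop :=
  (∀ i : Fin q, i.val < j → ed (y i) ⊆ W) ∧ (∀ i i' : Fin q, i.val < j → i'.val < j → i ≠ i' → Disjoint (ed (y i)) (ed (y i'))) ∧
    φ (q * g + j) ≤ (PM (GG ed ω (slo τ₀ ℓ q b j)) (W \ (univ.filter (fun i : Fin q => i.val < j)).biUnion (fun i => ed (y i)))).card

lemma okSeq_congr {ω : Fin N → (Fin (q+1) ↪ Fin n)} {τ₀ ℓ b g : ℕ} {W : Finset (Fin n)} {φ : ℕ → ℝ} {j : ℕ}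
    {y y' : Fin q → (Fin (q+1) ↪ Fin n)} (h : ∀ i : Fin q, i.val < j → y i = y' i) :
    okSeq ω τ₀ ℓ b g W φ j y ↔ okSeq ω τ₀ ℓ b g W φ j y' := by
  unfold okSeq
  have h3 : (univ.filter (fun i : Fin q => i.val < j)).biUnion (fun i => ed (y i)) =
      (univ.filter (fun i : Fin q => i.val < j)).biUnion (fun i => ed (y' i)) := by
    refine biUnion_congr rfl fun i hi => ?_
    rw [h i (mem_filter.1 hi).2]
  rw [h3]
  refine and_congr (forall₂_congr fun i hi => by rw [h i hi]) (and_congr_left fun _ => ?_)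
  refine forall₄_congr fun i i' hi hi' => ?_
  rw [h i hi, h i' hi']

lemma okSeq_card {ω : Fin N → (Fin (q+1) ↪ Fin n)} {τ₀ ℓ b g : ℕ} {W : Finset (Fin n)} {φ : ℕ → ℝ} {j : ℕ}
    {y : Fin q → (Fin (q+1) ↪ Fin n)} (hj : j ≤ q) (h : okSeq ω τ₀ ℓ b g W φ j y) :
    ((univ.filter (fun i : Fin q => i.val < j)).biUnion (fun i => ed (y i))).card = (q + 1) * j := by
  rw [card_biUnion]
  · simp only [card_ed, sum_const, smul_eq_mul]
    rw [mul_comm]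
    congr 1
    have : (univ.filter (fun i : Fin q => i.val < j)).card = (range j).card := by
      refine card_bij (fun i _ => i.val) ?_ ?_ ?_
      · intro i hi; simpa using hi
      · intro a _ b _ h; exact Fin.ext h
      · intro x hx
        rw [mem_range] at hx
        exact ⟨⟨x, by omega⟩, by simpa using hx, rfl⟩
    rw [this, card_range]
  · intro i hi i' hi' hne
    exact h.2.1 i i' (mem_filter.1 hi).2 (mem_filter.1 hi').2 hne

open scoped Classical in
lemma card_not_subset (U : Finset (Fin n)) (r : ℕ) :
    n * (univ.filter (fun x : Fin r ↪ Fin n => ¬ ed x ⊆ U)).card ≤ (n - U.card) * (r * n.descFactorial r) := by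
  have h1 : (univ.filter (fun x : Fin r ↪ Fin n => ¬ ed x ⊆ U)) ⊆ (univ \ U).biUnion (fun v => univ.filter (fun x : Fin r ↪ Fin n => v ∈ ed x)) := by
    intro x hx
    simp only [mem_filter, mem_univ, true_and, not_subset] at hx
    obtain ⟨v, hv, hvU⟩ := hx
    simp only [mem_biUnion, mem_sdiff, mem_univ, true_and, mem_filter]
    exact ⟨v, hvU, hv⟩
  have h2 := Nat.mul_le_mul_left n ((card_le_card h1).trans card_biUnion_le)
  rw [mul_sum, sum_congr rfl (fun v _ => card_mem_ed v), sum_const, smul_eq_mul, card_sdiff_of_subset (subset_univ _), card_univ,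
    Fintype.card_fin] at h2
  exact h2

theorem okSeq_prob {ω : Fin N → (Fin (q+1) ↪ Fin n)} {τ₀ ℓ b g : ℕ} {W : Finset (Fin n)} {φ : ℕ → ℝ} {δ' : ℝ} (hδ : 0 ≤ δ')
    (hn : 0 < n) (hX : 0 < Fintype.card (Fin (q+1) ↪ Fin n))
    (hG : GoodBlock ω τ₀ ℓ b g W φ δ') (hφ : φ (q * g) ≤ (PM (GG ed ω (slo τ₀ ℓ q b 0)) W).card)
    (hW : ((q : ℝ) + 1) * (n - W.card + (q + 1) * q) ≤ δ' * n) (j : ℕ) (hj : j ≤ q) :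
    Pr (fun y => ¬ okSeq ω τ₀ ℓ b g W φ j y) ≤ j * (2 * δ') := by
  classical
  have hX' : (0:ℝ) < Fintype.card (Fin (q+1) ↪ Fin n) := by exact_mod_cast hX
  have hn' : (0:ℝ) < n := by exact_mod_cast hn
  induction j with
  | zero =>
    have : ∀ y, okSeq ω τ₀ ℓ b g W φ 0 y := by
      intro y
      refine ⟨fun i hi => by omega, fun i _ hi => by omega, ?_⟩
      simpa using hφ
    simp [Pr, this]
  | succ j ih =>
    have ih' := ih (by omega)
    set jf : Fin q := ⟨j, by omega⟩ with hjf
    set tst : (Fin q → (Fin (q+1) ↪ Fin n)) → Finset (Fin n) := fun y => (univ.filter (fun i : Fin q => i.val < j)).biUnion (fun i => ed (y i)) with htst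
    set Q : (Fin q → (Fin (q+1) ↪ Fin n)) → (Fin (q+1) ↪ Fin n) → Prop := fun y x => ¬ ed x ⊆ W \ tst y ∨
      Light (GG ed ω (slo τ₀ ℓ q b j + ℓ)) (W \ tst y) (φ (q * g + j + 1)) (ed x) with hQ
    have htu : ∀ y x, tst (Function.update y jf x) = tst y := by
      intro y x
      refine biUnion_congr rfl fun i hi => ?_
      rw [Function.update_of_ne]
      rintro rfl
      simp [hjf] at hi
    have hstep := resample_count {jf} (fun y => okSeq ω τ₀ ℓ b g W φ j y) Q (p := 2 * δ') (by linarith) hX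
      (by
        intro i hi y x
        rw [mem_singleton] at hi; subst hi
        refine okSeq_congr fun i hi => ?_
        rw [Function.update_of_ne]
        rintro rfl
        simp [hjf] at hi)
      (by
        intro i hi y x z
        rw [mem_singleton] at hi; subst hi
        simp only [hQ, htu])
      (by
        intro y hy
        have hc := okSeq_card (by omega) hy
        have hsub : tst y ⊆ W := biUnion_subset.2 fun i hi => hy.1 i (mem_filter.1 hi).2
        have hb := hG j (by omega) (tst y) hsub hc
        unfold BadSlot at hb
        rw [not_and] at hb
        have hb' := hb hy.2.2
        push Not at hb'
        have h1 : (univ.filter (Q y)) ⊆ univ.filter (fun x => ¬ ed x ⊆ W \ tst y) ∪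
            univ.filter (fun x : Fin (q+1) ↪ Fin n => Light (GG ed ω (slo τ₀ ℓ q b j + ℓ)) (W \ tst y) (φ (q * g + j + 1)) (ed x)) := by
          intro x hx
          simpa [hQ] using hx
        have h2 : ((univ.filter (Q y)).card : ℝ) ≤ ((univ.filter (fun x : Fin (q+1) ↪ Fin n => ¬ ed x ⊆ W \ tst y)).card : ℝ) +
            ((univ.filter (fun x : Fin (q+1) ↪ Fin n => Light (GG ed ω (slo τ₀ ℓ q b j + ℓ)) (W \ tst y) (φ (q * g + j + 1)) (ed x))).card : ℝ) := by
          exact_mod_cast (card_le_card h1).trans (card_union_le _ _)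
        have h3 := card_not_subset (W \ tst y) (q+1)
        rw [← card_X] at h3
        have h4 : (W \ tst y).card + (q+1) * j = W.card := by
          rw [← hc]; exact card_sdiff_add_card_eq_card hsub
        have h5 : W.card ≤ n := by simpa using card_le_univ W
        have h6 : ((n - (W \ tst y).card : ℕ) : ℝ) ≤ n - W.card + (q + 1) * q := by
          rw [Nat.cast_sub (by omega)]
          have : ((W \ tst y).card : ℝ) + (q+1) * j = W.card := by exact_mod_cast h4
          have hjq : (j:ℝ) ≤ q := by exact_mod_cast (by omega : j ≤ q)
          have : ((q:ℝ)+1) * j ≤ (q+1) * q := mul_le_mul_of_nonneg_left hjq (by positivity)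
          linarith
        have h7 : (n:ℝ) * ((univ.filter (fun x : Fin (q+1) ↪ Fin n => ¬ ed x ⊆ W \ tst y)).card : ℝ) ≤
            n * (δ' * Fintype.card (Fin (q+1) ↪ Fin n)) := by
          have h3' : (n:ℝ) * ((univ.filter (fun x : Fin (q+1) ↪ Fin n => ¬ ed x ⊆ W \ tst y)).card : ℝ) ≤
            ((n - (W \ tst y).card : ℕ) : ℝ) * ((q+1) * Fintype.card (Fin (q+1) ↪ Fin n)) := by exact_mod_cast h3
          refine h3'.trans ?_
          calc _ ≤ ((n:ℝ) - W.card + (q + 1) * q) * ((q+1) * Fintype.card (Fin (q+1) ↪ Fin n)) :=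
                mul_le_mul_of_nonneg_right h6 (by positivity)
            _ = (((q:ℝ)+1) * (n - W.card + (q + 1) * q)) * Fintype.card (Fin (q+1) ↪ Fin n) := by ring
            _ ≤ (δ' * n) * Fintype.card (Fin (q+1) ↪ Fin n) := mul_le_mul_of_nonneg_right hW hX'.le
            _ = _ := by ring
        have h8 := le_of_mul_le_mul_left h7 hn'
        have h9 : ((univ.filter (fun x : Fin (q+1) ↪ Fin n => Light (GG ed ω (slo τ₀ ℓ q b j + ℓ)) (W \ tst y) (φ (q * g + j + 1)) (ed x))).card : ℝ) ≤
          δ' * Fintype.card (Fin (q+1) ↪ Fin n) := hb'.le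
        refine le_trans (le_of_eq ?_) (h2.trans ((add_le_add h8 h9).trans (by linarith)))
        congr!)
    have hPr1 : Pr (fun y => okSeq ω τ₀ ℓ b g W φ j y) ≤ 1 := by
      rw [Pr_eq]
      refine div_le_one_of_le₀ ?_ (by positivity)
      exact_mod_cast card_le_univ _
    refine le_trans (Pr_mono (F := fun y => (¬ okSeq ω τ₀ ℓ b g W φ j y) ∨ (okSeq ω τ₀ ℓ b g W φ j y ∧ ∀ i ∈ ({jf} : Finset (Fin q)), Q y (y i))) ?_)
      ((Pr_or _ _).trans ?_)
    · intro y hy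
      by_cases h : okSeq ω τ₀ ℓ b g W φ j y
      · right
        refine ⟨h, fun i hi => ?_⟩
        rw [mem_singleton] at hi; subst hi
        by_contra hQn
        simp only [hQ] at hQn
        push Not at hQn
        obtain ⟨hs, hL⟩ := hQn
        refine hy ⟨?_, ?_, ?_⟩
        · intro i hi
          rcases Nat.lt_succ_iff_lt_or_eq.1 hi with hi | hi
          · exact h.1 i hi
          · have : i = jf := Fin.ext hi
            rw [this]; exact hs.trans sdiff_subset
        · have hd : ∀ i : Fin q, i.val < j → Disjoint (ed (y jf)) (ed (y i)) := by
            intro i hi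
            rw [disjoint_left]
            intro v hv hv'
            exact (mem_sdiff.1 (hs hv)).2 (mem_biUnion.2 ⟨i, by simpa using hi, hv'⟩)
          intro i i' hi hi' hne
          rcases Nat.lt_succ_iff_lt_or_eq.1 hi with hi | hi <;> rcases Nat.lt_succ_iff_lt_or_eq.1 hi' with hi' | hi'
          · exact h.2.1 i i' hi hi' hne
          · have : i' = jf := Fin.ext hi'
            rw [this]; exact (hd i hi).symm
          · have : i = jf := Fin.ext hi
            rw [this]; exact hd i' hi'
          · exact absurd (Fin.ext (hi.trans hi'.symm)) hne
        · unfold Light at hL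
          rw [not_and] at hL
          have hL' := hL hs
          push Not at hL'
          have e1 : slo τ₀ ℓ q b (j + 1) = slo τ₀ ℓ q b j + ℓ := by unfold slo; ring
          have e2 : (univ.filter (fun i : Fin q => i.val < j + 1)).biUnion (fun i => ed (y i)) = tst y ∪ ed (y jf) := by
            have : (univ.filter (fun i : Fin q => i.val < j + 1)) = insert jf (univ.filter (fun i : Fin q => i.val < j)) := by
              ext i
              simp only [mem_filter, mem_univ, true_and, mem_insert, Fin.ext_iff, hjf]
              omega
            rw [this, biUnion_insert, union_comm]
          have e3 : W \ (tst y ∪ ed (y jf)) = (W \ tst y) \ ed (y jf) := by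
            ext v; simp only [mem_sdiff, mem_union]; tauto
          rw [e1, e2, ← add_assoc, e3]
          exact hL'
      · exact Or.inl h
    · rw [card_singleton, pow_one] at hstep
      push_cast
      nlinarith

/-- acceptance of a tuple of list entries -/
def Acc (ω : Fin N → (Fin (q+1) ↪ Fin n)) (τ₀ ℓ b g : ℕ) (W : Finset (Fin n)) (φ : ℕ → ℝ) (T : Fin (q+1) → Fin q → Fin n) : Prop :=
  Function.Injective (fun p : Fin (q+1) × Fin q => T p.1 p.2) ∧ (∀ j i, T j i ∈ W) ∧
    φ (q * (g + 1)) ≤ (PM (GG ed ω (slo τ₀ ℓ q (b + 1) 0)) (W \ univ.image (fun p : Fin (q+1) × Fin q => T p.1 p.2))).card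

open scoped Classical in
theorem acc_count {ω : Fin N → (Fin (q+1) ↪ Fin n)} {τ₀ ℓ b g : ℕ} {W : Finset (Fin n)} {φ : ℕ → ℝ} {δ' : ℝ} (hδ : 0 ≤ δ')
    (hq : 1 ≤ q) (hn : 0 < n) (hX : 0 < Fintype.card (Fin (q+1) ↪ Fin n))
    (hG : GoodBlock ω τ₀ ℓ b g W φ δ') (hφ : φ (q * g) ≤ (PM (GG ed ω (slo τ₀ ℓ q b 0)) W).card)
    (hW : ((q : ℝ) + 1) * (n - W.card + (q + 1) * q) ≤ δ' * n)
    (hXn : (1 - δ') * ((n : ℝ) ^ (q+1)) ^ q ≤ (Fintype.card (Fin (q+1) ↪ Fin n) : ℝ) ^ q) :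
    ((univ.filter (fun T : Fin (q+1) → Fin q → Fin n => ¬ Acc ω τ₀ ℓ b g W φ T)).card : ℝ) ≤ 3 * q * δ' * ((n:ℝ) ^ (q+1)) ^ q := by
  have h1 := okSeq_prob hδ hn hX hG hφ hW q le_rfl
  have hX' : (0:ℝ) < Fintype.card (Fin (q+1) ↪ Fin n) := by exact_mod_cast hX
  rw [Pr_eq, Fintype.card_fun, Fintype.card_fin, div_le_iff₀ (by positivity)] at h1
  push_cast at h1
  have h2 := card_filter_add_card_filter_not (s := (univ : Finset (Fin q → (Fin (q+1) ↪ Fin n)))) (fun y => okSeq ω τ₀ ℓ b g W φ q y)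
  have h3 := card_filter_add_card_filter_not (s := (univ : Finset (Fin (q+1) → Fin q → Fin n))) (fun T => Acc ω τ₀ ℓ b g W φ T)
  rw [card_univ, Fintype.card_fun, Fintype.card_fin] at h2
  rw [card_univ, Fintype.card_fun, Fintype.card_fin, Fintype.card_fun, Fintype.card_fin, Fintype.card_fin] at h3
  have h4 : (univ.filter (fun y => okSeq ω τ₀ ℓ b g W φ q y)).card ≤ (univ.filter (fun T => Acc ω τ₀ ℓ b g W φ T)).card := by
    refine card_le_card_of_injOn (fun y j i => y i j) ?_ ?_
    · intro y hy
      have hy' : okSeq ω τ₀ ℓ b g W φ q y := by simpa using hy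
      simp only [coe_filter, mem_univ, true_and, Set.mem_ofPred_eq]
      refine ⟨?_, ?_, ?_⟩
      · rintro ⟨j, i⟩ ⟨j', i'⟩ h
        simp only at h
        have hii : i = i' := by
          by_contra hne
          have := hy'.2.1 i i' i.isLt i'.isLt hne
          exact disjoint_left.1 this (mem_ed.2 ⟨j, rfl⟩) (mem_ed.2 ⟨j', h.symm⟩)
        subst hii
        rw [(y i).injective h]
      · intro j i
        exact hy'.1 i i.isLt (mem_ed.2 ⟨j, rfl⟩)
      · have e1 : slo τ₀ ℓ q (b + 1) 0 = slo τ₀ ℓ q b q := by unfold slo; ring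
        have e2 : univ.image (fun p : Fin (q+1) × Fin q => y p.2 p.1) = (univ.filter (fun i : Fin q => i.val < q)).biUnion (fun i => ed (y i)) := by
          ext v
          simp only [mem_image, mem_univ, true_and, Prod.exists, mem_biUnion, mem_filter, Fin.isLt, mem_ed]
          exact exists_comm
        rw [e1, e2]
        exact hy'.2.2
    · intro y _ y' _ h
      funext i
      ext j
      exact congrArg Fin.val (congrFun (congrFun h j) i)
  have h2' : ((univ.filter (fun y => okSeq ω τ₀ ℓ b g W φ q y)).card : ℝ) + ((univ.filter (fun y => ¬ okSeq ω τ₀ ℓ b g W φ q y)).card : ℝ) =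
    (Fintype.card (Fin (q+1) ↪ Fin n) : ℝ) ^ q := by exact_mod_cast h2
  have h3' : ((univ.filter (fun T => Acc ω τ₀ ℓ b g W φ T)).card : ℝ) + ((univ.filter (fun T => ¬ Acc ω τ₀ ℓ b g W φ T)).card : ℝ) =
    ((n:ℝ) ^ (q+1)) ^ q := by
    rw [← pow_mul, mul_comm (q+1) q, pow_mul]
    exact_mod_cast h3
  have h4' : ((univ.filter (fun y => okSeq ω τ₀ ℓ b g W φ q y)).card : ℝ) ≤ ((univ.filter (fun T => Acc ω τ₀ ℓ b g W φ T)).card : ℝ) := by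
    exact_mod_cast h4
  have h5 : (Fintype.card (Fin (q+1) ↪ Fin n) : ℝ) ^ q ≤ ((n:ℝ) ^ (q+1)) ^ q := by
    refine pow_le_pow_left₀ hX'.le ?_ q
    rw [card_X]
    exact_mod_cast Nat.descFactorial_le_pow n (q+1)
  have h6 : (1:ℝ) ≤ q := by exact_mod_cast hq
  set Y := ((n:ℝ) ^ (q+1)) ^ q
  set Z := (Fintype.card (Fin (q+1) ↪ Fin n) : ℝ) ^ q
  have h7 : (q:ℝ) * (2 * δ') * Z ≤ q * (2 * δ') * Y := mul_le_mul_of_nonneg_left h5 (by positivity)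
  have hY : 0 ≤ δ' * Y := mul_nonneg hδ (by positivity)
  have h8 : 1 * (δ' * Y) ≤ q * (δ' * Y) := mul_le_mul_of_nonneg_right h6 hY
  linarith

end block
end Sham

namespace Sham

section run
variable {n q N k : ℕ}

/-- set of vertices used by a tuple -/
def img (T : Fin (q+1) → Fin q → Fin n) : Finset (Fin n) := univ.image (fun p : Fin (q+1) × Fin q => T p.1 p.2)

open scoped Classical in
/-- the absorption procedure -/
noncomputable def run (σ : ℕ) (Gd : ℕ → ℕ → Finset (Fin n) → Prop) (Ac : ℕ → ℕ → Finset (Fin n) → (Fin (q+1) → Fin q → Fin n) → Prop)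
    (W₀ : Finset (Fin n)) (ts : ℕ → Fin k → Fin (q+1) → Fin q → Fin n) : ℕ → Option (Finset (Fin n) × ℕ)
  | 0 => some (W₀, 0)
  | b + 1 =>
    match run σ Gd Ac W₀ ts b with
    | none => none
    | some s =>
      if s.2 < σ ∧ Gd b s.2 s.1 then
        if h : ∃ a, Ac b s.2 s.1 (ts s.2 a) then some (s.1 \ img (ts s.2 h.choose), s.2 + 1) else none
      else some s

variable {σ : ℕ} {Gd : ℕ → ℕ → Finset (Fin n) → Prop} {Ac : ℕ → ℕ → Finset (Fin n) → (Fin (q+1) → Fin q → Fin n) → Prop}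
  {W₀ : Finset (Fin n)} {ts : ℕ → Fin k → Fin (q+1) → Fin q → Fin n}

lemma run_succ_some {b : ℕ} {s' : Finset (Fin n) × ℕ} (h : run σ Gd Ac W₀ ts (b+1) = some s') :
    ∃ s, run σ Gd Ac W₀ ts b = some s ∧
      ((s.2 < σ ∧ Gd b s.2 s.1 ∧ ∃ h : ∃ a, Ac b s.2 s.1 (ts s.2 a), s' = (s.1 \ img (ts s.2 h.choose), s.2 + 1)) ∨
       (¬ (s.2 < σ ∧ Gd b s.2 s.1) ∧ s' = s)) := by
  cases hs : run σ Gd Ac W₀ ts b with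
  | none => rw [run, hs] at h; simp at h
  | some s =>
    refine ⟨s, rfl, ?_⟩
    rw [run, hs] at h
    simp only at h
    by_cases h1 : s.2 < σ ∧ Gd b s.2 s.1
    · rw [if_pos h1] at h
      by_cases h2 : ∃ a, Ac b s.2 s.1 (ts s.2 a)
      · rw [dif_pos h2] at h
        exact Or.inl ⟨h1.1, h1.2, h2, (Option.some_injective _ h).symm⟩
      · rw [dif_neg h2] at h; simp at h
    · rw [if_neg h1] at h
      exact Or.inr ⟨h1, (Option.some_injective _ h).symm⟩

lemma run_none {b : ℕ} (h : run σ Gd Ac W₀ ts b = none) : ∃ b' < b, ∃ s, run σ Gd Ac W₀ ts b' = some s ∧ s.2 < σ ∧ Gd b' s.2 s.1 ∧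
    ∀ a, ¬ Ac b' s.2 s.1 (ts s.2 a) := by
  induction b with
  | zero => simp [run] at h
  | succ b ih =>
    cases hs : run σ Gd Ac W₀ ts b with
    | none =>
      obtain ⟨b', hb', h'⟩ := ih hs
      exact ⟨b', by omega, h'⟩
    | some s =>
      rw [run, hs] at h
      simp only at h
      by_cases h1 : s.2 < σ ∧ Gd b s.2 s.1
      · rw [if_pos h1] at h
        by_cases h2 : ∃ a, Ac b s.2 s.1 (ts s.2 a)
        · rw [dif_pos h2] at h; simp at h
        · push Not at h2
          exact ⟨b, by omega, s, hs, h1.1, h1.2, h2⟩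
      · rw [if_neg h1] at h; simp at h

lemma run_congr {ts' : ℕ → Fin k → Fin (q+1) → Fin q → Fin n} {b : ℕ} {s : Finset (Fin n) × ℕ}
    (h : ∀ g < s.2, ts g = ts' g) (hs : run σ Gd Ac W₀ ts b = some s) : run σ Gd Ac W₀ ts' b = some s := by
  induction b generalizing s with
  | zero => simpa [run] using hs
  | succ b ih =>
    obtain ⟨s0, hs0, hc⟩ := run_succ_some hs
    rcases hc with ⟨h1, h2, h3, rfl⟩ | ⟨h1, rfl⟩
    · have e := ih (s := s0) (fun g hg => h g (by simp only; omega)) hs0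
      have e2 : ts s0.2 = ts' s0.2 := h _ (by simp)
      rw [run, e]
      simp only
      rw [if_pos ⟨h1, h2⟩]
      have h3' : ∃ a, Ac b s0.2 s0.1 (ts' s0.2 a) := by rw [← e2]; exact h3
      rw [dif_pos h3']
      have : ∀ (f f' : Fin k → Fin (q+1) → Fin q → Fin n) (h : ∃ a, Ac b s0.2 s0.1 (f a)) (h' : ∃ a, Ac b s0.2 s0.1 (f' a)), f = f' →
          f h.choose = f' h'.choose := by
        intro f f' h h' hf; subst hf; rfl
      rw [this _ _ h3 h3' e2]
    · have e := ih h hs0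
      rw [run, e]
      simp only
      rw [if_neg h1]

variable [DecidableEq (Fin (q+1) ↪ Fin n)]

open scoped Classical in
theorem run_fail (Bk : ℕ) (C : Fin N → Finset (Fin (q+1) ↪ Fin n)) (idx : ℕ → Fin (q+1) → Fin k → Fin N) (own : ℕ → Fin (q+1) → Fin n)
    (hidx : ∀ g < σ, ∀ g' < σ, ∀ j j' a a', idx g j a = idx g' j' a' → g = g' ∧ j = j' ∧ a = a')
    (hC : ∀ g < σ, ∀ j a, ∀ x ∈ C (idx g j a), x 0 = own g j) {L β : ℝ} (hL : 0 < L)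
    (hCL : ∀ g < σ, ∀ j a, L ≤ (C (idx g j a)).card) (hβ : 0 ≤ β)
    (hbad : ∀ b g W, Gd b g W → ((univ.filter (fun T => ¬ Ac b g W T)).card : ℝ) ≤ β) :
    (((Fintype.piFinset C).filter (fun ω => run σ Gd Ac W₀ (fun g a j i => ω (idx g j a) i.succ) Bk = none)).card : ℝ) ≤
      Bk * σ * (β / L ^ (q+1)) ^ k * (Fintype.piFinset C).card := by
  set ε := β / L ^ (q+1) with hε
  have hε0 : 0 ≤ ε := div_nonneg hβ (pow_pos hL _).le
  set TS : (Fin N → (Fin (q+1) ↪ Fin n)) → ℕ → Fin k → Fin (q+1) → Fin q → Fin n := fun ω g a j i => ω (idx g j a) i.succ with hTS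
  set P := Fintype.piFinset C with hP
  -- one block
  have key : ∀ b, ∀ g < σ, ∀ S : Finset (Fin k),
      ((P.filter (fun ω => ∃ W, run σ Gd Ac W₀ (TS ω) b = some (W, g) ∧ Gd b g W ∧ ∀ a ∈ S, ¬ Ac b g W (TS ω g a))).card : ℝ) ≤
        ε ^ S.card * P.card := by
    intro b g hg S
    induction S using Finset.induction_on with
    | empty =>
      simp only [card_empty, pow_zero, one_mul]
      exact_mod_cast card_filter_le _ _
    | insert a S ha ih =>
      rw [card_insert_of_notMem ha, pow_succ', mul_assoc]
      refine le_trans ?_ (mul_le_mul_of_nonneg_left ih hε0)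
      rcases P.eq_empty_or_nonempty with hPe | hPne
      · simp [hPe]
      have hPc : (0:ℝ) < P.card := by exact_mod_cast card_pos.2 hPne
      set J : Finset (Fin N) := univ.image (fun j => idx g j a) with hJ
      have e1 : ∀ E : (Fin N → (Fin (q+1) ↪ Fin n)) → Prop, ∀ [DecidablePred E], ((P.filter E).card : ℝ) = ∑ ω ∈ P, if E ω then (1:ℝ) else 0 := by
        intro E _; simp
      rw [e1, e1, ← mul_le_mul_iff_right₀ hPc, ← pi_resample C J, mul_sum, mul_sum]
      refine sum_le_sum fun ω _ => ?_
      -- the other lists are unchanged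
      have hne : ∀ g' < σ, ∀ j a', (g', a') ≠ (g, a) → idx g' j a' ∉ J := by
        intro g' hg' j a' hne hmem
        rw [hJ, mem_image] at hmem
        obtain ⟨j', _, hj'⟩ := hmem
        obtain ⟨h1, _, h3⟩ := hidx g hg g' hg' j' j a a' hj'
        exact hne (by rw [h1, h3])
      have hT1 : ∀ y, ∀ g' < g, TS ω g' = TS (J.piecewise y ω) g' := by
        intro y g' hg'
        funext a' j i
        simp only [hTS]
        rw [piecewise_eq_of_notMem _ _ _ (hne g' (by omega) j a' (by simp; omega))]
      have hT2 : ∀ y, ∀ a' ∈ S, TS ω g a' = TS (J.piecewise y ω) g a' := by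
        intro y a' ha'
        funext j i
        simp only [hTS]
        rw [piecewise_eq_of_notMem _ _ _ (hne g hg j a' (by simp; rintro rfl; exact ha ha'))]
      have hT3 : ∀ y, TS (J.piecewise y ω) g a = fun j i => y (idx g j a) i.succ := by
        intro y
        funext j i
        simp only [hTS]
        rw [piecewise_eq_of_mem _ _ _ (mem_image_of_mem _ (mem_univ j))]
      by_cases hE : ∃ W, run σ Gd Ac W₀ (TS ω) b = some (W, g) ∧ Gd b g W ∧ ∀ a ∈ S, ¬ Ac b g W (TS ω g a)
      · rw [if_pos hE]
        obtain ⟨W, h1, h2, h3⟩ := hE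
        set Bad : Finset (Fin (q+1) → (Fin (q+1) ↪ Fin n)) := univ.filter (fun z => (∀ j, z j ∈ C (idx g j a)) ∧ ¬ Ac b g W (fun j i => z j i.succ)) with hBad
        have hBc : (Bad.card : ℝ) ≤ β := by
          refine le_trans ?_ (hbad b g W h2)
          have : Bad.card ≤ (univ.filter (fun T => ¬ Ac b g W T)).card := by
            refine card_le_card_of_injOn (fun z j i => z j i.succ) ?_ ?_
            · intro z hz
              rw [mem_coe, hBad, mem_filter] at hz
              simpa using hz.2.2
            · intro z hz z' hz' h
              rw [mem_coe, hBad, mem_filter] at hz hz'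
              funext j
              apply DFunLike.ext
              intro i
              refine Fin.cases ?_ (fun i => ?_) i
              · rw [hC g hg j a _ (hz.2.1 j), hC g hg j a _ (hz'.2.1 j)]
              · exact congrFun (congrFun h j) i
          exact_mod_cast this
        have hpc := pi_count C (fun j => idx g j a) (fun j j' h => (hidx g hg g hg j j' a a h).2.1) Bad hL hBc (fun j => hCL g hg j a) hβ
        rw [← hP] at hpc
        calc _ ≤ ((P.filter (fun y => (fun j => y (idx g j a)) ∈ Bad)).card : ℝ) := by
              rw [e1]
              refine sum_le_sum fun y hy => ?_
              by_cases hE' : ∃ W, run σ Gd Ac W₀ (TS (J.piecewise y ω)) b = some (W, g) ∧ Gd b g W ∧ ∀ a' ∈ insert a S, ¬ Ac b g W (TS (J.piecewise y ω) g a')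
              · rw [if_pos hE']
                obtain ⟨W', h1', h2', h3'⟩ := hE'
                have h4 := run_congr (s := (W, g)) (ts' := TS (J.piecewise y ω)) (fun g' hg' => hT1 y g' hg') h1
                rw [h1'] at h4
                have h5 : W' = W := by
                  have := Option.some_injective _ h4
                  exact (Prod.ext_iff.1 this).1
                subst h5
                have h6 := h3' a (mem_insert_self _ _)
                rw [hT3] at h6
                rw [if_pos]
                rw [hBad, mem_filter]
                exact ⟨mem_univ _, fun j => Fintype.mem_piFinset.1 hy _, h6⟩
              · rw [if_neg hE']; split_ifs <;> norm_num
          _ ≤ ε * P.card := hpc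
          _ = P.card * (ε * 1) := by ring
      · rw [if_neg hE]
        simp only [mul_zero]
        refine le_of_eq (sum_eq_zero fun y _ => if_neg ?_)
        rintro ⟨W, h1, h2, h3⟩
        refine hE ⟨W, run_congr (s := (W, g)) (fun g' hg' => (hT1 y g' hg').symm) h1, h2, fun a' ha' => ?_⟩
        rw [hT2 y a' ha']
        exact h3 a' (mem_insert_of_mem ha')
  have hsub : P.filter (fun ω => run σ Gd Ac W₀ (TS ω) Bk = none) ⊆ (range Bk ×ˢ range σ).biUnion (fun z =>
      P.filter (fun ω => ∃ W, run σ Gd Ac W₀ (TS ω) z.1 = some (W, z.2) ∧ Gd z.1 z.2 W ∧ ∀ a ∈ (univ : Finset (Fin k)), ¬ Ac z.1 z.2 W (TS ω z.2 a))) := by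
    intro ω hω
    rw [mem_filter] at hω
    obtain ⟨b', hb', s, h1, h2, h3, h4⟩ := run_none hω.2
    rw [mem_biUnion]
    refine ⟨(b', s.2), by simp [hb', h2], ?_⟩
    rw [mem_filter]
    exact ⟨hω.1, s.1, h1, h3, fun a _ => h4 a⟩
  have h1 : ((P.filter (fun ω => run σ Gd Ac W₀ (TS ω) Bk = none)).card : ℝ) ≤ ∑ z ∈ range Bk ×ˢ range σ,
      ((P.filter (fun ω => ∃ W, run σ Gd Ac W₀ (TS ω) z.1 = some (W, z.2) ∧ Gd z.1 z.2 W ∧ ∀ a ∈ (univ : Finset (Fin k)), ¬ Ac z.1 z.2 W (TS ω z.2 a))).card : ℝ) := by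
    exact_mod_cast (card_le_card hsub).trans card_biUnion_le
  refine h1.trans ((sum_le_sum fun z hz => key z.1 z.2 (mem_range.1 (mem_product.1 hz).2) univ).trans (le_of_eq ?_))
  simp
  ring

end run
end Sham

namespace Sham

/-- adding a partial matching -/
lemma PM_union {V : Type*} [DecidableEq V] {G F : Finset (Finset V)} {W : Finset V} (hF : F ⊆ G)
    (hd : ∀ e ∈ F, ∀ e' ∈ F, e ≠ e' → e ∩ e' = ∅) (hW : ∀ e ∈ F, Disjoint e W) (hne : ∀ e ∈ F, e.Nonempty) :
    (PM G W).card ≤ (PM G (W ∪ F.biUnion id)).card := by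
  have hx : ∀ M ∈ PM G W, ∀ e ∈ M, e ⊆ W := by
    intro M hM e he
    rw [mem_PM] at hM
    rw [← hM.2.2]
    exact subset_biUnion_of_mem id he
  have hdis : ∀ M ∈ PM G W, Disjoint M F := by
    intro M hM
    rw [Finset.disjoint_left]
    intro e he heF
    obtain ⟨v, hv⟩ := hne e heF
    exact Finset.disjoint_left.1 (hW e heF) hv (hx M hM e he hv)
  refine card_le_card_of_injOn (fun M => M ∪ F) ?_ ?_
  · intro M hM
    rw [mem_coe] at hM ⊢
    have hM' := mem_PM.1 hM
    rw [mem_PM]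
    refine ⟨union_subset hM'.1 hF, ?_, ?_⟩
    · intro A hA B hB hAB
      rw [mem_union] at hA hB
      rcases hA with hA | hA <;> rcases hB with hB | hB
      · exact hM'.2.1 A hA B hB hAB
      · have := (hW B hB).mono_right (hx M hM A hA)
        rw [inter_comm]; exact disjoint_iff_inter_eq_empty.1 this
      · have := (hW A hA).mono_right (hx M hM B hB)
        exact disjoint_iff_inter_eq_empty.1 this
      · exact hd A hA B hB hAB
    · rw [union_biUnion, hM'.2.2]
  · intro M hM M' hM' h
    have h1 := hdis M hM
    have h2 := hdis M' hM'
    simp only at h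
    have e1 : (M ∪ F) \ F = M := by rw [union_sdiff_right]; exact sdiff_eq_self_of_disjoint h1
    have e2 : (M' ∪ F) \ F = M' := by rw [union_sdiff_right]; exact sdiff_eq_self_of_disjoint h2
    rw [← e1, ← e2, h]

section absorb
variable {n q N k : ℕ}

lemma run_ne_none_of_le {σ : ℕ} {Gd : ℕ → ℕ → Finset (Fin n) → Prop} {Ac : ℕ → ℕ → Finset (Fin n) → (Fin (q+1) → Fin q → Fin n) → Prop}
    {W₀ : Finset (Fin n)} {ts : ℕ → Fin k → Fin (q+1) → Fin q → Fin n} {K b : ℕ} (h : run σ Gd Ac W₀ ts K ≠ none) (hb : b ≤ K) :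
    run σ Gd Ac W₀ ts b ≠ none := by
  induction K with
  | zero => rw [show b = 0 by omega]; exact h
  | succ K ih =>
    rcases Nat.lt_or_ge K b with h1 | h1
    · rw [show b = K + 1 by omega]; exact h
    · refine ih ?_ h1
      obtain ⟨s, hs⟩ := Option.ne_none_iff_exists'.1 h
      obtain ⟨s', hs', _⟩ := run_succ_some hs
      rw [hs']; simp

def GdP (ω₀ : Fin N → (Fin (q+1) ↪ Fin n)) (τ₀ ℓ nsz : ℕ) (φ : ℕ → ℝ) (δ' : ℝ) (b g : ℕ) (W : Finset (Fin n)) : Prop :=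
  nsz ≤ W.card ∧ φ (q * g) ≤ (PM (GG ed ω₀ (slo τ₀ ℓ q b 0)) W).card ∧ GoodBlock ω₀ τ₀ ℓ b g W φ δ'

lemma ed_eq_insert (x : Fin (q+1) ↪ Fin n) : ed x = insert (x 0) (univ.image (fun i : Fin q => x i.succ)) := by
  ext v
  simp only [mem_ed, mem_insert, mem_image, mem_univ, true_and]
  rw [Fin.exists_fin_succ]
  constructor
  · rintro (h | h)
    · exact Or.inl h.symm
    · exact Or.inr h
  · rintro (h | h)
    · exact Or.inl h.symm
    · exact Or.inr h

open scoped Classical in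
theorem absorb {ω₀ ω : Fin N → (Fin (q+1) ↪ Fin n)} {σ τ₀ ℓ nsz : ℕ} {φ : ℕ → ℝ} {δ' : ℝ} {W₀ : Finset (Fin n)}
    {idx : ℕ → Fin (q+1) → Fin k → Fin N} {own : ℕ → Fin (q+1) → Fin n} (hq : 1 ≤ q)
    (hown : ∀ g < σ, ∀ j a, ω (idx g j a) 0 = own g j)
    (hinj : ∀ g < σ, ∀ g' < σ, ∀ j j', own g j = own g' j' → g = g' ∧ j = j')
    (hW₀ : ∀ g < σ, ∀ j, own g j ∉ W₀)
    (hφ0 : φ 0 ≤ (PM (GG ed ω₀ τ₀) W₀).card) (hsz : nsz + (q+1)*q*σ ≤ W₀.card)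
    (hplan : ¬ ∃ p : Fin (2*σ) → PlanT n ((q+1)*q) q (q*σ),
      σ ≤ (univ.filter (fun b : Fin (2*σ) => BadSlot ed ω₀ (slo τ₀ ℓ q b (p b).2.2.1) (slo τ₀ ℓ q b (p b).2.2.1 + ℓ) (planW W₀ p b)
        (φ (p b).2.2.2) (φ ((p b).2.2.2 + 1)) δ')).card)
    (hrun : run σ (GdP ω₀ τ₀ ℓ nsz φ δ') (fun b g W T => Acc ω₀ τ₀ ℓ b g W φ T) W₀ (fun g a j i => ω (idx g j a) i.succ) (2*σ) ≠ none) :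
    ∃ W ⊆ W₀, ∃ F : Finset (Finset (Fin n)), (∀ e ∈ F, ∃ g < σ, ∃ j a, e = ed (ω (idx g j a))) ∧
      (∀ e ∈ F, ∀ e' ∈ F, e ≠ e' → e ∩ e' = ∅) ∧ (∀ e ∈ F, Disjoint e W) ∧
      W ∪ F.biUnion id = W₀ ∪ (univ : Finset (Fin σ × Fin (q+1))).image (fun z => own z.1 z.2) ∧
      φ (q * σ) ≤ (PM (GG ed ω₀ (slo τ₀ ℓ q (2*σ) 0)) W).card := by
  set ts : ℕ → Fin k → Fin (q+1) → Fin q → Fin n := fun g a j i => ω (idx g j a) i.succ with hts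
  set Gd := GdP ω₀ τ₀ ℓ nsz φ δ' with hGd
  set Ac : ℕ → ℕ → Finset (Fin n) → (Fin (q+1) → Fin q → Fin n) → Prop := fun b g W T => Acc ω₀ τ₀ ℓ b g W φ T with hAc
  have h0 : ∀ b, ∃ s, b ≤ 2*σ → run σ Gd Ac W₀ ts b = some s := by
    intro b
    by_cases hb : b ≤ 2*σ
    · obtain ⟨s, hs⟩ := Option.ne_none_iff_exists'.1 (run_ne_none_of_le hrun hb)
      exact ⟨s, fun _ => hs⟩
    · exact ⟨(W₀, 0), fun h => absurd h hb⟩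
  choose st hst using h0
  have hs0 : st 0 = (W₀, 0) := by
    have := hst 0 (by omega)
    rw [run] at this
    exact (Option.some_injective _ this).symm
  have hstep : ∀ b < 2*σ, ((st b).2 < σ ∧ Gd b (st b).2 (st b).1 ∧ ∃ a, Ac b (st b).2 (st b).1 (ts (st b).2 a) ∧
      st (b+1) = ((st b).1 \ img (ts (st b).2 a), (st b).2 + 1)) ∨ (¬ ((st b).2 < σ ∧ Gd b (st b).2 (st b).1) ∧ st (b+1) = st b) := by
    intro b hb
    obtain ⟨s, hs, hc⟩ := run_succ_some (hst (b+1) (by omega))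
    have e : s = st b := by
      rw [hst b (by omega)] at hs
      exact (Option.some_injective _ hs).symm
    subst e
    rcases hc with ⟨h1, h2, h3, h4⟩ | h
    · exact Or.inl ⟨h1, h2, h3.choose, h3.choose_spec, h4⟩
    · exact Or.inr h
  clear_value Gd
  have hinv : ∀ b ≤ 2*σ, (st b).1 ⊆ W₀ ∧ (st b).2 ≤ σ ∧ (st b).2 ≤ b ∧ W₀.card ≤ (st b).1.card + (q+1)*q*(st b).2 ∧
      φ (q * (st b).2) ≤ (PM (GG ed ω₀ (slo τ₀ ℓ q b 0)) (st b).1).card ∧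
      ∃ F : Finset (Finset (Fin n)), (∀ e ∈ F, ∃ g < σ, ∃ j a, e = ed (ω (idx g j a))) ∧
      (∀ e ∈ F, ∀ e' ∈ F, e ≠ e' → e ∩ e' = ∅) ∧ (∀ e ∈ F, Disjoint e (st b).1) ∧
      (st b).1 ∪ F.biUnion id = W₀ ∪ (univ : Finset (Fin (st b).2 × Fin (q+1))).image (fun z => own z.1 z.2) := by
    intro b
    induction b with
    | zero =>
      intro _
      rw [hs0]
      refine ⟨Subset.rfl, by simp, le_rfl, by simp, by simpa [slo] using hφ0, ∅, by simp, by simp, by simp, ?_⟩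
      simp
    | succ b ih =>
      intro hb
      obtain ⟨i1, i2, i3, i4, i5, F, f1, f2, f3, f4⟩ := ih (by omega)
      rcases hstep b (by omega) with ⟨h1, h2, a, h3, h4⟩ | ⟨h1, h2⟩
      · rw [h4]
        set g := (st b).2 with hg
        set W := (st b).1 with hW
        set T := ts g a with hT
        obtain ⟨a1, a2, a3⟩ := h3
        have himg : img T ⊆ W := by
          intro v hv
          simp only [img, mem_image, mem_univ, true_and] at hv
          obtain ⟨p, rfl⟩ := hv
          exact a2 _ _
        have hic : (img T).card = (q+1)*q := by
          rw [img, card_image_of_injective _ a1]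
          simp
        -- new edges
        have hE : ∀ j, ed (ω (idx g j a)) = insert (own g j) (univ.image (fun i : Fin q => T j i)) := by
          intro j
          rw [ed_eq_insert, hown g h1]
        set E : Finset (Finset (Fin n)) := univ.image (fun j : Fin (q+1) => ed (ω (idx g j a))) with hEdef
        have hTW : ∀ j, univ.image (fun i : Fin q => T j i) ⊆ img T := by
          intro j v hv
          simp only [mem_image, mem_univ, true_and] at hv
          obtain ⟨i, rfl⟩ := hv
          exact mem_image.2 ⟨(j, i), mem_univ _, rfl⟩
        have hownW : ∀ j, own g j ∉ W := fun j h => hW₀ g h1 j (i1 h)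
        have hEU : E.biUnion id = img T ∪ univ.image (fun j => own g j) := by
          ext v
          simp only [hEdef, mem_biUnion, mem_image, mem_univ, true_and, id, mem_union, exists_exists_eq_and, hE, mem_insert, img]
          constructor
          · rintro ⟨j, h | ⟨i, h⟩⟩
            · exact Or.inr ⟨j, h.symm⟩
            · exact Or.inl ⟨(j, i), h⟩
          · rintro (⟨⟨j, i⟩, h⟩ | ⟨j, h⟩)
            · exact ⟨j, Or.inr ⟨i, h⟩⟩
            · exact ⟨j, Or.inl h.symm⟩
        have hownF : ∀ j, own g j ∉ F.biUnion id := by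
          intro j h
          have h' : own g j ∈ W ∪ F.biUnion id := mem_union_right _ h
          rw [f4, mem_union] at h'
          rcases h' with h' | h'
          · exact hW₀ g h1 j h'
          · simp only [mem_image, mem_univ, true_and] at h'
            obtain ⟨z, hz⟩ := h'
            have := (hinj z.1 (by omega) g h1 z.2 j hz).1
            omega
        have hFW : Disjoint (F.biUnion id) W := by
          rw [disjoint_biUnion_left]; exact f3
        have hEF : ∀ e ∈ E, Disjoint e (F.biUnion id) := by
          intro e he
          simp only [hEdef, mem_image, mem_univ, true_and] at he
          obtain ⟨j, rfl⟩ := he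
          rw [hE, disjoint_insert_left]
          exact ⟨hownF j, (hFW.mono_right ((hTW j).trans himg)).symm⟩
        have hEE : ∀ e ∈ E, ∀ e' ∈ E, e ≠ e' → e ∩ e' = ∅ := by
          intro e he e' he' hne
          simp only [hEdef, mem_image, mem_univ, true_and] at he he'
          obtain ⟨j, rfl⟩ := he
          obtain ⟨j', rfl⟩ := he'
          have hj : j ≠ j' := by rintro rfl; exact hne rfl
          rw [← disjoint_iff_inter_eq_empty, hE, hE, disjoint_insert_left, disjoint_insert_right]
          refine ⟨?_, ?_, ?_⟩
          · rw [mem_insert]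
            rintro (h | h)
            · exact hj (hinj g h1 g h1 j j' h).2
            · exact hownW j (himg (hTW _ h))
          · exact fun h => hownW j' (himg (hTW _ h))
          · rw [Finset.disjoint_left]
            intro v hv hv'
            simp only [mem_image, mem_univ, true_and] at hv hv'
            obtain ⟨i, rfl⟩ := hv
            obtain ⟨i', h'⟩ := hv'
            have := a1 (a₁ := (j', i')) (a₂ := (j, i)) h'
            exact hj (Prod.ext_iff.1 this).1.symm
        refine ⟨sdiff_subset.trans i1, by simp only; omega, by simp only; omega, ?_, ?_, F ∪ E, ?_, ?_, ?_, ?_⟩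
        · simp only
          rw [card_sdiff_of_subset himg, hic]
          have := card_le_card himg
          rw [hic] at this
          rw [mul_add, mul_one]
          omega
        · exact a3
        · intro e he
          rcases mem_union.1 he with he | he
          · exact f1 e he
          · simp only [hEdef, mem_image, mem_univ, true_and] at he
            obtain ⟨j, rfl⟩ := he
            exact ⟨g, h1, j, a, rfl⟩
        · intro e he e' he' hne
          rcases mem_union.1 he with he | he <;> rcases mem_union.1 he' with he' | he'
          · exact f2 e he e' he' hne
          · have := (hEF e' he').mono_right (subset_biUnion_of_mem id he)
            rw [inter_comm]
            exact disjoint_iff_inter_eq_empty.1 this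
          · have := (hEF e he).mono_right (subset_biUnion_of_mem id he')
            exact disjoint_iff_inter_eq_empty.1 this
          · exact hEE e he e' he' hne
        · intro e he
          simp only
          rcases mem_union.1 he with he | he
          · exact (f3 e he).mono_right sdiff_subset
          · simp only [hEdef, mem_image, mem_univ, true_and] at he
            obtain ⟨j, rfl⟩ := he
            rw [hE, disjoint_insert_left]
            exact ⟨fun h => hownW j (sdiff_subset h), disjoint_sdiff.mono_left (hTW j)⟩
        · simp only
          rw [union_biUnion, hEU]
          have e1 : (univ : Finset (Fin (g+1) × Fin (q+1))).image (fun z => own z.1 z.2) =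
              (univ : Finset (Fin g × Fin (q+1))).image (fun z => own z.1 z.2) ∪ univ.image (fun j => own g j) := by
            ext v
            simp only [mem_image, mem_univ, true_and, mem_union, Prod.exists]
            constructor
            · rintro ⟨z, j, h⟩
              rcases Nat.lt_or_ge z.val g with hz | hz
              · exact Or.inl ⟨⟨z, hz⟩, j, h⟩
              · have : z.val = g := by omega
                rw [this] at h
                exact Or.inr ⟨j, h⟩
            · rintro (⟨z, j, h⟩ | ⟨j, h⟩)
              · exact ⟨⟨z.val, by omega⟩, j, h⟩
              · exact ⟨⟨g, by omega⟩, j, h⟩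
          rw [e1]
          have e2 : W \ img T ∪ img T = W := sdiff_union_of_subset himg
          conv_rhs => rw [← union_assoc, ← f4, ← e2]
          ac_rfl
      · rw [h2]
        refine ⟨i1, i2, by omega, i4, i5.trans ?_, F, f1, f2, f3, f4⟩
        have : (PM (GG ed ω₀ (slo τ₀ ℓ q b 0)) (st b).1).card ≤ (PM (GG ed ω₀ (slo τ₀ ℓ q (b+1) 0)) (st b).1).card := by
          refine card_le_card (PM_mono (GG_mono ?_) _)
          unfold slo
          have : b * q ≤ (b+1)*q := Nat.mul_le_mul_right _ (by omega)
          have := Nat.mul_le_mul_right ℓ this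
          simp only [add_zero]; omega
        exact_mod_cast this
  -- the final group number
  have hfin : (st (2*σ)).2 = σ := by
    by_contra hne
    have hlt : (st (2*σ)).2 < σ := lt_of_le_of_ne (hinv _ le_rfl).2.1 hne
    have hmono : ∀ b, b ≤ 2*σ → (st b).2 ≤ (st (2*σ)).2 := by
      intro b hb
      refine Nat.decreasingInduction' (P := fun b => (st b).2 ≤ (st (2*σ)).2) ?_ hb le_rfl
      intro b hb _ ih
      rcases hstep b hb with ⟨_, _, a, _, h4⟩ | ⟨_, h2⟩
      · rw [h4] at ih; simp only at ih; omega
      · rw [h2] at ih; exact ih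
    -- plan
    have hplanb : ∀ b : Fin (2*σ), ∃ p : PlanT n ((q+1)*q) q (q*σ), optSet p.1 = (st b).1 \ (st (b+1)).1 ∧
        ((¬ Gd b (st b).2 (st b).1) → optSet p.2.1 ⊆ (st b).1 ∧ p.2.2.2.val = q * (st b).2 + p.2.2.1.val ∧
          BadSlot ed ω₀ (slo τ₀ ℓ q b p.2.2.1) (slo τ₀ ℓ q b p.2.2.1 + ℓ) ((st b).1 \ optSet p.2.1) (φ p.2.2.2) (φ (p.2.2.2 + 1)) δ') := by
      intro b
      have hσ : 0 < σ := by omega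
      obtain ⟨i1, i2, i3, i4, i5, -⟩ := hinv b b.2.le
      have hb1 := hmono b b.2.le
      have hrem : ((st b).1 \ (st (b+1)).1).card ≤ (q+1)*q := by
        rcases hstep b b.2 with ⟨_, _, a, _, h4⟩ | ⟨_, h2⟩
        · rw [h4]
          simp only [sdiff_sdiff_right_self]
          refine (card_le_card inf_le_right).trans ?_
          exact card_image_le.trans (by simp)
        · rw [h2]; simp
      obtain ⟨rem, hrem⟩ := optSet_surj _ hrem
      by_cases hgd : Gd b (st b).2 (st b).1
      · exact ⟨(rem, rem, ⟨0, hq⟩, ⟨0, by positivity⟩), hrem, fun h => absurd hgd h⟩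
      · have hgd' := hgd
        rw [hGd] at hgd
        unfold GdP at hgd
        have hn : nsz ≤ (st b).1.card := by
          have : (q+1)*q*(st b).2 ≤ (q+1)*q*σ := Nat.mul_le_mul_left _ i2
          omega
        have hG : ¬ GoodBlock ω₀ τ₀ ℓ b (st b).2 (st b).1 φ δ' := fun h => hgd ⟨hn, i5, h⟩
        unfold GoodBlock at hG
        push Not at hG
        obtain ⟨j, hj, test, ht1, ht2, hbad⟩ := hG
        obtain ⟨tt, htt⟩ := optSet_surj (D := (q+1)*q) test (by rw [ht2]; exact Nat.mul_le_mul_left _ hj.le)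
        have hex : q * (st b).2 + j < q * σ := by
          have : q * ((st b).2 + 1) ≤ q * σ := Nat.mul_le_mul_left _ (by omega)
          rw [mul_add, mul_one] at this
          omega
        refine ⟨(rem, tt, ⟨j, hj⟩, ⟨_, hex⟩), hrem, fun _ => ⟨?_, rfl, ?_⟩⟩
        · simp only; rw [htt]; exact ht1
        · simp only; rw [htt]; exact hbad
    choose p hp1 hp2 using hplanb
    refine hplan ⟨p, ?_⟩
    have hW : ∀ b : Fin (2*σ), W₀ \ (univ.filter (fun b' => b' < b)).biUnion (fun b' => optSet (p b').1) = (st b).1 := by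
      intro b
      have : ∀ c ≤ b.val, W₀ \ (univ.filter (fun b' : Fin (2*σ) => b'.val < c)).biUnion (fun b' => optSet (p b').1) = (st c).1 := by
        intro c
        induction c with
        | zero => intro _; rw [hs0]; simp
        | succ c ih =>
          intro hc
          have hc2 : c < 2*σ := by omega
          have e : (univ.filter (fun b' : Fin (2*σ) => b'.val < c + 1)) = insert ⟨c, hc2⟩ (univ.filter (fun b' : Fin (2*σ) => b'.val < c)) := by
            ext x
            simp only [mem_filter, mem_univ, true_and, mem_insert, Fin.ext_iff]
            omega
          rw [e, biUnion_insert, union_comm, ← sup_eq_union, ← sdiff_sdiff_left, ih (by omega), hp1]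
          simp only
          rw [sdiff_sdiff_right_self]
          refine inf_eq_right.2 ?_
          rcases hstep c hc2 with ⟨_, _, a, _, h4⟩ | ⟨_, h2⟩
          · rw [h4]; exact sdiff_subset
          · rw [h2]
      exact this b.val le_rfl
    -- counting
    have hcount : ∀ c ≤ 2*σ, c ≤ (st c).2 + (univ.filter (fun b : Fin (2*σ) => b.val < c ∧ ¬ Gd b (st b).2 (st b).1)).card := by
      intro c
      induction c with
      | zero => intro _; simp
      | succ c ih =>
        intro hc
        have hc2 : c < 2*σ := by omega
        have ih := ih hc2.le
        rcases hstep c hc2 with ⟨_, _, a, _, h4⟩ | ⟨h1, h2⟩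
        · have : (univ.filter (fun b : Fin (2*σ) => b.val < c ∧ ¬ Gd b (st b).2 (st b).1)).card ≤
              (univ.filter (fun b : Fin (2*σ) => b.val < c + 1 ∧ ¬ Gd b (st b).2 (st b).1)).card := by
            refine card_le_card fun x hx => ?_
            simp only [mem_filter, mem_univ, true_and] at hx ⊢
            exact ⟨by omega, hx.2⟩
          rw [h4]; simp only; omega
        · have hn : ¬ Gd c (st c).2 (st c).1 := fun h => h1 ⟨lt_of_le_of_lt (hmono c hc2.le) hlt, h⟩
          have : (univ.filter (fun b : Fin (2*σ) => b.val < c ∧ ¬ Gd b (st b).2 (st b).1)).card <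
              (univ.filter (fun b : Fin (2*σ) => b.val < c + 1 ∧ ¬ Gd b (st b).2 (st b).1)).card := by
            refine card_lt_card ⟨fun x hx => ?_, fun h => ?_⟩
            · simp only [mem_filter, mem_univ, true_and] at hx ⊢
              exact ⟨by omega, hx.2⟩
            · have := h (show (⟨c, hc2⟩ : Fin (2*σ)) ∈ _ by simp [hn])
              simp at this
          rw [h2]; omega
    have h2 := hcount (2*σ) le_rfl
    refine le_trans (b := (univ.filter (fun b : Fin (2*σ) => b.val < 2*σ ∧ ¬ Gd b (st b).2 (st b).1)).card) (by omega) (card_le_card ?_)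
    intro b hb
    simp only [mem_filter, mem_univ, true_and] at hb ⊢
    have := (hp2 b hb.2).2.2
    unfold planW
    rw [hW b]
    exact this
  obtain ⟨i1, -, -, -, i5, F, f1, f2, f3, f4⟩ := hinv _ le_rfl
  rw [hfin] at i5 f4
  exact ⟨_, i1, F, f1, f2, f3, f4, i5⟩

end absorb
end Sham

namespace Sham

section cls
variable {n q N : ℕ}

/-- number of entries owned in the absorbing window -/
def ownN (m t1 : ℕ) (ω : Fin N → (Fin (q+1) ↪ Fin n)) (v : Fin n) : ℕ :=
  (univ.filter (fun i : Fin N => m ≤ i.val ∧ i.val < t1 ∧ ω i 0 = v)).card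

def BS (m t1 k₁ : ℕ) (ω : Fin N → (Fin (q+1) ↪ Fin n)) : Finset (Fin n) := univ.filter (fun v => ownN m t1 ω v < k₁)

open scoped Classical in
noncomputable def Cl (m t1 k₁ : ℕ) (ω : Fin N → (Fin (q+1) ↪ Fin n)) (i : Fin N) : Finset (Fin (q+1) ↪ Fin n) :=
  if m ≤ i.val ∧ i.val < t1 ∧ Disjoint (ed (ω i)) (BS m t1 k₁ ω) then
    univ.filter (fun x => x 0 = ω i 0 ∧ Disjoint (ed x) (BS m t1 k₁ ω)) else {ω i}

variable {m t1 k₁ : ℕ} {ω ω' : Fin N → (Fin (q+1) ↪ Fin n)}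

lemma mem_Cl_self (i : Fin N) : ω i ∈ Cl m t1 k₁ ω i := by
  unfold Cl
  split_ifs with h
  · simpa using h.2.2
  · simp

lemma Cl_self : ω ∈ Fintype.piFinset (Cl m t1 k₁ ω) := Fintype.mem_piFinset.2 fun i => mem_Cl_self i

lemma Cl_owner (h : ω' ∈ Fintype.piFinset (Cl m t1 k₁ ω)) (i : Fin N) : ω' i 0 = ω i 0 := by
  have := Fintype.mem_piFinset.1 h i
  unfold Cl at this
  split_ifs at this with h
  · simp only [mem_filter] at this; exact this.2.1
  · rw [mem_singleton] at this; rw [this]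

lemma Cl_BS (h : ω' ∈ Fintype.piFinset (Cl m t1 k₁ ω)) : BS m t1 k₁ ω' = BS m t1 k₁ ω := by
  unfold BS ownN
  simp only [Cl_owner h]

lemma Cl_disj (h : ω' ∈ Fintype.piFinset (Cl m t1 k₁ ω)) (i : Fin N) :
    ω' i = ω i ∨ (m ≤ i.val ∧ i.val < t1 ∧ Disjoint (ed (ω i)) (BS m t1 k₁ ω) ∧ Disjoint (ed (ω' i)) (BS m t1 k₁ ω)) := by
  have := Fintype.mem_piFinset.1 h i
  unfold Cl at this
  split_ifs at this with h
  · simp only [mem_filter] at this; exact Or.inr ⟨h.1, h.2.1, h.2.2, this.2.2⟩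
  · rw [mem_singleton] at this; exact Or.inl this

lemma Cl_eq (h : ω' ∈ Fintype.piFinset (Cl m t1 k₁ ω)) : Cl m t1 k₁ ω' = Cl m t1 k₁ ω := by
  funext i
  unfold Cl
  rw [Cl_BS h, Cl_owner h]
  rcases Cl_disj h i with h1 | ⟨h1, h2, h3, h4⟩
  · rw [h1]
  · simp [h1, h2, h3, h4]

lemma Cl_mem_comm : ω' ∈ Fintype.piFinset (Cl m t1 k₁ ω) ↔ ω ∈ Fintype.piFinset (Cl m t1 k₁ ω') := by
  constructor
  · intro h; rw [Cl_eq h]; exact Cl_self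
  · intro h; rw [Cl_eq h]; exact Cl_self

open scoped Classical in
lemma class_bound (Fail : (Fin N → (Fin (q+1) ↪ Fin n)) → Prop) {c : ℝ} (hc : 0 ≤ c)
    (h : ∀ ω₀, (((Fintype.piFinset (Cl m t1 k₁ ω₀)).filter Fail).card : ℝ) ≤ c * (Fintype.piFinset (Cl m t1 k₁ ω₀)).card) :
    Pr Fail ≤ c := by
  set P := fun ω : Fin N → (Fin (q+1) ↪ Fin n) => Fintype.piFinset (Cl m t1 k₁ ω) with hP
  have hpos : ∀ ω, (0:ℝ) < (P ω).card := fun ω => by exact_mod_cast card_pos.2 ⟨ω, Cl_self⟩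
  have h1 : ((univ.filter Fail).card : ℝ) ≤ c * Fintype.card (Fin N → (Fin (q+1) ↪ Fin n)) := by
    calc ((univ.filter Fail).card : ℝ) = ∑ ω, if Fail ω then (1:ℝ) else 0 := by simp
      _ = ∑ ω, ∑ ω₀, if ω₀ ∈ P ω then (if Fail ω then (1:ℝ) else 0) / (P ω).card else 0 := by
          refine sum_congr rfl fun ω _ => ?_
          rw [← sum_filter, filter_mem_eq_inter, univ_inter, sum_const, nsmul_eq_mul]
          rw [mul_div_cancel₀ _ (hpos ω).ne']
      _ = ∑ ω₀, ∑ ω, if ω₀ ∈ P ω then (if Fail ω then (1:ℝ) else 0) / (P ω).card else 0 := sum_comm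
      _ ≤ ∑ ω₀ : Fin N → (Fin (q+1) ↪ Fin n), c := by
          refine sum_le_sum fun ω₀ _ => ?_
          calc _ = ∑ ω, if ω ∈ P ω₀ then (if Fail ω then (1:ℝ) else 0) / (P ω₀).card else 0 := by
                refine sum_congr rfl fun ω _ => ?_
                by_cases hm : ω ∈ P ω₀
                · rw [if_pos hm, if_pos (Cl_mem_comm.1 hm)]
                  rw [show (P ω).card = (P ω₀).card by simp only [hP]; rw [Cl_eq hm]]
                · rw [if_neg hm, if_neg (fun h => hm (Cl_mem_comm.1 h))]
            _ = (((P ω₀).filter Fail).card : ℝ) / (P ω₀).card := by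
                rw [← sum_filter, filter_mem_eq_inter, univ_inter, ← sum_div]
                simp
            _ ≤ c := by
                rw [div_le_iff₀ (hpos ω₀)]
                exact h ω₀
      _ = _ := by rw [sum_const, nsmul_eq_mul, card_univ, mul_comm]
  rw [Pr_eq]
  exact div_le_of_le_mul₀ (by positivity) hc h1

/-- edges which are certainly present at the hitting time -/
def EarlyG (t1 : ℕ) (ω : Fin N → (Fin (q+1) ↪ Fin n)) : Finset (Finset (Fin n)) :=
  (univ.filter (fun i : Fin N => i.val < t1 ∨ ∃ v ∈ ed (ω i), ∀ i' < i, v ∉ ed (ω i'))).image (fun i => ed (ω i))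

lemma mem_EarlyG {e : Finset (Fin n)} : e ∈ EarlyG t1 ω ↔ ∃ i : Fin N, (i.val < t1 ∨ ∃ v ∈ ed (ω i), ∀ i' < i, v ∉ ed (ω i')) ∧ ed (ω i) = e := by
  simp [EarlyG]

/-- a good edge at the low vertex `b` -/
def GoodEdge (t1 : ℕ) (B : Finset (Fin n)) (ω : Fin N → (Fin (q+1) ↪ Fin n)) (b : Fin n) (i : Fin N) : Prop :=
  b ∈ ed (ω i) ∧ (i.val < t1 ∨ ∀ i' < i, b ∉ ed (ω i')) ∧ ed (ω i) ∩ B = {b} ∧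
    ∀ j : Fin N, ∀ b' ∈ B, b' ≠ b → b' ∈ ed (ω j) → b ∉ ed (ω j) → Disjoint (ed (ω i)) (ed (ω j))

open scoped Classical in
structure Nice (m t1 k₁ k σ τ₀ ℓ nmin : ℕ) (φ : Finset (Fin n) → ℕ → ℝ) (δ' : ℝ) (ω : Fin N → (Fin (q+1) ↪ Fin n)) : Prop where
  good : ∀ b ∈ BS m t1 k₁ ω, ∃ i, GoodEdge t1 (BS m t1 k₁ ω) ω b i
  lists : ∀ v, v ∉ BS m t1 k₁ ω → k ≤ (univ.filter (fun i : Fin N => m ≤ i.val ∧ i.val < t1 ∧ ω i 0 = v ∧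
    Disjoint (ed (ω i)) (BS m t1 k₁ ω))).card
  small : (q+1) * (BS m t1 k₁ ω).card + nmin ≤ n
  start : ∀ V₀ : Finset (Fin n), nmin ≤ V₀.card → (q+1) ∣ V₀.card → ∃ W₀ ⊆ V₀, W₀.card + (q+1)*σ = V₀.card ∧
    φ W₀ 0 ≤ (PM (GG ed ω τ₀) W₀).card
  plan : ¬ ∃ W₀ : Finset (Fin n), (nmin ≤ W₀.card + (q+1)*σ ∧ (q+1) ∣ W₀.card) ∧ ∃ p : Fin (2*σ) → PlanT n ((q+1)*q) q (q*σ),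
      σ ≤ (univ.filter (fun b : Fin (2*σ) => BadSlot ed ω (slo τ₀ ℓ q b (p b).2.2.1) (slo τ₀ ℓ q b (p b).2.2.1 + ℓ) (planW W₀ p b)
        (φ W₀ (p b).2.2.2) (φ W₀ ((p b).2.2.2 + 1)) δ')).card

lemma exists_idx {k : ℕ} {ι : Type*} [DecidableEq ι] (S : Finset ι) (h : k ≤ S.card) : ∃ f : Fin k → ι, Function.Injective f ∧ ∀ a, f a ∈ S := by
  obtain ⟨S', hS', hc⟩ := exists_subset_card_eq h
  let e := S'.equivFin.symm
  refine ⟨fun a => (e (Fin.cast hc.symm a) : ι), ?_, fun a => hS' (Subtype.mem _)⟩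
  intro a a' h
  have h1 : e (Fin.cast hc.symm a) = e (Fin.cast hc.symm a') := Subtype.ext h
  have h2 := e.injective h1
  exact Fin.ext (by simpa [Fin.ext_iff] using h2)

set_option maxHeartbeats 1600000 in
open scoped Classical in
theorem class_fail {k σ τ₀ ℓ nmin nsz : ℕ} {φ : Finset (Fin n) → ℕ → ℝ} {δ' L φfin : ℝ} (hq : 1 ≤ q) (hn : 0 < n) (hN : 0 < N) (hδ' : 0 ≤ δ')
    (hL : 0 < L) (hX : 0 < Fintype.card (Fin (q+1) ↪ Fin n)) (hqn : (q+1) ∣ n)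
    (hwin : τ₀ + 2 * σ * q * ℓ ≤ m) (hmt : m ≤ t1)
    (hnsz : nsz + (q+1)*q*σ + (q+1)*σ ≤ nmin)
    (hCL : ∀ (v : Fin n) (B : Finset (Fin n)), v ∉ B → (q+1) * B.card + nmin ≤ n →
      L ≤ ((univ.filter (fun x : Fin (q+1) ↪ Fin n => x 0 = v ∧ Disjoint (ed x) B)).card : ℝ))
    (hW : ((q : ℝ) + 1) * (n - nsz + (q + 1) * q) ≤ δ' * n)
    (hXn : (1 - δ') * ((n : ℝ) ^ (q+1)) ^ q ≤ (Fintype.card (Fin (q+1) ↪ Fin n) : ℝ) ^ q)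
    (hφfin : ∀ W₀ : Finset (Fin n), nmin ≤ W₀.card + (q+1)*σ → (q+1) ∣ W₀.card → φfin ≤ φ W₀ (q * σ)) :
    Pr (fun ω : Fin N → (Fin (q+1) ↪ Fin n) => Nice m t1 k₁ k σ τ₀ ℓ nmin φ δ' ω ∧ ¬ φfin ≤ (PM (EarlyG t1 ω) univ).card) ≤
      2 * σ * σ * (3 * q * δ' * ((n:ℝ) ^ (q+1)) ^ q / L ^ (q+1)) ^ k := by
  set β : ℝ := 3 * q * δ' * ((n:ℝ) ^ (q+1)) ^ q with hβ
  have hβ0 : 0 ≤ β := by positivity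
  suffices key : ∀ Fail : (Fin N → (Fin (q+1) ↪ Fin n)) → Prop, (∀ ω, Fail ω → Nice m t1 k₁ k σ τ₀ ℓ nmin φ δ' ω ∧
      ¬ φfin ≤ (PM (EarlyG t1 ω) univ).card) → Pr Fail ≤ 2 * σ * σ * (β / L ^ (q+1)) ^ k from key _ (fun _ h => h)
  intro Fail hFail
  refine class_bound (m := m) (t1 := t1) (k₁ := k₁) _ (by positivity) fun ω₁ => ?_
  by_cases hex : ∃ ω₀ ∈ Fintype.piFinset (Cl m t1 k₁ ω₁), Nice m t1 k₁ k σ τ₀ ℓ nmin φ δ' ω₀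
  swap
  · refine le_trans (le_of_eq (?_ : _ = (0:ℝ))) (mul_nonneg (mul_nonneg (by positivity) (pow_nonneg (div_nonneg hβ0 (pow_pos hL _).le) _)) (Nat.cast_nonneg _))
    rw [Nat.cast_eq_zero, card_eq_zero, filter_eq_empty_iff]
    intro ω hω h
    exact hex ⟨ω, hω, (hFail ω h).1⟩
  obtain ⟨ω₀, hω₀, hnice⟩ := hex
  rw [← Cl_eq hω₀]
  clear hω₀ ω₁
  set B := BS m t1 k₁ ω₀ with hB
  obtain ⟨N1, N2, N3, N4, N5⟩ := hnice
  rw [← hB] at N1 N2 N3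
  -- the matching covering B
  have h1 : ∀ b, ∃ i, b ∈ B → GoodEdge t1 B ω₀ b i := by
    intro b
    by_cases hb : b ∈ B
    · obtain ⟨i, hi⟩ := N1 b hb; exact ⟨i, fun _ => hi⟩
    · exact ⟨⟨0, hN⟩, fun h => absurd h hb⟩
  choose ib hib using h1
  set MB : Finset (Finset (Fin n)) := B.image (fun b => ed (ω₀ (ib b))) with hMB
  have hMBd : ∀ e ∈ MB, ∀ e' ∈ MB, e ≠ e' → e ∩ e' = ∅ := by
    intro e he e' he' hne
    rw [hMB, mem_image] at he he'
    obtain ⟨b, hb, rfl⟩ := he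
    obtain ⟨b', hb', rfl⟩ := he'
    have hbb : b' ≠ b := by rintro rfl; exact hne rfl
    have g1 := hib b hb
    have g2 := hib b' hb'
    rw [← disjoint_iff_inter_eq_empty]
    refine g1.2.2.2 (ib b') b' hb' hbb g2.1 fun h => ?_
    have : b ∈ ed (ω₀ (ib b')) ∩ B := mem_inter.2 ⟨h, hb⟩
    rw [g2.2.2.1, mem_singleton] at this
    exact hbb this.symm
  have hMBc : (MB.biUnion id).card = (q+1) * B.card := by
    rw [card_biUnion (t := id) (fun e he e' he' h => disjoint_iff_inter_eq_empty.2 (hMBd e he e' he' h))]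
    rw [sum_congr rfl (g := fun _ => q+1), sum_const, smul_eq_mul, mul_comm, hMB, card_image_of_injOn]
    · intro b hb b' hb' h
      have g1 := hib b hb
      have g2 := hib b' hb'
      simp only at h
      have := g1.2.2.1
      rw [h, g2.2.2.1] at this
      exact (singleton_injective this).symm
    · intro e he
      rw [hMB, mem_image] at he
      obtain ⟨b, hb, rfl⟩ := he
      exact card_ed _
  have hBV : B ⊆ MB.biUnion id := by
    intro b hb
    rw [mem_biUnion]
    exact ⟨_, mem_image_of_mem _ hb, (hib b hb).1⟩
  set V₀ := (MB.biUnion id)ᶜ with hV₀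
  have hV₀c : V₀.card = n - (q+1)*B.card := by rw [hV₀, card_compl, hMBc, Fintype.card_fin]
  obtain ⟨W₀, hW₀V, hW₀c, hφ0⟩ := N4 V₀ (by omega) (by rw [hV₀c]; exact Nat.dvd_sub hqn (dvd_mul_right _ _))
  have hqW : (q+1) ∣ W₀.card := by
    have h1 : (q+1) ∣ V₀.card := by rw [hV₀c]; exact Nat.dvd_sub hqn (dvd_mul_right _ _)
    rw [← hW₀c] at h1
    exact (Nat.dvd_add_left (dvd_mul_right _ _)).1 h1
  have hgoodW : nmin ≤ W₀.card + (q+1)*σ := by omega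
  -- owners
  have hoc : (V₀ \ W₀).card = Fintype.card (Fin σ × Fin (q+1)) := by
    rw [card_sdiff_of_subset hW₀V]
    simp only [Fintype.card_prod, Fintype.card_fin]
    rw [mul_comm]; omega
  let oe : Fin σ × Fin (q+1) ≃ (V₀ \ W₀ : Finset (Fin n)) := Fintype.equivOfCardEq (by rw [Fintype.card_coe, hoc])
  set own : ℕ → Fin (q+1) → Fin n := fun g j => if h : g < σ then (oe (⟨g, h⟩, j) : Fin n) else ⟨0, hn⟩ with hown
  have hownE : ∀ g (h : g < σ) j, own g j = (oe (⟨g, h⟩, j) : Fin n) := fun g h j => by simp only [hown, dif_pos h]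
  have hownV : ∀ g < σ, ∀ j, own g j ∈ V₀ ∧ own g j ∉ W₀ := by
    intro g hg j
    rw [hownE g hg]
    exact mem_sdiff.1 (Subtype.mem _)
  have hinj : ∀ g < σ, ∀ g' < σ, ∀ j j', own g j = own g' j' → g = g' ∧ j = j' := by
    intro g hg g' hg' j j' h
    rw [hownE g hg, hownE g' hg'] at h
    have := oe.injective (Subtype.ext h)
    simp only [Prod.mk.injEq, Fin.mk.injEq] at this
    exact this
  have hownim : (univ : Finset (Fin σ × Fin (q+1))).image (fun z => own z.1 z.2) = V₀ \ W₀ := by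
    ext v
    simp only [mem_image, mem_univ, true_and]
    constructor
    · rintro ⟨z, rfl⟩
      rw [hownE _ z.1.2]; exact Subtype.mem _
    · intro hv
      refine ⟨oe.symm ⟨v, hv⟩, ?_⟩
      rw [hownE _ (oe.symm ⟨v, hv⟩).1.2]
      simp
  have hownB : ∀ g < σ, ∀ j, own g j ∉ B := by
    intro g hg j h
    have := (hownV g hg j).1
    rw [hV₀, mem_compl] at this
    exact this (hBV h)
  have h2 : ∀ v, ∃ f : Fin k → Fin N, v ∉ B → Function.Injective f ∧ ∀ a, f a ∈ (univ.filter (fun i : Fin N => m ≤ i.val ∧ i.val < t1 ∧ ω₀ i 0 = v ∧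
    Disjoint (ed (ω₀ i)) B)) := by
    intro v
    by_cases hv : v ∈ B
    · exact ⟨fun _ => ⟨0, hN⟩, fun h => absurd hv h⟩
    · obtain ⟨f, hf⟩ := exists_idx _ (N2 v hv)
      exact ⟨f, fun _ => hf⟩
  choose fi hfi using h2
  set idx : ℕ → Fin (q+1) → Fin k → Fin N := fun g j a => fi (own g j) a with hidxd
  have hidxp : ∀ g < σ, ∀ j a, m ≤ (idx g j a).val ∧ (idx g j a).val < t1 ∧ ω₀ (idx g j a) 0 = own g j ∧ Disjoint (ed (ω₀ (idx g j a))) B := by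
    intro g hg j a
    simpa using (hfi (own g j) (hownB g hg j)).2 a
  have hidx : ∀ g < σ, ∀ g' < σ, ∀ j j' a a', idx g j a = idx g' j' a' → g = g' ∧ j = j' ∧ a = a' := by
    intro g hg g' hg' j j' a a' h
    have e1 := (hidxp g hg j a).2.2.1
    have e2 := (hidxp g' hg' j' a').2.2.1
    rw [← h, e1] at e2
    obtain ⟨rfl, rfl⟩ := hinj g hg g' hg' j j' e2
    exact ⟨rfl, rfl, (hfi (own g j) (hownB g hg j)).1 h⟩
  have hClidx : ∀ g < σ, ∀ j a, Cl m t1 k₁ ω₀ (idx g j a) = univ.filter (fun x => x 0 = own g j ∧ Disjoint (ed x) B) := by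
    intro g hg j a
    obtain ⟨p1, p2, p3, p4⟩ := hidxp g hg j a
    rw [Cl, if_pos ⟨p1, p2, p4⟩, p3]
  have hrf := run_fail (σ := σ) (Gd := GdP ω₀ τ₀ ℓ nsz (φ W₀) δ') (Ac := fun b g W T => Acc ω₀ τ₀ ℓ b g W (φ W₀) T) (W₀ := W₀) (2*σ)
    (Cl m t1 k₁ ω₀) idx own hidx
    (by
      intro g hg j a x hx
      rw [hClidx g hg, mem_filter] at hx
      exact hx.2.1) hL
    (by
      intro g hg j a
      rw [hClidx g hg]
      exact hCL _ _ (hownB g hg j) N3) hβ0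
    (by
      rintro b g W ⟨d1, d2, d3⟩
      refine acc_count hδ' hq hn hX d3 d2 (le_trans ?_ hW) hXn
      have : (nsz:ℝ) ≤ W.card := by exact_mod_cast d1
      refine mul_le_mul_of_nonneg_left (by linarith) (by positivity))
  push_cast at hrf
  refine le_trans ?_ hrf
  refine Nat.cast_le.2 (card_le_card ?_)
  · intro ω hω
    rw [mem_filter] at hω ⊢
    obtain ⟨hω, hfail⟩ := hω
    replace hfail := (hFail ω hfail).2
    refine ⟨hω, ?_⟩
    by_contra hrun
    apply hfail
    obtain ⟨W, hWW, F, f1, f2, f3, f4, f5⟩ := absorb (ω₀ := ω₀) (ω := ω) (φ := φ W₀) hq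
      (fun g hg j a => by rw [Cl_owner hω]; exact (hidxp g hg j a).2.2.1) hinj (fun g hg j => (hownV g hg j).2) hφ0 (by omega)
      (fun h => N5 ⟨W₀, ⟨hgoodW, hqW⟩, h⟩) hrun
    rw [hownim, union_sdiff_of_subset hW₀V] at f4
    have g1 : GG ed ω₀ (slo τ₀ ℓ q (2*σ) 0) ⊆ EarlyG t1 ω := by
      intro e he
      rw [mem_GG] at he
      obtain ⟨i, hi, rfl⟩ := he
      have him : i.val < m := by
        unfold slo at hi
        rw [add_zero] at hi
        omega
      rw [mem_EarlyG]
      refine ⟨i, Or.inl (by omega), ?_⟩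
      rcases Cl_disj hω i with h | h
      · rw [h]
      · omega
    have g2 : F ⊆ EarlyG t1 ω := by
      intro e he
      obtain ⟨g, hg, j, a, rfl⟩ := f1 e he
      rw [mem_EarlyG]
      exact ⟨_, Or.inl (hidxp g hg j a).2.1, rfl⟩
    have hmemB : ∀ i, ∀ b ∈ B, b ∈ ed (ω i) → ω i = ω₀ i := by
      intro i b hb hbi
      rcases Cl_disj hω i with h | h
      · exact h
      · exact absurd hb (Finset.disjoint_left.1 h.2.2.2 hbi)
    have hmemB2 : ∀ i, ∀ b ∈ B, b ∈ ed (ω₀ i) → ω i = ω₀ i := by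
      intro i b hb hbi
      rcases Cl_disj hω i with h | h
      · exact h
      · exact absurd hb (Finset.disjoint_left.1 h.2.2.1 hbi)
    have g3 : MB ⊆ EarlyG t1 ω := by
      intro e he
      rw [hMB, mem_image] at he
      obtain ⟨b, hb, rfl⟩ := he
      have gb := hib b hb
      have e1 := hmemB2 _ b hb gb.1
      rw [mem_EarlyG]
      refine ⟨ib b, ?_, by rw [e1]⟩
      rcases gb.2.1 with h | h
      · exact Or.inl h
      · refine Or.inr ⟨b, by rw [e1]; exact gb.1, fun i' hi' hbi => h i' hi' ?_⟩
        rw [← hmemB i' b hb hbi]; exact hbi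
    have hne : ∀ e ∈ F ∪ MB, e.Nonempty := by
      intro e he
      have : ∃ x : Fin (q+1) ↪ Fin n, e = ed x := by
        rcases mem_union.1 he with he | he
        · obtain ⟨g, _, j, a, rfl⟩ := f1 e he; exact ⟨_, rfl⟩
        · rw [hMB, mem_image] at he
          obtain ⟨b, _, rfl⟩ := he
          exact ⟨_, rfl⟩
      obtain ⟨x, rfl⟩ := this
      rw [← card_pos, card_ed]; omega
    have s1 : (PM (GG ed ω₀ (slo τ₀ ℓ q (2*σ) 0)) W).card ≤ (PM (EarlyG t1 ω) W).card := card_le_card (PM_mono g1 _)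
    have s2 := PM_union g2 f2 f3 (fun e he => hne e (mem_union_left _ he))
    rw [f4] at s2
    have s3 := PM_union (W := V₀) g3 hMBd (fun e he => by
      rw [hV₀]
      exact (disjoint_compl_right).mono_left (subset_biUnion_of_mem id he)) (fun e he => hne e (mem_union_right _ he))
    rw [show V₀ ∪ MB.biUnion id = univ by rw [hV₀, union_comm]; exact union_compl _] at s3
    have s4 : ((PM (GG ed ω₀ (slo τ₀ ℓ q (2*σ) 0)) W).card : ℝ) ≤ (PM (EarlyG t1 ω) univ).card := by
      exact_mod_cast s1.trans (s2.trans s3)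
    exact (hφfin W₀ hgoodW hqW).trans (f5.trans s4)

end cls
end Sham

namespace Sham

section gen
variable {N : ℕ} {X : Type*} [Fintype X]

open scoped Classical in
lemma Pr_all (hX : 0 < Fintype.card X) (S : Finset (Fin N)) (Q : X → Prop) [DecidablePred Q] :
    Pr (fun ω : Fin N → X => ∀ i ∈ S, Q (ω i)) = (((univ.filter Q).card : ℝ) / Fintype.card X) ^ S.card := by
  have hX' : (0:ℝ) < Fintype.card X := by exact_mod_cast hX
  rw [Pr_eq]
  have h1 : (univ.filter (fun ω : Fin N → X => ∀ i ∈ S, Q (ω i))) = Fintype.piFinset (fun i => if i ∈ S then univ.filter Q else univ) := by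
    ext ω
    simp only [mem_filter, mem_univ, true_and, Fintype.mem_piFinset]
    refine forall_congr' fun i => ?_
    split_ifs with h <;> simp [h]
  rw [h1, Fintype.card_piFinset, Fintype.card_fun, Fintype.card_fin]
  have h2 : ∀ i : Fin N, (if i ∈ S then univ.filter Q else (univ : Finset X)).card = if i ∈ S then (univ.filter Q).card else Fintype.card X := by
    intro i; split_ifs <;> simp
  rw [prod_congr rfl (fun i _ => h2 i), prod_ite]
  simp only [prod_const, filter_mem_eq_inter, univ_inter]
  have h3 : (univ.filter (fun i => i ∉ S)).card + S.card = N := by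
    have h := card_filter_add_card_filter_not (s := (univ : Finset (Fin N))) (fun i => i ∈ S)
    rw [card_univ, Fintype.card_fin, filter_mem_eq_inter, univ_inter] at h
    omega
  rw [div_pow, div_eq_div_iff (by positivity) (by positivity)]
  push_cast
  have h4 : (Fintype.card X : ℝ) ^ N = (Fintype.card X : ℝ) ^ (univ.filter (fun i => i ∉ S)).card * (Fintype.card X : ℝ) ^ S.card := by
    rw [← pow_add, h3]
  rw [h4]
  ring

lemma many_prob (hX : 0 < Fintype.card X) (S : Finset (Fin N)) (Q : X → Prop) [DecidablePred Q] {p : ℝ} (_hp0 : 0 ≤ p)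
    (hp : ((univ.filter Q).card : ℝ) ≤ p * Fintype.card X) (K : ℕ) :
    Pr (fun ω : Fin N → X => K ≤ (S.filter (fun i => Q (ω i))).card) ≤ (S.card.choose K) * p ^ K := by
  have h1 := Pr_exists_le (Ω := Fin N → X) (S.powersetCard K) (fun I ω => ∀ i ∈ I, Q (ω i)) (p := p ^ K) (by
    intro I hI
    rw [Pr_all hX, (mem_powersetCard.1 hI).2]
    refine pow_le_pow_left₀ (by positivity) ?_ _
    rw [div_le_iff₀ (by exact_mod_cast hX)]
    exact hp)
  rw [card_powersetCard] at h1
  refine le_trans (Pr_mono fun ω hω => ?_) h1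
  obtain ⟨I, hI, hc⟩ := exists_subset_card_eq hω
  refine ⟨I, mem_powersetCard.2 ⟨hI.trans (filter_subset _ _), hc⟩, fun i hi => (mem_filter.1 (hI hi)).2⟩

lemma choose_le_pow_div' (s K : ℕ) (p : ℝ) (hp : 0 ≤ p) : (s.choose K : ℝ) * p ^ K ≤ (s * p) ^ K / K.factorial := by
  have h := Nat.choose_le_pow_div (α := ℝ) K s
  rw [mul_pow, mul_div_right_comm]
  exact mul_le_mul_of_nonneg_right h (pow_nonneg hp _)

lemma low_tail' (hX : 0 < Fintype.card X) (S : Finset (Fin N)) (Q : X → Prop) [DecidablePred Q] {p lam : ℝ} (hl : 0 < lam) (hl1 : lam ≤ 1)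
    (k : ℕ) (hp : p * Fintype.card X ≤ ((univ.filter Q).card : ℝ)) :
    Pr (fun ω : Fin N → X => (S.filter (fun i => Q (ω i))).card ≤ k) ≤
      (1 / lam) ^ k * Real.exp (-((1 - lam) * (p * S.card))) := by
  convert low_tail hX S Q hl hl1 k (p := p) (by convert hp)

lemma chernoff_lower' (hX : 0 < Fintype.card X) (S : Finset (Fin N)) (Q : X → Prop) [DecidablePred Q] {p β : ℝ} (hp0 : 0 ≤ p) (hβ : 0 ≤ β)
    (hp : p * Fintype.card X ≤ ((univ.filter Q).card : ℝ)) :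
    Pr (fun ω : Fin N → X => ((S.filter (fun i => Q (ω i))).card : ℝ) ≤ (1 - β) * (p * S.card)) ≤
      Real.exp (-(β ^ 2 / 2 * (p * S.card))) := by
  convert chernoff_lower hX S Q hp0 hβ (by convert hp)

lemma card_ed_subset' {n r : ℕ} (U : Finset (Fin n)) [DecidablePred (fun x : Fin r ↪ Fin n => ed x ⊆ U)] :
    (univ.filter (fun x : Fin r ↪ Fin n => ed x ⊆ U)).card = U.card.descFactorial r := by
  rw [← card_ed_subset]
  congr!

end gen

section ev
variable {n q N : ℕ}

lemma card_lt_fin {t : ℕ} (ht : t ≤ N) : (univ.filter (fun i : Fin N => i.val < t)).card = t := by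
  rw [Fin.card_filter_val_lt]; omega

open scoped Classical in
lemma p_mem (v : Fin n) (_hX : 0 < Fintype.card (Fin (q+1) ↪ Fin n)) :
    ((univ.filter (fun x : Fin (q+1) ↪ Fin n => v ∈ ed x)).card : ℝ) = ((q+1:ℝ) / n) * Fintype.card (Fin (q+1) ↪ Fin n) := by
  have hn : (0:ℝ) < n := by exact_mod_cast v.pos
  have := card_mem_ed (r := q+1) v
  rw [card_X, div_mul_eq_mul_div, eq_div_iff hn.ne', mul_comm]
  exact_mod_cast this

open scoped Classical in
lemma p_owner (v : Fin n) :
    ((univ.filter (fun x : Fin (q+1) ↪ Fin n => x 0 = v)).card : ℝ) = (1 / n : ℝ) * Fintype.card (Fin (q+1) ↪ Fin n) := by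
  have hn : (0:ℝ) < n := by exact_mod_cast v.pos
  have := card_owner (q := q) v
  rw [card_X, div_mul_eq_mul_div, eq_div_iff hn.ne', mul_comm, one_mul]
  exact_mod_cast this

open scoped Classical in
/-- two given vertices -/
lemma p_mem2 {u v : Fin n} (huv : u ≠ v) (hn2 : 2 ≤ n) :
    ((univ.filter (fun x : Fin (q+1) ↪ Fin n => u ∈ ed x ∧ v ∈ ed x)).card : ℝ) ≤ (2 * (q+1)^2 / n ^ 2 : ℝ) * Fintype.card (Fin (q+1) ↪ Fin n) := by
  have hn : (0:ℝ) < n := by exact_mod_cast v.pos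
  have h := card_mem2_ed (r := q+1) huv
  rw [card_X]
  have h' : (n:ℝ) * (n - 1) * ((univ.filter (fun x : Fin (q+1) ↪ Fin n => u ∈ ed x ∧ v ∈ ed x)).card : ℝ) = (q+1) * q * (n.descFactorial (q+1) : ℝ) := by
    have h2 : ((n - 1 : ℕ) : ℝ) = n - 1 := by rw [Nat.cast_sub (by omega)]; simp
    rw [← h2]
    rw [Nat.add_sub_cancel] at h
    exact_mod_cast h
  set c := ((univ.filter (fun x : Fin (q+1) ↪ Fin n => u ∈ ed x ∧ v ∈ ed x)).card : ℝ)
  set X := (n.descFactorial (q+1) : ℝ)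
  have hn2' : (2:ℝ) ≤ n := by exact_mod_cast hn2
  have hc : 0 ≤ c := Nat.cast_nonneg _
  have hX : 0 ≤ X := Nat.cast_nonneg _
  have hq : (0:ℝ) ≤ q := Nat.cast_nonneg _
  rw [div_mul_eq_mul_div, le_div_iff₀ (by positivity)]
  have e1 : n ^ 2 * c ≤ 2 * (n * (n - 1) * c) := by nlinarith [mul_nonneg (mul_nonneg hn.le (by linarith : (0:ℝ) ≤ n - 2)) hc]
  have e2 : ((q:ℝ)+1) * q * X ≤ (q+1)^2 * X := by nlinarith [mul_nonneg (by linarith : (0:ℝ) ≤ q + 1) hX]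
  nlinarith

open scoped Classical in
theorem cod_prob {t : ℕ} (ht : t ≤ N) (hn2 : 2 ≤ n) (hX : 0 < Fintype.card (Fin (q+1) ↪ Fin n)) :
    Pr (fun ω : Fin N → (Fin (q+1) ↪ Fin n) => ¬ Cod ed ω t) ≤ n ^ 2 * (t * (2 * (q+1)^2 / n ^ 2 : ℝ)) ^ 3 := by
  have h1 := Pr_exists_le (Ω := Fin N → (Fin (q+1) ↪ Fin n)) (univ.filter (fun z : Fin n × Fin n => z.1 ≠ z.2))
    (fun z ω => 3 ≤ ((univ.filter (fun i : Fin N => i.val < t)).filter (fun i => z.1 ∈ ed (ω i) ∧ z.2 ∈ ed (ω i))).card)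
    (p := (t * (2 * (q+1)^2 / n ^ 2 : ℝ)) ^ 3) (by
    intro z hz
    refine (many_prob hX _ (fun x => z.1 ∈ ed x ∧ z.2 ∈ ed x) (by positivity) (p_mem2 (mem_filter.1 hz).2 hn2) 3).trans ?_
    rw [card_lt_fin ht]
    refine (choose_le_pow_div' _ _ _ (by positivity)).trans ?_
    exact div_le_self (by positivity) (by exact_mod_cast Nat.factorial_pos 3))
  refine le_trans (Pr_mono fun ω hω => ?_) (h1.trans ?_)
  · unfold Cod at hω
    push Not at hω
    obtain ⟨x, y, hxy, h⟩ := hω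
    refine ⟨(x, y), by simpa using hxy, ?_⟩
    rw [filter_filter]
    exact h
  · refine mul_le_mul_of_nonneg_right ?_ (by positivity)
    have : (univ.filter (fun z : Fin n × Fin n => z.1 ≠ z.2)).card ≤ n ^ 2 := (card_le_univ _).trans (by simp [sq])
    exact_mod_cast this

open scoped Classical in
/-- every vertex is covered by time `N` -/
theorem covN_prob (hn : 0 < n) (hX : 0 < Fintype.card (Fin (q+1) ↪ Fin n)) :
    Pr (fun ω : Fin N → (Fin (q+1) ↪ Fin n) => ¬ ∀ v, ∃ i, v ∈ ed (ω i)) ≤ n * Real.exp (-(1/2 * ((q+1) / n * N))) := by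
  have h1 := Pr_exists_le (Ω := Fin N → (Fin (q+1) ↪ Fin n)) (univ : Finset (Fin n))
    (fun v ω => ((univ : Finset (Fin N)).filter (fun i => v ∈ ed (ω i))).card ≤ 0)
    (p := Real.exp (-(1/2 * ((q+1) / n * N)))) (by
    intro v _
    refine (low_tail' hX univ (fun x => v ∈ ed x) (lam := 1/2) (by norm_num) (by norm_num) 0 (p_mem v hX).ge).trans ?_
    simp only [pow_zero, one_mul, card_univ, Fintype.card_fin]
    rw [show (1:ℝ) - 1/2 = 1/2 by norm_num])
  rw [card_univ, Fintype.card_fin] at h1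
  refine le_trans (Pr_mono fun ω hω => ?_) h1
  push Not at hω
  obtain ⟨v, hv⟩ := hω
  refine ⟨v, mem_univ _, ?_⟩
  rw [filter_eq_empty_iff.2 (fun i _ => hv i)]
  simp

lemma desc_ratio1 (hn : 0 < n) (r : ℕ) (hr : r ≤ n) : (n:ℝ) * ((n-1).descFactorial r : ℝ) = (n - r) * n.descFactorial r := by
  obtain ⟨m, rfl⟩ : ∃ m, n = m + 1 := ⟨n - 1, by omega⟩
  have h := Nat.succ_descFactorial m r
  have h2 : ((m + 1 - r : ℕ) : ℝ) = ((m+1 : ℕ):ℝ) - r := Nat.cast_sub hr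
  rw [← h2, Nat.add_sub_cancel]
  exact_mod_cast h.symm

open scoped Classical in
/-- not everything is covered by time `t` -/
theorem covt_prob {t : ℕ} (ht : t ≤ N) (hnq : q + 3 ≤ n) :
    Pr (fun ω : Fin N → (Fin (q+1) ↪ Fin n) => ∀ v, ∃ i : Fin N, i.val < t ∧ v ∈ ed (ω i)) ≤ 1 / (n * (1 - (q+1) / n : ℝ) ^ t) := by
  have hX : 0 < Fintype.card (Fin (q+1) ↪ Fin n) := by rw [card_X]; exact Nat.descFactorial_pos.2 (by omega)
  have hX' : (0:ℝ) < Fintype.card (Fin (q+1) ↪ Fin n) := by exact_mod_cast hX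
  have : Nonempty (Fin (q+1) ↪ Fin n) := Fintype.card_pos_iff.1 hX
  have hn : (0:ℝ) < n := by exact_mod_cast (by omega : 0 < n)
  have hnq' : (q:ℝ) + 3 ≤ n := by exact_mod_cast hnq
  set a : ℝ := 1 - (q+1) / n with ha
  have ha0 : 0 < a := by
    rw [ha, sub_pos, div_lt_one hn]; linarith
  set S := univ.filter (fun i : Fin N => i.val < t) with hS
  set U : Fin n → (Fin N → (Fin (q+1) ↪ Fin n)) → Prop := fun v ω => ∀ i ∈ S, v ∉ ed (ω i) with hU
  have hΩc : (0:ℝ) < Fintype.card (Fin N → (Fin (q+1) ↪ Fin n)) := by exact_mod_cast Fintype.card_pos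
  have f1 : ((n-1).descFactorial (q+1) : ℝ) = a * n.descFactorial (q+1) := by
    have := desc_ratio1 (n := n) (by omega) (q+1) (by omega)
    rw [ha, sub_mul, one_mul, div_mul_eq_mul_div, eq_sub_iff_add_eq]
    field_simp
    push_cast at this
    linarith
  have f2 : ((n-2).descFactorial (q+1) : ℝ) ≤ a * (n-1).descFactorial (q+1) := by
    have := desc_ratio1 (n := n-1) (by omega) (q+1) (by omega)
    rw [show n - 1 - 1 = n - 2 by omega] at this
    rw [Nat.cast_sub (by omega : 1 ≤ n)] at this
    push_cast at this
    have hn1 : (0:ℝ) < n - 1 := by linarith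
    have e : ((n-2).descFactorial (q+1) : ℝ) = (n - 1 - (q + 1)) / (n - 1) * (n-1).descFactorial (q+1) := by
      rw [div_mul_eq_mul_div, eq_div_iff hn1.ne']; linarith
    rw [e]
    refine mul_le_mul_of_nonneg_right ?_ (Nat.cast_nonneg _)
    rw [ha, div_le_iff₀ hn1]
    rw [sub_mul, one_mul, div_mul_eq_mul_div]
    have : ((q:ℝ)+1) * (n-1) / n ≤ q + 1 := by
      rw [div_le_iff₀ hn]; nlinarith
    linarith
  have hP1 : ∀ v, Pr (U v) = a ^ t := by
    intro v
    have : Pr (U v) = Pr (fun ω : Fin N → (Fin (q+1) ↪ Fin n) => ∀ i ∈ S, ed (ω i) ⊆ univ.erase v) := by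
      congr 1; funext ω; simp only [hU, subset_erase, subset_univ, true_and]
    rw [this, Pr_all hX S (fun x => ed x ⊆ univ.erase v), hS, card_lt_fin ht, card_ed_subset', card_erase_of_mem (mem_univ _), card_univ, Fintype.card_fin, f1, card_X,
      mul_div_assoc, div_self, mul_one]
    rw [card_X] at hX'; exact hX'.ne'
  have hP2 : ∀ u v, u ≠ v → Pr (fun ω => U u ω ∧ U v ω) ≤ a ^ t * a ^ t := by
    intro u v huv
    have : Pr (fun ω => U u ω ∧ U v ω) = Pr (fun ω : Fin N → (Fin (q+1) ↪ Fin n) => ∀ i ∈ S, ed (ω i) ⊆ (univ.erase u).erase v) := by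
      congr 1; funext ω; simp only [hU, subset_erase, subset_univ, true_and]
      rw [← forall₂_and]
    rw [this, Pr_all hX S (fun x => ed x ⊆ (univ.erase u).erase v), hS, card_lt_fin ht, card_ed_subset', card_erase_of_mem (by simp [huv.symm]), card_erase_of_mem (mem_univ _), card_univ, Fintype.card_fin,
      ← mul_pow]
    refine pow_le_pow_left₀ (by positivity) ?_ _
    rw [div_le_iff₀ hX', card_X, mul_assoc, ← f1]
    exact f2
  set μ : ℝ := n * a ^ t with hμ
  have hμ0 : 0 < μ := by positivity
  set Y : (Fin N → (Fin (q+1) ↪ Fin n)) → ℝ := fun ω => ∑ v, if U v ω then (1:ℝ) else 0 with hY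
  have hPsum : ∀ E : (Fin N → (Fin (q+1) ↪ Fin n)) → Prop, ∀ [DecidablePred E], (∑ ω, if E ω then (1:ℝ) else 0) = Pr E * Fintype.card (Fin N → (Fin (q+1) ↪ Fin n)) := by
    intro E _
    rw [Pr_eq, div_mul_cancel₀ _ hΩc.ne']
    simp
  have hEY : ∑ ω, Y ω = μ * Fintype.card (Fin N → (Fin (q+1) ↪ Fin n)) := by
    simp only [hY]
    rw [sum_comm]
    rw [sum_congr rfl (fun v _ => (hPsum (U v)).trans (by rw [hP1 v]))]
    rw [sum_const, card_univ, Fintype.card_fin, nsmul_eq_mul, hμ]; ring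
  have hEY2 : ∑ ω, Y ω ^ 2 ≤ (μ + μ ^ 2) * Fintype.card (Fin N → (Fin (q+1) ↪ Fin n)) := by
    have : ∀ ω, Y ω ^ 2 = ∑ u, ∑ v, if U u ω ∧ U v ω then (1:ℝ) else 0 := by
      intro ω
      simp only [hY, sq, sum_mul_sum]
      refine sum_congr rfl fun u _ => sum_congr rfl fun v _ => ?_
      by_cases h1 : U u ω <;> by_cases h2 : U v ω <;> simp [h1, h2]
    rw [sum_congr rfl (fun ω _ => this ω), sum_comm]
    have : ∀ u, ∑ ω, ∑ v, (if U u ω ∧ U v ω then (1:ℝ) else 0) ≤ (a ^ t + n * (a ^ t * a ^ t)) * Fintype.card (Fin N → (Fin (q+1) ↪ Fin n)) := by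
      intro u
      rw [sum_comm]
      rw [sum_congr rfl (fun v _ => hPsum (fun ω => U u ω ∧ U v ω))]
      rw [← sum_mul]
      refine mul_le_mul_of_nonneg_right ?_ hΩc.le
      rw [← add_sum_erase _ _ (mem_univ u)]
      refine add_le_add ?_ ?_
      · simp only [and_self]; exact (hP1 u).le
      · refine (sum_le_sum fun v hv => hP2 u v (mem_erase.1 hv).1.symm).trans ?_
        rw [sum_const, nsmul_eq_mul]
        refine mul_le_mul_of_nonneg_right ?_ (by positivity)
        have : ((univ : Finset (Fin n)).erase u).card ≤ n := (card_le_univ _).trans (by simp)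
        exact_mod_cast this
    refine (sum_le_sum fun u _ => this u).trans ?_
    rw [sum_const, card_univ, Fintype.card_fin, nsmul_eq_mul, hμ]
    apply le_of_eq; ring
  have hmk := Pr_markov (Ω := Fin N → (Fin (q+1) ↪ Fin n)) (fun ω => ∀ v, ∃ i : Fin N, i.val < t ∧ v ∈ ed (ω i)) (fun ω => (Y ω - μ) ^ 2) (fun ω => sq_nonneg _) (c := μ ^ 2) (b := μ)
    (by positivity) (by
      intro ω hω
      have : Y ω = 0 := by
        simp only [hY]
        refine sum_eq_zero fun v _ => if_neg ?_
        intro h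
        obtain ⟨i, hi, hv⟩ := hω v
        exact h i (by simpa [hS] using hi) hv
      rw [this]; simp) (by
      have : ∀ ω, (Y ω - μ)^2 = Y ω ^ 2 - 2 * μ * Y ω + μ ^ 2 := fun ω => by ring
      simp only [this]
      rw [sum_add_distrib, sum_sub_distrib, ← mul_sum, hEY, sum_const, card_univ, nsmul_eq_mul]
      nlinarith)
  refine hmk.trans (le_of_eq ?_)
  rw [sq, div_mul_eq_div_div, div_self hμ0.ne']

end ev
end Sham

namespace Sham

section st
variable {n q N : ℕ}

noncomputable def phi (q : ℕ) (c Λ : ℝ) {n : ℕ} (W : Finset (Fin n)) (ex : ℕ) : ℝ :=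
  c ^ (W.card / (q+1)) * ((q+1) * (W.card / (q+1))).factorial / (W.card / (q+1)).factorial / Λ ^ ex

theorem start_prob {τ₀ σ nmin : ℕ} {β Λ : ℝ} (hβ : 0 ≤ β) (hβ1 : β ≤ 1) (hτ : τ₀ ≤ N)
    (hX : 0 < Fintype.card (Fin (q+1) ↪ Fin n)) (hmin : (q+1) * σ ≤ nmin) :
    Pr (fun ω : Fin N → (Fin (q+1) ↪ Fin n) => Function.Injective (fun i => ed (ω i)) ∧
      ¬ ∀ V₀ : Finset (Fin n), nmin ≤ V₀.card → (q+1) ∣ V₀.card → ∃ W₀ ⊆ V₀, W₀.card + (q+1)*σ = V₀.card ∧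
        phi q ((1 - β) * (τ₀ / n.descFactorial (q+1))) Λ W₀ 0 ≤ (PM (GG ed ω τ₀) W₀).card) ≤
      2 ^ n * Real.exp (-(β ^ 2 / 2 * (((q+1)*σ).descFactorial (q+1) / n.descFactorial (q+1) * τ₀))) := by
  classical
  have hX' : (0:ℝ) < n.descFactorial (q+1) := by rw [← card_X]; exact_mod_cast hX
  set S := univ.filter (fun i : Fin N => i.val < τ₀) with hS
  have hSc : S.card = τ₀ := card_lt_fin hτ
  have key : ∀ U ∈ univ.filter (fun U : Finset (Fin n) => (q+1)*σ ≤ U.card),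
      Pr (fun ω : Fin N → (Fin (q+1) ↪ Fin n) => ((S.filter (fun i => ed (ω i) ⊆ U)).card : ℝ) ≤ (1 - β) * ((U.card.descFactorial (q+1) / n.descFactorial (q+1) : ℝ) * S.card))
      ≤ Real.exp (-(β ^ 2 / 2 * (((q+1)*σ).descFactorial (q+1) / n.descFactorial (q+1) * τ₀))) := by
    intro U hU
    refine (chernoff_lower' hX S (fun x => ed x ⊆ U) (p := (U.card.descFactorial (q+1) / n.descFactorial (q+1) : ℝ)) (by positivity) hβ ?_).trans ?_
    · rw [card_ed_subset', card_X, div_mul_cancel₀ _ hX'.ne']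
    · rw [hSc]
      refine Real.exp_le_exp.2 (neg_le_neg (mul_le_mul_of_nonneg_left ?_ (by positivity)))
      refine mul_le_mul_of_nonneg_right ?_ (Nat.cast_nonneg _)
      refine div_le_div_of_nonneg_right ?_ hX'.le
      exact_mod_cast Nat.descFactorial_le _ (mem_filter.1 hU).2
  have h1 := Pr_exists_le _ _ key
  refine le_trans (Pr_mono fun ω hω => ?_) (h1.trans ?_)
  swap
  · refine mul_le_mul_of_nonneg_right ?_ (Real.exp_pos _).le
    have : (univ.filter (fun U : Finset (Fin n) => (q+1)*σ ≤ U.card)).card ≤ 2 ^ n := (card_le_univ _).trans (by simp)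
    exact_mod_cast this
  by_contra hno
  push Not at hno
  refine hω.2 fun V₀ hV hd => ?_
  obtain ⟨z, hz⟩ := hd
  have hzs : σ ≤ z := by
    have : (q+1) * σ ≤ (q+1) * z := by omega
    exact Nat.le_of_mul_le_mul_left this (by omega)
  have hJ : (q+1) * (z - σ) + (q+1) * σ = V₀.card := by rw [hz, ← Nat.mul_add, Nat.sub_add_cancel hzs]
  obtain ⟨W, hWV, hWc, hW⟩ := greedy (G := GG ed ω τ₀) (r := q+1) (by omega) (by
      intro e he
      obtain ⟨i, _, rfl⟩ := mem_GG.1 he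
      exact card_ed _) (V₀ := V₀) (J := z - σ) (by omega) (c := (1 - β) * (τ₀ / n.descFactorial (q+1)))
      (mul_nonneg (by linarith) (by positivity)) (by
      intro U hU hUc
      have h2 := hno U (by simp; omega)
      have h3 : (S.filter (fun i => ed (ω i) ⊆ U)).card ≤ ((GG ed ω τ₀).filter (fun e => e ⊆ U)).card := by
        refine card_le_card_of_injOn (fun i => ed (ω i)) ?_ (fun i _ j _ h => hω.1 h)
        intro i hi
        simp only [hS, coe_filter, Set.mem_setOf_eq, mem_filter, mem_univ, true_and, mem_GG] at hi ⊢
        exact ⟨⟨i, hi.1, rfl⟩, hi.2⟩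
      have h3' : ((S.filter (fun i => ed (ω i) ⊆ U)).card : ℝ) ≤ ((GG ed ω τ₀).filter (fun e => e ⊆ U)).card := by exact_mod_cast h3
      refine le_trans (le_of_eq ?_) (h2.le.trans h3')
      rw [hSc]; ring)
  refine ⟨W, hWV, by omega, ?_⟩
  have : W.card / (q+1) = z - σ := by rw [hWc]; exact Nat.mul_div_cancel_left _ (by omega)
  unfold phi
  rw [this, pow_zero, div_one]
  exact hW

end st
end Sham

namespace Sham

section lowv
variable {n q N : ℕ}

/-- low set where the coordinates in `I` are ignored -/
def BI (m t1 k₁ : ℕ) (I : Finset (Fin N)) (ω : Fin N → (Fin (q+1) ↪ Fin n)) : Finset (Fin n) :=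
  univ.filter (fun v => (univ.filter (fun i : Fin N => i ∉ I ∧ m ≤ i.val ∧ i.val < t1 ∧ ω i 0 = v)).card < k₁)

def NI (m t1 k₁ : ℕ) (I : Finset (Fin N)) (v : Fin n) (ω : Fin N → (Fin (q+1) ↪ Fin n)) : Finset (Fin n) :=
  (univ.filter (fun j : Fin N => j ∉ I ∧ v ∉ ed (ω j) ∧ ∃ u ∈ BI m t1 k₁ I ω, u ≠ v ∧ u ∈ ed (ω j))).biUnion (fun j => ed (ω j))

def BadI (B : Finset (Fin n)) (ω : Fin N → (Fin (q+1) ↪ Fin n)) (v : Fin n) (i : Fin N) : Prop :=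
  v ∈ ed (ω i) ∧ ((∃ u ∈ B, u ≠ v ∧ u ∈ ed (ω i)) ∨
    ∃ j, v ∉ ed (ω j) ∧ (∃ u ∈ B, u ≠ v ∧ u ∈ ed (ω j)) ∧ ¬ Disjoint (ed (ω i)) (ed (ω j)))

def dgN (ω : Fin N → (Fin (q+1) ↪ Fin n)) (v : Fin n) : ℕ := (univ.filter (fun i : Fin N => v ∈ ed (ω i))).card

variable {m t1 k₁ : ℕ}

lemma mem_BS' {ω : Fin N → (Fin (q+1) ↪ Fin n)} {v : Fin n} : v ∈ BS m t1 k₁ ω ↔ ownN m t1 ω v < k₁ := by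
  unfold BS
  rw [mem_filter]
  simp

lemma Pr_le_one {Ω : Type*} [Fintype Ω] (E : Ω → Prop) : Pr E ≤ 1 := by
  unfold Pr
  refine div_le_one_of_le₀ ?_ (Nat.cast_nonneg _)
  exact_mod_cast card_le_univ _

lemma BI_update (I : Finset (Fin N)) {i : Fin N} (hi : i ∈ I) (ω : Fin N → (Fin (q+1) ↪ Fin n)) (x) :
    BI m t1 k₁ I (Function.update ω i x) = BI m t1 k₁ I ω := by
  unfold BI
  congr 1; funext v
  congr 2
  ext j
  simp only [mem_filter, mem_univ, true_and]
  refine and_congr_right fun hj => ?_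
  rw [Function.update_of_ne (by rintro rfl; exact hj hi)]

lemma NI_update (I : Finset (Fin N)) (v : Fin n) {i : Fin N} (hi : i ∈ I) (ω : Fin N → (Fin (q+1) ↪ Fin n)) (x) :
    NI m t1 k₁ I v (Function.update ω i x) = NI m t1 k₁ I v ω := by
  have hne : ∀ j, j ∉ I → Function.update ω i x j = ω j := fun j hj => Function.update_of_ne (by rintro rfl; exact hj hi) _ _
  ext w
  simp only [NI, mem_biUnion, mem_filter, mem_univ, true_and, BI_update I hi]
  refine exists_congr fun j => ?_
  by_cases hj : j ∈ I
  · simp [hj]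
  · rw [hne j hj]

lemma BS_subset_BI (I : Finset (Fin N)) (ω : Fin N → (Fin (q+1) ↪ Fin n)) : BS m t1 k₁ ω ⊆ BI m t1 k₁ I ω := by
  intro v hv
  rw [mem_BS'] at hv
  unfold ownN at hv
  simp only [BI, mem_filter, mem_univ, true_and]
  refine lt_of_le_of_lt (card_le_card ?_) hv
  intro i hi
  simp only [mem_filter, mem_univ, true_and] at hi ⊢
  exact hi.2

lemma BI_subset_BS (I : Finset (Fin N)) {s : ℕ} (hI : I.card ≤ s) (ω : Fin N → (Fin (q+1) ↪ Fin n)) : BI m t1 k₁ I ω ⊆ BS m t1 (k₁ + s) ω := by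
  intro v hv
  rw [mem_BS']
  unfold ownN
  simp only [BI, mem_filter, mem_univ, true_and] at hv
  have : (univ.filter (fun i : Fin N => m ≤ i.val ∧ i.val < t1 ∧ ω i 0 = v)) ⊆
    (univ.filter (fun i : Fin N => i ∉ I ∧ m ≤ i.val ∧ i.val < t1 ∧ ω i 0 = v)) ∪ I := by
    intro i hi
    simp only [mem_filter, mem_univ, true_and, mem_union] at hi ⊢
    tauto
  have h2 := (card_le_card this).trans (card_union_le _ _)
  omega

lemma NI_card {I : Finset (Fin N)} {s : ℕ} (hI : I.card ≤ s) {v : Fin n} {ω : Fin N → (Fin (q+1) ↪ Fin n)} {b₀ Δ : ℕ}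
    (hb : (BS m t1 (k₁ + s) ω).card ≤ b₀) (hΔ : ∀ v, dgN ω v ≤ Δ) :
    (BI m t1 k₁ I ω).card + (NI m t1 k₁ I v ω).card ≤ b₀ + b₀ * (Δ * (q+1)) := by
  have hB := BI_subset_BS (m := m) (t1 := t1) (k₁ := k₁) I hI ω
  refine add_le_add ((card_le_card hB).trans hb) ?_
  have h1 : NI m t1 k₁ I v ω ⊆ (BS m t1 (k₁ + s) ω).biUnion (fun u => (univ.filter (fun i : Fin N => u ∈ ed (ω i))).biUnion (fun j => ed (ω j))) := by
    intro w hw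
    simp only [NI, mem_biUnion, mem_filter, mem_univ, true_and] at hw ⊢
    obtain ⟨j, ⟨_, _, u, hu, _, huj⟩, hw⟩ := hw
    exact ⟨u, hB hu, j, huj, hw⟩
  refine (card_le_card h1).trans ((card_biUnion_le_card_mul _ _ (Δ * (q+1)) ?_).trans (Nat.mul_le_mul_right _ hb))
  intro u _
  refine (card_biUnion_le_card_mul _ _ (q+1) ?_).trans (Nat.mul_le_mul_right _ (hΔ u))
  intro j _
  exact (card_ed _).le

/-- the resampling predicate -/
def QB (m t1 k₁ : ℕ) (I : Finset (Fin N)) (v : Fin n) (ω : Fin N → (Fin (q+1) ↪ Fin n)) (x : Fin (q+1) ↪ Fin n) : Prop :=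
  v ∈ ed x ∧ ∃ u ∈ BI m t1 k₁ I ω ∪ NI m t1 k₁ I v ω, u ≠ v ∧ u ∈ ed x

open scoped Classical in
lemma QB_card {I : Finset (Fin N)} {v : Fin n} {ω : Fin N → (Fin (q+1) ↪ Fin n)} {Mx : ℕ} (hn2 : 2 ≤ n)
    (h : (BI m t1 k₁ I ω).card + (NI m t1 k₁ I v ω).card ≤ Mx) :
    ((univ.filter (QB m t1 k₁ I v ω)).card : ℝ) ≤ (Mx * (2 * (q+1)^2 / n ^ 2) : ℝ) * Fintype.card (Fin (q+1) ↪ Fin n) := by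
  have h1 : univ.filter (QB m t1 k₁ I v ω) ⊆ ((BI m t1 k₁ I ω ∪ NI m t1 k₁ I v ω).erase v).biUnion
      (fun u => univ.filter (fun x : Fin (q+1) ↪ Fin n => u ∈ ed x ∧ v ∈ ed x)) := by
    intro x hx
    simp only [mem_filter, mem_univ, true_and, QB] at hx
    obtain ⟨hv, u, hu, huv, hux⟩ := hx
    simp only [mem_biUnion, mem_filter, mem_univ, true_and]
    exact ⟨u, mem_erase.2 ⟨huv, hu⟩, hux, hv⟩
  have h2 : ((univ.filter (QB m t1 k₁ I v ω)).card : ℝ) ≤ ∑ u ∈ (BI m t1 k₁ I ω ∪ NI m t1 k₁ I v ω).erase v,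
      ((univ.filter (fun x : Fin (q+1) ↪ Fin n => u ∈ ed x ∧ v ∈ ed x)).card : ℝ) := by
    exact_mod_cast (card_le_card h1).trans card_biUnion_le
  refine h2.trans ((sum_le_sum fun u hu => p_mem2 (mem_erase.1 hu).1 hn2).trans ?_)
  rw [sum_const, nsmul_eq_mul, ← mul_assoc]
  have h3 : ((BI m t1 k₁ I ω ∪ NI m t1 k₁ I v ω).erase v).card ≤ Mx :=
    (card_le_card (erase_subset _ _)).trans ((card_union_le _ _).trans h)
  have h3' : (((BI m t1 k₁ I ω ∪ NI m t1 k₁ I v ω).erase v).card : ℝ) ≤ Mx := by exact_mod_cast h3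
  gcongr

lemma BadI_QB {I : Finset (Fin N)} {v : Fin n} {ω : Fin N → (Fin (q+1) ↪ Fin n)} (hI : ∀ i ∈ I, v ∈ ed (ω i)) {i : Fin N}
    (h : BadI (BS m t1 k₁ ω) ω v i) : QB m t1 k₁ I v ω (ω i) := by
  refine ⟨h.1, ?_⟩
  rcases h.2 with ⟨u, hu, huv, hui⟩ | ⟨j, hvj, ⟨u, hu, huv, huj⟩, hd⟩
  · exact ⟨u, mem_union_left _ (BS_subset_BI I ω hu), huv, hui⟩
  · obtain ⟨w, hwi, hwj⟩ := not_disjoint_iff.1 hd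
    refine ⟨w, mem_union_right _ ?_, ?_, hwi⟩
    · simp only [NI, mem_biUnion, mem_filter, mem_univ, true_and]
      exact ⟨j, ⟨fun hj => hvj (hI j hj), hvj, u, BS_subset_BI I ω hu, huv, huj⟩, hwj⟩
    · rintro rfl; exact hvj hwj

open scoped Classical in
/-- few bad edges at each vertex -/
theorem bad_many {S b₀ Δ : ℕ} (hn2 : 2 ≤ n) (hX : 0 < Fintype.card (Fin (q+1) ↪ Fin n)) :
    Pr (fun ω : Fin N → (Fin (q+1) ↪ Fin n) => ((BS m t1 (k₁ + (S+1)) ω).card ≤ b₀ ∧ ∀ v, dgN ω v ≤ Δ) ∧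
      ∃ v, S + 1 ≤ (univ.filter (fun i : Fin N => BadI (BS m t1 k₁ ω) ω v i)).card) ≤
      n * (N * (((b₀ + b₀ * (Δ * (q+1)) : ℕ) : ℝ) * (2 * (q+1)^2 / n ^ 2))) ^ (S+1) := by
  set Mx := b₀ + b₀ * (Δ * (q+1)) with hMx
  set p : ℝ := (Mx : ℝ) * (2 * (q+1)^2 / n ^ 2) with hp
  have hp0 : 0 ≤ p := by positivity
  have key : ∀ v ∈ (univ : Finset (Fin n)), Pr (fun ω : Fin N → (Fin (q+1) ↪ Fin n) => ∃ I ∈ univ.powersetCard (S+1),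
      (((BI m t1 k₁ I ω).card + (NI m t1 k₁ I v ω).card ≤ Mx) ∧ ∀ i ∈ I, QB m t1 k₁ I v ω (ω i))) ≤ (N * p) ^ (S+1) := by
    intro v _
    refine (Pr_exists_le _ _ (p := p ^ (S+1)) ?_).trans ?_
    · intro I hI
      have hIc := (mem_powersetCard.1 hI).2
      refine (resample_count I (fun ω => (BI m t1 k₁ I ω).card + (NI m t1 k₁ I v ω).card ≤ Mx) (QB m t1 k₁ I v) hp0 hX ?_ ?_ ?_).trans ?_
      · intro i hi ω x; rw [BI_update I hi, NI_update I v hi]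
      · intro i hi ω x y; unfold QB; rw [BI_update I hi, NI_update I v hi]
      · intro ω h; convert QB_card hn2 h
      · rw [hIc]
        exact mul_le_of_le_one_right (pow_nonneg hp0 _) (Pr_le_one _)
    · rw [card_powersetCard, card_univ, Fintype.card_fin]
      refine (choose_le_pow_div' N (S+1) p hp0).trans ?_
      exact div_le_self (by positivity) (by exact_mod_cast Nat.factorial_pos _)
  have h1 := Pr_exists_le _ _ key
  rw [card_univ, Fintype.card_fin] at h1
  refine (Pr_mono fun ω hω => ?_).trans h1
  obtain ⟨⟨hb, hΔ⟩, v, hv⟩ := hω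
  obtain ⟨I, hI, hc⟩ := exists_subset_card_eq hv
  have hI' : ∀ i ∈ I, BadI (BS m t1 k₁ ω) ω v i := fun i hi => (mem_filter.1 (hI hi)).2
  refine ⟨v, mem_univ _, I, mem_powersetCard.2 ⟨subset_univ _, hc⟩, NI_card hc.le hb hΔ, fun i hi => BadI_QB (fun i hi => (hI' i hi).1) (hI' i hi)⟩

open scoped Classical in
/-- no bad edges at vertices of small degree -/
theorem bad_low {S b₀ Δ : ℕ} {lam : ℝ} (hl : 0 < lam) (hl1 : lam ≤ 1) (ht1 : t1 ≤ N) (hn2 : 2 ≤ n) (hX : 0 < Fintype.card (Fin (q+1) ↪ Fin n)) :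
    Pr (fun ω : Fin N → (Fin (q+1) ↪ Fin n) => ((BS m t1 (k₁ + (S+1)) ω).card ≤ b₀ ∧ ∀ v, dgN ω v ≤ Δ) ∧
      ∃ v, (univ.filter (fun i : Fin N => i.val < t1 ∧ v ∈ ed (ω i))).card ≤ S ∧ ∃ i, BadI (BS m t1 k₁ ω) ω v i) ≤
      n * (N * ((((b₀ + b₀ * (Δ * (q+1)) : ℕ) : ℝ) * (2 * (q+1)^2 / n ^ 2)) * ((1 / lam) ^ S * Real.exp (-((1 - lam) * ((q+1) / n * (t1 - 1 : ℝ))))))) := by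
  set Mx := b₀ + b₀ * (Δ * (q+1)) with hMx
  set p : ℝ := (Mx : ℝ) * (2 * (q+1)^2 / n ^ 2) with hp
  have hp0 : 0 ≤ p := by positivity
  have key : ∀ v ∈ (univ : Finset (Fin n)), Pr (fun ω : Fin N → (Fin (q+1) ↪ Fin n) => ∃ i ∈ (univ : Finset (Fin N)),
      (((BI m t1 k₁ {i} ω).card + (NI m t1 k₁ {i} v ω).card ≤ Mx ∧ (((univ.filter (fun i : Fin N => i.val < t1)).erase i).filter (fun j => v ∈ ed (ω j))).card ≤ S)
        ∧ ∀ j ∈ ({i} : Finset (Fin N)), QB m t1 k₁ {i} v ω (ω j))) ≤ N * (p * ((1 / lam) ^ S * Real.exp (-((1 - lam) * ((q+1) / n * (t1 - 1 : ℝ)))))) := by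
    intro v _
    refine (Pr_exists_le _ _ (p := p * ((1 / lam) ^ S * Real.exp (-((1 - lam) * ((q+1) / n * (t1 - 1 : ℝ)))))) ?_).trans (le_of_eq (by rw [card_univ, Fintype.card_fin]))
    intro i _
    refine (resample_count {i} (fun ω => (BI m t1 k₁ {i} ω).card + (NI m t1 k₁ {i} v ω).card ≤ Mx ∧ (((univ.filter (fun i : Fin N => i.val < t1)).erase i).filter (fun j => v ∈ ed (ω j))).card ≤ S)
       (QB m t1 k₁ {i} v) hp0 hX ?_ ?_ ?_).trans ?_
    · intro j hj ω x; rw [BI_update {i} hj, NI_update {i} v hj]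
      rw [mem_singleton] at hj
      have : (((univ.filter (fun i : Fin N => i.val < t1)).erase i).filter (fun j' => v ∈ ed (Function.update ω j x j'))) = (((univ.filter (fun i : Fin N => i.val < t1)).erase i).filter (fun j => v ∈ ed (ω j))) := by
        refine filter_congr fun j' hj' => ?_
        rw [Function.update_of_ne (by rw [hj]; exact (mem_erase.1 hj').1)]
      rw [this]
    · intro j hj ω x y; unfold QB; rw [BI_update {i} hj, NI_update {i} v hj]
    · intro ω h; convert QB_card hn2 h.1
    · rw [card_singleton, pow_one]
      refine mul_le_mul_of_nonneg_left ?_ hp0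
      refine (Pr_mono fun ω hω => hω.2).trans ((low_tail' hX _ (fun x => v ∈ ed x) hl hl1 S (p_mem v hX).ge).trans ?_)
      refine mul_le_mul_of_nonneg_left ?_ (by positivity)
      refine Real.exp_le_exp.2 (neg_le_neg (mul_le_mul_of_nonneg_left ?_ (by linarith)))
      refine mul_le_mul_of_nonneg_left ?_ (by positivity)
      have h1 : t1 - 1 ≤ ((univ.filter (fun i : Fin N => i.val < t1)).erase i).card := by
        have := pred_card_le_card_erase (s := univ.filter (fun i : Fin N => i.val < t1)) (a := i)
        rwa [card_lt_fin ht1] at this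
      have h2 : t1 ≤ ((univ.filter (fun i : Fin N => i.val < t1)).erase i).card + 1 := by omega
      have h3 : (t1:ℝ) ≤ ((univ.filter (fun i : Fin N => i.val < t1)).erase i).card + 1 := by exact_mod_cast h2
      linarith
  have h1 := Pr_exists_le _ _ key
  rw [card_univ, Fintype.card_fin] at h1
  refine (Pr_mono fun ω hω => ?_).trans h1
  obtain ⟨⟨hb, hΔ⟩, v, hv, i, hi⟩ := hω
  refine ⟨v, mem_univ _, i, mem_univ _, ⟨NI_card (by simp) hb hΔ, ?_⟩, fun j hj => ?_⟩
  · refine le_trans (card_le_card ?_) hv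
    intro j hj
    simp only [mem_filter, mem_erase, mem_univ, true_and] at hj ⊢
    exact ⟨hj.1.2, hj.2⟩
  · rw [mem_singleton] at hj
    subst hj
    exact BadI_QB (fun i hi' => by rw [mem_singleton] at hi'; subst hi'; exact hi.1) hi

open scoped Classical in
theorem BS_prob {k₂ : ℕ} {b₀ : ℕ} (hb : 0 < b₀) (hmt : m ≤ t1) (ht1 : t1 ≤ N) (hX : 0 < Fintype.card (Fin (q+1) ↪ Fin n)) :
    Pr (fun ω : Fin N → (Fin (q+1) ↪ Fin n) => ¬ (BS m t1 k₂ ω).card ≤ b₀) ≤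
      n * (2 ^ k₂ * Real.exp (-(1/2 * (1 / n * (t1 - m : ℝ))))) / b₀ := by
  have : Nonempty (Fin (q+1) ↪ Fin n) := Fintype.card_pos_iff.1 hX
  refine Pr_markov _ (fun ω => ((BS m t1 k₂ ω).card : ℝ)) (fun ω => Nat.cast_nonneg _) (by exact_mod_cast hb) (fun ω h => by
    have : b₀ ≤ (BS m t1 k₂ ω).card := by omega
    exact_mod_cast this) ?_
  have hΩc : (0:ℝ) < Fintype.card (Fin N → (Fin (q+1) ↪ Fin n)) := by exact_mod_cast Fintype.card_pos
  have h1 : ∀ ω : Fin N → (Fin (q+1) ↪ Fin n), ((BS m t1 k₂ ω).card : ℝ) = ∑ v, if ownN m t1 ω v < k₂ then (1:ℝ) else 0 := by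
    intro ω; simp [BS]
  simp only [h1]
  rw [sum_comm]
  have h2 : ∀ v, (∑ ω : Fin N → (Fin (q+1) ↪ Fin n), if ownN m t1 ω v < k₂ then (1:ℝ) else 0) ≤ (2 ^ k₂ * Real.exp (-(1/2 * (1 / n * (t1 - m : ℝ))))) * Fintype.card (Fin N → (Fin (q+1) ↪ Fin n)) := by
    intro v
    have h3 : (∑ ω : Fin N → (Fin (q+1) ↪ Fin n), if ownN m t1 ω v < k₂ then (1:ℝ) else 0) = Pr (fun ω : Fin N → (Fin (q+1) ↪ Fin n) => ownN m t1 ω v < k₂) * Fintype.card (Fin N → (Fin (q+1) ↪ Fin n)) := by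
      rw [Pr_eq, div_mul_cancel₀ _ hΩc.ne']
      simp
    rw [h3]
    refine mul_le_mul_of_nonneg_right ?_ hΩc.le
    have h4 := low_tail' hX (univ.filter (fun i : Fin N => m ≤ i.val ∧ i.val < t1)) (fun x => x 0 = v) (lam := 1/2) (by norm_num) (by norm_num) k₂ (p_owner v).ge
    refine (Pr_mono fun ω hω => ?_).trans (h4.trans (le_of_eq ?_))
    · rw [filter_filter]
      unfold ownN at hω
      simp only [and_assoc]
      exact hω.le
    · have h5 : (univ.filter (fun i : Fin N => m ≤ i.val ∧ i.val < t1)).card = t1 - m := by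
        have e1 := card_filter_add_card_filter_not (s := univ.filter (fun i : Fin N => i.val < t1)) (fun i => i.val < m)
        rw [filter_filter, filter_filter, card_lt_fin ht1] at e1
        have e2 : (univ.filter (fun i : Fin N => i.val < t1 ∧ i.val < m)).card = m := by
          refine Eq.trans (congrArg _ ?_) (card_lt_fin (N := N) (hmt.trans ht1))
          refine filter_congr fun i _ => ?_
          constructor
          · exact fun h => h.2
          · exact fun h => ⟨by omega, h⟩
        have e3 : univ.filter (fun i : Fin N => m ≤ i.val ∧ i.val < t1) = univ.filter (fun i : Fin N => i.val < t1 ∧ ¬ i.val < m) := by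
          refine filter_congr fun i _ => ?_
          constructor <;> intro h <;> omega
        rw [e3]; omega
      rw [h5, Nat.cast_sub hmt]
      norm_num
  refine (sum_le_sum fun v _ => h2 v).trans (le_of_eq ?_)
  rw [sum_const, card_univ, Fintype.card_fin, nsmul_eq_mul]
  ring

theorem dg_prob {Δ : ℕ} (hX : 0 < Fintype.card (Fin (q+1) ↪ Fin n)) :
    Pr (fun ω : Fin N → (Fin (q+1) ↪ Fin n) => ¬ ∀ v, dgN ω v ≤ Δ) ≤ n * ((N * ((q+1) / n)) ^ Δ / Δ.factorial) := by
  have key : ∀ v ∈ (univ : Finset (Fin n)), Pr (fun ω : Fin N → (Fin (q+1) ↪ Fin n) => Δ ≤ (univ.filter (fun i : Fin N => v ∈ ed (ω i))).card) ≤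
      (N * ((q+1) / n)) ^ Δ / Δ.factorial := by
    intro v _
    refine (many_prob hX univ (fun x => v ∈ ed x) (p := (q+1)/n) (by positivity) (by convert (p_mem v hX).le) Δ).trans ?_
    rw [card_univ, Fintype.card_fin]
    exact choose_le_pow_div' _ _ _ (by positivity)
  have h1 := Pr_exists_le _ _ key
  rw [card_univ, Fintype.card_fin] at h1
  refine (Pr_mono fun ω hω => ?_).trans h1
  push Not at hω
  obtain ⟨v, hv⟩ := hω
  exact ⟨v, mem_univ _, hv.le⟩

open scoped Classical in
/-- deterministic part -/
theorem good_lists {S k : ℕ} {ω : Fin N → (Fin (q+1) ↪ Fin n)} (hk : k + S ≤ k₁)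
    (hcov : ∀ v, ∃ i, v ∈ ed (ω i))
    (h2 : ¬ ∃ v, S + 1 ≤ (univ.filter (fun i : Fin N => BadI (BS m t1 k₁ ω) ω v i)).card)
    (h3 : ¬ ∃ v, (univ.filter (fun i : Fin N => i.val < t1 ∧ v ∈ ed (ω i))).card ≤ S ∧ ∃ i, BadI (BS m t1 k₁ ω) ω v i) :
    (∀ b ∈ BS m t1 k₁ ω, ∃ i, GoodEdge t1 (BS m t1 k₁ ω) ω b i) ∧
    (∀ v, v ∉ BS m t1 k₁ ω → k ≤ (univ.filter (fun i : Fin N => m ≤ i.val ∧ i.val < t1 ∧ ω i 0 = v ∧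
    Disjoint (ed (ω i)) (BS m t1 k₁ ω))).card) := by
  push Not at h2 h3
  set B := BS m t1 k₁ ω with hB
  constructor
  · intro b hb
    have fin : ∀ i, b ∈ ed (ω i) → ¬ BadI B ω b i → (i.val < t1 ∨ ∀ i' < i, b ∉ ed (ω i')) → GoodEdge t1 B ω b i := by
      intro i hbi hnb ht
      unfold BadI at hnb
      push Not at hnb
      obtain ⟨n1, n2⟩ := hnb hbi
      refine ⟨hbi, ht, ?_, ?_⟩
      · ext u
        simp only [mem_inter, mem_singleton]
        constructor
        · rintro ⟨hui, huB⟩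
          by_contra hne
          exact n1 u huB hne hui
        · rintro rfl; exact ⟨hbi, hb⟩
      · intro j b' hb' hne hb'j hbj
        exact n2 j hbj ⟨b', hb', hne, hb'j⟩
    by_cases hd : (univ.filter (fun i : Fin N => i.val < t1 ∧ b ∈ ed (ω i))).card ≤ S
    · have hn := h3 b hd
      have hne : (univ.filter (fun i : Fin N => b ∈ ed (ω i))).Nonempty := by
        obtain ⟨i, hi⟩ := hcov b
        exact ⟨i, by simpa using hi⟩
      refine ⟨(univ.filter (fun i : Fin N => b ∈ ed (ω i))).min' hne, fin _ ?_ (hn _) (Or.inr ?_)⟩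
      · exact (mem_filter.1 (min'_mem _ hne)).2
      · intro i' hi' hbi'
        exact absurd (min'_le _ i' (by simpa using hbi')) (not_le.2 hi')
    · have : ∃ i ∈ univ.filter (fun i : Fin N => i.val < t1 ∧ b ∈ ed (ω i)), i ∉ univ.filter (fun i : Fin N => BadI B ω b i) := by
        by_contra hcon
        push Not at hcon
        have := card_le_card (show univ.filter (fun i : Fin N => i.val < t1 ∧ b ∈ ed (ω i)) ⊆ univ.filter (fun i : Fin N => BadI B ω b i) from hcon)
        have := h2 b
        omega
      obtain ⟨i, hi, hnb⟩ := this
      simp only [mem_filter, mem_univ, true_and] at hi hnb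
      exact ⟨i, fin i hi.2 hnb (Or.inl hi.1)⟩
  · intro v hv
    have ho : k₁ ≤ ownN m t1 ω v := by
      by_contra hcon
      exact hv (by rw [hB, mem_BS']; omega)
    unfold ownN at ho
    have hsub : univ.filter (fun i : Fin N => m ≤ i.val ∧ i.val < t1 ∧ ω i 0 = v) ⊆
        univ.filter (fun i : Fin N => m ≤ i.val ∧ i.val < t1 ∧ ω i 0 = v ∧ Disjoint (ed (ω i)) B) ∪ univ.filter (fun i : Fin N => BadI B ω v i) := by
      intro i hi
      simp only [mem_filter, mem_univ, true_and, mem_union] at hi ⊢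
      by_cases hd : Disjoint (ed (ω i)) B
      · exact Or.inl ⟨hi.1, hi.2.1, hi.2.2, hd⟩
      · right
        obtain ⟨w, hw, hwB⟩ := not_disjoint_iff.1 hd
        exact ⟨mem_ed.2 ⟨0, hi.2.2⟩, Or.inl ⟨w, hwB, by rintro rfl; exact hv hwB, hw⟩⟩
    have h5 := (card_le_card hsub).trans (card_union_le _ _)
    have h6 := h2 v
    have h7 : k ≤ (univ.filter (fun i : Fin N => m ≤ i.val ∧ i.val < t1 ∧ ω i 0 = v ∧ Disjoint (ed (ω i)) B)).card := by omega
    convert h7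

end lowv
end Sham

namespace Sham

section asm
variable {n q N : ℕ}

/-- the outcome we want, in the sequence model -/
def GoodSeq (φfin : ℝ) (ω : Fin N → (Fin (q+1) ↪ Fin n)) : Prop :=
  ∃ T ≤ N, (∀ v, ∃ i : Fin N, i.val < T ∧ v ∈ ed (ω i)) ∧ (∀ t < T, ¬ ∀ v, ∃ i : Fin N, i.val < t ∧ v ∈ ed (ω i)) ∧
    φfin ≤ (PM (GG ed ω T) univ).card

lemma early_sub {t1 T : ℕ} {ω : Fin N → (Fin (q+1) ↪ Fin n)} (hT : ∀ v, ∃ i : Fin N, i.val < T ∧ v ∈ ed (ω i)) (h1 : t1 ≤ T) :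
    EarlyG t1 ω ⊆ GG ed ω T := by
  intro e he
  rw [mem_EarlyG] at he
  rw [mem_GG]
  obtain ⟨i, hi, rfl⟩ := he
  refine ⟨i, ?_, rfl⟩
  rcases hi with hi | ⟨v, hv, hf⟩
  · omega
  · by_contra hcon
    obtain ⟨i', hi', hv'⟩ := hT v
    exact hf i' (by rw [Fin.lt_def]; omega) hv'

lemma Pr_or_le {Ω : Type*} [Fintype Ω] {E F : Ω → Prop} {a b : ℝ} (h1 : Pr E ≤ a) (h2 : Pr F ≤ b) : Pr (fun ω => E ω ∨ F ω) ≤ a + b :=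
  (Pr_or E F).trans (add_le_add h1 h2)

open scoped Classical in
theorem omega_bound {m t1 k₁ k S σ τ₀ ℓ nmin nsz b₀ Δ : ℕ} {δ' δ'' L φfin β Λ lam ε : ℝ} (hq : 1 ≤ q) (hnq : q + 3 ≤ n) (hN : 0 < N) (hδ' : 0 ≤ δ') (hδ'' : 0 ≤ δ'')
    (hL : 0 < L) (hqn : (q+1) ∣ n) (hβ : 0 ≤ β) (hβ1 : β ≤ 1) (hl : 0 < lam) (hl1 : lam ≤ 1) (hb₀ : 0 < b₀)
    (hwin : τ₀ + 2 * σ * q * ℓ ≤ m) (hmt : m ≤ t1) (ht1 : t1 ≤ N)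
    (hnsz : nsz + (q+1)*q*σ + (q+1)*σ ≤ nmin) (hsmall : (q+1) * b₀ + nmin ≤ n) (hk : k + S ≤ k₁)
    (hCL : ∀ (v : Fin n) (B : Finset (Fin n)), v ∉ B → (q+1) * B.card + nmin ≤ n →
      L ≤ ((univ.filter (fun x : Fin (q+1) ↪ Fin n => x 0 = v ∧ Disjoint (ed x) B)).card : ℝ))
    (hW : ((q : ℝ) + 1) * (n - nsz + (q + 1) * q) ≤ δ' * n)
    (hXn : (1 - δ') * ((n : ℝ) ^ (q+1)) ^ q ≤ (Fintype.card (Fin (q+1) ↪ Fin n) : ℝ) ^ q)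
    (hφfin : ∀ W₀ : Finset (Fin n), nmin ≤ W₀.card + (q+1)*σ → (q+1) ∣ W₀.card →
      φfin ≤ phi q ((1 - β) * (τ₀ / n.descFactorial (q+1))) Λ W₀ (q * σ))
    (hLL : ∀ W₀ : Finset (Fin n), (nmin ≤ W₀.card + (q+1)*σ ∧ (q+1) ∣ W₀.card) → ∀ W ⊆ W₀, W₀.card ≤ W.card + ((q+1)*q) * (2*σ + 1) → ∀ ex < q*σ, ∀ τ, τ₀ ≤ τ → τ < m →
      ∀ G : Finset (Finset (Fin n)), (∀ e ∈ G, e.card = q+1) → QR G → G.card ≤ τ + 1 →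
        phi q ((1 - β) * (τ₀ / n.descFactorial (q+1))) Λ W₀ ex ≤ (PM G W).card →
      ((G.filter (Light G W (phi q ((1 - β) * (τ₀ / n.descFactorial (q+1))) Λ W₀ (ex + 1)))).card : ℝ) ≤ δ'' / 2 * (τ + 1))
    (e1 : n * Real.exp (-(1/2 * ((q+1) / n * N))) ≤ ε)
    (e2 : 1 / (n * (1 - (q+1) / n : ℝ) ^ t1) ≤ ε)
    (e3 : n * (2 ^ (k₁ + (S+1)) * Real.exp (-(1/2 * (1 / n * (t1 - m : ℝ))))) / b₀ ≤ ε)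
    (e4 : n * ((N * ((q+1) / n)) ^ Δ / Δ.factorial) ≤ ε)
    (e5 : n * (N * (((b₀ + b₀ * (Δ * (q+1)) : ℕ) : ℝ) * (2 * (q+1)^2 / n ^ 2))) ^ (S+1) ≤ ε)
    (e6 : n * (N * ((((b₀ + b₀ * (Δ * (q+1)) : ℕ) : ℝ) * (2 * (q+1)^2 / n ^ 2)) * ((1 / lam) ^ S * Real.exp (-((1 - lam) * ((q+1) / n * (t1 - 1 : ℝ))))))) ≤ ε)
    (e7 : 2 ^ n * Real.exp (-(β ^ 2 / 2 * (((q+1)*σ).descFactorial (q+1) / n.descFactorial (q+1) * τ₀))) ≤ ε)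
    (e8 : (n:ℝ) ^ 2 * (m * (2 * (q+1)^2 / n ^ 2 : ℝ)) ^ 3 ≤ ε)
    (e9 : 2 ^ n * ((n + 1) ^ ((q+1)*q) * ((n + 1) ^ ((q+1)*q) * (q * (q*σ : ℕ))) : ℝ) ^ (2*σ) * Real.exp ((2*σ : ℕ) * ℓ * δ'' / 2 - σ * ℓ * δ' / 4) ≤ ε)
    (e10 : 2 * σ * σ * (3 * q * δ' * ((n:ℝ) ^ (q+1)) ^ q / L ^ (q+1)) ^ k ≤ ε) :
    Pr (fun ω : Fin N → (Fin (q+1) ↪ Fin n) => Function.Injective (fun i => ed (ω i)) ∧ ¬ GoodSeq φfin ω) ≤ 10 * ε := by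
  have hX : 0 < Fintype.card (Fin (q+1) ↪ Fin n) := by rw [card_X]; exact Nat.descFactorial_pos.2 (by omega)
  have hn : 0 < n := by omega
  have p1 := (covN_prob (N := N) hn hX).trans e1
  have p2 := (covt_prob ht1 hnq).trans e2
  have p3 := (BS_prob (k₂ := k₁ + (S+1)) hb₀ hmt ht1 hX).trans e3
  have p4 := (dg_prob (N := N) (Δ := Δ) hX).trans e4
  have p5 := (bad_many (m := m) (t1 := t1) (k₁ := k₁) (S := S) (b₀ := b₀) (Δ := Δ) (N := N) (by omega) hX).trans e5
  have p6 := (bad_low (m := m) (t1 := t1) (k₁ := k₁) (S := S) (b₀ := b₀) (Δ := Δ) (N := N) hl hl1 ht1 (by omega) hX).trans e6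
  have p7 := (start_prob (N := N) (τ₀ := τ₀) (σ := σ) (nmin := nmin) (Λ := Λ) hβ hβ1 (by omega) hX (by omega)).trans e7
  have p8 := (cod_prob (N := N) (t := m) (by omega) (by omega) hX).trans e8
  have p9 := (plans_bound (D := (q+1)*q) (Ex := q*σ) (K := 2*σ) (κ := σ) (ℓ := ℓ) (τ₀ := τ₀) (t := m) (N := N) (by omega) hX hq hwin (by omega) _ _ hδ' hδ'' hLL).trans e9
  have p10 := (class_fail (k₁ := k₁) (k := k) (φ := phi q ((1 - β) * (τ₀ / n.descFactorial (q+1))) Λ) (N := N) hq hn hN hδ' hL hX hqn hwin hmt hnsz hCL hW hXn hφfin).trans e10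
  have o9 := Pr_or_le p9 p10
  have o8 := Pr_or_le p8 o9
  have o7 := Pr_or_le p7 o8
  have o6 := Pr_or_le p6 o7
  have o5 := Pr_or_le p5 o6
  have o4 := Pr_or_le p4 o5
  have o3 := Pr_or_le p3 o4
  have o2 := Pr_or_le p2 o3
  have o1 := Pr_or_le p1 o2
  refine le_trans (Pr_mono ?_) (o1.trans (by linarith))
  rintro ω ⟨hinj, hbad⟩
  by_contra hno
  push Not at hno
  obtain ⟨g1, g2, g3, g4, g5, g6, g7, g8, g9, g10⟩ := hno
  have gg : (BS m t1 (k₁ + (S+1)) ω).card ≤ b₀ ∧ ∀ v, dgN ω v ≤ Δ := ⟨g3, g4⟩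
  have hgl := good_lists (m := m) (t1 := t1) (k₁ := k₁) (k := k) (S := S) hk g1 (by
    rintro ⟨v, hv⟩; exact absurd hv (not_le.2 (g5 gg v))) (by
    rintro ⟨v, hv, i, hi⟩; exact g6 gg v hv i hi)
  have hnice : Nice m t1 k₁ k σ τ₀ ℓ nmin (phi q ((1 - β) * (τ₀ / n.descFactorial (q+1))) Λ) δ' ω := by
    refine ⟨hgl.1, hgl.2, ?_, g7 hinj, ?_⟩
    · refine le_trans (Nat.add_le_add_right (Nat.mul_le_mul_left _ ?_) _) hsmall
      refine (card_le_card ?_).trans g3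
      intro v hv
      rw [mem_BS'] at hv ⊢
      omega
    · rintro ⟨W₀, hW₀, p, hp⟩
      exact absurd hp (not_le.2 (g9 g8 W₀ hW₀ p))
  have hfin := g10 hnice
  apply hbad
  have hex : ∃ T, ∀ v, ∃ i : Fin N, i.val < T ∧ v ∈ ed (ω i) := ⟨N, fun v => by
    obtain ⟨i, hi⟩ := g1 v
    exact ⟨i, i.2, hi⟩⟩
  have hT := Nat.find_spec hex
  have hTm : ∀ t < Nat.find hex, ¬ ∀ v, ∃ i : Fin N, i.val < t ∧ v ∈ ed (ω i) := fun t ht => Nat.find_min hex ht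
  have hTN : Nat.find hex ≤ N := Nat.find_min' hex (fun v => by
    obtain ⟨i, hi⟩ := g1 v
    exact ⟨i, i.2, hi⟩)
  have ht1T : t1 ≤ Nat.find hex := by
    by_contra hcon
    obtain ⟨v, hv⟩ := g2
    obtain ⟨i, hi, hvi⟩ := hT v
    exact hv i (by omega) hvi
  refine ⟨Nat.find hex, hTN, hT, hTm, hfin.trans ?_⟩
  exact_mod_cast card_le_card (PM_mono (early_sub hT ht1T) _)

end asm
end Sham

namespace Sham

section tr
variable {n q N : ℕ}

lemma card_ed_eq {n r : ℕ} (s : Finset (Fin n)) (hs : s.card = r) [DecidablePred (fun x : Fin r ↪ Fin n => ed x = s)] :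
    (univ.filter (fun x : Fin r ↪ Fin n => ed x = s)).card = r.factorial := by
  classical
  have h := card_ed_subset' (r := r) s
  rw [hs, Nat.descFactorial_self] at h
  rw [← h]
  congr 1
  refine filter_congr fun x _ => ?_
  constructor
  · intro h; rw [h]
  · intro h; exact eq_of_subset_of_card_le h (by rw [hs, card_ed])

lemma card_agree {M : ℕ} {Y : Type*} [Fintype Y] [Fintype (Fin M ≃ Y)] (hM : Fintype.card Y = M) (hNM : N ≤ M) (f : Fin N → Y) (hf : Function.Injective f)
    [DecidablePred (fun σ : Fin M ≃ Y => ∀ i : Fin N, σ (Fin.castLE hNM i) = f i)] :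
    (univ.filter (fun σ : Fin M ≃ Y => ∀ i : Fin N, σ (Fin.castLE hNM i) = f i)).card ≤ (M - N).factorial := by
  classical
  have hc : Fintype.card ({i : Fin M // N ≤ i.val} ↪ {y : Y // ∀ i, f i ≠ y}) = (M - N).factorial := by
    rw [Fintype.card_embedding_eq]
    have h1 : Fintype.card {i : Fin M // N ≤ i.val} = M - N := by
      rw [Fintype.card_subtype]
      have e1 := card_filter_add_card_filter_not (s := (univ : Finset (Fin M))) (fun i => i.val < N)
      rw [card_lt_fin hNM, card_univ, Fintype.card_fin] at e1
      simp only [not_lt] at e1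
      omega
    have h2 : Fintype.card {y : Y // ∀ i, f i ≠ y} = M - N := by
      rw [Fintype.card_subtype]
      have e1 := card_filter_add_card_filter_not (s := (univ : Finset Y)) (fun y => ∀ i, f i ≠ y)
      rw [card_univ, hM] at e1
      have e2 : (univ.filter (fun y => ¬ ∀ i, f i ≠ y)) = univ.image f := by
        ext y; simp
      rw [e2, card_image_of_injective _ hf, card_univ, Fintype.card_fin] at e1
      omega
    rw [h1, h2, Nat.descFactorial_self]
  rw [← hc, ← Fintype.card_coe]
  have hmem : ∀ σ : {σ // σ ∈ univ.filter (fun σ : Fin M ≃ Y => ∀ i : Fin N, σ (Fin.castLE hNM i) = f i)}, ∀ i : Fin N, σ.1 (Fin.castLE hNM i) = f i :=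
    fun σ => (mem_filter.1 σ.2).2
  refine Fintype.card_le_of_injective (fun σ => (⟨fun i => ⟨σ.1 i.1, fun j hj => ?_⟩, ?_⟩ : {i : Fin M // N ≤ i.val} ↪ {y : Y // ∀ i, f i ≠ y})) ?_
  · rw [← hmem σ j] at hj
    have := σ.1.injective hj
    have h2 := i.2
    rw [← this] at h2
    simp only [Fin.val_castLE] at h2
    omega
  · intro i i' h
    exact Subtype.ext (σ.1.injective (by simpa using h))
  · intro σ σ' h
    refine Subtype.ext (Equiv.ext fun i => ?_)
    by_cases hi : N ≤ i.val
    · exact congrArg Subtype.val (DFunLike.congr_fun h ⟨i, hi⟩)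
    · have e : i = Fin.castLE hNM ⟨i.val, by omega⟩ := Fin.ext rfl
      rw [e, hmem, hmem]

lemma pow_le_two_desc {M : ℕ} (h : 2 * N ^ 2 ≤ M) : (M:ℝ) ^ N ≤ 2 * M.descFactorial N := by
  rcases Nat.eq_zero_or_pos M with rfl | hM
  · have : N = 0 := by nlinarith
    subst this; simp
  have hM' : (0:ℝ) < M := by exact_mod_cast hM
  have hNM : N ≤ M := by nlinarith [Nat.le_self_pow (two_ne_zero) N]
  have h' : 2 * (N:ℝ) ^ 2 ≤ M := by exact_mod_cast h
  have hNM' : (N:ℝ) ≤ M := by exact_mod_cast hNM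
  have h1 : ((M:ℝ) - N) ^ N ≤ M.descFactorial N := by
    have := Nat.pow_sub_le_descFactorial M N
    have h2 : ((M + 1 - N : ℕ):ℝ) ^ N ≤ M.descFactorial N := by exact_mod_cast this
    refine le_trans (pow_le_pow_left₀ (by linarith) ?_ _) h2
    rw [Nat.cast_sub (by omega)]; push_cast; linarith
  have h2 : (1:ℝ)/2 ≤ (1 - N / M : ℝ) ^ N := by
    have hb := one_add_mul_le_pow (a := -(N / M : ℝ)) (by
      have : (N:ℝ) / M ≤ 1 := (div_le_one hM').2 hNM'
      linarith) N
    rw [← sub_eq_add_neg] at hb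
    refine le_trans ?_ hb
    have : (N:ℝ) * (N / M) ≤ 1/2 := by
      rw [← mul_div_assoc, div_le_iff₀ hM']; nlinarith
    linarith
  have h3 : ((M:ℝ) - N) ^ N = M ^ N * (1 - N / M : ℝ) ^ N := by
    rw [← mul_pow]; congr 1; field_simp
  have h4 : (0:ℝ) < (M:ℝ)^N := by positivity
  nlinarith

/-- finite set of `Fin n` viewed in `ℕ` -/
def up (s : Finset (Fin n)) : Finset ℕ := s.map Fin.valEmbedding

lemma up_inj : Function.Injective (up (n := n)) := Finset.map_injective _

lemma mem_up {s : Finset (Fin n)} {a : ℕ} : a ∈ up s ↔ ∃ h : a < n, (⟨a, h⟩ : Fin n) ∈ s := by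
  unfold up
  simp only [mem_map, Fin.valEmbedding_apply]
  constructor
  · rintro ⟨v, hv, rfl⟩; exact ⟨v.2, hv⟩
  · rintro ⟨h, hv⟩; exact ⟨_, hv, rfl⟩

lemma up_inter (s t : Finset (Fin n)) : up s ∩ up t = up (s ∩ t) := (map_inter _ _).symm

lemma PM_up (G : Finset (Finset (Fin n))) : (PM G univ).card ≤ pmCount (range n) (G.image up) := by
  unfold pmCount
  refine card_le_card_of_injOn (fun M => M.image up) ?_ ?_
  · intro M hM
    rw [mem_coe, mem_PM] at hM
    rw [mem_coe, pmSet, mem_filter, mem_powerset]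
    refine ⟨image_subset_image hM.1, ?_, ?_⟩
    · intro A hA B hB hne
      obtain ⟨A', hA', rfl⟩ := mem_image.1 hA
      obtain ⟨B', hB', rfl⟩ := mem_image.1 hB
      rw [up_inter, hM.2.1 A' hA' B' hB' (by rintro rfl; exact hne rfl)]
      simp [up]
    · ext a
      simp only [mem_biUnion, mem_image, id, mem_range]
      constructor
      · rintro ⟨A, ⟨A', _, rfl⟩, ha⟩
        exact (mem_up.1 ha).1
      · intro ha
        have : (⟨a, ha⟩ : Fin n) ∈ M.biUnion id := by rw [hM.2.2]; exact mem_univ _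
        obtain ⟨A, hA, haA⟩ := mem_biUnion.1 this
        exact ⟨up A, ⟨A, hA, rfl⟩, mem_up.2 ⟨ha, haA⟩⟩
  · intro M _ M' _ h
    exact image_injective up_inj h

lemma up_mem_Kn {s : Finset (Fin n)} {r : ℕ} (hs : s.card = r) : up s ∈ Kn n r := by
  rw [Kn, mem_powersetCard]
  refine ⟨fun a ha => mem_range.2 (mem_up.1 ha).1, by rw [up, card_map, hs]⟩

lemma exists_down {r : ℕ} {A : Finset ℕ} (hA : A ∈ Kn n r) : ∃ s : Finset (Fin n), s.card = r ∧ up s = A := by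
  rw [Kn, mem_powersetCard] at hA
  have : up (univ.filter (fun v : Fin n => v.val ∈ A)) = A := by
    ext a
    rw [mem_up]
    simp only [mem_filter, mem_univ, true_and, exists_prop, and_iff_right_iff_imp]
    exact fun h => mem_range.1 (hA.1 h)
  refine ⟨_, ?_, this⟩
  have h2 := congrArg card this
  rw [up, card_map] at h2
  rw [h2, hA.2]

lemma goodSeq_hit {φfin : ℝ} (hNM : N ≤ (Kn n (q+1)).card) (σ : Fin (Kn n (q+1)).card ≃ {A // A ∈ Kn n (q+1)})
    (ω : Fin N → (Fin (q+1) ↪ Fin n)) (hag : ∀ i : Fin N, ((σ (Fin.castLE hNM i)) : Finset ℕ) = up (ed (ω i)))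
    (hg : GoodSeq φfin ω) : φfin ≤ pmCount (range n) (Ht n (q+1) (hitTime n (q+1) σ) σ) := by
  obtain ⟨T, hTN, hT, hTm, hφ⟩ := hg
  have hHt : ∀ t ≤ N, Ht n (q+1) t σ = (GG ed ω t).image up := by
    intro t ht
    ext A
    simp only [Ht, mem_image, mem_filter, mem_univ, true_and, mem_GG]
    constructor
    · rintro ⟨i, hi, rfl⟩
      refine ⟨_, ⟨⟨i.val, by omega⟩, hi, rfl⟩, ?_⟩
      rw [← hag]
      rfl
    · rintro ⟨_, ⟨i, hi, rfl⟩, rfl⟩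
      exact ⟨Fin.castLE hNM i, hi, hag i⟩
  have hcov : ∀ t ≤ N, ((Ht n (q+1) t σ).biUnion id = range n ↔ ∀ v, ∃ i : Fin N, i.val < t ∧ v ∈ ed (ω i)) := by
    intro t ht
    rw [hHt t ht]
    constructor
    · intro h v
      have : v.val ∈ ((GG ed ω t).image up).biUnion id := by rw [h]; exact mem_range.2 v.2
      obtain ⟨A, hA, hv⟩ := mem_biUnion.1 this
      obtain ⟨e, he, rfl⟩ := mem_image.1 hA
      obtain ⟨i, hi, rfl⟩ := mem_GG.1 he
      obtain ⟨_, hv⟩ := mem_up.1 hv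
      exact ⟨i, hi, hv⟩
    · intro h
      ext a
      rw [mem_biUnion, mem_range]
      constructor
      · rintro ⟨A, hA, ha⟩
        obtain ⟨e, he, rfl⟩ := mem_image.1 hA
        exact (mem_up.1 ha).1
      · intro ha
        obtain ⟨i, hi, hv⟩ := h ⟨a, ha⟩
        exact ⟨up (ed (ω i)), mem_image_of_mem _ (mem_GG.2 ⟨i, hi, rfl⟩), mem_up.2 ⟨ha, hv⟩⟩
  have hhit : hitTime n (q+1) σ = T := by
    unfold hitTime
    have hmem : T ∈ {t : ℕ | (Ht n (q+1) t σ).biUnion id = Finset.range n} := (hcov T hTN).2 hT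
    refine le_antisymm (Nat.sInf_le hmem) ?_
    by_contra hcon
    push Not at hcon
    have h2 := Nat.sInf_mem ⟨T, hmem⟩
    exact hTm _ hcon ((hcov _ (by omega)).1 h2)
  rw [hhit, hHt T hTN]
  refine hφ.trans ?_
  exact_mod_cast PM_up _

theorem transfer {φfin ε : ℝ} (hn : q + 1 ≤ n) (hNM : 2 * N ^ 2 ≤ (Kn n (q+1)).card)
    (hP : Pr (fun ω : Fin N → (Fin (q+1) ↪ Fin n) => Function.Injective (fun i => ed (ω i)) ∧ ¬ GoodSeq φfin ω) ≤ ε)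
    [Fintype (Fin (Kn n (q+1)).card ≃ {A // A ∈ Kn n (q+1)})]
    (F : (Fin (Kn n (q+1)).card ≃ {A // A ∈ Kn n (q+1)}) → Prop) [DecidablePred F]
    (hF : ∀ σ, φfin ≤ pmCount (range n) (Ht n (q+1) (hitTime n (q+1) σ) σ) → F σ) :
    1 - 2 * ε ≤ ((univ.filter F).card : ℝ) / Fintype.card (Fin (Kn n (q+1)).card ≃ {A // A ∈ Kn n (q+1)}) := by
  classical
  have hNM' : N ≤ (Kn n (q+1)).card := by nlinarith [Nat.le_self_pow (two_ne_zero) N]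
  have hMc : (Kn n (q+1)).card = n.choose (q+1) := by rw [Kn, card_powersetCard, card_range]
  haveI hFin : Fintype {A // A ∈ Kn n (q+1)} := Finset.fintypeCoeSort _
  have hYc : Fintype.card {A // A ∈ Kn n (q+1)} = (Kn n (q+1)).card := Fintype.card_coe _
  have hEc : Fintype.card (Fin (Kn n (q+1)).card ≃ {A // A ∈ Kn n (q+1)}) = (Kn n (q+1)).card.factorial := by
    have := Fintype.card_equiv (Fintype.equivFinOfCardEq hYc).symm
    rw [Fintype.card_fin] at this
    rw [← this]; congr!
  have hE0 : (0:ℝ) < (Kn n (q+1)).card.factorial := by exact_mod_cast Nat.factorial_pos _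
  let R : (Fin (Kn n (q+1)).card ≃ {A // A ∈ Kn n (q+1)}) → (Fin N → (Fin (q+1) ↪ Fin n)) → Prop := fun σ ω => ∀ i : Fin N, ((σ (Fin.castLE hNM' i)) : Finset ℕ) = up (ed (ω i))
  obtain ⟨bσ, hbσ⟩ : ∃ b, b = univ.filter (fun σ => ¬ F σ) := ⟨_, rfl⟩
  obtain ⟨bω, hbω⟩ : ∃ b, b = univ.filter (fun ω : Fin N → (Fin (q+1) ↪ Fin n) => Function.Injective (fun i => ed (ω i)) ∧ ¬ GoodSeq φfin ω) := ⟨_, rfl⟩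
  have dc := card_mul_le_card_mul (s := bσ) (t := bω) R (m := (q+1).factorial ^ N) (n := ((Kn n (q+1)).card - N).factorial) (by
    intro σ hσ
    rw [hbσ, mem_filter] at hσ
    choose s hs1 hs2 using fun i : Fin N => exists_down (σ (Fin.castLE hNM' i)).2
    have : Fintype.piFinset (fun i => univ.filter (fun x : Fin (q+1) ↪ Fin n => ed x = s i)) ⊆ bipartiteAbove R bω σ := by
      intro ω hω
      rw [Fintype.mem_piFinset] at hω
      have hω' : ∀ i, ed (ω i) = s i := fun i => (mem_filter.1 (hω i)).2
      have hRR : R σ ω := fun i => by rw [hω' i]; exact (hs2 i).symm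
      rw [mem_bipartiteAbove, hbω, mem_filter]
      refine ⟨⟨mem_univ _, ?_, ?_⟩, hRR⟩
      · intro i j hij
        have h1 : ((σ (Fin.castLE hNM' i)) : Finset ℕ) = (σ (Fin.castLE hNM' j)) := by rw [hRR i, hRR j]; exact congrArg up hij
        have h2 := σ.injective (Subtype.ext h1)
        exact Fin.castLE_injective hNM' h2
      · intro hg
        exact hσ.2 (hF σ (goodSeq_hit hNM' σ ω hRR hg))
    refine le_trans (le_of_eq ?_) (card_le_card this)
    rw [Fintype.card_piFinset]
    simp only [card_ed_eq _ (hs1 _), prod_const, card_univ, Fintype.card_fin]) (by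
    intro ω hω
    rw [hbω, mem_filter] at hω
    have h1 := card_agree (N := N) hYc hNM' (fun i => (⟨up (ed (ω i)), up_mem_Kn (card_ed _)⟩ : {A // A ∈ Kn n (q+1)})) (by
      intro i j hij
      exact hω.2.1 (up_inj (congrArg Subtype.val hij)))
    refine le_trans (card_le_card ?_) h1
    intro σ hσ
    rw [mem_bipartiteBelow] at hσ
    rw [mem_filter]
    exact ⟨mem_univ _, fun i => Subtype.ext (hσ.2 i)⟩)
  have hX : (Fintype.card (Fin (q+1) ↪ Fin n) : ℝ) = (q+1).factorial * (Kn n (q+1)).card := by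
    rw [card_X, Nat.descFactorial_eq_factorial_mul_choose, ← hMc]; push_cast; ring
  have hM0 : 0 < (Kn n (q+1)).card := by rw [hMc]; exact Nat.choose_pos hn
  have hX0 : (0:ℝ) < Fintype.card (Fin (q+1) ↪ Fin n) := by
    rw [hX]; exact mul_pos (by exact_mod_cast Nat.factorial_pos _) (by exact_mod_cast hM0)
  rw [Pr_eq, Fintype.card_fun, Fintype.card_fin] at hP
  push_cast at hP
  rw [div_le_iff₀ (pow_pos hX0 _), hX] at hP
  rw [← hbω] at hP
  have hf0 : (0:ℝ) < ((q+1).factorial : ℝ) ^ N := pow_pos (by exact_mod_cast Nat.factorial_pos _) _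
  have hg0 : (0:ℝ) < (((Kn n (q+1)).card - N).factorial : ℝ) := by exact_mod_cast Nat.factorial_pos _
  have dc' : (bσ.card : ℝ) * ((q+1).factorial : ℝ) ^ N ≤ bω.card * (((Kn n (q+1)).card - N).factorial : ℝ) := by exact_mod_cast dc
  have h5 : (bσ.card : ℝ) ≤ ε * (Kn n (q+1)).card ^ N * ((Kn n (q+1)).card - N).factorial := by
    have : (bω.card : ℝ) ≤ ε * (((q+1).factorial : ℝ) ^ N * (Kn n (q+1)).card ^ N) := by rw [← mul_pow]; exact hP
    have h6 : (bσ.card : ℝ) * ((q+1).factorial : ℝ) ^ N ≤ (ε * (Kn n (q+1)).card ^ N * ((Kn n (q+1)).card - N).factorial) * ((q+1).factorial : ℝ) ^ N := by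
      refine dc'.trans ((mul_le_mul_of_nonneg_right this hg0.le).trans (le_of_eq ?_)); ring
    exact le_of_mul_le_mul_right h6 hf0
  have hε : 0 ≤ ε := by
    have hpos : (0:ℝ) < ((q+1).factorial * (Kn n (q+1)).card : ℝ) ^ N := by rw [← hX]; exact pow_pos hX0 _
    have : 0 ≤ ε * ((q+1).factorial * (Kn n (q+1)).card : ℝ) ^ N := le_trans (Nat.cast_nonneg _) hP
    exact nonneg_of_mul_nonneg_left this hpos
  have h7 := pow_le_two_desc hNM
  have h8 : (((Kn n (q+1)).card - N).factorial : ℝ) * (Kn n (q+1)).card.descFactorial N = (Kn n (q+1)).card.factorial := by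
    exact_mod_cast Nat.factorial_mul_descFactorial hNM'
  have h9 : (bσ.card : ℝ) ≤ 2 * ε * (Kn n (q+1)).card.factorial := by
    rw [← h8]
    refine h5.trans ?_
    have := mul_le_mul_of_nonneg_left h7 (mul_nonneg hε hg0.le)
    calc ε * ((Kn n (q+1)).card:ℝ) ^ N * ((Kn n (q+1)).card - N).factorial = ε * ((Kn n (q+1)).card - N).factorial * (Kn n (q+1)).card ^ N := by ring
      _ ≤ _ := this
      _ = _ := by ring
  have h10 := card_filter_add_card_filter_not (s := (univ : Finset (Fin (Kn n (q+1)).card ≃ {A // A ∈ Kn n (q+1)}))) F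
  rw [card_univ, hEc] at h10
  have h11 : ((univ.filter F).card : ℝ) + bσ.card = (Kn n (q+1)).card.factorial := by rw [hbσ]; exact_mod_cast h10
  rw [hEc, le_div_iff₀ hE0]
  nlinarith

end tr
end Sham

namespace Sham

section num
variable {n q : ℕ}

lemma hCL_lemma (hn2 : 2 ≤ n) (hX : (n:ℝ)^(q+1) / 2 ≤ Fintype.card (Fin (q+1) ↪ Fin n)) (v : Fin n) (B : Finset (Fin n)) (hv : v ∉ B)
    (hB : 4 * ((q:ℝ)+1)^2 * B.card ≤ n) [DecidablePred (fun x : Fin (q+1) ↪ Fin n => x 0 = v ∧ Disjoint (ed x) B)] :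
    (n:ℝ)^q / 4 ≤ ((univ.filter (fun x : Fin (q+1) ↪ Fin n => x 0 = v ∧ Disjoint (ed x) B)).card : ℝ) := by
  classical
  have hn : (0:ℝ) < n := by exact_mod_cast v.pos
  have h1 : (univ.filter (fun x : Fin (q+1) ↪ Fin n => x 0 = v)) ⊆
      (univ.filter (fun x : Fin (q+1) ↪ Fin n => x 0 = v ∧ Disjoint (ed x) B)) ∪
      B.biUnion (fun b => univ.filter (fun x : Fin (q+1) ↪ Fin n => v ∈ ed x ∧ b ∈ ed x)) := by
    intro x hx
    have hx0 := (mem_filter.1 hx).2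
    by_cases hd : Disjoint (ed x) B
    · exact mem_union_left _ (mem_filter.2 ⟨mem_univ _, hx0, hd⟩)
    · refine mem_union_right _ ?_
      obtain ⟨b, hb1, hb2⟩ := not_disjoint_iff.1 hd
      refine mem_biUnion.2 ⟨b, hb2, mem_filter.2 ⟨mem_univ _, ?_, hb1⟩⟩
      rw [← hx0]; simp [ed]
  have h2 := (card_le_card h1).trans (card_union_le _ _)
  have h3 : ((B.biUnion (fun b => univ.filter (fun x : Fin (q+1) ↪ Fin n => v ∈ ed x ∧ b ∈ ed x))).card : ℝ) ≤ B.card * ((2 * (q+1)^2 / n ^ 2 : ℝ) * Fintype.card (Fin (q+1) ↪ Fin n)) := by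
    have : ((B.biUnion (fun b => univ.filter (fun x : Fin (q+1) ↪ Fin n => v ∈ ed x ∧ b ∈ ed x))).card : ℝ) ≤ ∑ b ∈ B, ((univ.filter (fun x : Fin (q+1) ↪ Fin n => v ∈ ed x ∧ b ∈ ed x)).card : ℝ) := by
      exact_mod_cast card_biUnion_le
    refine this.trans ((sum_le_card_nsmul _ _ _ fun b hb => ?_).trans (le_of_eq (nsmul_eq_mul _ _)))
    exact p_mem2 (fun h => hv (h ▸ hb)) hn2
  have h4 := p_owner (q := q) v
  have h5 : ((univ.filter (fun x : Fin (q+1) ↪ Fin n => x 0 = v)).card : ℝ) ≤ ((univ.filter (fun x : Fin (q+1) ↪ Fin n => x 0 = v ∧ Disjoint (ed x) B)).card : ℝ) + ((B.biUnion (fun b => univ.filter (fun x : Fin (q+1) ↪ Fin n => v ∈ ed x ∧ b ∈ ed x))).card : ℝ) := by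
    exact_mod_cast h2
  have hX0 : (0:ℝ) ≤ Fintype.card (Fin (q+1) ↪ Fin n) := Nat.cast_nonneg _
  generalize (Fintype.card (Fin (q+1) ↪ Fin n) : ℝ) = X at *
  have h6 : B.card * ((2 * (q+1)^2 / n ^ 2 : ℝ) * X) ≤ X / (2 * n) := by
    have : B.card * ((2 * (q+1)^2 / n ^ 2 : ℝ) * X) = (4 * ((q:ℝ)+1)^2 * B.card) * (X / (2 * n^2)) := by field_simp; ring
    rw [this]
    refine (mul_le_mul_of_nonneg_right hB (by positivity)).trans (le_of_eq ?_)
    field_simp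
  have h7 : (n:ℝ)^q/4 ≤ X / (2 * n) := by
    rw [le_div_iff₀ (by positivity)]
    rw [pow_succ] at hX
    linarith
  have h8 : 1 / (n:ℝ) * X = X / (2*n) + X / (2*n) := by field_simp; norm_num
  linarith

lemma phi_lower {a Λ : ℝ} {J ex σ : ℕ} (ha : 0 < a) (hΛ : 1 ≤ Λ) {W : Finset (Fin n)} (hW : W.card = J * (q+1)) (hJ : 1 ≤ J)
    (hn : q + 1 ≤ n) (hex : ex ≤ q * σ) (hWn : (n:ℝ) ≤ (q+1) * J + (q+2) * σ) :
    0 < phi q (a / n.descFactorial (q+1)) Λ W ex ∧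
    J * (Real.log (a / J) - q) - ((q+2) * σ + 1 + Real.log n + q * σ * Real.log Λ) ≤ Real.log (phi q (a / n.descFactorial (q+1)) Λ W ex) := by
  have hn0 : (0:ℝ) < n := by exact_mod_cast (by omega : 0 < n)
  have hJ0 : (0:ℝ) < J := by exact_mod_cast hJ
  have hD0 : (0:ℝ) < n.descFactorial (q+1) := by exact_mod_cast Nat.descFactorial_pos.2 hn
  have hΛ0 : 0 < Λ := by linarith
  have hdiv : W.card / (q+1) = J := by rw [hW]; exact Nat.mul_div_cancel _ (by omega)
  have hf1 : (0:ℝ) < ((q+1)*J).factorial := by exact_mod_cast Nat.factorial_pos _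
  have hf2 : (0:ℝ) < J.factorial := by exact_mod_cast Nat.factorial_pos _
  have hJn : J ≤ n := by
    have : W.card ≤ n := by simpa using card_le_univ W
    rw [hW] at this
    nlinarith
  unfold phi
  rw [hdiv]
  have hc0 : 0 < a / (n.descFactorial (q+1) : ℝ) := div_pos ha hD0
  refine ⟨by positivity, ?_⟩
  have hcJ : 0 < (a / (n.descFactorial (q+1) : ℝ)) ^ J := pow_pos hc0 _
  rw [Real.log_div (div_pos (mul_pos hcJ hf1) hf2).ne' (pow_pos hΛ0 _).ne', Real.log_div (mul_pos hcJ hf1).ne' hf2.ne', Real.log_mul hcJ.ne' hf1.ne', Real.log_pow, Real.log_pow, Real.log_div ha.ne' hD0.ne', Real.log_div ha.ne' hJ0.ne']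
  have g1 := log_fact_ge ((q+1)*J)
  have g2 := log_fact_le hJ
  have g3 : Real.log (n.descFactorial (q+1)) ≤ (q+1) * Real.log n := by
    have : Real.log (n.descFactorial (q+1)) ≤ Real.log ((n:ℝ)^(q+1)) := Real.log_le_log hD0 (by exact_mod_cast Nat.descFactorial_le_pow n (q+1))
    rw [Real.log_pow] at this
    push_cast at this; exact this
  have g4 : Real.log J ≤ Real.log n := Real.log_le_log hJ0 (by exact_mod_cast hJn)
  have g5 : (ex:ℝ) * Real.log Λ ≤ q * σ * Real.log Λ := by
    refine mul_le_mul_of_nonneg_right ?_ (Real.log_nonneg hΛ)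
    exact_mod_cast hex
  have hq0 : (0:ℝ) < (q:ℝ)+1 := by positivity
  have g6 : ((q:ℝ)+1) * J - n ≤ (q+1) * J * (Real.log ((q+1) * J) - Real.log n) := by
    have hx : 0 < ((q:ℝ)+1) * J / n := by positivity
    have := Real.one_sub_inv_le_log_of_pos hx
    rw [Real.log_div (by positivity) hn0.ne'] at this
    have h2 := mul_le_mul_of_nonneg_left this (by positivity : 0 ≤ ((q:ℝ)+1) * J)
    refine le_trans (le_of_eq ?_) h2
    field_simp
  push_cast at g1
  have g7 := mul_le_mul_of_nonneg_left g3 hJ0.le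
  have g8 : (J:ℝ) * (Real.log a - Real.log (n.descFactorial (q+1))) ≥ J * Real.log a - J * ((q+1) * Real.log n) := by linarith [mul_sub (J:ℝ) (Real.log a) (Real.log (n.descFactorial (q+1)))]
  nlinarith

/-- the function `J (log (a/J) - q)` is increasing -/
lemma f_mono {a J ν b : ℝ} (ha : 0 < a) (hν : 0 < ν) (hνJ : ν ≤ J) (hb : b + 1 ≤ Real.log (a / J)) :
    ν * (Real.log (a / ν) - b) ≤ J * (Real.log (a / J) - b) := by
  have hJ : 0 < J := by linarith
  rw [Real.log_div ha.ne' hν.ne']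
  rw [Real.log_div ha.ne' hJ.ne'] at hb ⊢
  have h1 := Real.log_le_sub_one_of_pos (div_pos hJ hν)
  rw [Real.log_div hJ.ne' hν.ne'] at h1
  have h2 := mul_le_mul_of_nonneg_left h1 hν.le
  have h3 : ν * (J / ν - 1) = J - ν := by field_simp
  rw [h3] at h2
  nlinarith

lemma hLL_num {β Λ δ'' ε₁ D₀ φ : ℝ} {m σ τ₀ τ ν J ν₀ : ℕ}
    (hUb : ∀ ν : ℕ, ν₀ ≤ ν → ∀ A : ℝ, D₀ * ν ≤ A → Ub (q + 1) A ν ≤ Real.exp (ν * (Real.log (A / ν) - q + ε₁)))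
    (hδ0 : 0 < δ'') (hδ1 : δ'' ≤ 1) (hD₀ : 0 < D₀) (hn0 : (0:ℝ) < n)
    (hD : D₀ * n ≤ τ₀ / 2) (hlog : (q:ℝ) + 1 ≤ Real.log ((1 - β) * τ₀ / n))
    (hgap : δ'' / 8 ≤ Real.log ((1 - β) * τ₀) - Real.log ((1 - δ''/4) * m) - ε₁)
    (herr : (q+2) * σ + 1 + Real.log n + q * σ * Real.log Λ + m / Λ < δ'' / 8 * (n / (2 * (q+1))))
    (ha : 0 < (1 - β) * (τ₀:ℝ)) (hpos : 0 < φ)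
    (hlow : J * (Real.log ((1 - β) * τ₀ / J) - q) - ((q+2) * σ + 1 + Real.log n + q * σ * Real.log Λ) ≤ Real.log φ)
    (hνν : ν₀ ≤ ν) (hνJ : ν ≤ J) (hν0 : (0:ℝ) < ν) (hΛ0 : 0 < Λ) (hνbig : (n:ℝ) / (2 * (q+1)) ≤ ν) (hνn : (ν:ℝ) ≤ n)
    (hτ1 : (τ₀:ℝ) ≤ τ + 1) (hτm' : (τ:ℝ) + 1 ≤ m) (hJ1 : 1 ≤ J) (hJn : (J:ℝ) ≤ n) :
    Ub (q+1) ((τ:ℝ) + 1 - δ'' / 2 * (τ + 1) / 2) ν < φ * Real.exp (-(((τ:ℝ)+1) * (φ / Λ) / φ)) := by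
  have hA : (τ:ℝ) + 1 - δ'' / 2 * (τ + 1) / 2 = (1 - δ''/4) * (τ + 1) := by ring
  rw [hA]
  have hd4 : 0 < 1 - δ''/4 := by linarith
  have hApos : 0 < (1 - δ''/4) * ((τ:ℝ) + 1) := by positivity
  have hU := hUb ν hνν ((1 - δ''/4) * (τ + 1)) (by
    have : D₀ * ν ≤ D₀ * n := mul_le_mul_of_nonneg_left hνn hD₀.le
    nlinarith)
  refine lt_of_le_of_lt hU ?_
  have hrw : φ * Real.exp (-(((τ:ℝ)+1) * (φ / Λ) / φ)) = Real.exp (Real.log φ - (τ+1)/Λ) := by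
    rw [sub_eq_add_neg, Real.exp_add, Real.exp_log hpos]
    congr 3
    field_simp
  rw [hrw, Real.exp_lt_exp]
  have hm0 : (0:ℝ) < m := by
    have : (0:ℝ) ≤ τ := Nat.cast_nonneg _
    linarith
  have g1 : ((τ:ℝ)+1)/Λ ≤ m / Λ := div_le_div_of_nonneg_right hτm' hΛ0.le
  have hJ0 : (0:ℝ) < J := by exact_mod_cast hJ1
  have g2 := f_mono (b := q) ha hν0 (by exact_mod_cast hνJ : (ν:ℝ) ≤ J) (by
    refine hlog.trans (Real.log_le_log (by positivity) ?_)
    exact div_le_div_of_nonneg_left ha.le hJ0 hJn)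
  have g3 : Real.log ((1 - δ''/4) * ((τ:ℝ) + 1)) ≤ Real.log ((1 - δ''/4) * m) := Real.log_le_log hApos (mul_le_mul_of_nonneg_left hτm' hd4.le)
  rw [Real.log_div ha.ne' hν0.ne'] at g2
  rw [Real.log_div hApos.ne' hν0.ne']
  have g4 : δ''/8 * (n / (2 * (q+1))) ≤ ν * (δ''/8) := by
    rw [mul_comm]; exact mul_le_mul_of_nonneg_right hνbig (by positivity)
  have g5 : ν * (δ''/8) ≤ ν * (Real.log ((1 - β) * τ₀) - Real.log ((1 - δ''/4) * (τ+1)) - ε₁) := mul_le_mul_of_nonneg_left (by linarith) hν0.le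
  nlinarith

set_option maxHeartbeats 1000000 in
theorem hLL_lemma {β Λ δ'' ε₁ D₀ : ℝ} {m σ τ₀ nmin ν₀ : ℕ} (hq : 1 ≤ q) (hn : q + 1 ≤ n)
    (hUb : ∀ ν : ℕ, ν₀ ≤ ν → ∀ A : ℝ, D₀ * ν ≤ A → Ub (q + 1) A ν ≤ Real.exp (ν * (Real.log (A / ν) - q + ε₁)))
    (hβ1 : β < 1) (hΛ : 1 ≤ Λ) (hδ0 : 0 < δ'') (hδ1 : δ'' ≤ 1) (hD₀ : 0 < D₀) (hτ0 : 0 < τ₀)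
    (hnmin : (n:ℝ) ≤ nmin + σ)
    (hbig : (q+1) * (ν₀ + 1) + ((q+1)*q) * (2*σ+1) + (q+1)*σ + σ ≤ n)
    (hbig2 : n ≤ 2 * (n - ((q+1)*q) * (2*σ+1) - (q+1)*σ - σ : ℝ))
    (hD : D₀ * n ≤ τ₀ / 2)
    (hlog : (q:ℝ) + 1 ≤ Real.log ((1 - β) * τ₀ / n))
    (hgap : δ'' / 8 ≤ Real.log ((1 - β) * τ₀) - Real.log ((1 - δ''/4) * m) - ε₁)
    (herr : (q+2) * σ + 1 + Real.log n + q * σ * Real.log Λ + m / Λ < δ'' / 8 * (n / (2 * (q+1)))) :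
    ∀ W₀ : Finset (Fin n), (nmin ≤ W₀.card + (q+1)*σ ∧ (q+1) ∣ W₀.card) → ∀ W ⊆ W₀, W₀.card ≤ W.card + ((q+1)*q) * (2*σ + 1) → ∀ ex < q*σ, ∀ τ, τ₀ ≤ τ → τ < m →
      ∀ G : Finset (Finset (Fin n)), (∀ e ∈ G, e.card = q+1) → QR G → G.card ≤ τ + 1 →
        phi q ((1 - β) * (τ₀ / n.descFactorial (q+1))) Λ W₀ ex ≤ (PM G W).card →
      ∀ [DecidablePred (Light G W (phi q ((1 - β) * (τ₀ / n.descFactorial (q+1))) Λ W₀ (ex + 1)))],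
      ((G.filter (Light G W (phi q ((1 - β) * (τ₀ / n.descFactorial (q+1))) Λ W₀ (ex + 1)))).card : ℝ) ≤ δ'' / 2 * (τ + 1) := by
  rintro W₀ ⟨hW₀, J, hJ'⟩ W hWW hWc ex hex τ hτ hτm G hG hQ hGc hφ _
  have hJ : W₀.card = J * (q+1) := by rw [hJ', mul_comm]
  have hn0 : (0:ℝ) < n := by exact_mod_cast (by omega : 0 < n)
  have hnmin' : n ≤ nmin + σ := by exact_mod_cast hnmin
  have hWcard : (q+1) * (ν₀ + 1) ≤ W.card := by
    omega
  have hJ1 : 1 ≤ J := by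
    have := card_le_card hWW
    rw [hJ] at this
    by_contra h
    have : J = 0 := by omega
    subst this
    have : 0 < (q+1) * (ν₀+1) := by positivity
    omega
  have hW₀n : (q+1) * J ≤ n := by
    have : W₀.card ≤ n := by simpa using card_le_univ W₀
    rw [hJ] at this
    linarith
  have ha : 0 < (1 - β) * (τ₀:ℝ) := mul_pos (by linarith) (by exact_mod_cast hτ0)
  have hWn : (n:ℝ) ≤ (q+1) * J + (q+2) * σ := by
    have : n ≤ J * (q+1) + (q+1)*σ + σ := by rw [← hJ]; omega
    have h' : (n:ℝ) ≤ J * (q+1) + (q+1)*σ + σ := by exact_mod_cast this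
    linarith
  rw [← mul_div_assoc] at hφ
  obtain ⟨hpos, hlow⟩ := phi_lower (n := n) (q := q) (ex := ex) ha hΛ hJ hJ1 hn hex.le hWn
  have hPM : 0 < (PM G W).card := by
    have : (0:ℝ) < (PM G W).card := lt_of_lt_of_le hpos hφ
    exact_mod_cast this
  obtain ⟨M, hM⟩ := card_pos.1 hPM
  have hν := (PM_card hG hM).symm
  set ν := M.card with hνdef
  have hνν : ν₀ ≤ ν := by
    rw [hν] at hWcard
    have : ν₀ + 1 ≤ ν := Nat.le_of_mul_le_mul_left (by rw [mul_comm _ ν]; exact hWcard) (Nat.succ_pos q)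
    omega
  have hν1 : 1 ≤ ν := by
    rw [hν] at hWcard
    have : ν₀ + 1 ≤ ν := Nat.le_of_mul_le_mul_left (by rw [mul_comm _ ν]; exact hWcard) (Nat.succ_pos q)
    omega
  have hνJ : ν ≤ J := by
    have := card_le_card hWW
    rw [hJ, hν] at this
    exact Nat.le_of_mul_le_mul_right this (by omega)
  have hν0 : (0:ℝ) < ν := by exact_mod_cast hν1
  have hΛ0 : 0 < Λ := by linarith
  have hθ : phi q ((1 - β) * (τ₀:ℝ) / n.descFactorial (q+1)) Λ W₀ (ex + 1) = phi q ((1 - β) * (τ₀:ℝ) / n.descFactorial (q+1)) Λ W₀ ex / Λ := by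
    unfold phi; rw [pow_succ, div_mul_eq_div_div]
  have hνbig : (n:ℝ) / (2 * (q+1)) ≤ ν := by
    have h1 : n ≤ ν * (q+1) + ((q+1)*q) * (2*σ+1) + (q+1)*σ + σ := by rw [← hν]; omega
    have h2 : (n:ℝ) ≤ ν * (q+1) + ((q+1)*q) * (2*σ+1) + (q+1)*σ + σ := by exact_mod_cast h1
    rw [div_le_iff₀ (by positivity)]
    linarith
  have hνn : (ν:ℝ) ≤ n := by
    have : ν ≤ n := hνJ.trans (le_trans (Nat.le_mul_of_pos_left _ (Nat.succ_pos q)) hW₀n)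
    exact_mod_cast this
  have hτ1 : (τ₀:ℝ) ≤ τ + 1 := by exact_mod_cast (by omega : τ₀ ≤ τ + 1)
  have hτm' : (τ:ℝ) + 1 ≤ m := by exact_mod_cast hτm
  have hτ0' : (0:ℝ) < τ₀ := by exact_mod_cast hτ0
  have hφe := hφ
  have key := light_few (G := G) (r := q+1) (by omega) hG hQ hν (t := (τ:ℝ)+1) (lam := δ''/2 * (τ+1)) (φ := phi q ((1 - β) * (τ₀:ℝ) / n.descFactorial (q+1)) Λ W₀ ex)
    (θ := phi q ((1 - β) * (τ₀:ℝ) / n.descFactorial (q+1)) Λ W₀ (ex+1)) (by exact_mod_cast hGc) hpos (by rw [hθ]; positivity) hφ ?_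
  · classical
    refine le_trans ?_ key.le
    refine Nat.cast_le.2 (card_le_card fun x hx => ?_)
    rw [mem_filter] at hx ⊢
    exact ⟨hx.1, by rw [mul_div_assoc]; exact hx.2⟩
  rw [hθ]
  have hJn : (J:ℝ) ≤ n := by
    have : J ≤ n := le_trans (Nat.le_mul_of_pos_left _ (Nat.succ_pos q)) hW₀n
    exact_mod_cast this
  exact hLL_num hUb hδ0 hδ1 hD₀ hn0 hD hlog hgap herr ha hpos hlow hνν hνJ hν0 hΛ0 hνbig hνn hτ1 hτm' hJ1 hJn

theorem hfin_lemma {β Λ δ κ y : ℝ} {σ τ₀ nmin : ℕ} (hn : q + 1 ≤ n) (hqn : (q+1) ∣ n)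
    (hβ1 : β < 1) (hΛ : 1 ≤ Λ) (hτ0 : 0 < τ₀) (hy : 0 < y) (hly : (q:ℝ) ≤ Real.log y)
    (hnmin : (n:ℝ) ≤ nmin + σ) (hbig : (q+1)*σ + σ < n)
    (hκ : Real.log y - κ ≤ Real.log ((1 - β) * τ₀ * (q+1) / n)) (hκ0 : 0 ≤ κ)
    (herr : (q+2) * σ * Real.log y + κ * n + ((q+2) * σ + 1 + Real.log n + q * σ * Real.log Λ) ≤ δ / 2 * n) :
    ∀ W₀ : Finset (Fin n), nmin ≤ W₀.card + (q+1)*σ → (q+1) ∣ W₀.card →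
      (Real.exp (-(q:ℝ)) * y) ^ (n / (q+1)) * Real.exp (-(δ/2*n)) ≤ phi q ((1 - β) * (τ₀ / n.descFactorial (q+1))) Λ W₀ (q * σ) := by
  rintro W₀ hW₀ ⟨J, hJ'⟩
  have hJ : W₀.card = J * (q+1) := by rw [hJ', mul_comm]
  have hn0 : (0:ℝ) < n := by exact_mod_cast (by omega : 0 < n)
  have hnmin' : n ≤ nmin + σ := by exact_mod_cast hnmin
  have hJ1 : 1 ≤ J := by
    by_contra h
    have : J = 0 := by omega
    subst this
    omega
  have ha : 0 < (1 - β) * (τ₀:ℝ) := mul_pos (by linarith) (by exact_mod_cast hτ0)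
  have hWn : (n:ℝ) ≤ (q+1) * J + (q+2) * σ := by
    have : n ≤ J * (q+1) + (q+1)*σ + σ := by rw [← hJ]; omega
    have h' : (n:ℝ) ≤ J * (q+1) + (q+1)*σ + σ := by exact_mod_cast this
    linarith
  rw [← mul_div_assoc]
  obtain ⟨hpos, hlow⟩ := phi_lower (n := n) (q := q) (ex := q * σ) ha hΛ hJ hJ1 hn le_rfl hWn
  have hJ0 : (0:ℝ) < J := by exact_mod_cast hJ1
  rw [← Real.exp_log hpos]
  obtain ⟨I, hI⟩ := hqn
  have hdiv : n / (q+1) = I := by rw [hI]; exact Nat.mul_div_cancel_left _ (by omega)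
  rw [hdiv, mul_pow, ← Real.exp_nat_mul, ← Real.exp_log (pow_pos hy I), ← Real.exp_add, ← Real.exp_add, Real.exp_le_exp, Real.log_pow]
  refine le_trans ?_ hlow
  have hIn : (n:ℝ) = (q+1) * I := by exact_mod_cast hI
  have hW₀n : (q+1) * J ≤ (q+1) * I := by
    have : W₀.card ≤ n := by simpa using card_le_univ W₀
    rw [hJ, hI] at this
    linarith
  have hJI : (J:ℝ) ≤ I := by exact_mod_cast Nat.le_of_mul_le_mul_left hW₀n (by omega)
  have g1 : Real.log y - κ ≤ Real.log ((1 - β) * τ₀ / J) := by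
    refine hκ.trans (Real.log_le_log (by positivity) ?_)
    rw [hIn, div_le_div_iff₀ (by rw [← hIn]; exact hn0) hJ0]
    have : (1 - β) * (τ₀:ℝ) * J ≤ (1 - β) * (τ₀:ℝ) * I := mul_le_mul_of_nonneg_left hJI ha.le
    nlinarith [(Nat.cast_nonneg q : (0:ℝ) ≤ q)]
  have g2 : (J:ℝ) * (Real.log y - κ - q) ≤ J * (Real.log ((1 - β) * τ₀ / J) - q) := mul_le_mul_of_nonneg_left (by linarith) hJ0.le
  have hσ0 : (0:ℝ) ≤ σ := Nat.cast_nonneg _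
  have hq0 : (0:ℝ) ≤ q := Nat.cast_nonneg _
  have hI0 : (0:ℝ) ≤ I := Nat.cast_nonneg _
  have g3 : (I:ℝ) - J ≤ (q+2) * σ := by
    have : ((q:ℝ)+1) * (I - J) ≤ (q+2)*σ := by rw [hIn] at hWn; linarith
    nlinarith [mul_nonneg hq0 (sub_nonneg.2 hJI)]
  have g4 : ((I:ℝ) - J) * (Real.log y - q) ≤ (q+2) * σ * Real.log y := by
    refine mul_le_mul g3 (by linarith) (by linarith) (by positivity)
  have g5 : (J:ℝ) * κ ≤ κ * n := by
    rw [mul_comm]; refine mul_le_mul_of_nonneg_left ?_ hκ0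
    rw [hIn]; nlinarith
  nlinarith

end num
end Sham

namespace Sham

section num2
open Filter Topology

lemma ev_nat {P : ℝ → Prop} (h : ∀ᶠ y in atTop, P y) : ∀ᶠ n : ℕ in atTop, P (Real.log n) :=
  (Real.tendsto_log_atTop.comp tendsto_natCast_atTop_atTop).eventually h

lemma ev_poly (K : ℝ) (p : ℕ) {a ε : ℝ} (ha : 0 < a) (hε : 0 < ε) : ∀ᶠ y : ℝ in atTop, K * y ^ p * Real.exp (-(a * y)) ≤ ε := by
  have h1 := tendsto_rpow_mul_exp_neg_mul_atTop_nhds_zero (p : ℝ) a ha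
  have h2 := (h1.const_mul K)
  rw [mul_zero] at h2
  filter_upwards [h2.eventually_le_const hε] with y hy
  simp only [Real.rpow_natCast, neg_mul] at hy
  linarith

variable {q n : ℕ}

lemma exp_logn (hn : 0 < n) : Real.exp (Real.log n) = n := Real.exp_log (by exact_mod_cast hn)

lemma num_e1 {N : ℕ} {y ε : ℝ} (hn : (n:ℝ) = Real.exp y) (hN : 3 * y * n ≤ (q+1) * N) (h : 1 * y ^ 0 * Real.exp (-(1/2 * y)) ≤ ε) :
    n * Real.exp (-(1/2 * ((q+1) / n * N))) ≤ ε := by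
  have hn0 : (0:ℝ) < n := by rw [hn]; exact Real.exp_pos _
  have h1 : 3 * y ≤ (q+1 : ℝ) / n * N := by rw [div_mul_eq_mul_div, le_div_iff₀ hn0]; exact hN
  refine le_trans ?_ h
  rw [pow_zero, one_mul, one_mul]
  nth_rewrite 1 [hn]
  rw [← Real.exp_add, Real.exp_le_exp]
  linarith

lemma num_e2 {t1 : ℕ} {y ε η : ℝ} (hn : (n:ℝ) = Real.exp y) (hy : 0 ≤ y) (hη : 0 < η) (hη1 : η ≤ 1) (ht : (q+1) * t1 ≤ (1 - η) * (n * y))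
    (hx : ((q:ℝ)+1) / n ≤ η / 2) (h : 1 * y ^ 0 * Real.exp (-(η/2 * y)) ≤ ε) :
    1 / (n * (1 - (q+1) / n : ℝ) ^ t1) ≤ ε := by
  have hn0 : (0:ℝ) < n := by rw [hn]; exact Real.exp_pos _
  refine le_trans ?_ h
  rw [pow_zero, one_mul, one_mul, Real.exp_neg, ← one_div]
  refine one_div_le_one_div_of_le (Real.exp_pos _) ?_
  set x := ((q:ℝ)+1) / n with hxd
  have hx0 : 0 ≤ x := by positivity
  have h1x : 0 < 1 - x := by linarith
  have h1 := Real.one_sub_inv_le_log_of_pos h1x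
  have h2 : Real.exp (-(1 - η/2) * y) ≤ (1 - x) ^ t1 := by
    rw [← Real.exp_log (pow_pos h1x t1), Real.exp_le_exp, Real.log_pow]
    have h3 : x * t1 ≤ (1 - η) * y := by
      rw [hxd, div_mul_eq_mul_div, div_le_iff₀ hn0]; linarith
    have h4 : x * t1 * (1 - x)⁻¹ ≤ (1 - η/2) * y := by
      rw [← div_eq_mul_inv, div_le_iff₀ h1x]
      have : (1 - η) ≤ (1 - η/2) * (1 - x) := by nlinarith
      nlinarith [mul_le_mul_of_nonneg_right this hy]
    have h5 : 1 - (1 - x)⁻¹ = - (x * (1-x)⁻¹) := by field_simp; ring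
    rw [h5] at h1
    have h6 := mul_le_mul_of_nonneg_left h1 (Nat.cast_nonneg t1 : (0:ℝ) ≤ t1)
    linarith [h6, (by ring : (t1:ℝ) * -(x * (1 - x)⁻¹) = -(x * t1 * (1-x)⁻¹))]
  calc Real.exp (η/2 * y) = Real.exp y * Real.exp (-(1 - η/2) * y) := by rw [← Real.exp_add]; congr 1; ring
    _ ≤ _ := by rw [← hn]; exact mul_le_mul_of_nonneg_left h2 hn0.le

lemma two_pow_le_exp (k : ℕ) : (2:ℝ) ^ k ≤ Real.exp k := by
  have : (2:ℝ) ≤ Real.exp 1 := by linarith [Real.add_one_le_exp (1:ℝ)]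
  calc (2:ℝ)^k ≤ (Real.exp 1)^k := pow_le_pow_left₀ (by norm_num) this k
    _ = _ := by rw [← Real.exp_nat_mul, mul_one]

lemma num_e3 {t1 m k₁ S b₀ : ℕ} {y ε α c : ℝ} (hn : (n:ℝ) = Real.exp y) (hc : α = 8 * (q+1) * c)
    (ht : α * (n * y) ≤ (q+1) * (t1 - m : ℝ)) (hk₁ : (k₁:ℝ) ≤ c * y) (hb : Real.exp ((1 - c) * y) ≤ b₀)
    (h : 2 ^ (S+1) * y ^ 0 * Real.exp (-(2 * c * y)) ≤ ε) :
    n * (2 ^ (k₁ + (S+1)) * Real.exp (-(1/2 * (1 / n * (t1 - m : ℝ))))) / b₀ ≤ ε := by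
  have hn0 : (0:ℝ) < n := by rw [hn]; exact Real.exp_pos _
  have hb0 : (0:ℝ) < b₀ := lt_of_lt_of_le (Real.exp_pos _) hb
  refine le_trans ?_ h
  rw [div_le_iff₀ hb0, pow_zero, mul_one]
  have h1 : 8 * c * y ≤ 1 / n * (t1 - m : ℝ) := by
    rw [div_mul_eq_mul_div, one_mul, le_div_iff₀ hn0]
    have hq : (0:ℝ) < q + 1 := by positivity
    have : (q+1) * (8 * c * y * n) ≤ (q+1) * (t1 - m : ℝ) := by rw [hc] at ht; linarith
    exact le_of_mul_le_mul_left this hq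
  have h2 := two_pow_le_exp k₁
  calc n * ((2:ℝ) ^ (k₁ + (S+1)) * Real.exp (-(1/2 * (1 / n * (t1 - m : ℝ)))))
      ≤ Real.exp y * ((Real.exp (c * y) * 2^(S+1)) * Real.exp (-(4 * c * y))) := by
        rw [← hn, pow_add]
        refine mul_le_mul_of_nonneg_left (mul_le_mul (mul_le_mul_of_nonneg_right (h2.trans (Real.exp_le_exp.2 hk₁)) (by positivity)) (Real.exp_le_exp.2 (by linarith)) (Real.exp_pos _).le (by positivity)) hn0.le
    _ = 2^(S+1) * Real.exp (-(2*c*y)) * Real.exp ((1-c)*y) := by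
        have : Real.exp y * Real.exp (c * y) * Real.exp (-(4*c*y)) = Real.exp (-(2*c*y)) * Real.exp ((1-c)*y) := by
          rw [← Real.exp_add, ← Real.exp_add, ← Real.exp_add]; congr 1; ring
        linear_combination 2^(S+1) * this
    _ ≤ _ := mul_le_mul_of_nonneg_left hb (by positivity)

lemma num_e4 {N Δ : ℕ} {y ε : ℝ} (hn : (n:ℝ) = Real.exp y) (hy : 1 ≤ y) (hN : (q+1) * N ≤ 4 * y * n) (hN0 : 0 < N) (hΔ : 40 * y ≤ Δ)
    (h : 1 * y ^ 0 * Real.exp (-(1 * y)) ≤ ε) :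
    n * ((N * ((q+1) / n)) ^ Δ / Δ.factorial) ≤ ε := by
  have hn0 : (0:ℝ) < n := by rw [hn]; exact Real.exp_pos _
  have hN0' : (0:ℝ) < N := by exact_mod_cast hN0
  refine le_trans ?_ h
  rw [pow_zero, one_mul, one_mul, one_mul]
  have hx : (N:ℝ) * ((q+1) / n) ≤ 4 * y := by
    rw [← mul_div_assoc, div_le_iff₀ hn0]; linarith
  have hx0 : 0 < (N:ℝ) * ((q+1) / n) := by positivity
  have hΔ0 : (0:ℝ) < Δ := by linarith
  have hf : (0:ℝ) < Δ.factorial := by exact_mod_cast Nat.factorial_pos _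
  generalize (N:ℝ) * ((q+1) / n) = x at *
  have h1 : x ^ Δ / Δ.factorial ≤ Real.exp (-Δ) := by
    rw [← Real.exp_log (div_pos (pow_pos hx0 Δ) hf), Real.exp_le_exp, Real.log_div (pow_pos hx0 _).ne' hf.ne', Real.log_pow]
    have g1 := log_fact_ge Δ
    have g2 : Real.log x ≤ Real.log Δ - 2 := by
      have : x ≤ Δ / Real.exp 2 := by
        rw [le_div_iff₀ (Real.exp_pos _)]
        have he : Real.exp 2 ≤ 10 := by
          have : Real.exp 2 = Real.exp 1 * Real.exp 1 := by rw [← Real.exp_add]; norm_num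
          rw [this]
          have := Real.exp_one_lt_d9
          nlinarith [Real.exp_pos 1]
        nlinarith
      have := Real.log_le_log hx0 this
      rwa [Real.log_div hΔ0.ne' (Real.exp_pos _).ne', Real.log_exp] at this
    nlinarith [mul_le_mul_of_nonneg_left g2 hΔ0.le]
  calc n * (x ^ Δ / Δ.factorial) ≤ Real.exp y * Real.exp (-Δ) := by rw [← hn]; exact mul_le_mul_of_nonneg_left h1 hn0.le
    _ ≤ _ := by rw [← Real.exp_add, Real.exp_le_exp]; linarith

lemma num_base {N Δ b₀ : ℕ} {y c : ℝ} (hn : (n:ℝ) = Real.exp y) (hy : 1 ≤ y) (hN : (q+1) * N ≤ 4 * y * n) (hΔ : (Δ:ℝ) ≤ 41 * y)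
    (hb : (b₀:ℝ) ≤ 2 * Real.exp ((1 - c) * y))
    (h : 672 * ((q:ℝ)+1)^3 * y ^ 2 * Real.exp (-(c/2 * y)) ≤ 1) :
    N * (((b₀ + b₀ * (Δ * (q+1)) : ℕ) : ℝ) * (2 * (q+1)^2 / n ^ 2)) ≤ Real.exp (-(c/2*y)) := by
  have hn0 : (0:ℝ) < n := by rw [hn]; exact Real.exp_pos _
  have hq : (1:ℝ) ≤ q + 1 := by linarith [(Nat.cast_nonneg q : (0:ℝ) ≤ q)]
  have hN' : (N:ℝ) ≤ 4 * y * n := by nlinarith [(Nat.cast_nonneg N : (0:ℝ) ≤ N)]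
  have h1 : ((b₀ + b₀ * (Δ * (q+1)) : ℕ) : ℝ) ≤ 2 * Real.exp ((1 - c) * y) * (42 * (q+1) * y) := by
    push_cast
    have : (b₀:ℝ) + b₀ * (Δ * (q+1)) = b₀ * (1 + Δ * (q+1)) := by ring
    rw [this]
    refine mul_le_mul hb ?_ (by positivity) (by positivity)
    nlinarith
  have h2 : N * (((b₀ + b₀ * (Δ * (q+1)) : ℕ) : ℝ) * (2 * (q+1)^2 / n ^ 2)) ≤ (4 * y * n) * ((2 * Real.exp ((1 - c) * y) * (42 * (q+1) * y)) * (2 * (q+1)^2 / n ^ 2)) := by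
    refine mul_le_mul hN' (mul_le_mul_of_nonneg_right h1 (by positivity)) (by positivity) (by positivity)
  refine h2.trans ?_
  have h3 : (4 * y * n) * ((2 * Real.exp ((1 - c) * y) * (42 * (q+1) * y)) * (2 * (q+1)^2 / n ^ 2)) = 672 * ((q:ℝ)+1)^3 * y^2 * (Real.exp ((1-c)*y) / n) := by
    field_simp; ring
  rw [h3]
  have h4 : Real.exp ((1-c)*y) / n = Real.exp (-(c/2*y)) * Real.exp (-(c/2*y)) := by
    rw [hn, ← Real.exp_sub, ← Real.exp_add]; congr 1; ring
  rw [h4]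
  calc 672 * ((q:ℝ)+1)^3 * y^2 * (Real.exp (-(c/2*y)) * Real.exp (-(c/2*y))) = (672 * ((q:ℝ)+1)^3 * y^2 * Real.exp (-(c/2*y))) * Real.exp (-(c/2*y)) := by ring
    _ ≤ 1 * Real.exp (-(c/2*y)) := mul_le_mul_of_nonneg_right h (Real.exp_pos _).le
    _ = _ := one_mul _

lemma num_e5 {S : ℕ} {y c ε b : ℝ} (hn : (n:ℝ) = Real.exp y) (hy : 1 ≤ y) (hb0 : 0 ≤ b) (hb : b ≤ Real.exp (-(c/2*y))) (hS : 4 ≤ c * (S+1))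
    (h : 1 * y ^ 0 * Real.exp (-(1 * y)) ≤ ε) : n * b ^ (S+1) ≤ ε := by
  refine le_trans ?_ h
  rw [pow_zero, one_mul, one_mul, one_mul]
  have h1 : b ^ (S+1) ≤ Real.exp (-(2 * y)) := by
    refine (pow_le_pow_left₀ hb0 hb _).trans ?_
    rw [← Real.exp_nat_mul, Real.exp_le_exp]
    push_cast
    nlinarith
  calc n * b ^ (S+1) ≤ Real.exp y * Real.exp (-(2*y)) := by rw [← hn]; exact mul_le_mul_of_nonneg_left h1 (Nat.cast_nonneg _)
    _ = _ := by rw [← Real.exp_add]; congr 1; ring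

lemma num_e6 {N t1 S : ℕ} {y c ε b η : ℝ} (hn : (n:ℝ) = Real.exp y) (hy : 1 ≤ y) (hb0 : 0 ≤ b) (hb : N * b ≤ Real.exp (-(c/2*y))) (hη : 0 < η) (hη1 : η ≤ 1) (hc : c = 12 * η)
    (ht : (1 - 2 * η) * (n * y) ≤ (q+1) * (t1 - 1 : ℝ))
    (h : (1/η)^S * y ^ 0 * Real.exp (-(c/4 * y)) ≤ ε) :
    n * (N * (b * ((1 / η) ^ S * Real.exp (-((1 - η) * ((q+1) / n * (t1 - 1 : ℝ))))))) ≤ ε := by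
  have hn0 : (0:ℝ) < n := by rw [hn]; exact Real.exp_pos _
  refine le_trans ?_ h
  rw [pow_zero, mul_one]
  have h1 : (1 - 2 * η) * y ≤ (q+1) / n * (t1 - 1 : ℝ) := by
    rw [div_mul_eq_mul_div, le_div_iff₀ hn0]; linarith
  have h2 : Real.exp (-((1 - η) * ((q+1) / n * (t1 - 1 : ℝ)))) ≤ Real.exp (-((1 - 3 * η) * y)) := by
    rw [Real.exp_le_exp, neg_le_neg_iff]
    refine le_trans ?_ (mul_le_mul_of_nonneg_left h1 (by linarith : 0 ≤ 1 - η))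
    nlinarith [mul_nonneg (sq_nonneg η) (by linarith : 0 ≤ y)]
  calc n * (N * (b * ((1 / η) ^ S * Real.exp (-((1 - η) * ((q+1) / n * (t1 - 1 : ℝ)))))))
      = (N * b) * ((1/η)^S * (n * Real.exp (-((1 - η) * ((q+1) / n * (t1 - 1 : ℝ)))))) := by ring
    _ ≤ Real.exp (-(c/2*y)) * ((1/η)^S * (Real.exp y * Real.exp (-((1 - 3 * η) * y)))) := by
        rw [← hn]
        refine mul_le_mul hb (mul_le_mul_of_nonneg_left (mul_le_mul_of_nonneg_left h2 hn0.le) (by positivity)) (by positivity) (Real.exp_pos _).le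
    _ = (1/η)^S * Real.exp (-(c/4*y)) := by
        have : Real.exp (-(c/2*y)) * Real.exp y * Real.exp (-((1 - 3 * η) * y)) = Real.exp (-(c/4*y)) := by
          rw [← Real.exp_add, ← Real.exp_add]; congr 1; rw [hc]; ring
        rw [← this]; ring

lemma num_e8 {m : ℕ} {y ε : ℝ} (hn : (n:ℝ) = Real.exp y) (hm : (m:ℝ) ≤ n * y)
    (h : 8 * ((q:ℝ)+1)^6 * y ^ 3 * Real.exp (-(1 * y)) ≤ ε) :
    (n:ℝ) ^ 2 * (m * (2 * (q+1)^2 / n ^ 2 : ℝ)) ^ 3 ≤ ε := by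
  have hn0 : (0:ℝ) < n := by rw [hn]; exact Real.exp_pos _
  refine le_trans ?_ h
  rw [one_mul, Real.exp_neg, ← hn]
  have h1 : (m * (2 * (q+1)^2 / n ^ 2 : ℝ)) ≤ (n * y) * (2 * (q+1)^2 / n ^ 2 : ℝ) := mul_le_mul_of_nonneg_right hm (by positivity)
  refine (mul_le_mul_of_nonneg_left (pow_le_pow_left₀ (by positivity) h1 3) (by positivity)).trans (le_of_eq ?_)
  field_simp
  ring

end num2
end Sham

namespace Sham

section num3
variable {q n : ℕ}

lemma num_e7 {σ τ₀ : ℕ} {y u ε β : ℝ} (hn : (n:ℝ) = Real.exp y) (hqn : q + 1 ≤ n) (hσ1 : 1 ≤ σ) (hu : 1 ≤ u) (huy : u ^ (2 * (q+1)) = y)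
    (hσ : n / u ≤ (σ:ℝ)) (hτ : n * y ≤ 4 * (q+1) * (τ₀:ℝ)) (hβ : 16 * ((q:ℝ)+1) ≤ β^2 * u)
    (h : 1 * y ^ 0 * Real.exp (-(1 * y)) ≤ ε) :
    2 ^ n * Real.exp (-(β ^ 2 / 2 * (((q+1)*σ).descFactorial (q+1) / n.descFactorial (q+1) * τ₀))) ≤ ε := by
  have hn0 : (0:ℝ) < n := by rw [hn]; exact Real.exp_pos _
  have hu0 : 0 < u := by linarith
  refine le_trans ?_ h
  rw [pow_zero, one_mul, one_mul, one_mul]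
  have hD0 : (0:ℝ) < n.descFactorial (q+1) := by exact_mod_cast Nat.descFactorial_pos.2 hqn
  have h1 : (σ:ℝ) ^ (q+1) ≤ ((q+1)*σ).descFactorial (q+1) := by
    have h2 := Nat.pow_sub_le_descFactorial ((q+1)*σ) (q+1)
    have h3 : σ ≤ (q+1)*σ + 1 - (q+1) := by
      obtain ⟨s, rfl⟩ : ∃ s, σ = s + 1 := ⟨σ - 1, by omega⟩
      have : (q+1)*(s+1) + 1 - (q+1) = (q+1)*s + 1 := by
        have : (q+1)*(s+1) = (q+1)*s + (q+1) := by ring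
        omega
      rw [this]
      nlinarith [Nat.zero_le (q * s)]
    exact_mod_cast (Nat.pow_le_pow_left h3 (q+1)).trans h2
  have h2 : (n.descFactorial (q+1) : ℝ) ≤ (n:ℝ)^(q+1) := by exact_mod_cast Nat.descFactorial_le_pow n (q+1)
  have h3 : (1 / u) ^ (q+1) ≤ (((q+1)*σ).descFactorial (q+1) / n.descFactorial (q+1) : ℝ) := by
    rw [le_div_iff₀ hD0]
    calc (1/u)^(q+1) * (n.descFactorial (q+1) : ℝ) ≤ (1/u)^(q+1) * (n:ℝ)^(q+1) := mul_le_mul_of_nonneg_left h2 (by positivity)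
      _ = (n / u)^(q+1) := by rw [← mul_pow]; congr 1; field_simp
      _ ≤ (σ:ℝ)^(q+1) := pow_le_pow_left₀ (by positivity) hσ _
      _ ≤ _ := h1
  have h4 : (n:ℝ) * u ≤ 4 * (q+1) * ((((q+1)*σ).descFactorial (q+1) / n.descFactorial (q+1) : ℝ) * τ₀) := by
    have h5 : u ≤ (1/u)^(q+1) * y := by
      rw [← huy, show 2*(q+1) = (q+1)+(q+1) by ring, pow_add u (q+1) (q+1), ← mul_assoc, ← mul_pow, one_div, inv_mul_cancel₀ hu0.ne', one_pow, one_mul]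
      exact le_self_pow₀ hu (by omega)
    calc (n:ℝ) * u ≤ n * ((1/u)^(q+1) * y) := mul_le_mul_of_nonneg_left h5 hn0.le
      _ = (1/u)^(q+1) * (n * y) := by ring
      _ ≤ (1/u)^(q+1) * (4 * (q+1) * τ₀) := mul_le_mul_of_nonneg_left hτ (by positivity)
      _ ≤ _ := by
        have := mul_le_mul_of_nonneg_right h3 (by positivity : 0 ≤ 4 * ((q:ℝ)+1) * τ₀)
        linarith
  generalize ((((q+1)*σ).descFactorial (q+1) / n.descFactorial (q+1) : ℝ) * τ₀) = Z at *
  have h6 : 2 * (n:ℝ) ≤ β^2/2 * Z := by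
    have hq : (0:ℝ) < q + 1 := by positivity
    have a1 := mul_le_mul_of_nonneg_left h4 (sq_nonneg β)
    have a2 := mul_le_mul_of_nonneg_right hβ hn0.le
    have : (q+1) * (2 * (n:ℝ)) ≤ (q+1) * (β^2/2*Z) := by nlinarith
    exact le_of_mul_le_mul_left this hq
  have h7 : y ≤ n := by rw [hn]; linarith [Real.add_one_le_exp y]
  calc 2 ^ n * Real.exp (-(β^2/2*Z)) ≤ Real.exp n * Real.exp (-(2 * n)) :=
        mul_le_mul (two_pow_le_exp n) (Real.exp_le_exp.2 (by linarith)) (Real.exp_pos _).le (Real.exp_pos _).le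
    _ ≤ _ := by rw [← Real.exp_add, Real.exp_le_exp]; linarith

lemma num_e9 {σ ℓ m : ℕ} {y u ε δ' δ'' η₂ κ : ℝ} (hn : (n:ℝ) = Real.exp y) (hn2 : 2 ≤ n) (hqn : q ≤ n) (hσn : σ ≤ n) (hq : 1 ≤ q) (hy : 0 < y) (hu : 0 < u)
    (hδ' : 0 < δ') (hd : δ'' = δ' / 16)
    (hσ : (σ:ℝ) ≤ 2 * n / u) (hm : n * y ≤ 2 * (q+1) * (m:ℝ)) (hη₂ : 0 ≤ η₂) (hℓ : η₂ * m - 2 * σ * q ≤ 2 * σ * q * (ℓ:ℝ))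
    (hκ : κ = 3/16 * δ' * η₂ / (4 * q * (q+1))) (hκ0 : 0 < κ)
    (H1 : 6 ≤ κ * y) (H2 : 48 * (2 * ((q:ℝ)+1) * q + 3) ≤ κ * u) (H3 : 6 * δ' ≤ κ * u * y)
    (h : 1 * y ^ 0 * Real.exp (-(κ/2 * y)) ≤ ε) :
    2 ^ n * ((n + 1) ^ ((q+1)*q) * ((n + 1) ^ ((q+1)*q) * (q * (q*σ : ℕ))) : ℝ) ^ (2*σ) * Real.exp ((2*σ : ℕ) * ℓ * δ'' / 2 - σ * ℓ * δ' / 4) ≤ ε := by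
  have hn0 : (0:ℝ) < n := by rw [hn]; exact Real.exp_pos _
  have hn1 : (1:ℝ) ≤ n := by exact_mod_cast (by omega : 1 ≤ n)
  have hq0 : (0:ℝ) < q := by exact_mod_cast hq
  refine le_trans ?_ h
  rw [pow_zero, one_mul, one_mul]
  have hP : ((n + 1) ^ ((q+1)*q) * ((n + 1) ^ ((q+1)*q) * (q * (q*σ : ℕ))) : ℝ) ≤ Real.exp (2 * (2 * (q+1) * q + 3) * y) := by
    have h1 : (n + 1) ^ ((q+1)*q) * ((n + 1) ^ ((q+1)*q) * (q * (q*σ))) ≤ (n^2) ^ (2 * ((q+1)*q) + 3) := by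
      have a : n + 1 ≤ n ^ 2 := by nlinarith
      have b : q * (q*σ) ≤ (n+1)^3 := by
        calc q * (q * σ) ≤ (n+1) * ((n+1) * (n+1)) := Nat.mul_le_mul (by omega) (Nat.mul_le_mul (by omega) (by omega))
          _ = _ := by ring
      calc (n + 1) ^ ((q+1)*q) * ((n + 1) ^ ((q+1)*q) * (q * (q*σ))) ≤ (n + 1) ^ ((q+1)*q) * ((n + 1) ^ ((q+1)*q) * (n+1)^3) := by
            exact Nat.mul_le_mul_left _ (Nat.mul_le_mul_left _ b)
        _ = (n+1) ^ (2 * ((q+1)*q) + 3) := by ring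
        _ ≤ _ := Nat.pow_le_pow_left a _
    have h2 : ((n + 1) ^ ((q+1)*q) * ((n + 1) ^ ((q+1)*q) * (q * (q*σ : ℕ))) : ℝ) ≤ ((n:ℝ)^2) ^ (2 * ((q+1)*q) + 3) := by exact_mod_cast h1
    refine h2.trans (le_of_eq ?_)
    rw [hn, ← pow_mul, ← Real.exp_nat_mul]
    push_cast
    congr 1; ring
  have hP0 : (0:ℝ) ≤ ((n + 1) ^ ((q+1)*q) * ((n + 1) ^ ((q+1)*q) * (q * (q*σ : ℕ))) : ℝ) := by positivity
  generalize ((n + 1) ^ ((q+1)*q) * ((n + 1) ^ ((q+1)*q) * (q * (q*σ : ℕ))) : ℝ) = P at *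
  have hP2 : P ^ (2*σ) ≤ Real.exp (8 * (2 * (q+1) * q + 3) * y * (n / u)) := by
    refine (pow_le_pow_left₀ hP0 hP _).trans ?_
    rw [← Real.exp_nat_mul, Real.exp_le_exp]
    push_cast
    have : (2:ℝ) * n / u = 2 * (n/u) := by ring
    rw [this] at hσ
    have h3 := mul_le_mul_of_nonneg_left hσ (by positivity : 0 ≤ 4 * (2 * ((q:ℝ)+1) * q + 3) * y)
    linarith
  have hE : ((2*σ : ℕ) * ℓ * δ'' / 2 - σ * ℓ * δ' / 4 : ℝ) ≤ - (κ * (n * y)) + δ' * (n / u) := by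
    push_cast
    rw [hd]
    have g1 : η₂ * m / (2*q) - σ ≤ σ * (ℓ:ℝ) := by
      rw [sub_le_iff_le_add, div_le_iff₀ (by positivity)]; linarith
    have g2 : κ * (n * y) ≤ 3/16 * δ' * (η₂ * m / (2*q)) := by
      rw [hκ]
      have : 3/16 * δ' * (η₂ * m / (2*q)) = 3/16 * δ' * η₂ / (4 * q * (q+1)) * (2 * (q+1) * m) := by field_simp; ring
      rw [this]
      exact mul_le_mul_of_nonneg_left hm (by positivity)
    have g3 : (σ:ℝ) ≤ 2 * (n/u) := by rw [← mul_div_assoc]; exact hσ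
    have g4 := mul_le_mul_of_nonneg_left g1 (by positivity : 0 ≤ 3/16*δ')
    have g5 := mul_le_mul_of_nonneg_left g3 (by positivity : 0 ≤ 3/16*δ')
    have g6 : 0 ≤ δ' * (n/u) := by positivity
    linarith
  have hyn : 0 < n * y := by positivity
  have key1 : (n:ℝ) ≤ κ * (n * y) / 6 := by
    have := mul_le_mul_of_nonneg_left H1 hn0.le
    linarith
  have key2 : 8 * (2 * ((q:ℝ)+1) * q + 3) * y * (n / u) ≤ κ * (n * y) / 6 := by
    rw [← mul_div_assoc, div_le_iff₀ hu]
    have := mul_le_mul_of_nonneg_left H2 hyn.le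
    linarith
  have key3 : δ' * (n/u) ≤ κ * (n * y) / 6 := by
    rw [← mul_div_assoc, div_le_iff₀ hu]
    have := mul_le_mul_of_nonneg_left H3 hn0.le
    linarith
  have key4 : κ * y ≤ κ * (n * y) := by
    refine mul_le_mul_of_nonneg_left ?_ hκ0.le
    nlinarith
  calc 2 ^ n * P ^ (2*σ) * Real.exp ((2*σ : ℕ) * ℓ * δ'' / 2 - σ * ℓ * δ' / 4)
      ≤ Real.exp n * Real.exp (8 * (2 * (q+1) * q + 3) * y * (n / u)) * Real.exp (- (κ * (n * y)) + δ' * (n / u)) := by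
        refine mul_le_mul (mul_le_mul (two_pow_le_exp n) hP2 (by positivity) (Real.exp_pos _).le) (Real.exp_le_exp.2 hE) (Real.exp_pos _).le (by positivity)
    _ ≤ Real.exp (-(κ/2*y)) := by
        rw [← Real.exp_add, ← Real.exp_add, Real.exp_le_exp]
        linarith

lemma num_e10 {σ k S : ℕ} {y ε δ' γ : ℝ} (hn : (n:ℝ) = Real.exp y) (hσn : σ ≤ n) (hδ' : 0 ≤ δ') (hγ : 0 < γ)
    (hR : 3 * q * δ' * 4 ^ (q+1) ≤ Real.exp (-(4/γ))) (hk : γ * y - 1 - S ≤ (k:ℝ))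
    (h : 2 * Real.exp (4/γ * (1 + S)) * y ^ 0 * Real.exp (-(2 * y)) ≤ ε) :
    2 * σ * σ * (3 * q * δ' * ((n:ℝ) ^ (q+1)) ^ q / ((n:ℝ)^q/4) ^ (q+1)) ^ k ≤ ε := by
  have hn0 : (0:ℝ) < n := by rw [hn]; exact Real.exp_pos _
  refine le_trans ?_ h
  rw [pow_zero, mul_one]
  have h1 : 3 * q * δ' * ((n:ℝ) ^ (q+1)) ^ q / ((n:ℝ)^q/4) ^ (q+1) = 3 * q * δ' * 4 ^ (q+1) := by
    rw [div_pow, ← pow_mul, ← pow_mul, mul_comm q (q+1)]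
    field_simp
  rw [h1]
  have h2 : (3 * q * δ' * 4 ^ (q+1)) ^ k ≤ Real.exp (-(4 * y) + 4/γ * (1+S)) := by
    refine (pow_le_pow_left₀ (by positivity) hR k).trans ?_
    rw [← Real.exp_nat_mul, Real.exp_le_exp]
    have := mul_le_mul_of_nonneg_left hk (by positivity : 0 ≤ 4/γ)
    have e : 4/γ * (γ * y - 1 - S) = 4 * y - 4/γ * (1+S) := by field_simp; ring
    rw [e] at this
    linarith
  have hσ : (σ:ℝ) ≤ Real.exp y := by rw [← hn]; exact_mod_cast hσn
  calc 2 * σ * σ * (3 * q * δ' * 4 ^ (q+1)) ^ k ≤ 2 * Real.exp y * Real.exp y * Real.exp (-(4 * y) + 4/γ * (1+S)) := by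
        refine mul_le_mul ?_ h2 (by positivity) (by positivity)
        refine mul_le_mul (mul_le_mul_of_nonneg_left hσ (by norm_num)) hσ (by positivity) (by positivity)
    _ = _ := by
        rw [mul_assoc, mul_assoc, mul_assoc, ← Real.exp_add, ← Real.exp_add, ← Real.exp_add]
        congr 2; ring

lemma desc_pow_lower (hqn : q ≤ n) (hn : 0 < n) (j : ℕ) :
    (1 - j * ((q+1) * q / n : ℝ)) * ((n:ℝ)^(q+1))^j ≤ (Fintype.card (Fin (q+1) ↪ Fin n) : ℝ) ^ j := by
  have hn0 : (0:ℝ) < n := by exact_mod_cast hn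
  rw [card_X]
  have h1 : ((n:ℝ) - q)^(q+1) ≤ n.descFactorial (q+1) := by
    have h2 := Nat.pow_sub_le_descFactorial n (q+1)
    have h3 : n + 1 - (q+1) = n - q := by omega
    rw [h3] at h2
    have h4 : ((n - q : ℕ):ℝ)^(q+1) ≤ n.descFactorial (q+1) := by exact_mod_cast h2
    rwa [Nat.cast_sub hqn] at h4
  have hqn' : (q:ℝ) ≤ n := by exact_mod_cast hqn
  have h5 : (((n:ℝ) - q)^(q+1))^j ≤ (n.descFactorial (q+1) : ℝ)^j := pow_le_pow_left₀ (pow_nonneg (by linarith) _) h1 j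
  refine le_trans ?_ h5
  have hb := one_add_mul_le_pow (a := -((q:ℝ)/n)) (by
    have : (q:ℝ)/n ≤ 1 := (div_le_one hn0).2 hqn'
    linarith) ((q+1)*j)
  have e : (((n:ℝ) - q)^(q+1))^j = (1 + -((q:ℝ)/n))^((q+1)*j) * ((n:ℝ)^(q+1))^j := by
    rw [← pow_mul, ← pow_mul, ← mul_pow]; congr 1; field_simp; ring
  rw [e]
  refine mul_le_mul_of_nonneg_right (le_trans (le_of_eq ?_) hb) (by positivity)
  push_cast
  ring

end num3
end Sham

namespace Sham

section fin
variable {q n : ℕ}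

lemma log_one_sub_ge {x : ℝ} (h0 : 0 ≤ x) (h1 : x ≤ 1/2) : -(2 * x) ≤ Real.log (1 - x) := by
  have h2 := Real.one_sub_inv_le_log_of_pos (by linarith : 0 < 1 - x)
  refine le_trans ?_ h2
  have h3 : (1 - x)⁻¹ ≤ 1 + 2 * x := by
    rw [inv_le_iff_one_le_mul₀ (by linarith)]
    nlinarith
  linarith

/-- the rounded parameters -/
lemma params {y u α c η β : ℝ} {S : ℕ} (hq : 1 ≤ q) (hn : (n:ℝ) = Real.exp y) (hu : 1 ≤ u) (huy : u ≤ y)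
    (hη : 0 < η) (hα : η ≤ α) (hα1 : α ≤ 1/16) (hc : 0 < c) (hc1 : c ≤ 1) (hβ : 0 < β) (hβ1 : β ≤ 1)
    (hU3 : 2 * ((q:ℝ)+1) ≤ η * u) (hU10 : (S:ℝ) + 1 ≤ c * u) :
    ∃ N t1 m k₁ k b₀ Δ σ ℓ τ₀ : ℕ,
      (3 * y * n ≤ (q+1) * (N:ℝ) ∧ (q+1) * (N:ℝ) ≤ 4 * y * n) ∧
      ((q+1) * (t1:ℝ) ≤ (1 - η) * (n * y) ∧ (1 - 2 * η) * (n * y) ≤ (q+1) * (t1 - 1 : ℝ)) ∧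
      ((q+1) * (m:ℝ) ≤ (1 - 2 * α) * (n * y) ∧ (1 - 3 * α) * (n * y) ≤ (q+1) * (m:ℝ)) ∧
      ((k₁:ℝ) ≤ c * y ∧ c * y - 1 - S ≤ (k:ℝ) ∧ k + S ≤ k₁) ∧
      (Real.exp ((1 - c) * y) ≤ (b₀:ℝ) ∧ (b₀:ℝ) ≤ 2 * Real.exp ((1 - c) * y)) ∧
      (40 * y ≤ (Δ:ℝ) ∧ (Δ:ℝ) ≤ 41 * y) ∧
      (1 ≤ σ ∧ n / u ≤ (σ:ℝ) ∧ (σ:ℝ) ≤ 2 * n / u) ∧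
      (τ₀ + 2 * σ * q * ℓ = m ∧ β * m - 2 * σ * q ≤ 2 * σ * q * (ℓ:ℝ) ∧ 2 * σ * q * (ℓ:ℝ) ≤ β * m) := by
  have hy : 1 ≤ y := hu.trans huy
  have hn1 : y + 1 ≤ n := by rw [hn]; exact Real.add_one_le_exp y
  have hr0 : (0:ℝ) < (q:ℝ) + 1 := by positivity
  have hq0 : (0:ℝ) < q := by exact_mod_cast hq
  have hn0 : (0:ℝ) < n := by linarith
  have hu0 : 0 < u := by linarith
  have hny : u ≤ n * y := by nlinarith
  have hηny : 2 * ((q:ℝ)+1) ≤ η * (n * y) := hU3.trans (mul_le_mul_of_nonneg_left hny hη.le)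
  have hαny : η * (n * y) ≤ α * (n * y) := mul_le_mul_of_nonneg_right hα (by positivity)
  have hny0 : 0 < n * y := by positivity
  -- N
  have N1 := Nat.le_ceil (3 * y * n / ((q:ℝ)+1))
  have N2 := Nat.ceil_lt_add_one (by positivity : 0 ≤ 3 * y * n / ((q:ℝ)+1))
  rw [div_le_iff₀ hr0] at N1
  rw [div_add_one hr0.ne', lt_div_iff₀ hr0] at N2
  -- t1
  have t10 : 0 ≤ (1 - η) * (n * y) / ((q:ℝ)+1) := div_nonneg (mul_nonneg (by linarith) hny0.le) hr0.le
  have T1 := Nat.floor_le t10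
  have T2 := Nat.lt_floor_add_one ((1 - η) * (n * y) / ((q:ℝ)+1))
  rw [le_div_iff₀ hr0] at T1
  rw [div_lt_iff₀ hr0] at T2
  -- m
  have m0 : 0 ≤ (1 - 2*α) * (n * y) / ((q:ℝ)+1) := div_nonneg (mul_nonneg (by linarith) hny0.le) hr0.le
  have M1 := Nat.floor_le m0
  have M2 := Nat.lt_floor_add_one ((1 - 2*α) * (n * y) / ((q:ℝ)+1))
  rw [le_div_iff₀ hr0] at M1
  rw [div_lt_iff₀ hr0] at M2
  -- k
  have cy : (S:ℝ) + 1 ≤ c * y := hU10.trans (mul_le_mul_of_nonneg_left huy hc.le)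
  have K1 := Nat.floor_le (by positivity : 0 ≤ c * y)
  have K2 := Nat.lt_floor_add_one (c * y)
  have K3 : S ≤ ⌊c * y⌋₊ := Nat.le_floor (by linarith)
  -- b₀
  have B0 : 1 ≤ Real.exp ((1 - c) * y) := Real.one_le_exp (mul_nonneg (by linarith) (by linarith))
  have B1 := Nat.le_ceil (Real.exp ((1 - c) * y))
  have B2 := Nat.ceil_lt_add_one (Real.exp_pos ((1 - c) * y)).le
  -- Δ
  have D1 := Nat.le_ceil (40 * y)
  have D2 := Nat.ceil_lt_add_one (by positivity : 0 ≤ 40 * y)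
  -- σ
  have s0 : 1 ≤ n / u := by rw [le_div_iff₀ hu0]; linarith
  have S1 := Nat.le_ceil (n / u)
  have S2 := Nat.ceil_lt_add_one (by positivity : 0 ≤ n / u)
  have S3 : 1 ≤ ⌈n / u⌉₊ := Nat.one_le_ceil_iff.2 (by linarith)
  have S4 : 2 * n / u = n / u + n / u := by ring
  obtain ⟨σ, hσ⟩ : ∃ σ, σ = ⌈n / u⌉₊ := ⟨_, rfl⟩
  obtain ⟨m, hm⟩ : ∃ m, m = ⌊(1 - 2*α) * (n * y) / ((q:ℝ)+1)⌋₊ := ⟨_, rfl⟩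
  rw [← hσ] at S1 S2 S3
  rw [← hm] at M1 M2
  have sq0 : (0:ℝ) < 2 * σ * q := by
    have : (1:ℝ) ≤ σ := by exact_mod_cast S3
    positivity
  have L1 := Nat.floor_le (by positivity : 0 ≤ β * m / (2 * σ * q))
  have L2 := Nat.lt_floor_add_one (β * m / (2 * σ * q))
  rw [le_div_iff₀ sq0] at L1
  rw [div_lt_iff₀ sq0] at L2
  have L3 : 2 * σ * q * ⌊β * m / (2 * σ * q)⌋₊ ≤ m := by
    have : (2 * σ * q * ⌊β * m / (2 * σ * q)⌋₊ : ℝ) ≤ m := by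
      have : β * m ≤ 1 * m := mul_le_mul_of_nonneg_right hβ1 (Nat.cast_nonneg m)
      linarith
    exact_mod_cast this
  have hN4 : (q:ℝ) + 1 ≤ y * n := by
    have : η * (n * y) ≤ 1 * (n * y) := mul_le_mul_of_nonneg_right (by linarith) hny0.le
    linarith
  refine ⟨⌈3 * y * n / ((q:ℝ)+1)⌉₊, ⌊(1 - η) * (n * y) / ((q:ℝ)+1)⌋₊, m, ⌊c * y⌋₊, ⌊c * y⌋₊ - S, ⌈Real.exp ((1 - c) * y)⌉₊, ⌈40 * y⌉₊, σ,
    ⌊β * m / (2 * σ * q)⌋₊, m - 2 * σ * q * ⌊β * m / (2 * σ * q)⌋₊, ⟨?_, ?_⟩, ⟨?_, ?_⟩, ⟨?_, ?_⟩, ⟨K1, ?_, by omega⟩, ⟨B1, by linarith⟩, ⟨D1, by linarith⟩,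
    ⟨S3, S1, by linarith⟩, Nat.sub_add_cancel L3, by linarith, by linarith⟩
  · linarith
  · linarith
  · linarith
  · linarith
  · linarith
  · linarith
  · rw [Nat.cast_sub K3]; linarith

end fin
end Sham

namespace Sham

section fin2
variable {q n : ℕ}

lemma gap_lemma {β δ'' : ℝ} {m τ₀ : ℕ} (hb : β = δ''/64) (h0 : 0 < δ'') (h1 : δ'' ≤ 1) (hm : 0 < m) (hτ : (1 - β) * m ≤ (τ₀:ℝ)) :
    δ'' / 8 ≤ Real.log ((1 - β) * τ₀) - Real.log ((1 - δ''/4) * m) - β := by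
  have hm0 : (0:ℝ) < m := by exact_mod_cast hm
  have hβ1 : 0 < 1 - β := by linarith
  have hτ0 : (0:ℝ) < τ₀ := lt_of_lt_of_le (by positivity) hτ
  have a1 : Real.log (1 - β) + (Real.log (1 - β) + Real.log m) ≤ Real.log ((1 - β) * τ₀) := by
    rw [Real.log_mul hβ1.ne' hτ0.ne', ← Real.log_mul hβ1.ne' hm0.ne']
    have := Real.log_le_log (by positivity) hτ
    linarith
  have a2 := log_one_sub_ge (x := β) (by linarith) (by linarith)
  have a3 : Real.log ((1 - δ''/4) * m) ≤ -(δ''/4) + Real.log m := by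
    rw [Real.log_mul (by linarith) hm0.ne']
    have := Real.log_le_sub_one_of_pos (by linarith : 0 < 1 - δ''/4)
    linarith
  linarith

lemma kap_lemma {β α y : ℝ} {m τ₀ : ℕ} (h0 : 0 ≤ β) (h1 : β ≤ 1/2) (hα : 0 ≤ α) (hα1 : 3 * α ≤ 1/2) (hn : 0 < n) (hy : 0 < y)
    (hm : (1 - 3 * α) * (n * y) ≤ (q+1) * (m:ℝ)) (hτ : (1 - β) * m ≤ (τ₀:ℝ)) :
    Real.log y - (4 * β + 6 * α) ≤ Real.log ((1 - β) * τ₀ * (q+1) / n) := by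
  have hn0 : (0:ℝ) < n := by exact_mod_cast hn
  have hβ1 : 0 < 1 - β := by linarith
  have hα2 : 0 < 1 - 3 * α := by linarith
  have b1 : (1 - β) * ((1 - β) * ((1 - 3 * α) * y)) ≤ (1 - β) * τ₀ * (q+1) / n := by
    rw [le_div_iff₀ hn0]
    have c1 := mul_le_mul_of_nonneg_right hτ (by positivity : 0 ≤ (q:ℝ)+1)
    have c2 := mul_le_mul_of_nonneg_left hm hβ1.le
    have c3 : (1 - β) * ((1 - 3 * α) * (n * y)) ≤ τ₀ * (q+1) := by linarith
    have c4 := mul_le_mul_of_nonneg_left c3 hβ1.le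
    linarith
  have b2 := Real.log_le_log (by positivity) b1
  rw [Real.log_mul hβ1.ne' (by positivity), Real.log_mul hβ1.ne' (by positivity), Real.log_mul hα2.ne' hy.ne'] at b2
  have a2 := log_one_sub_ge h0 h1
  have a3 := log_one_sub_ge (x := 3 * α) (by linarith) hα1
  linarith

lemma err_lemma {σ : ℕ} {y u θ θ₂ C : ℝ} (hu : 0 < u) (hy : 0 < y) (hC : 0 < C) (hθ : θ₂ = θ / (16 * (q+2))) (hθ0 : 0 < θ)
    (hly0 : 0 ≤ Real.log y) (hσ : (σ:ℝ) ≤ 2 * n / u) (h1 : 1 ≤ θ₂ * u) (h2 : Real.log C ≤ θ₂ * u) (h3 : Real.log y ≤ θ₂ * u)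
    (h4 : 1 + y ≤ θ / 2 * n) :
    (q+2) * σ * Real.log y + ((q+2) * σ + 1 + y + q * σ * Real.log (C * y)) ≤ θ * n := by
  have hσ0 : (0:ℝ) ≤ σ := Nat.cast_nonneg σ
  have hs : σ * u ≤ 2 * n := by rwa [le_div_iff₀ hu] at hσ
  have hθ2 : 0 < θ₂ := by rw [hθ]; positivity
  have hθ' : 16 * ((q:ℝ)+2) * θ₂ = θ := by rw [hθ]; field_simp
  have k : σ * (θ₂ * u) ≤ θ₂ * (2 * n) := by
    have := mul_le_mul_of_nonneg_left hs hθ2.le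
    linarith
  rw [Real.log_mul hC.ne' hy.ne']
  have q0 : (0:ℝ) ≤ q := Nat.cast_nonneg q
  have a1 := mul_le_mul_of_nonneg_left h1 hσ0
  have a2 := mul_le_mul_of_nonneg_left h2 hσ0
  have a3 := mul_le_mul_of_nonneg_left h3 hσ0
  have c1 : (q+2) * (σ * 1 : ℝ) ≤ (q+2) * (θ₂ * (2 * n)) := mul_le_mul_of_nonneg_left (by linarith) (by positivity)
  have c2 : q * (σ * Real.log C) ≤ q * (θ₂ * (2 * n)) := mul_le_mul_of_nonneg_left (by linarith) (by positivity)
  have c3 : (q+2) * (σ * Real.log y) ≤ (q+2) * (θ₂ * (2 * n)) := mul_le_mul_of_nonneg_left (by linarith) (by positivity)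
  have c4 : q * (σ * Real.log y) ≤ q * (θ₂ * (2 * n)) := mul_le_mul_of_nonneg_left (by linarith) (by positivity)
  have d : 0 ≤ θ₂ * n := by positivity
  have e : 16 * ((q:ℝ)+2) * θ₂ * n = θ * n := by rw [hθ']
  nlinarith

lemma sig_lemma {σ ν₀ : ℕ} {u δ' : ℝ} (hu : 0 < u) (hσ1 : 1 ≤ σ) (hσ : (σ:ℝ) ≤ 2 * n / u) (hU1 : 6 * ((q:ℝ)+1)^3 ≤ δ' * u)
    (hU2 : 4 * ((ν₀:ℝ) + 6) * ((q:ℝ)+1)^2 ≤ u) :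
    2 * (((ν₀:ℝ) + 6) * ((q:ℝ)+1)^2 * σ) ≤ n ∧ 3 * ((q:ℝ)+1)^3 * σ ≤ δ' * n := by
  have hs : σ * u ≤ 2 * n := by rwa [le_div_iff₀ hu] at hσ
  have hσ0 : (0:ℝ) ≤ σ := Nat.cast_nonneg σ
  constructor
  · have := mul_le_mul_of_nonneg_left hU2 hσ0
    linarith
  · have := mul_le_mul_of_nonneg_left hU1 hσ0
    have h2 : 0 ≤ δ' := by
      by_contra h
      push Not at h
      have : δ' * u < 0 := mul_neg_of_neg_of_pos h hu
      have : (0:ℝ) ≤ 6 * ((q:ℝ)+1)^3 := by positivity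
      linarith
    have := mul_le_mul_of_nonneg_left hs h2
    linarith

lemma choose_lemma {N : ℕ} {y : ℝ} (hq : 2 ≤ q) (hn : (n:ℝ) = Real.exp y) (hy : 0 ≤ y) (hqn : 2 * (q+1) ≤ n) (hN : (q+1) * (N:ℝ) ≤ 4 * y * n)
    (h : 256 * ((q+1).factorial:ℝ) * y ^ 2 * Real.exp (-(1 * y)) ≤ 1) : 2 * N ^ 2 ≤ (Kn n (q+1)).card := by
  rw [Kn, card_powersetCard, card_range]
  have hn0 : (0:ℝ) < n := by rw [hn]; exact Real.exp_pos _
  have h1 : (((n + 1 - (q+1) : ℕ) : ℝ)^(q+1)) ≤ ((q+1).factorial : ℝ) * (n.choose (q+1) : ℝ) := by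
    have := Nat.pow_sub_le_descFactorial n (q+1)
    rw [Nat.descFactorial_eq_factorial_mul_choose] at this
    exact_mod_cast this
  have h2 : (n:ℝ)/2 ≤ ((n + 1 - (q+1) : ℕ) : ℝ) := by
    have : n ≤ 2 * (n + 1 - (q+1)) := by omega
    have : (n:ℝ) ≤ 2 * ((n + 1 - (q+1) : ℕ) : ℝ) := by exact_mod_cast this
    linarith
  have h3 : ((n:ℝ)/2)^3 ≤ ((q+1).factorial : ℝ) * (n.choose (q+1) : ℝ) := by
    refine le_trans ?_ (le_trans (pow_le_pow_left₀ (by positivity) h2 (q+1)) h1)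
    refine pow_le_pow_right₀ ?_ (by omega)
    have : 2 ≤ n := by omega
    have : (2:ℝ) ≤ n := by exact_mod_cast this
    linarith
  have hN' : (N:ℝ) ≤ 4 * y * n := by
    have : (0:ℝ) ≤ q * N := by positivity
    nlinarith
  have h4 : 256 * ((q+1).factorial:ℝ) * y ^ 2 ≤ n := by
    rw [one_mul, Real.exp_neg, ← hn, ← div_eq_mul_inv, div_le_one hn0] at h
    exact h
  have hf : (0:ℝ) < (q+1).factorial := by exact_mod_cast Nat.factorial_pos _
  have h5 : ((q+1).factorial:ℝ) * (2 * (N:ℝ)^2) ≤ ((q+1).factorial:ℝ) * (n.choose (q+1) : ℝ) := by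
    refine le_trans ?_ h3
    have a1 : (N:ℝ)^2 ≤ (4 * y * n)^2 := pow_le_pow_left₀ (Nat.cast_nonneg _) hN' 2
    have a2 := mul_le_mul_of_nonneg_right h4 (by positivity : 0 ≤ (n:ℝ)^2)
    have a3 := mul_le_mul_of_nonneg_left a1 hf.le
    nlinarith
  exact_mod_cast le_of_mul_le_mul_left h5 hf

end fin2
end Sham

namespace Sham

section core
variable {q n : ℕ}

set_option maxHeartbeats 2000000 in
theorem core {y u α c η β δ δ' δ'' κ θ θ₂ C D₀ ε : ℝ} {S ν₀ : ℕ} (hq : 2 ≤ q) (hqn : (q+1) ∣ n) (hn : (n:ℝ) = Real.exp y)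
    (hu : 1 ≤ u) (huy : u ^ (2 * (q+1)) = y)
    -- constants
    (hc0 : 0 < c) (hα : α = 8 * (q+1) * c) (hα1 : α ≤ 1/16) (hαδ : α ≤ δ/48) (hη : c = 12 * η) (hS : 4 ≤ c * (S+1))
    (hδ' : 0 < δ') (hδ'1 : δ' ≤ 1) (hδ'δ : δ' ≤ δ) (hR : 3 * q * δ' * 4 ^ (q+1) ≤ Real.exp (-(4/c)))
    (hd : δ'' = δ' / 16) (hb : β = δ''/64) (hκ : κ = 3/16 * δ' * β / (4 * q * (q+1)))
    (hθ : θ = δ'' / (32 * (q+1))) (hθ₂ : θ₂ = θ / (16 * (q+2))) (hC : C = 64 / δ'') (hD₀ : 0 < D₀)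
    (hUb : ∀ ν : ℕ, ν₀ ≤ ν → ∀ A : ℝ, D₀ * ν ≤ A → Ub (q + 1) A ν ≤ Real.exp (ν * (Real.log (A / ν) - q + β)))
    -- largeness
    (hU1 : 6 * ((q:ℝ)+1)^3 ≤ δ' * u) (hU2 : 4 * ((ν₀:ℝ) + 6) * ((q:ℝ)+1)^2 ≤ u) (hU3 : 2 * ((q:ℝ)+1) ≤ η * u)
    (hU4 : 16 * ((q:ℝ)+1) ≤ β^2 * u) (hU5 : 48 * (2 * ((q:ℝ)+1) * q + 3) ≤ κ * u) (hU6 : 6 * δ' ≤ κ * u) (hU7 : 6 ≤ κ * u)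
    (hU8 : 8 * ((q:ℝ)+1) * Real.exp (q+1) ≤ u) (hU9 : 8 * ((q:ℝ)+1) * D₀ ≤ u) (hU10 : (S:ℝ) + 1 ≤ c * u)
    (hU11 : 1 ≤ θ₂ * u) (hU12 : Real.log C ≤ θ₂ * u) (hU13 : Real.log y ≤ θ₂ * u)
    (x1 : 1 * y ^ 0 * Real.exp (-(1/2 * y)) ≤ ε) (x2 : 1 * y ^ 0 * Real.exp (-(η/2 * y)) ≤ ε)
    (x3 : 2 ^ (S+1) * y ^ 0 * Real.exp (-(2 * c * y)) ≤ ε) (x4 : 1 * y ^ 0 * Real.exp (-(1 * y)) ≤ ε)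
    (x5 : 672 * ((q:ℝ)+1)^3 * y ^ 2 * Real.exp (-(c/2 * y)) ≤ 1) (x6 : (1/η)^S * y ^ 0 * Real.exp (-(c/4 * y)) ≤ ε)
    (x8 : 8 * ((q:ℝ)+1)^6 * y ^ 3 * Real.exp (-(1 * y)) ≤ ε) (x9 : 1 * y ^ 0 * Real.exp (-(κ/2 * y)) ≤ ε)
    (x10 : 2 * Real.exp (4/c * (1 + S)) * y ^ 0 * Real.exp (-(2 * y)) ≤ ε)
    (x11 : 256 * ((q+1).factorial:ℝ) * y ^ 2 * Real.exp (-(1 * y)) ≤ 1)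
    (x12 : 2 * ((q:ℝ)+1) * y ^ 1 * Real.exp (-(c * y)) ≤ 1)
    (x13 : 2 * y ^ 1 * Real.exp (-(1 * y)) ≤ θ/2) :
    ∃ N : ℕ, 2 * N ^ 2 ≤ (Kn n (q+1)).card ∧
      Pr (fun ω : Fin N → (Fin (q+1) ↪ Fin n) => Function.Injective (fun i => ed (ω i)) ∧
        ¬ GoodSeq ((Real.exp (-(q:ℝ)) * y) ^ (n / (q+1)) * Real.exp (-(δ/2*n))) ω) ≤ 10 * ε := by
  classical
  have hr0 : (0:ℝ) < (q:ℝ) + 1 := by positivity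
  have hq0 : (2:ℝ) ≤ q := by exact_mod_cast hq
  have hu0 : 0 < u := by linarith
  have huy' : u ≤ y := by rw [← huy]; exact le_self_pow₀ hu (by omega)
  have hy : 1 ≤ y := hu.trans huy'
  have hy0 : 0 < y := by linarith
  have hn1 : y + 1 ≤ n := by rw [hn]; exact Real.add_one_le_exp y
  have hn0 : (0:ℝ) < n := by linarith
  have hnN : 0 < n := by exact_mod_cast hn0
  have hη0 : 0 < η := by linarith
  have hcα : c ≤ α := by rw [hα]; nlinarith only [hc0, hq0, mul_nonneg hc0.le (by linarith only [hq0] : (0:ℝ) ≤ q)]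
  have hα0 : 0 < α := by linarith only [hcα, hc0]
  have hηα : η ≤ α := by linarith only [hcα, hη, hη0]
  have hδ''0 : 0 < δ'' := by rw [hd]; linarith
  have hβ0 : 0 < β := by linarith
  have hκ0 : 0 < κ := by rw [hκ]; positivity
  have hθ0 : 0 < θ := by rw [hθ]; positivity
  have hny : 0 < n * y := by positivity
  have hlogn : Real.log n = y := by rw [hn, Real.log_exp]
  obtain ⟨N, t1, m, k₁, k, b₀, Δ, σ, ℓ, τ₀, ⟨N1, N2⟩, ⟨T1, T2⟩, ⟨M1, M2⟩, ⟨K1, K2, K3⟩, ⟨B1, B2⟩, ⟨D1, D2⟩, ⟨S1, S2, S3⟩, L1, L2, L3⟩ :=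
    params (q := q) (n := n) (y := y) (u := u) (α := α) (c := c) (η := η) (β := β) (S := S) (by omega) hn hu huy' hη0 (by linarith) hα1 hc0 (by linarith) hβ0 (by linarith) hU3 hU10
  obtain ⟨G1, G2⟩ := sig_lemma hu0 S1 S3 hU1 hU2
  have hσ1 : (1:ℝ) ≤ σ := by exact_mod_cast S1
  have hσ0 : (0:ℝ) < σ := by linarith
  have hν0 : (0:ℝ) ≤ ν₀ := Nat.cast_nonneg _
  -- basic size facts
  have R2 : 0 ≤ ((q:ℝ)+1)^2 * σ := by positivity
  have R3 : 0 ≤ (ν₀:ℝ) * (((q:ℝ)+1)^2 * σ) := by positivity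
  have G3 : 12 * (((q:ℝ)+1)^2 * σ) ≤ n := by linarith only [G1, R3]
  have r2 : ((q:ℝ)+1)^2 ≤ ((q:ℝ)+1)^2 * σ := le_mul_of_one_le_right (sq_nonneg _) hσ1
  have r1 : ((q:ℝ)+1) * σ ≤ ((q:ℝ)+1)^2 * σ := mul_le_mul_of_nonneg_right (by nlinarith only [hq0]) hσ0.le
  have r3 : 3 * (σ:ℝ) ≤ ((q:ℝ)+1) * σ := mul_le_mul_of_nonneg_right (by linarith only [hq0]) hσ0.le
  have r4 : ((q:ℝ)+1) ≤ ((q:ℝ)+1)^2 := by nlinarith only [hq0]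
  have hqnR : 12 * ((q:ℝ)+1)^2 ≤ n := by linarith
  have hqn2 : 2 * (q+1) ≤ n := by
    have : (2:ℝ) * (q+1) ≤ n := by linarith
    exact_mod_cast this
  have hσn : (σ:ℝ) ≤ n := by linarith
  have hσnN : σ ≤ n := by exact_mod_cast hσn
  have hτeq : (τ₀:ℝ) + 2 * σ * q * ℓ = m := by exact_mod_cast L1
  have hτm : (1 - β) * m ≤ (τ₀:ℝ) := by linarith
  have hm2 : n * y ≤ 2 * (q+1) * (m:ℝ) := by nlinarith only [M2, mul_le_mul_of_nonneg_right hα1 hny.le, hny]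
  have hm0 : (0:ℝ) < m := by
    by_contra h
    push Not at h
    have : (2:ℝ) * (q+1) * m ≤ 0 := mul_nonpos_of_nonneg_of_nonpos (by positivity) h
    linarith
  have hβh : β ≤ 1/2 := by linarith
  have hmN : 0 < m := by exact_mod_cast hm0
  have hτ2 : (m:ℝ) ≤ 2 * τ₀ := by linarith only [hτm, hm0, mul_le_mul_of_nonneg_right hβh hm0.le]
  have hτR : (0:ℝ) < τ₀ := by linarith
  have hτN : 0 < τ₀ := by exact_mod_cast hτR
  have hτ4 : n * y ≤ 4 * (q+1) * (τ₀:ℝ) := by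
    have := mul_le_mul_of_nonneg_left hτ2 (by positivity : 0 ≤ 2 * ((q:ℝ)+1))
    linarith
  have hmny : (q+1) * (m:ℝ) ≤ n * y := by linarith only [M1, mul_nonneg hα0.le hny.le]
  have hmny' : (m:ℝ) ≤ n * y := by nlinarith only [hmny, hm0, mul_nonneg hm0.le (by linarith only [hq0] : (0:ℝ) ≤ q)]
  have hNR : (0:ℝ) < N := by
    by_contra h
    push Not at h
    have : ((q:ℝ)+1) * N ≤ 0 := mul_nonpos_of_nonneg_of_nonpos (by positivity) h
    have : 0 < 3 * y * n := by positivity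
    linarith
  have hNN : 0 < N := by exact_mod_cast hNR
  have hmt : m ≤ t1 := by
    have : ((q:ℝ)+1) * m ≤ (q+1) * t1 := by linarith only [M1, T2, mul_nonneg hα0.le hny.le, mul_le_mul_of_nonneg_right hηα hny.le, hr0]
    exact_mod_cast le_of_mul_le_mul_left this hr0
  have ht1 : t1 ≤ N := by
    have : ((q:ℝ)+1) * t1 ≤ (q+1) * N := by linarith only [T1, N1, hny, mul_pos hη0 hny]
    exact_mod_cast le_of_mul_le_mul_left this hr0
  have hC0 : 0 < C := by rw [hC]; positivity
  have hC1 : 1 ≤ C := by rw [hC, le_div_iff₀ hδ''0]; linarith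
  have hΛ : 1 ≤ C * y := one_le_mul_of_one_le_of_one_le hC1 hy
  have hb0R : (0:ℝ) < b₀ := lt_of_lt_of_le (Real.exp_pos _) B1
  have hb0N : 0 < b₀ := by exact_mod_cast hb0R
  have hrb : (q+1) * b₀ ≤ σ := by
    have h1 : ((q:ℝ)+1) * b₀ ≤ n / u := by
      rw [le_div_iff₀ hu0]
      have e1 : Real.exp ((1 - c) * y) = n * Real.exp (-(c*y)) := by rw [hn, ← Real.exp_add]; congr 1; ring
      rw [e1] at B2
      rw [pow_one] at x12
      have e2 : ((q:ℝ)+1) * b₀ * u ≤ ((q:ℝ)+1) * (2 * (n * Real.exp (-(c*y)))) * y :=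
        mul_le_mul (mul_le_mul_of_nonneg_left B2 hr0.le) huy' hu0.le (by positivity)
      have e3 := mul_le_mul_of_nonneg_left x12 hn0.le
      linarith
    have h2 : ((q:ℝ)+1) * b₀ ≤ σ := h1.trans S2
    exact_mod_cast h2
  have hyexp : 8 * ((q:ℝ)+1) * Real.exp (q+1) ≤ y := hU8.trans huy'
  have hyD : 8 * ((q:ℝ)+1) * D₀ ≤ y := hU9.trans huy'
  have hly : (q:ℝ) ≤ Real.log y := by
    rw [Real.le_log_iff_exp_le hy0]
    have : Real.exp q ≤ Real.exp (q+1) := Real.exp_le_exp.2 (by linarith)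
    have h3 := Real.exp_pos ((q:ℝ)+1)
    nlinarith only [this, h3, hyexp, mul_nonneg h3.le (by linarith only [hq0] : (0:ℝ) ≤ q)]
  have hr3 : ((q:ℝ)+1)^3 ≤ δ' * n := by
    have : ((q:ℝ)+1)^3 ≤ ((q:ℝ)+1)^3 * σ := le_mul_of_one_le_right (by positivity) hσ1
    have : 0 ≤ ((q:ℝ)+1)^3 * σ := by positivity
    linarith
  -- error terms
  have hERR := err_lemma (q := q) (n := n) (C := C) hu0 hy0 hC0 hθ₂ hθ0 (by linarith) S3 hU11 hU12 hU13 (by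
    rw [pow_one, one_mul, Real.exp_neg, ← hn, ← div_eq_mul_inv, div_le_iff₀ hn0] at x13
    linarith)
  have hbig2 : n ≤ 2 * (n - ((q+1)*q) * (2*σ+1) - (q+1)*σ - σ : ℝ) := by
    nlinarith only [G3, r1, r2, r3, r4, hq0, hσ0, hσ1, mul_nonneg (by linarith only [hq0] : (0:ℝ) ≤ q) hσ0.le]
  have hX2 : (n:ℝ)^(q+1) / 2 ≤ Fintype.card (Fin (q+1) ↪ Fin n) := by
    have h := desc_pow_lower (q := q) (n := n) (by omega) hnN 1
    rw [pow_one, pow_one] at h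
    refine le_trans ?_ h
    have : (q+1) * q / n ≤ (1/2:ℝ) := by rw [div_le_iff₀ hn0]; nlinarith only [hqnR, hq0]
    have h2 : 0 < (n:ℝ)^(q+1) := by positivity
    rw [Nat.cast_one, one_mul]
    nlinarith only [this, h2, mul_le_mul_of_nonneg_right this h2.le]
  have hsub : (1 + (q+1)*q + (q+1)) * σ ≤ n := by
    have : ((1 + (q+1)*q + (q+1)) * σ : ℝ) ≤ n := by nlinarith only [G3, r1, r2, r3, hσ0]
    exact_mod_cast this
  have hnszc : (((n - (1 + (q+1)*q + (q+1)) * σ : ℕ)) : ℝ) = n - (1 + (q+1)*q + (q+1)) * σ := by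
    rw [Nat.cast_sub hsub]; push_cast; ring
  have hnminc : (((n - σ : ℕ)) : ℝ) = n - σ := Nat.cast_sub hσnN
  have hbase := num_base hn hy N2 D2 B2 x5
  refine ⟨N, choose_lemma hq hn hy0.le hqn2 N2 x11, ?_⟩
  refine omega_bound (q := q) (n := n) (N := N) (m := m) (t1 := t1) (k₁ := k₁) (k := k) (S := S) (σ := σ) (τ₀ := τ₀) (ℓ := ℓ) (nmin := n - σ)
    (nsz := n - (1 + (q+1)*q + (q+1)) * σ) (b₀ := b₀) (Δ := Δ) (δ' := δ') (δ'' := δ'') (L := (n:ℝ)^q/4) (β := β) (Λ := C * y) (lam := η) (ε := ε)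
    (by omega) (by omega) hNN hδ'.le hδ''0.le (by positivity) hqn hβ0.le (by linarith) hη0 (by linarith) hb0N L1.le hmt ht1
    ?_ (by omega) K3 ?_ ?_ ?_ ?_ ?_ ?_ ?_ ?_ ?_ ?_ ?_ ?_ ?_ ?_ ?_
  · have : (1 + (q+1)*q + (q+1)) * σ = σ + ((q+1)*q*σ + (q+1)*σ) := by ring
    omega
  · intro v B hv hB
    have hB' : (q+1) * B.card ≤ σ := by omega
    have hB2 : ((q:ℝ)+1) * B.card ≤ σ := by exact_mod_cast hB'
    refine hCL_lemma (by omega) hX2 v B hv ?_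
    have := mul_le_mul_of_nonneg_left hB2 hr0.le
    nlinarith only [this, G3, r1]
  · rw [hnszc]
    have a := le_mul_of_one_le_right (by positivity : 0 ≤ ((q:ℝ)+1)^3) hσ1
    have b := mul_le_mul_of_nonneg_left r3 hr0.le
    have b' := mul_le_mul_of_nonneg_left r1 hr0.le
    nlinarith only [a, b, b', G2, hq0, hσ0]
  · have h := desc_pow_lower (q := q) (n := n) (by omega) hnN q
    refine le_trans (mul_le_mul_of_nonneg_right ?_ (by positivity)) h
    have : q * ((q+1) * q / n) ≤ δ' := by
      rw [← mul_div_assoc, div_le_iff₀ hn0]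
      nlinarith only [hr3, hq0]
    linarith
  · refine hfin_lemma (κ := 4 * β + 6 * α) (by omega) hqn (by linarith) hΛ hτN hy0 hly (by rw [hnminc]; linarith) ?_
      (kap_lemma hβ0.le (by linarith) (by linarith) (by linarith) hnN hy0 M2 hτm) (by linarith) ?_
    · have : ((q+1) * σ + σ : ℝ) < n := by linarith
      exact_mod_cast this
    · rw [hlogn]
      have h1 : (4 * β + 6 * α) * n ≤ (δ/4) * n := mul_le_mul_of_nonneg_right (by linarith) hn0.le
      have h2 : θ * n ≤ δ/4 * n := by
        refine mul_le_mul_of_nonneg_right ?_ hn0.le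
        rw [hθ, div_le_iff₀ (by positivity)]
        have : 0 ≤ δ * q := mul_nonneg (by linarith) (by linarith)
        nlinarith only [this, hd, hδ'δ, hδ', hq0]
      linarith
  · intro W₀ h1 W h2 h3 ex h4 τ h5 h6 G h7 h8 h9 h10
    refine hLL_lemma (D₀ := D₀) (ν₀ := ν₀) (ε₁ := β) (by omega) (by omega) hUb (by linarith) hΛ hδ''0 (by linarith) hD₀ hτN (by rw [hnminc]; linarith) ?_ hbig2 ?_ ?_
      (gap_lemma hb hδ''0 (by linarith) hmN hτm) ?_ W₀ h1 W h2 h3 ex h4 τ h5 h6 G h7 h8 h9 h10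
    · have : (((q:ℝ)+1) * (ν₀ + 1) + ((q+1)*q) * (2*σ+1) + (q+1)*σ + σ) ≤ n := by
        have a : ((q:ℝ)+1) * ν₀ ≤ ν₀ * (((q:ℝ)+1)^2 * σ) := by
          rw [mul_comm]; exact mul_le_mul_of_nonneg_left (by linarith only [r4, r2]) hν0
        nlinarith only [a, G1, r1, r2, r3, r4, hq0, hσ0, R3, R2, mul_nonneg (by linarith only [hq0] : (0:ℝ) ≤ q) hσ0.le]
      exact_mod_cast this
    · have h := mul_le_mul_of_nonneg_left hyD hn0.le
      have : (q+1) * (D₀ * n) ≤ (q+1) * (τ₀ / 2 : ℝ) := by linarith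
      exact le_of_mul_le_mul_left this hr0
    · rw [Real.le_log_iff_exp_le (by have : 0 < 1 - β := by linarith
                                     positivity), le_div_iff₀ hn0]
      have h := mul_le_mul_of_nonneg_left hyexp hn0.le
      have h' : (1/2) * (τ₀:ℝ) ≤ (1 - β) * τ₀ := mul_le_mul_of_nonneg_right (by linarith) hτR.le
      have : (q+1) * (Real.exp (q+1) * n) ≤ (q+1) * ((1/2) * τ₀ : ℝ) := by linarith
      exact (le_of_mul_le_mul_left this hr0).trans h'
    · rw [hlogn]
      have h1 : m / (C * y) ≤ θ / 2 * n := by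
        rw [div_le_iff₀ (by positivity)]
        have : (q+1) * (m:ℝ) ≤ (q+1) * (θ / 2 * n * (C * y)) := by
          have e : (q+1) * (θ / 2 * n * (C * y)) = n * y := by rw [hθ, hC]; field_simp; norm_num
          rw [e]; exact hmny
        exact le_of_mul_le_mul_left this hr0
      have h2 : δ'' / 8 * (n / (2 * (q+1))) = 2 * (θ * n) := by rw [hθ]; field_simp; norm_num
      have h3 : 0 ≤ (q+2) * σ * Real.log y := mul_nonneg (by positivity) (by linarith)
      have h4 : 0 < θ * n := by positivity
      rw [h2]; linarith
  · exact num_e1 hn N1 x1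
  · refine num_e2 hn hy0.le hη0 (by linarith) T1 ?_ x2
    rw [div_le_iff₀ hn0]
    have : η * u ≤ η * n := mul_le_mul_of_nonneg_left (by linarith) hη0.le
    linarith
  · refine num_e3 hn hα ?_ K1 B1 x3
    have : η * (n * y) ≤ α/4 * (n * y) := mul_le_mul_of_nonneg_right (by linarith) hny.le
    have : 0 ≤ α * (n * y) := by
      refine mul_nonneg (by linarith) hny.le
    linarith
  · exact num_e4 hn hy N2 hNN D1 x4
  · exact num_e5 hn hy (by positivity) hbase hS x4
  · exact num_e6 hn hy (by positivity) hbase hη0 (by linarith) hη T2 x6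
  · exact num_e7 hn (by omega) S1 hu huy S2 hτ4 hU4 x4
  · exact num_e8 hn hmny' x8
  · refine num_e9 hn (by omega) (by omega) hσnN (by omega) hy0 hu0 hδ' hd S3 hm2 hβ0.le L2 hκ hκ0 ?_ hU5 ?_ x9
    · have := mul_le_mul_of_nonneg_left huy' hκ0.le
      linarith
    · have : κ * u ≤ κ * u * y := le_mul_of_one_le_right (by positivity) hy
      linarith
  · exact num_e10 hn hσnN hδ'.le hc0 hR K2 x10

end core
end Sham

namespace Sham

open Filter in
lemma ev_lin {K a : ℝ} (ha : 0 < a) : ∀ᶠ u : ℝ in atTop, K ≤ a * u := by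
  filter_upwards [eventually_ge_atTop (K / a)] with u hu
  rw [div_le_iff₀ ha] at hu
  linarith

open Filter in
open scoped Classical in
theorem main_thm (r : ℕ) (hr : 3 ≤ r)
    (δ : ℝ) (hδ : 0 < δ) (ρ : ℝ) (hρ : 0 < ρ) :
    ∃ n₀ : ℕ, ∀ n : ℕ, n₀ ≤ n → r ∣ n →
      1 - ρ ≤
        ((Finset.univ.filter
            (fun σ : Fin (Kn n r).card ≃ {A // A ∈ Kn n r} =>
              (Real.exp (-((r : ℝ) - 1)) * Real.log n) ^ (n / r) * Real.exp (-δ * n) <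
                (pmCount (Finset.range n) (Ht n r (hitTime n r σ) σ) : ℝ))).card : ℝ) /
          (Fintype.card (Fin (Kn n r).card ≃ {A // A ∈ Kn n r}) : ℝ) := by
  obtain ⟨q, rfl⟩ : ∃ q, r = q + 1 := ⟨r - 1, by omega⟩
  have hq : 2 ≤ q := by omega
  have hq0 : (0:ℝ) < q := by exact_mod_cast (by omega : 0 < q)
  have hr0 : (0:ℝ) < (q:ℝ) + 1 := by positivity
  obtain ⟨α, hα⟩ : ∃ α : ℝ, α = min 1 δ / 48 := ⟨_, rfl⟩
  have hmin : 0 < min 1 δ := lt_min one_pos hδ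
  have hα0 : 0 < α := by rw [hα]; positivity
  have hα1 : α ≤ 1/16 := by rw [hα]; linarith [min_le_left 1 δ]
  have hαδ : α ≤ δ/48 := by rw [hα]; linarith [min_le_right 1 δ]
  obtain ⟨c, hc⟩ : ∃ c : ℝ, c = α / (8 * (q+1)) := ⟨_, rfl⟩
  have hc0 : 0 < c := by rw [hc]; positivity
  have hαc : α = 8 * (q+1) * c := by rw [hc]; field_simp
  obtain ⟨η, hη⟩ : ∃ η : ℝ, c = 12 * η := ⟨c/12, by ring⟩
  have hη0 : 0 < η := by linarith
  obtain ⟨S, hS⟩ : ∃ S : ℕ, 4 ≤ c * (S+1) := by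
    refine ⟨⌈4/c⌉₊, ?_⟩
    have := Nat.le_ceil (4/c)
    rw [div_le_iff₀ hc0] at this
    linarith
  obtain ⟨δ', hδ'⟩ : ∃ δ' : ℝ, δ' = min (min 1 δ) (Real.exp (-(4/c)) / (3 * q * 4 ^ (q+1))) := ⟨_, rfl⟩
  have hδ'0 : 0 < δ' := by rw [hδ']; exact lt_min hmin (by positivity)
  have hδ'1 : δ' ≤ 1 := by rw [hδ']; exact (min_le_left _ _).trans (min_le_left _ _)
  have hδ'δ : δ' ≤ δ := by rw [hδ']; exact (min_le_left _ _).trans (min_le_right _ _)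
  have hR : 3 * q * δ' * 4 ^ (q+1) ≤ Real.exp (-(4/c)) := by
    have : δ' ≤ Real.exp (-(4/c)) / (3 * q * 4 ^ (q+1)) := by rw [hδ']; exact min_le_right _ _
    rw [le_div_iff₀ (by positivity)] at this
    linarith
  obtain ⟨δ'', hd⟩ : ∃ δ'' : ℝ, δ'' = δ' / 16 := ⟨_, rfl⟩
  have hd0 : 0 < δ'' := by linarith
  obtain ⟨β, hb⟩ : ∃ β : ℝ, β = δ'' / 64 := ⟨_, rfl⟩
  have hb0 : 0 < β := by linarith
  obtain ⟨κ, hκ⟩ : ∃ κ : ℝ, κ = 3/16 * δ' * β / (4 * q * (q+1)) := ⟨_, rfl⟩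
  have hκ0 : 0 < κ := by rw [hκ]; positivity
  obtain ⟨θ, hθ⟩ : ∃ θ : ℝ, θ = δ'' / (32 * (q+1)) := ⟨_, rfl⟩
  have hθ0 : 0 < θ := by rw [hθ]; positivity
  obtain ⟨θ₂, hθ₂⟩ : ∃ θ₂ : ℝ, θ₂ = θ / (16 * (q+2)) := ⟨_, rfl⟩
  have hθ₂0 : 0 < θ₂ := by rw [hθ₂]; positivity
  obtain ⟨C, hC⟩ : ∃ C : ℝ, C = 64 / δ'' := ⟨_, rfl⟩
  obtain ⟨D₀, hD₀, ν₀, hUb⟩ := Ub_asymp (q := q) (by omega) hb0 (by linarith)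
  obtain ⟨ε, hε⟩ : ∃ ε : ℝ, ε = ρ / 20 := ⟨_, rfl⟩
  have hε0 : 0 < ε := by linarith
  obtain ⟨s, hs⟩ : ∃ s : ℝ, s = 1 / ((2 * (q+1) : ℕ) : ℝ) := ⟨_, rfl⟩
  have hs0 : 0 < s := by rw [hs]; positivity
  have hut : Tendsto (fun y : ℝ => y ^ s) atTop atTop := tendsto_rpow_atTop hs0
  have U1 := hut.eventually (ev_lin (K := 6 * ((q:ℝ)+1)^3) hδ'0)
  have U2 := hut.eventually (eventually_ge_atTop (4 * ((ν₀:ℝ) + 6) * ((q:ℝ)+1)^2))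
  have U3 := hut.eventually (ev_lin (K := 2 * ((q:ℝ)+1)) hη0)
  have U4 := hut.eventually (ev_lin (K := 16 * ((q:ℝ)+1)) (pow_pos hb0 2))
  have U5 := hut.eventually (ev_lin (K := 48 * (2 * ((q:ℝ)+1) * q + 3)) hκ0)
  have U6 := hut.eventually (ev_lin (K := 6 * δ') hκ0)
  have U7 := hut.eventually (ev_lin (K := 6) hκ0)
  have U8 := hut.eventually (eventually_ge_atTop (8 * ((q:ℝ)+1) * Real.exp (q+1)))
  have U9 := hut.eventually (eventually_ge_atTop (8 * ((q:ℝ)+1) * D₀))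
  have U10 := hut.eventually (ev_lin (K := (S:ℝ) + 1) hc0)
  have U11 := hut.eventually (ev_lin (K := 1) hθ₂0)
  have U12 := hut.eventually (ev_lin (K := Real.log C) hθ₂0)
  have U13 : ∀ᶠ y : ℝ in atTop, Real.log y ≤ θ₂ * y ^ s := by
    filter_upwards [(isLittleO_log_rpow_atTop hs0).def hθ₂0, eventually_ge_atTop 1] with y h1 h2
    rw [Real.norm_eq_abs, Real.norm_eq_abs, abs_of_nonneg (Real.rpow_nonneg (by linarith) s)] at h1
    exact (le_abs_self _).trans h1
  have U0 := hut.eventually (eventually_ge_atTop 1)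
  have X1 := ev_poly 1 0 (by norm_num : (0:ℝ) < 1/2) hε0
  have X2 := ev_poly 1 0 (by positivity : (0:ℝ) < η/2) hε0
  have X3 := ev_poly (2^(S+1)) 0 (by positivity : (0:ℝ) < 2*c) hε0
  have X4 := ev_poly 1 0 (by positivity : (0:ℝ) < 1) hε0
  have X5 := ev_poly (672 * ((q:ℝ)+1)^3) 2 (by positivity : (0:ℝ) < c/2) one_pos
  have X6 := ev_poly ((1/η)^S) 0 (by positivity : (0:ℝ) < c/4) hε0
  have X8 := ev_poly (8 * ((q:ℝ)+1)^6) 3 (by positivity : (0:ℝ) < 1) hε0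
  have X9 := ev_poly 1 0 (by positivity : (0:ℝ) < κ/2) hε0
  have X10 := ev_poly (2 * Real.exp (4/c * (1 + S))) 0 (by positivity : (0:ℝ) < 2) hε0
  have X11 := ev_poly (256 * ((q+1).factorial:ℝ)) 2 (by positivity : (0:ℝ) < 1) one_pos
  have X12 := ev_poly (2 * ((q:ℝ)+1)) 1 hc0 one_pos
  have X13 := ev_poly 2 1 (by positivity : (0:ℝ) < 1) (by positivity : 0 < θ/2)
  have ALL : ∀ᶠ y : ℝ in atTop, 0 < y ∧ ∀ n : ℕ, (q+1) ∣ n → (n:ℝ) = Real.exp y →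
      ∃ N : ℕ, 2 * N ^ 2 ≤ (Kn n (q+1)).card ∧
      Pr (fun ω : Fin N → (Fin (q+1) ↪ Fin n) => Function.Injective (fun i => ed (ω i)) ∧
        ¬ GoodSeq ((Real.exp (-(q:ℝ)) * y) ^ (n / (q+1)) * Real.exp (-(δ/2*n))) ω) ≤ 10 * ε := by
    filter_upwards [eventually_gt_atTop 0, U0, U1, U2, U3, U4, U5, U6, U7, U8, U9, U10, U11, U12, U13, X1, X2, X3, X4, X5, X6, X8, X9, X10, X11, X12, X13]
      with y hy0 u0 u1 u2 u3 u4 u5 u6 u7 u8 u9 u10 u11 u12 u13 x1 x2 x3 x4 x5 x6 x8 x9 x10 x11 x12 x13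
    refine ⟨hy0, fun n hqn hn => ?_⟩
    refine core (u := y ^ s) hq hqn hn u0 ?_ hc0 hαc hα1 hαδ hη hS hδ'0 hδ'1 hδ'δ hR hd hb hκ hθ hθ₂ hC hD₀ hUb u1 u2 u3 u4 u5 u6 u7 u8 u9 u10 u11 u12 u13
      x1 x2 x3 x4 x5 x6 x8 x9 x10 x11 x12 x13
    rw [← Real.rpow_natCast, ← Real.rpow_mul hy0.le, hs, one_div, inv_mul_cancel₀ (by positivity), Real.rpow_one]
  obtain ⟨n₀, hn₀⟩ := eventually_atTop.1 (ev_nat ALL)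
  refine ⟨max n₀ (q+1), fun n hn hqn => ?_⟩
  have hnq : q + 1 ≤ n := (le_max_right _ _).trans hn
  have hnR : (0:ℝ) < n := by exact_mod_cast (by omega : 0 < n)
  obtain ⟨hy0, H⟩ := hn₀ n ((le_max_left _ _).trans hn)
  obtain ⟨N, hN, hP⟩ := H n hqn (Real.exp_log hnR).symm
  have hρε : ρ = 2 * (10 * ε) := by rw [hε]; ring
  rw [hρε]
  refine transfer hnq hN hP _ (fun σ h => lt_of_lt_of_le ?_ h)
  have e : -(((q+1 : ℕ) : ℝ) - 1) = -(q:ℝ) := by push_cast; ring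
  rw [e]
  refine mul_lt_mul_of_pos_left (Real.exp_lt_exp.2 ?_) (by positivity)
  have : 0 < δ * n := by positivity
  linarith

end Sham

open scoped Classical in
/-- **Counting version at the hitting time (Theorem 6).** W.h.p.
`Φ(H_T) > (e^{-(r-1)}·log n)^{n/r}·e^{-o(n)}`. -/
theorem shamir_hitting_time_counting (r : ℕ) (hr : 3 ≤ r)
    (δ : ℝ) (hδ : 0 < δ) (ρ : ℝ) (hρ : 0 < ρ) :
    ∃ n₀ : ℕ, ∀ n : ℕ, n₀ ≤ n → r ∣ n →
      1 - ρ ≤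
        ((Finset.univ.filter
            (fun σ : Fin (Kn n r).card ≃ {A // A ∈ Kn n r} =>
              (Real.exp (-((r : ℝ) - 1)) * Real.log n) ^ (n / r) * Real.exp (-δ * n) <
                (pmCount (Finset.range n) (Ht n r (hitTime n r σ) σ) : ℝ))).card : ℝ) /
          (Fintype.card (Fin (Kn n r).card ≃ {A // A ∈ Kn n r}) : ℝ) := by
  exact Sham.main_thm r hr δ hδ ρ hρ
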